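/- Fix an integer n ≥ 1. There exists a constant C > 0 such that, for admissible T → ∞, ∑_{0<γ≤T} ζ^{(n)}(ρ) = (−1)^{n+1} (1/(n+1)) (T/2π) log^{n+1}(T/2π) + (−1)^{n+1} ∑_{k=0}^{n} binom(n,k) (−1)^k k! (−1 + ∑_{j=0}^{k} (−1)^j C_j) (T/2π) log^{n−k}(T/2π) + n! A_n (T/2π) + O(T e^{−C√(log T)}). -/

import Mathlib

section FrozenDefs
open Complex Filter Finset

/-- The order of vanishing of the Riemann zeta function at a point `ρ`:
the least `k` such that the `k`-th derivative of `ζ` is nonzero at `ρ`. -/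
noncomputable def zetaZeroOrder (ρ : ℂ) : ℕ :=
  sInf {k : ℕ | iteratedDeriv k riemannZeta ρ ≠ 0}

/-- A non-trivial zero of the Riemann zeta function. -/
def IsNontrivialZero (ρ : ℂ) : Prop :=
  riemannZeta ρ = 0 ∧ 0 < ρ.re ∧ ρ.re < 1

/-- `∑_{0<γ≤T} ζ^{(n)}(ρ)`, the sum of the `n`-th derivative of `ζ` over the
non-trivial zeros `ρ = β + iγ` with `0 < γ ≤ T`, counted with multiplicity. -/
noncomputable def zetaZeroSum (n : ℕ) (T : ℝ) : ℂ :=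
  ∑ᶠ ρ ∈ {ρ : ℂ | IsNontrivialZero ρ ∧ 0 < ρ.im ∧ ρ.im ≤ T},
    (zetaZeroOrder ρ : ℂ) * iteratedDeriv n riemannZeta ρ

/-- `T` is admissible: `|T - γ| ≥ δ / log T` for every ordinate `γ` of a
non-trivial zero of `ζ`. -/
def AdmissibleHeight (δ T : ℝ) : Prop :=
  ∀ ρ : ℂ, IsNontrivialZero ρ → δ / Real.log T ≤ |T - ρ.im|

/-- The full main term in the asymptotic expansion of `∑_{0<γ≤T} ζ^{(n)}(ρ)`,
expressed in terms of the Laurent coefficients `C j` of `ζ` and `A j` of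
`ζ'/ζ` about `s = 1`. -/
noncomputable def mainTerm (C A : ℕ → ℂ) (n : ℕ) (T : ℝ) : ℂ :=
  (-1 : ℂ) ^ (n + 1) * (1 / ((n : ℂ) + 1)) *
      (((T / (2 * Real.pi)) * Real.log (T / (2 * Real.pi)) ^ (n + 1) : ℝ) : ℂ)
  + (-1 : ℂ) ^ (n + 1) *
      ∑ k ∈ Finset.range (n + 1),
        (n.choose k : ℂ) * (-1 : ℂ) ^ k * (k.factorial : ℂ) *
          (-1 + ∑ j ∈ Finset.range (k + 1), (-1 : ℂ) ^ j * C j) *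
          (((T / (2 * Real.pi)) * Real.log (T / (2 * Real.pi)) ^ (n - k) : ℝ) : ℂ)
  + (n.factorial : ℂ) * A n * ((T / (2 * Real.pi) : ℝ) : ℂ)

end FrozenDefs

namespace ZS
section Gam
open Complex Filter Topology Asymptotics Set

lemma arg_lower (s : ℂ) (hs : 0 < s.re) : Real.pi / 2 * |s.im| - s.re ≤ s.im * s.arg := by
  have key : ∀ a b : ℝ, 0 < a → 0 ≤ b → Real.pi / 2 * b - a ≤ b * Real.arctan (b / a) := by
    intro a b ha hb
    rcases hb.eq_or_lt with rfl | hb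
    · simp; exact ha.le
    have h1 : Real.arctan (b / a) = Real.pi / 2 - Real.arctan (a / b) := by
      have := Real.arctan_inv_of_pos (x := a / b) (by positivity)
      rwa [inv_div] at this
    have h2 : Real.arctan (a / b) ≤ a / b := by
      have hp : 0 ≤ Real.arctan (a / b) := by
        rw [← Real.arctan_zero]; exact Real.arctan_strictMono.monotone (by positivity)
      have h := Real.le_tan hp (Real.arctan_lt_pi_div_two _)
      rwa [Real.tan_arctan] at h
    rw [h1]
    have : b * Real.arctan (a / b) ≤ a := by
      calc _ ≤ b * (a / b) := by gcongr
        _ = a := by field_simp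
    nlinarith
  have harg : s.arg = Real.arctan (s.im / s.re) := by
    rw [Complex.arg_of_re_nonneg hs.le]
    have : s.im / ‖s‖ = Real.sin s.arg := (Complex.sin_arg s).symm
    rw [← Complex.tan_arg, Real.arctan_tan]
    · rw [Complex.arg_of_re_nonneg hs.le]
    · have := (abs_lt.mp ((Complex.abs_arg_lt_pi_div_two_iff).2 (Or.inl hs))).1
      exact this
    · exact (abs_lt.mp ((Complex.abs_arg_lt_pi_div_two_iff).2 (Or.inl hs))).2
  rw [harg]
  rcases le_total 0 s.im with h | h
  · rw [abs_of_nonneg h]; exact key _ _ hs h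
  · rw [abs_of_nonpos h]
    have := key s.re (-s.im) hs (by linarith)
    rw [neg_div, Real.arctan_neg] at this
    linarith

lemma arg_upper (s : ℂ) (hs : 0 < s.re) : s.im * s.arg ≤ Real.pi / 2 * |s.im| := by
  have h := (Complex.abs_arg_lt_pi_div_two_iff (z := s)).2 (Or.inl hs)
  calc s.im * s.arg ≤ |s.im * s.arg| := le_abs_self _
    _ = |s.im| * |s.arg| := abs_mul _ _
    _ ≤ |s.im| * (Real.pi / 2) := by gcongr
    _ = _ := mul_comm _ _

lemma norm_Gamma_half (t : ℝ) :
    ‖Complex.Gamma (1/2 + t * I)‖ * Real.exp (Real.pi / 2 * |t|) ≤ Real.sqrt (2 * Real.pi) := by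
  have h := Complex.Gamma_mul_Gamma_one_sub (1/2 + t * I)
  have hc : (1 : ℂ) - (1/2 + t * I) = (starRingEnd ℂ) (1/2 + t * I) := by
    apply Complex.ext <;> simp <;> norm_num
  rw [hc, Complex.Gamma_conj] at h
  have hs : Complex.sin (Real.pi * (1/2 + t * I)) = (Real.cosh (Real.pi * t) : ℂ) := by
    rw [show (Real.pi : ℂ) * (1/2 + t * I) = (Real.pi * t : ℂ) * I + Real.pi / 2 by ring]
    rw [Complex.sin_add_pi_div_two, Complex.cos_mul_I]
    push_cast; rfl
  rw [hs, Complex.mul_conj] at h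
  have h2 : Complex.normSq (Complex.Gamma (1/2 + t * I)) = Real.pi / Real.cosh (Real.pi * t) := by
    exact_mod_cast h
  rw [Complex.normSq_eq_norm_sq] at h2
  apply Real.le_sqrt_of_sq_le
  rw [mul_pow, h2, ← Real.exp_nat_mul]
  have h3 : Real.exp ((2:ℕ) * (Real.pi / 2 * |t|)) ≤ 2 * Real.cosh (Real.pi * t) := by
    rw [← Real.cosh_abs, Real.cosh_eq, abs_mul, abs_of_pos Real.pi_pos]
    have := Real.exp_pos (-(Real.pi * |t|))
    push_cast
    rw [show 2 * (Real.pi / 2 * |t|) = Real.pi * |t| by ring]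
    linarith
  have hp := Real.cosh_pos (Real.pi * t)
  rw [div_mul_eq_mul_div, div_le_iff₀ hp]
  nlinarith [Real.pi_pos]

lemma norm_Gamma_le_re {s : ℂ} (hs : 0 < s.re) : ‖Complex.Gamma s‖ ≤ Real.Gamma s.re := by
  rw [Complex.Gamma_eq_integral hs, Real.Gamma_eq_integral hs, Complex.GammaIntegral]
  refine (MeasureTheory.norm_integral_le_integral_norm _).trans (le_of_eq ?_)
  refine MeasureTheory.setIntegral_congr_fun measurableSet_Ioi ?_
  intro x hx
  simp only [norm_mul]
  rw [Complex.norm_cpow_eq_rpow_re_of_pos hx, Complex.norm_real, Real.norm_of_nonneg (Real.exp_pos _).le]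
  simp

lemma cont_Gamma_re : ∃ M : ℝ, ∀ x ∈ Icc (1/2:ℝ) (3/2), Real.Gamma x ≤ M := by
  have : ContinuousOn Real.Gamma (Icc (1/2:ℝ) (3/2)) := by
    intro x hx
    apply (Real.differentiableAt_Gamma _).continuousAt.continuousWithinAt
    intro m
    have := hx.1
    have : (0:ℝ) ≤ m := Nat.cast_nonneg m
    intro h; linarith
  obtain ⟨M, hM⟩ := (isCompact_Icc.image_of_continuousOn this).bddAbove
  exact ⟨M, fun x hx => hM ⟨x, hx, rfl⟩⟩

lemma norm_aux (s : ℂ) (hs : 0 < s.re) :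
    ‖Complex.exp (-(s - 1/2) * Complex.log s)‖ =
      ‖s‖ ^ (-(s.re - 1/2)) * Real.exp (s.im * s.arg) := by
  have h0 : 0 < ‖s‖ := norm_pos_iff.2 (fun h => by simp [h] at hs)
  rw [Complex.norm_exp, Real.rpow_def_of_pos h0, ← Real.exp_add]
  congr 1
  simp [Complex.mul_re, Complex.log_re, Complex.log_im]
  ring

lemma Gamma_strip {s : ℂ} (h1 : 1/2 ≤ s.re) (h2 : s.re ≤ 3/2) :
    ‖Complex.Gamma s * Complex.exp (-(s - 1/2) * Complex.log s)‖ ≤ Real.sqrt (2 * Real.pi) := by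
  obtain ⟨M, hM⟩ := cont_Gamma_re
  have hM0 : 0 ≤ M := (Real.Gamma_pos_of_pos (by norm_num : (0:ℝ) < 1)).le.trans (hM 1 (by constructor <;> norm_num))
  have hdiff : ∀ z : ℂ, 0 < z.re → DifferentiableAt ℂ (fun s => Complex.Gamma s * Complex.exp (-(s - 1/2) * Complex.log s)) z := by
    intro z hz
    have hG : DifferentiableAt ℂ Complex.Gamma z := by
      apply Complex.differentiableAt_Gamma
      intro m h
      rw [h] at hz; simp at hz
      have : (0:ℝ) ≤ m := Nat.cast_nonneg m
      linarith
    have hl : DifferentiableAt ℂ Complex.log z := Complex.differentiableAt_log (Or.inl hz)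
    fun_prop
  refine PhragmenLindelof.vertical_strip (a := 1/2) (b := 3/2)
    (f := fun s => Complex.Gamma s * Complex.exp (-(s - 1/2) * Complex.log s)) ?_ ?_ ?_ ?_ h1 h2
  · apply DifferentiableOn.diffContOnCl
    intro z hz
    apply (hdiff z _).differentiableWithinAt
    rw [Complex.closure_preimage_re, closure_Ioo (by norm_num)] at hz
    have := hz.1
    linarith
  · refine ⟨1, by rw [lt_div_iff₀ (by norm_num)]; linarith [Real.pi_gt_three], Real.pi, ?_⟩
    rw [isBigO_iff]
    refine ⟨M * 2, ?_⟩
    rw [eventually_inf_principal]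
    refine Eventually.of_forall ?_
    intro z hz
    have hz1 : 1/2 < z.re := hz.1
    have hz2 : z.re < 3/2 := hz.2
    have hz0 : 0 < z.re := by linarith
    rw [norm_mul, norm_aux z hz0]
    have a1 : ‖Complex.Gamma z‖ ≤ M := (norm_Gamma_le_re hz0).trans (hM _ ⟨hz1.le, hz2.le⟩)
    have a2 : ‖z‖ ^ (-(z.re - 1/2)) ≤ 2 := by
      have hn : 1/2 ≤ ‖z‖ := hz1.le.trans (Complex.re_le_norm z)
      have h0 : 0 < ‖z‖ := by linarith
      rw [Real.rpow_neg h0.le, ← Real.inv_rpow h0.le]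
      have hi : ‖z‖⁻¹ ≤ 2 := by rw [inv_le_comm₀ h0 (by norm_num)]; linarith
      calc ‖z‖⁻¹ ^ (z.re - 1/2) ≤ 2 ^ (z.re - 1/2) := by
            apply Real.rpow_le_rpow (by positivity) hi; linarith
        _ ≤ 2 ^ (1:ℝ) := by apply Real.rpow_le_rpow_of_exponent_le (by norm_num); linarith
        _ = 2 := by norm_num
    have a3 : Real.exp (z.im * z.arg) ≤ ‖Real.exp (Real.pi * Real.exp (1 * |z.im|))‖ := by
      rw [Real.norm_of_nonneg (Real.exp_pos _).le]
      apply Real.exp_le_exp.2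
      refine (arg_upper z hz0).trans ?_
      have := Real.add_one_le_exp |z.im|
      have := abs_nonneg z.im
      rw [one_mul]
      nlinarith [Real.pi_pos]
    calc _ ≤ M * (2 * ‖Real.exp (Real.pi * Real.exp (1 * |z.im|))‖) := by gcongr
      _ = _ := by ring
  · intro z hz
    have hz' : z = 1/2 + z.im * I := by apply Complex.ext <;> simp [hz]
    have hz0 : 0 < z.re := by rw [hz]; norm_num
    rw [norm_mul, norm_aux z hz0, hz]
    simp only [sub_self, neg_zero, Real.rpow_zero, one_mul]
    refine le_trans ?_ (norm_Gamma_half z.im)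
    rw [← hz']
    exact mul_le_mul_of_nonneg_left (Real.exp_le_exp.2 (arg_upper z hz0)) (norm_nonneg _)
  · intro z hz
    have hz' : z = (1/2 + z.im * I) + 1 := by apply Complex.ext <;> simp [hz]; norm_num
    have hz0 : 0 < z.re := by rw [hz]; norm_num
    rw [norm_mul, norm_aux z hz0, hz]
    have hn : ‖z‖ ≥ ‖(1/2 + z.im * I : ℂ)‖ := by
      rw [Complex.norm_def, Complex.norm_def]
      apply Real.sqrt_le_sqrt
      simp [Complex.normSq_apply, hz]
      norm_num
    have h0 : 0 < ‖z‖ := norm_pos_iff.2 (fun h => by simp [h] at hz0)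
    have hG : ‖Complex.Gamma z‖ ≤ ‖z‖ * ‖Complex.Gamma (1/2 + z.im * I)‖ := by
      conv_lhs => rw [hz']
      rw [Complex.Gamma_add_one, norm_mul]
      · gcongr
      · intro h; have := congrArg Complex.re h; simp at this
    norm_num
    rw [Real.rpow_neg_one]
    calc _ ≤ (‖z‖ * ‖Complex.Gamma (1/2 + z.im * I)‖) * (‖z‖⁻¹ * Real.exp (Real.pi / 2 * |z.im|)) := by
          have := Real.exp_le_exp.2 (arg_upper z hz0)
          gcongr
      _ = ‖Complex.Gamma (1/2 + z.im * I)‖ * Real.exp (Real.pi / 2 * |z.im|) := by field_simp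
      _ ≤ _ := (norm_Gamma_half z.im).trans (by rw [Real.sqrt_mul (by norm_num)])

/-- basic Gamma bound in the strip -/
lemma Gamma_bd : ∃ C : ℝ, 0 < C ∧ ∀ s : ℂ, 1/2 ≤ s.re → s.re ≤ 3/2 →
    ‖Complex.Gamma s‖ ≤ C * ‖s‖ ^ (s.re - 1/2) * Real.exp (-(Real.pi / 2 * |s.im|)) := by
  refine ⟨Real.sqrt (2 * Real.pi) * Real.exp (3/2), by positivity, ?_⟩
  intro s h1 h2
  have hs0 : 0 < s.re := by linarith
  have h := Gamma_strip h1 h2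
  rw [norm_mul, norm_aux s hs0] at h
  have h0 : 0 < ‖s‖ := norm_pos_iff.2 (fun h => by simp [h] at hs0)
  rw [Real.rpow_neg h0.le] at h
  have hp : 0 < ‖s‖ ^ (s.re - 1/2) := Real.rpow_pos_of_pos h0 _
  have hE := Real.exp_pos (s.im * s.arg)
  have h3 : ‖Complex.Gamma s‖ ≤ Real.sqrt (2 * Real.pi) * ‖s‖ ^ (s.re - 1/2) * Real.exp (-(s.im * s.arg)) := by
    rw [Real.exp_neg, ← div_eq_mul_inv, le_div_iff₀ hE]
    calc _ = (‖Complex.Gamma s‖ * ((‖s‖ ^ (s.re - 1/2))⁻¹ * Real.exp (s.im * s.arg))) * ‖s‖ ^ (s.re - 1/2) := by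
          field_simp
      _ ≤ _ := by gcongr
  refine h3.trans ?_
  have h4 : Real.exp (-(s.im * s.arg)) ≤ Real.exp (3/2) * Real.exp (-(Real.pi / 2 * |s.im|)) := by
    rw [← Real.exp_add]
    apply Real.exp_le_exp.2
    have := arg_lower s hs0
    linarith
  calc _ ≤ Real.sqrt (2 * Real.pi) * ‖s‖ ^ (s.re - 1/2) * (Real.exp (3/2) * Real.exp (-(Real.pi / 2 * |s.im|))) := by gcongr
    _ = _ := by ring
end Gam
end ZS

namespace ZS
section Zet
open Complex Filter Topology Asymptotics Set

lemma Gamma_bd_gen (k : ℕ) : ∃ C : ℝ, 0 < C ∧ ∀ s : ℂ, 1/2 ≤ s.re → s.re ≤ 3/2 + k →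
    ‖Complex.Gamma s‖ ≤ C * ‖s‖ ^ (s.re - 1/2) * Real.exp (-(Real.pi / 2 * |s.im|)) := by
  induction k with
  | zero => simpa using Gamma_bd
  | succ k ih =>
    obtain ⟨C, hC, h⟩ := ih
    refine ⟨C, hC, ?_⟩
    intro s h1 h2
    by_cases h3 : s.re ≤ 3/2 + k
    · exact h s h1 h3
    push Not at h3
    push_cast at h2
    have hk : (0:ℝ) ≤ k := Nat.cast_nonneg k
    have hs1 : s - 1 ≠ 0 := by
      intro hh
      have := congrArg Complex.re hh
      simp at this
      linarith
    have hG : Complex.Gamma s = (s - 1) * Complex.Gamma (s - 1) := by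
      have := Complex.Gamma_add_one (s - 1) hs1
      rwa [sub_add_cancel] at this
    have hh := h (s - 1) (by simp; linarith) (by simp; linarith)
    have hn : ‖s - 1‖ ≤ ‖s‖ := by
      rw [Complex.norm_def, Complex.norm_def]
      apply Real.sqrt_le_sqrt
      simp [Complex.normSq_apply]
      nlinarith
    have h0 : 0 < ‖s - 1‖ := norm_pos_iff.2 hs1
    have h0' : 0 < ‖s‖ := h0.trans_le hn
    rw [hG, norm_mul]
    simp only [sub_re, one_re, sub_im, one_im, sub_zero] at hh
    calc ‖s - 1‖ * ‖Complex.Gamma (s - 1)‖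
        ≤ ‖s‖ * (C * ‖s‖ ^ (s.re - 1 - 1/2) * Real.exp (-(Real.pi / 2 * |s.im|))) := by
          refine mul_le_mul hn (hh.trans ?_) (norm_nonneg _) (norm_nonneg _)
          gcongr
          linarith
      _ = C * (‖s‖ ^ (1:ℝ) * ‖s‖ ^ (s.re - 1 - 1/2)) * Real.exp (-(Real.pi / 2 * |s.im|)) := by
          rw [Real.rpow_one]; ring
      _ = _ := by
          rw [← Real.rpow_add h0']
          ring_nf

lemma norm_exp_mul_I_le (w : ℂ) : ‖Complex.exp (w * I)‖ ≤ Real.exp |w.im| := by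
  rw [Complex.norm_exp]
  apply Real.exp_le_exp.2
  simp
  exact neg_le_abs _

lemma norm_cos_le (w : ℂ) : ‖Complex.cos w‖ ≤ Real.exp |w.im| := by
  rw [Complex.cos]
  have h1 := norm_exp_mul_I_le w
  have h2 := norm_exp_mul_I_le (-w)
  simp only [neg_im, abs_neg] at h2
  rw [norm_div, Complex.norm_two]
  have := norm_add_le (Complex.exp (w * I)) (Complex.exp (-w * I))
  linarith

lemma zeta_FE_bd (k : ℕ) : ∃ C : ℝ, 0 < C ∧ ∀ w : ℂ, 1/2 ≤ w.re → w.re ≤ 3/2 + k → w ≠ 1 →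
    ‖riemannZeta (1 - w)‖ ≤ C * ‖w‖ ^ (w.re - 1/2) * ‖riemannZeta w‖ := by
  obtain ⟨C, hC, h⟩ := Gamma_bd_gen k
  refine ⟨2 * C, by positivity, ?_⟩
  intro w h1 h2 hw
  rw [riemannZeta_one_sub _ hw]
  · rw [norm_mul, norm_mul, norm_mul, norm_mul, Complex.norm_two]
    have a1 : ‖(2 * (Real.pi : ℂ)) ^ (-w)‖ ≤ 1 := by
      have : (2 * (Real.pi : ℂ)) = ((2 * Real.pi : ℝ) : ℂ) := by push_cast; rfl
      rw [this, Complex.norm_cpow_eq_rpow_re_of_pos (by positivity)]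
      apply Real.rpow_le_one_of_one_le_of_nonpos
      · linarith [Real.pi_gt_three]
      · simp; linarith
    have a2 := h w h1 h2
    have a3 : ‖Complex.cos (Real.pi * w / 2)‖ ≤ Real.exp (Real.pi / 2 * |w.im|) := by
      refine (norm_cos_le _).trans (le_of_eq ?_)
      congr 1
      have : (Real.pi * w / 2 : ℂ) = ((Real.pi / 2 : ℝ) : ℂ) * w := by push_cast; ring
      rw [this, Complex.im_ofReal_mul, abs_mul, abs_of_pos (by positivity)]
    calc _ ≤ 2 * 1 * (C * ‖w‖ ^ (w.re - 1/2) * Real.exp (-(Real.pi / 2 * |w.im|))) * Real.exp (Real.pi / 2 * |w.im|) * ‖riemannZeta w‖ := by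
          gcongr
      _ = 2 * C * ‖w‖ ^ (w.re - 1/2) * ‖riemannZeta w‖ * (Real.exp (-(Real.pi / 2 * |w.im|)) * Real.exp (Real.pi / 2 * |w.im|)) := by ring
      _ = _ := by rw [← Real.exp_add]; simp
  · intro n hn
    rw [hn] at h1
    simp at h1
    have : (0:ℝ) ≤ n := Nat.cast_nonneg n
    linarith

/-- the telescoped term -/
noncomputable def bt (n : ℕ) (s : ℂ) : ℂ :=
  (s - 1) * ((n : ℂ) + 1) ^ (-s) + (((n : ℂ) + 2) ^ (1 - s) - ((n : ℂ) + 1) ^ (1 - s))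

lemma bt_bound (n : ℕ) (s : ℂ) (hs : 0 < s.re) :
    ‖bt n s‖ ≤ ‖s - 1‖ * ‖s‖ * ((n : ℝ) + 1) ^ (-s.re - 1) := by
  have hn : (0:ℝ) < (n:ℝ) + 1 := by positivity
  set a : ℝ := (n:ℝ) + 1 with ha
  have dpow : ∀ (c : ℂ) (u : ℝ), 0 < u → HasDerivAt (fun u : ℝ => (u : ℂ) ^ c) (c * (u:ℂ) ^ (c - 1)) u := by
    intro c u hu
    have h1 := (hasDerivAt_id (u:ℂ)).cpow_const (c := c) (Or.inl (by simpa using hu))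
    have := h1.comp_ofReal
    simpa using this
  have step1 : ∀ u ∈ Icc a (a+1), ‖(u:ℂ) ^ (-s) - (a:ℂ) ^ (-s)‖ ≤ ‖s‖ * a ^ (-s.re - 1) := by
    intro u hu
    have hb : ∀ v ∈ Ico a (a+1), ‖(-s) * (v:ℂ) ^ (-s - 1)‖ ≤ ‖s‖ * a ^ (-s.re - 1) := by
      intro v hv
      rw [norm_mul, norm_neg, Complex.norm_cpow_eq_rpow_re_of_pos (hn.trans_le hv.1)]
      gcongr
      simp only [sub_re, neg_re, one_re]
      exact Real.rpow_le_rpow_of_nonpos hn hv.1 (by linarith)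
    have h := norm_image_sub_le_of_norm_deriv_le_segment' (f := fun u : ℝ => (u : ℂ) ^ (-s)) (f' := fun v => (-s) * (v:ℂ) ^ (-s - 1)) (a := a) (b := a + 1) (C := ‖s‖ * a ^ (-s.re - 1))
      (fun v hv => (dpow (-s) v (hn.trans_le hv.1)).hasDerivWithinAt) hb u hu
    refine h.trans ?_
    have : u - a ≤ 1 := by linarith [hu.2]
    have h0 : 0 ≤ ‖s‖ * a ^ (-s.re - 1) := by positivity
    nlinarith
  have h := norm_image_sub_le_of_norm_deriv_le_segment' (f := fun u : ℝ => (u : ℂ) ^ (1 - s) + (s - 1) * (u:ℂ) * (a:ℂ) ^ (-s))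
    (f' := fun v => (1 - s) * (v:ℂ) ^ (1 - s - 1) + (s - 1) * (1:ℝ) * (a:ℂ) ^ (-s)) (a := a) (b := a + 1) (C := ‖s - 1‖ * ‖s‖ * a ^ (-s.re - 1)) ?_ ?_ (a + 1) ⟨by linarith, le_rfl⟩
  · have e : bt n s = (((a + 1 : ℝ) : ℂ) ^ (1 - s) + (s - 1) * ((a + 1 : ℝ):ℂ) * (a:ℂ) ^ (-s)) - ((a : ℂ) ^ (1 - s) + (s - 1) * (a:ℂ) * (a:ℂ) ^ (-s)) := by
      rw [bt, ha]; push_cast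
      rw [show (n:ℂ) + 1 + 1 = n + 2 by ring]; ring
    rw [e]
    refine h.trans (le_of_eq ?_)
    ring
  · intro v hv
    apply HasDerivAt.hasDerivWithinAt
    refine (dpow (1 - s) v (hn.trans_le hv.1)).add ?_
    exact (((hasDerivAt_id v).ofReal_comp).const_mul (s - 1)).mul_const _
  · intro v hv
    have : (1 - s) * (v:ℂ) ^ (1 - s - 1) + (s - 1) * (1:ℝ) * (a:ℂ) ^ (-s) = -((s - 1) * ((v:ℂ) ^ (-s) - (a:ℂ) ^ (-s))) := by
      rw [show 1 - s - 1 = -s by ring]; push_cast; ring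
    rw [this, norm_neg, norm_mul, mul_assoc]
    gcongr
    exact step1 v ⟨hv.1, hv.2.le⟩

lemma summable_shift (p : ℝ) (hp : 1 < p) : Summable (fun n : ℕ => ((n:ℝ) + 1) ^ (-p)) := by
  have := (summable_nat_add_iff 1).2 (Real.summable_nat_rpow.2 (by linarith : -p < -1))
  simpa using this

lemma bt_diff (n : ℕ) : Differentiable ℂ (bt n) := by
  have h1 : ((n:ℂ) + 1) ≠ 0 := by exact_mod_cast Nat.succ_ne_zero n
  have h2 : ((n:ℂ) + 2) ≠ 0 := by exact_mod_cast Nat.succ_ne_zero (n+1)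
  intro s
  unfold bt
  have a1 : DifferentiableAt ℂ (fun s : ℂ => ((n:ℂ) + 1) ^ (-s)) s := 
    (differentiableAt_id.neg).const_cpow (Or.inl h1)
  have a2 : DifferentiableAt ℂ (fun s : ℂ => ((n:ℂ) + 1) ^ (1-s)) s := 
    (differentiableAt_id.const_sub 1).const_cpow (Or.inl h1)
  have a3 : DifferentiableAt ℂ (fun s : ℂ => ((n:ℂ) + 2) ^ (1-s)) s := 
    (differentiableAt_id.const_sub 1).const_cpow (Or.inl h2)
  fun_prop

lemma zeta1_sum_of_one_lt (s : ℂ) (hs : 1 < s.re) : riemannZeta₁ s - 1 = ∑' n, bt n s := by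
  have hz := zeta_eq_tsum_one_div_nat_add_one_cpow hs
  have hs1 : s ≠ 1 := by intro h; rw [h] at hs; simp at hs
  have hsm : Summable (fun n : ℕ => 1 / ((n:ℂ) + 1) ^ s) := by
    have := (summable_nat_add_iff 1).2 (Complex.summable_one_div_nat_cpow.2 hs)
    simpa using this
  have htel : HasSum (fun n : ℕ => (((n : ℂ) + 2) ^ (1 - s) - ((n : ℂ) + 1) ^ (1 - s))) (-1) := by
    have hlim : Tendsto (fun n : ℕ => ((n:ℂ) + 1) ^ (1 - s)) atTop (𝓝 0) := by
      rw [tendsto_zero_iff_norm_tendsto_zero]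
      have h1 : Tendsto (fun x : ℝ => x ^ (-(s.re - 1))) atTop (𝓝 0) := tendsto_rpow_neg_atTop (by linarith)
      have h2 : Tendsto (fun n : ℕ => (n:ℝ) + 1) atTop atTop := 
        tendsto_atTop_add_const_right _ _ tendsto_natCast_atTop_atTop
      refine (h1.comp h2).congr ?_
      intro n
      have : ((n:ℂ) + 1) = (((n:ℝ) + 1 : ℝ) : ℂ) := by push_cast; rfl
      rw [this, Complex.norm_cpow_eq_rpow_re_of_pos (by positivity)]
      simp
    have hsum : Summable (fun n : ℕ => (((n : ℂ) + 2) ^ (1 - s) - ((n : ℂ) + 1) ^ (1 - s))) := by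
      have hb : Summable (fun n => bt n s) := by
        refine Summable.of_norm_bounded (g := fun n : ℕ => ‖s - 1‖ * ‖s‖ * ((n : ℝ) + 1) ^ (-s.re - 1)) ?_ (fun n => bt_bound n s (by linarith))
        have := (summable_shift (s.re + 1) (by linarith)).mul_left (‖s - 1‖ * ‖s‖)
        simpa [neg_add, sub_eq_add_neg, add_comm] using this
      have := hb.sub (hsm.mul_left (s - 1))
      refine this.congr ?_
      intro n
      rw [bt, Complex.cpow_neg]; ring
    rw [hsum.hasSum_iff_tendsto_nat]
    have : ∀ N : ℕ, ∑ n ∈ Finset.range N, (((n : ℂ) + 2) ^ (1 - s) - ((n : ℂ) + 1) ^ (1 - s)) = ((N:ℂ) + 1) ^ (1 - s) - 1 := by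
      intro N
      have := Finset.sum_range_sub (fun n : ℕ => ((n : ℂ) + 1) ^ (1 - s)) N
      simp only [Nat.cast_zero, zero_add, one_cpow] at this
      rw [← this]
      apply Finset.sum_congr rfl
      intro n _
      push_cast
      rw [show (n:ℂ) + 1 + 1 = n + 2 by ring]
    simp_rw [this]
    simpa using hlim.sub_const 1
  have htot := (hsm.hasSum.mul_left (s - 1)).add htel
  rw [← hz] at htot
  have : HasSum (fun n => bt n s) ((s - 1) * riemannZeta s + -1) := by
    have e : (fun n => bt n s) = fun n : ℕ => (s - 1) * (1 / ((n:ℂ) + 1) ^ s) + (((n : ℂ) + 2) ^ (1 - s) - ((n : ℂ) + 1) ^ (1 - s)) := by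
      funext n
      rw [bt, Complex.cpow_neg]; ring
    rw [e]; exact htot
  rw [this.tsum_eq, riemannZeta_eq_inv_sub_mul hs1]
  have : s - 1 ≠ 0 := sub_ne_zero.2 hs1
  field_simp
  ring

lemma zeta1_sum (s : ℂ) (hs : 0 < s.re) : riemannZeta₁ s - 1 = ∑' n, bt n s := by
  have hopen : IsOpen {s : ℂ | 0 < s.re} := isOpen_lt continuous_const Complex.continuous_re
  have hd : DifferentiableOn ℂ (fun s => ∑' n, bt n s) {s : ℂ | 0 < s.re} := by
    intro z hz
    have hz : 0 < z.re := hz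
    set V : Set ℂ := {s : ℂ | z.re / 2 < s.re} ∩ Metric.ball 0 (‖z‖ + 1)
    have hV : IsOpen V := (isOpen_lt continuous_const Complex.continuous_re).inter Metric.isOpen_ball
    have hzV : z ∈ V := ⟨by simp; linarith, by simp⟩
    have := differentiableOn_tsum_of_summable_norm (F := fun n s => bt n s) (U := V)
      (u := fun n : ℕ => ((‖z‖ + 2) * (‖z‖ + 1)) * ((n : ℝ) + 1) ^ (-(z.re / 2 + 1))) 
      ((summable_shift _ (by linarith)).mul_left _) (fun n => (bt_diff n).differentiableOn) hV ?_
    · exact ((this z hzV).differentiableAt (hV.mem_nhds hzV)).differentiableWithinAt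
    · intro n w hw
      have hw1 : z.re / 2 < w.re := hw.1
      have hw2 : ‖w‖ < ‖z‖ + 1 := by simpa using hw.2
      refine (bt_bound n w (by linarith)).trans ?_
      have h3 : ‖w - 1‖ ≤ ‖z‖ + 2 := by
        have := norm_sub_le w 1
        simp at this; linarith
      have h4 : ((n:ℝ) + 1) ^ (-w.re - 1) ≤ ((n:ℝ) + 1) ^ (-(z.re / 2 + 1)) := by
        apply Real.rpow_le_rpow_of_exponent_le
        · have : (0:ℝ) ≤ n := Nat.cast_nonneg n
          linarith
        · linarith
      gcongr
  have h1 : AnalyticOnNhd ℂ (fun s => riemannZeta₁ s - 1) {s : ℂ | 0 < s.re} :=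
    (differentiable_riemannZeta₁.sub_const 1).differentiableOn.analyticOnNhd hopen
  have h2 := hd.analyticOnNhd hopen
  have hpc : IsPreconnected {s : ℂ | 0 < s.re} := (convex_halfSpace_re_gt 0).isPreconnected
  have := h1.eqOn_of_preconnected_of_eventuallyEq h2 hpc (z₀ := 2) (by simp) ?_
  · exact this hs
  · have : {s : ℂ | 1 < s.re} ∈ 𝓝 (2:ℂ) := (isOpen_lt continuous_const Complex.continuous_re).mem_nhds (by simp)
    filter_upwards [this] with w hw
    exact zeta1_sum_of_one_lt w hw

lemma zeta1_growth_right : ∃ C : ℝ, 0 < C ∧ ∀ s : ℂ, 1/2 ≤ s.re → ‖riemannZeta₁ s‖ ≤ C * (1 + ‖s‖) ^ 2 := by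
  set S := ∑' n : ℕ, ((n:ℝ) + 1) ^ (-(3/2:ℝ)) with hS
  have hsm := summable_shift (3/2) (by norm_num)
  have hS0 : 0 ≤ S := tsum_nonneg (fun n => by positivity)
  refine ⟨1 + S, by positivity, ?_⟩
  intro s hs
  have h := zeta1_sum s (by linarith)
  have hb : ∀ n, ‖bt n s‖ ≤ ‖s - 1‖ * ‖s‖ * ((n : ℝ) + 1) ^ (-(3/2:ℝ)) := by
    intro n
    refine (bt_bound n s (by linarith)).trans ?_
    gcongr
    · have : (0:ℝ) ≤ n := Nat.cast_nonneg n
      linarith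
    · linarith
  have h2 : ‖∑' n, bt n s‖ ≤ ‖s - 1‖ * ‖s‖ * S := by
    rw [hS, ← tsum_mul_left]
    exact tsum_of_norm_bounded (hsm.mul_left _).hasSum hb
  have h3 : ‖riemannZeta₁ s‖ ≤ 1 + ‖s - 1‖ * ‖s‖ * S := by
    have : riemannZeta₁ s = 1 + (riemannZeta₁ s - 1) := by ring
    rw [this, h]
    refine (norm_add_le _ _).trans ?_
    simp; exact h2
  have h4 : ‖s - 1‖ ≤ 1 + ‖s‖ := by
    have := norm_sub_le s 1
    simp at this; linarith
  have h5 := norm_nonneg s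
  calc _ ≤ 1 + ‖s - 1‖ * ‖s‖ * S := h3
    _ ≤ 1 + (1 + ‖s‖) * (1 + ‖s‖) * S := by gcongr; linarith
    _ ≤ _ := by nlinarith

lemma zeta1_eq (s : ℂ) (hs : s ≠ 1) : riemannZeta₁ s = (s - 1) * riemannZeta s := by
  rw [riemannZeta_eq_inv_sub_mul hs]
  have : s - 1 ≠ 0 := sub_ne_zero.2 hs
  field_simp

lemma zeta1_growth : ∃ C : ℝ, 0 < C ∧ ∀ s : ℂ, -7 ≤ s.re → ‖riemannZeta₁ s‖ ≤ C * (3 + ‖s‖) ^ 12 := by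
  obtain ⟨C, hC, h⟩ := zeta1_growth_right
  obtain ⟨D, hD, hd⟩ := zeta_FE_bd 7
  have hcpt : IsCompact (Metric.closedBall (0:ℂ) 10) := isCompact_closedBall 0 10
  obtain ⟨M, hM⟩ := (hcpt.image differentiable_riemannZeta₁.continuous).isBounded.exists_norm_le
  refine ⟨C + |M| + 2 * (D * C), by positivity, ?_⟩
  intro s hs
  have hn := norm_nonneg s
  have hone : (1:ℝ) ≤ (3 + ‖s‖) ^ 12 := one_le_pow₀ (by linarith)
  by_cases h1 : 1/2 ≤ s.re
  · calc _ ≤ C * (1 + ‖s‖) ^ 2 := h s h1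
      _ ≤ C * (3 + ‖s‖) ^ 12 := by
        gcongr
        calc (1 + ‖s‖) ^ 2 ≤ (3 + ‖s‖) ^ 2 := by gcongr; linarith
          _ ≤ _ := by apply pow_le_pow_right₀ <;> linarith
      _ ≤ _ := by
        gcongr
        have := abs_nonneg M
        have : 0 ≤ D * C := by positivity
        linarith
  push Not at h1
  by_cases h2 : s ∈ Metric.closedBall (0:ℂ) 10
  · have := hM _ ⟨s, h2, rfl⟩
    have h3 := le_abs_self M
    have : 0 ≤ D * C := by positivity
    calc _ ≤ |M| * 1 := by linarith
      _ ≤ |M| * (3 + ‖s‖) ^ 12 := by gcongr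
      _ ≤ _ := by gcongr; linarith
  simp at h2
  have hw1 : (1 - s) ≠ 1 := by
    intro hh
    have : s = 0 := by linear_combination -hh
    simp [this] at h2
    linarith
  have hs1 : s ≠ 1 := by rintro rfl; simp at h1; linarith
  have hfe := hd (1 - s) (by simp; linarith) (by simp; linarith) hw1
  rw [sub_sub_cancel] at hfe
  have hz := zeta1_eq (1 - s) hw1
  have hzb := h (1 - s) (by simp; linarith)
  rw [hz, norm_mul] at hzb
  have e1 : ‖1 - s - 1‖ = ‖s‖ := by rw [show 1 - s - 1 = -s by ring, norm_neg]
  rw [e1] at hzb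
  have e2 : ‖1 - s‖ ≤ 1 + ‖s‖ := by
    have := norm_sub_le 1 s
    simp at this; linarith
  have e3 : 1 ≤ ‖1 - s‖ := by
    have := norm_sub_norm_le s 1
    rw [norm_sub_rev] at this
    simp at this; linarith
  have e4 : ‖1 - s‖ ^ ((1 - s).re - 1/2) ≤ (3 + ‖s‖) ^ 8 := by
    calc _ ≤ ‖1 - s‖ ^ ((8:ℕ):ℝ) := by
          apply Real.rpow_le_rpow_of_exponent_le e3
          simp; linarith
      _ = ‖1 - s‖ ^ 8 := by rw [Real.rpow_natCast]
      _ ≤ _ := by gcongr; linarith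
  have e5 : ‖riemannZeta (1 - s)‖ ≤ C * (3 + ‖s‖) ^ 2 := by
    have : ‖riemannZeta (1 - s)‖ ≤ ‖s‖ * ‖riemannZeta (1 - s)‖ := by
      have := norm_nonneg (riemannZeta (1 - s))
      nlinarith
    refine this.trans (hzb.trans ?_)
    have e7 : 1 + ‖1 - s‖ ≤ 3 + ‖s‖ := by linarith
    gcongr C * ?_ ^ 2
  rw [zeta1_eq s hs1, norm_mul]
  have e6 : ‖s - 1‖ ≤ 3 + ‖s‖ := by rw [norm_sub_rev]; linarith
  calc _ ≤ (3 + ‖s‖) * (D * (3 + ‖s‖) ^ 8 * (C * (3 + ‖s‖) ^ 2)) := by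
        gcongr
        refine hfe.trans ?_
        gcongr
    _ = (D * C) * (3 + ‖s‖) ^ 11 := by ring
    _ ≤ (D * C) * (3 + ‖s‖) ^ 12 := by
        gcongr <;> linarith
    _ ≤ _ := by
        gcongr
        have := abs_nonneg M
        have : 0 ≤ D * C := by positivity
        linarith
end Zet
end ZS

namespace ZS
section Zet2
open Complex Filter Topology Asymptotics Set

lemma zeta_bdd_right (σ₀ : ℝ) (h0 : 1 < σ₀) : ∃ C : ℝ, 0 < C ∧ ∀ s : ℂ, σ₀ ≤ s.re → ‖riemannZeta s‖ ≤ C := by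
  have hsm := summable_shift σ₀ h0
  set S := ∑' n : ℕ, ((n:ℝ) + 1) ^ (-σ₀) with hS
  have hS0 : 0 ≤ S := tsum_nonneg (fun n => by positivity)
  refine ⟨S + 1, by linarith, ?_⟩
  intro s hs
  rw [zeta_eq_tsum_one_div_nat_add_one_cpow (by linarith)]
  have : ‖∑' n : ℕ, 1 / ((n:ℂ) + 1) ^ s‖ ≤ S := by
    refine tsum_of_norm_bounded hsm.hasSum ?_
    intro n
    have e : ((n:ℂ) + 1) = (((n:ℝ) + 1 : ℝ) : ℂ) := by push_cast; rfl
    rw [norm_div, e, Complex.norm_cpow_eq_rpow_re_of_pos (by positivity), norm_one, one_div, ← Real.rpow_neg (by positivity)]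
    apply Real.rpow_le_rpow_of_exponent_le
    · have : (0:ℝ) ≤ n := Nat.cast_nonneg n
      linarith
    · linarith
  linarith

lemma zeta_sub_one_decay : ∃ C : ℝ, 0 < C ∧ ∀ s : ℂ, 2 ≤ s.re → ‖riemannZeta s - 1‖ ≤ C * (2:ℝ) ^ (-s.re) := by
  have hsm := summable_shift 2 (by norm_num)
  have hsm' := (summable_nat_add_iff 1).2 hsm
  set S := ∑' n : ℕ, (((n + 1 : ℕ):ℝ) + 1) ^ (-(2:ℝ)) with hS
  have hS0 : 0 ≤ S := tsum_nonneg (fun n => by positivity)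
  refine ⟨4 * S + 1, by linarith, ?_⟩
  intro s hs
  have hz := zeta_eq_tsum_one_div_nat_add_one_cpow (s := s) (by linarith)
  have hsum : Summable (fun n : ℕ => 1 / ((n:ℂ) + 1) ^ s) := by
    have := (summable_nat_add_iff 1).2 (Complex.summable_one_div_nat_cpow.2 (by linarith : 1 < s.re))
    simpa using this
  rw [hsum.tsum_eq_zero_add] at hz
  simp only [Nat.cast_zero, zero_add, one_cpow, div_one] at hz
  rw [hz, add_sub_cancel_left]
  have : ‖∑' n : ℕ, 1 / (((n + 1 : ℕ):ℂ) + 1) ^ s‖ ≤ (4 * 2 ^ (-s.re)) * S := by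
    rw [hS, ← tsum_mul_left]
    refine tsum_of_norm_bounded (hsm'.mul_left _).hasSum ?_
    intro n
    have e : (((n + 1 : ℕ):ℂ) + 1) = ((((n + 1 : ℕ):ℝ) + 1 : ℝ) : ℂ) := by push_cast; rfl
    have hp : (2:ℝ) ≤ ((n + 1 : ℕ):ℝ) + 1 := by
      push_cast
      have : (0:ℝ) ≤ n := Nat.cast_nonneg n
      linarith
    set a := ((n + 1 : ℕ):ℝ) + 1
    have ha : 0 < a := by linarith
    rw [norm_div, e, Complex.norm_cpow_eq_rpow_re_of_pos ha, norm_one, one_div, ← Real.rpow_neg ha.le]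
    have e1 : a ^ (-s.re) = a ^ (-(s.re - 2)) * a ^ (-(2:ℝ)) := by
      rw [← Real.rpow_add ha]; ring_nf
    have e2 : (4:ℝ) * 2 ^ (-s.re) = 2 ^ (-(s.re - 2)) := by
      rw [show (4:ℝ) = 2 ^ (2:ℝ) by norm_num, ← Real.rpow_add (by norm_num)]; ring_nf
    rw [e1, e2]
    exact mul_le_mul_of_nonneg_right (Real.rpow_le_rpow_of_nonpos (by norm_num) hp (by linarith)) (by positivity)
  have hp : (0:ℝ) < 2 ^ (-s.re) := by positivity
  nlinarith

lemma cauchy_deriv {f : ℂ → ℂ} {c : ℂ} {R B : ℝ} (hR : 0 < R) (n : ℕ)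
    (hf : ∀ z ∈ Metric.closedBall c R, DifferentiableAt ℂ f z)
    (hB : ∀ z ∈ Metric.sphere c R, ‖f z‖ ≤ B) :
    ‖iteratedDeriv n f c‖ ≤ n.factorial * B / R ^ n := by
  refine Complex.norm_iteratedDeriv_le_of_forall_mem_sphere_norm_le n hR ?_ hB
  apply DifferentiableOn.diffContOnCl
  rw [closure_ball _ hR.ne']
  exact fun z hz => (hf z hz).differentiableWithinAt

lemma re_of_mem_closedBall {z s : ℂ} {R : ℝ} (h : z ∈ Metric.closedBall s R) : |z.re - s.re| ≤ R ∧ |z.im - s.im| ≤ R := by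
  rw [Metric.mem_closedBall, dist_eq_norm] at h
  have h1 := Complex.abs_re_le_norm (z - s)
  have h2 := Complex.abs_im_le_norm (z - s)
  simp only [sub_re, sub_im] at h1 h2
  exact ⟨h1.trans h, h2.trans h⟩

lemma ne_one_of_re {s : ℂ} (h : 1 < s.re) : s ≠ 1 := by rintro rfl; simp at h
lemma ne_one_of_im {s : ℂ} (h : s.im ≠ 0) : s ≠ 1 := by rintro rfl; simp at h

lemma zeta_deriv_decay (n : ℕ) (hn : 1 ≤ n) : ∃ C : ℝ, 0 < C ∧ ∀ s : ℂ, 3 ≤ s.re →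
    ‖iteratedDeriv n riemannZeta s‖ ≤ C * (2:ℝ) ^ (-s.re) := by
  obtain ⟨C, hC, h⟩ := zeta_sub_one_decay
  refine ⟨n.factorial * (2 * C), by positivity, ?_⟩
  intro s hs
  have h1 : iteratedDeriv n riemannZeta s = iteratedDeriv n (fun s => riemannZeta s - 1) s := by
    obtain ⟨m, rfl⟩ : ∃ m, n = m + 1 := ⟨n - 1, by omega⟩
    rw [iteratedDeriv_succ', iteratedDeriv_succ']
    congr 1
    funext z
    rw [deriv_sub_const]
  rw [h1]
  have := cauchy_deriv (f := fun s => riemannZeta s - 1) (c := s) (R := 1) (B := 2 * C * (2:ℝ) ^ (-s.re)) one_pos n ?_ ?_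
  · simpa [mul_assoc] using this
  · intro z hz
    have := abs_le.1 (re_of_mem_closedBall hz).1
    exact (differentiableAt_riemannZeta (ne_one_of_re (by linarith))).sub_const _
  · intro z hz
    have := abs_le.1 (re_of_mem_closedBall (Metric.sphere_subset_closedBall hz)).1
    refine (h z (by linarith)).trans ?_
    have e : (2:ℝ) * C * 2 ^ (-s.re) = C * 2 ^ (1 + -s.re) := by
      rw [Real.rpow_add (by norm_num)]; norm_num; ring
    rw [e]
    gcongr
    · norm_num
    · linarith

lemma zeta_deriv_bdd_right (σ₀ : ℝ) (h0 : 1 < σ₀) (n : ℕ) : ∃ C : ℝ, 0 < C ∧ ∀ s : ℂ, σ₀ ≤ s.re →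
    ‖iteratedDeriv n riemannZeta s‖ ≤ C := by
  obtain ⟨C, hC, h⟩ := zeta_bdd_right ((σ₀ + 1) / 2) (by linarith)
  have hr : 0 < (σ₀ - 1) / 2 := by linarith
  refine ⟨n.factorial * C / ((σ₀ - 1) / 2) ^ n, by positivity, ?_⟩
  intro s hs
  refine cauchy_deriv hr n ?_ ?_
  · intro z hz
    have := abs_le.1 (re_of_mem_closedBall hz).1
    exact (differentiableAt_riemannZeta (ne_one_of_re (by linarith)))
  · intro z hz
    have := abs_le.1 (re_of_mem_closedBall (Metric.sphere_subset_closedBall hz)).1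
    exact (h z (by linarith))

lemma poly_O (C : ℝ) (k : ℕ) : ∃ B D : ℝ, ∀ y : ℝ, 0 ≤ y → C * (5 + y) ^ k ≤ D * Real.exp (B * Real.exp (1 * y)) := by
  refine ⟨k * 5, |C|, ?_⟩
  intro y hy
  have h1 : (5 + y) ^ k ≤ Real.exp ((k * 5) * Real.exp (1 * y)) := by
    rw [mul_assoc, Real.exp_nat_mul]
    gcongr
    have h2 := Real.add_one_le_exp (5 * Real.exp (1 * y))
    have h3 := Real.add_one_le_exp (1 * y)
    linarith
  calc _ ≤ |C| * (5 + y) ^ k := by gcongr; exact le_abs_self C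
    _ ≤ _ := by gcongr

lemma zeta_convexity_aux : ∃ C : ℝ, 0 < C ∧ ∀ s : ℂ, -1/5 ≤ s.re → s.re ≤ 6/5 →
    ‖riemannZeta₁ s‖ ^ 4 ≤ C * ‖s + 3‖ ^ 7 := by
  obtain ⟨A, hA, ha⟩ := zeta_bdd_right (6/5) (by norm_num)
  obtain ⟨D, hD, hd⟩ := zeta_FE_bd 0
  obtain ⟨G, hG, hg⟩ := zeta1_growth
  set C := A ^ 4 + (D * A) ^ 4 with hCdef
  have hC : 0 < C := by positivity
  refine ⟨C, hC, ?_⟩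
  have hnorm : ∀ z : ℂ, -1/5 ≤ z.re → 1 ≤ ‖z + 3‖ ∧ ‖z - 1‖ ≤ ‖z + 3‖ := by
    intro z hz
    constructor
    · refine le_trans ?_ (Complex.re_le_norm _)
      simp; linarith
    · rw [Complex.norm_def, Complex.norm_def]
      apply Real.sqrt_le_sqrt
      simp [Complex.normSq_apply]
      nlinarith
  intro s hs1 hs2
  have key : ‖riemannZeta₁ s ^ 4 / (s + 3) ^ 7‖ ≤ C := by
    refine PhragmenLindelof.vertical_strip (a := -1/5) (b := 6/5) (f := fun s => riemannZeta₁ s ^ 4 / (s + 3) ^ 7) ?_ ?_ ?_ ?_ hs1 hs2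
    · apply DifferentiableOn.diffContOnCl
      intro z hz
      rw [Complex.closure_preimage_re, closure_Ioo (by norm_num)] at hz
      have hz1 : -1/5 ≤ z.re := hz.1
      have : (z + 3) ^ 7 ≠ 0 := by
        apply pow_ne_zero
        intro h
        have := (hnorm z hz1).1
        rw [h] at this; simp at this; linarith
      exact ((differentiable_riemannZeta₁ z).pow 4 |>.div (by fun_prop) this).differentiableWithinAt
    · obtain ⟨B, E, hBE⟩ := poly_O (G ^ 4) 48
      refine ⟨1, by rw [lt_div_iff₀ (by norm_num)]; linarith [Real.pi_gt_three], B, ?_⟩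
      rw [isBigO_iff]
      refine ⟨E, ?_⟩
      rw [eventually_inf_principal]
      refine Eventually.of_forall ?_
      intro z hz
      have hz1 : -1/5 < z.re := hz.1
      have hz2 : z.re < 6/5 := hz.2
      rw [Real.norm_of_nonneg (Real.exp_pos _).le]
      refine le_trans ?_ (hBE |z.im| (abs_nonneg _))
      rw [norm_div, norm_pow, norm_pow]
      have h1 := (hnorm z hz1.le).1
      have h3 : ‖z‖ ≤ 2 + |z.im| := by
        refine (Complex.norm_le_abs_re_add_abs_im z).trans ?_
        have : |z.re| ≤ 2 := by rw [abs_le]; constructor <;> linarith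
        linarith
      calc ‖riemannZeta₁ z‖ ^ 4 / ‖z + 3‖ ^ 7 ≤ ‖riemannZeta₁ z‖ ^ 4 := by
            apply div_le_self (by positivity)
            exact one_le_pow₀ h1
        _ ≤ (G * (3 + ‖z‖) ^ 12) ^ 4 := by gcongr; exact hg z (by linarith)
        _ ≤ (G * (5 + |z.im|) ^ 12) ^ 4 := by
            have : 3 + ‖z‖ ≤ 5 + |z.im| := by linarith
            gcongr
        _ = _ := by ring
    · intro z hz
      have hz1 : -1/5 ≤ z.re := hz.ge
      obtain ⟨h1, h2⟩ := hnorm z hz1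
      rw [norm_div, norm_pow, norm_pow, div_le_iff₀ (by positivity)]
      have hw : (1 - z) ≠ 1 := by
        intro h; have := congrArg Complex.re h; simp [hz] at this; 
      have h3 := hd (1 - z) (by simp [hz]; norm_num) (by simp [hz]; norm_num) hw
      rw [sub_sub_cancel] at h3
      have h4 := ha (1 - z) (by simp [hz]; norm_num)
      have hz' : z ≠ 1 := by rintro rfl; simp at hz; norm_num at hz
      rw [zeta1_eq z hz', norm_mul]
      have h5 : ‖1 - z‖ ^ ((1 - z).re - 1/2) ≤ ‖z + 3‖ ^ (7/10 : ℝ) := by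
        have : (1 - z).re - 1/2 = 7/10 := by simp [hz]; norm_num
        rw [this]
        gcongr
        rw [norm_sub_rev]; exact h2
      have h6 : (‖z + 3‖ ^ (7/10 : ℝ)) ^ 4 ≤ ‖z + 3‖ ^ 3 := by
        rw [← Real.rpow_natCast, ← Real.rpow_mul (norm_nonneg _), ← Real.rpow_natCast]
        apply Real.rpow_le_rpow_of_exponent_le h1
        norm_num
      calc (‖z - 1‖ * ‖riemannZeta z‖) ^ 4 ≤ (‖z + 3‖ * (D * ‖z + 3‖ ^ (7/10 : ℝ) * A)) ^ 4 := by
            gcongr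
            refine h3.trans ?_
            gcongr
        _ = (D * A) ^ 4 * (‖z + 3‖ ^ 4 * (‖z + 3‖ ^ (7/10 : ℝ)) ^ 4) := by ring
        _ ≤ (D * A) ^ 4 * (‖z + 3‖ ^ 4 * ‖z + 3‖ ^ 3) := by gcongr
        _ = (D * A) ^ 4 * ‖z + 3‖ ^ 7 := by ring
        _ ≤ _ := by
            gcongr
            have : 0 ≤ A ^ 4 := by positivity
            linarith
    · intro z hz
      have hz1 : -1/5 ≤ z.re := by rw [hz]; norm_num
      obtain ⟨h1, h2⟩ := hnorm z hz1
      rw [norm_div, norm_pow, norm_pow, div_le_iff₀ (by positivity)]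
      have h4 := ha z hz.ge
      rw [zeta1_eq z (ne_one_of_re (by rw [hz]; norm_num)), norm_mul]
      calc (‖z - 1‖ * ‖riemannZeta z‖) ^ 4 ≤ (‖z + 3‖ * A) ^ 4 := by gcongr
        _ = A ^ 4 * ‖z + 3‖ ^ 4 := by ring
        _ ≤ C * ‖z + 3‖ ^ 7 := by
            have : 0 ≤ (D * A) ^ 4 := by positivity
            gcongr
            · linarith
            · norm_num
  obtain ⟨h1, h2⟩ := hnorm s hs1
  rwa [norm_div, norm_pow, norm_pow, div_le_iff₀ (by positivity)] at key

lemma zeta_convexity : ∃ C : ℝ, 0 < C ∧ ∀ s : ℂ, -1/5 ≤ s.re → s.re ≤ 6/5 → 1 ≤ |s.im| →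
    ‖riemannZeta s‖ ≤ C * |s.im| ^ (3/4 : ℝ) := by
  obtain ⟨C, hC, h⟩ := zeta_convexity_aux
  refine ⟨(C * 6 ^ 7) ^ (1/4 : ℝ), by positivity, ?_⟩
  intro s h1 h2 h3
  have hs := h s h1 h2
  have ht : 0 < |s.im| := by linarith
  rw [zeta1_eq s (ne_one_of_im (by intro h; simp [h] at ht)), norm_mul] at hs
  have h4 : |s.im| ≤ ‖s - 1‖ := by simpa using Complex.abs_im_le_norm (s - 1)
  have h5 : ‖s + 3‖ ≤ 6 * |s.im| := by
    refine (Complex.norm_le_abs_re_add_abs_im _).trans ?_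
    have : |(s + 3).re| ≤ 5 := by rw [abs_le]; constructor <;> simp <;> linarith
    simp at this ⊢
    linarith
  have h6 : ‖riemannZeta s‖ ^ 4 ≤ (C * 6 ^ 7) * |s.im| ^ 3 := by
    have : |s.im| ^ 4 * ‖riemannZeta s‖ ^ 4 ≤ |s.im| ^ 4 * ((C * 6 ^ 7) * |s.im| ^ 3) := by
      calc _ ≤ (‖s - 1‖ * ‖riemannZeta s‖) ^ 4 := by rw [mul_pow]; gcongr
        _ ≤ C * (6 * |s.im|) ^ 7 := hs.trans (by gcongr)
        _ = _ := by ring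
    exact le_of_mul_le_mul_left this (by positivity)
  have h7 : ‖riemannZeta s‖ = (‖riemannZeta s‖ ^ 4) ^ (1/4 : ℝ) := by
    rw [← Real.rpow_natCast, ← Real.rpow_mul (norm_nonneg _)]; norm_num
  rw [h7]
  calc _ ≤ ((C * 6 ^ 7) * |s.im| ^ 3) ^ (1/4 : ℝ) := by gcongr
    _ = _ := by
      rw [Real.mul_rpow (by positivity) (by positivity)]
      congr 1
      rw [← Real.rpow_natCast, ← Real.rpow_mul ht.le]; norm_num

lemma zeta_deriv_convexity (n : ℕ) : ∃ C : ℝ, 0 < C ∧ ∀ s : ℂ, -1/10 ≤ s.re → s.re ≤ 11/10 → 2 ≤ |s.im| →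
    ‖iteratedDeriv n riemannZeta s‖ ≤ C * |s.im| ^ (3/4 : ℝ) := by
  obtain ⟨C, hC, h⟩ := zeta_convexity
  refine ⟨n.factorial * (2 * C) / (1/10) ^ n, by positivity, ?_⟩
  intro s h1 h2 h3
  have := cauchy_deriv (f := riemannZeta) (c := s) (R := 1/10) (B := 2 * C * |s.im| ^ (3/4 : ℝ)) (by norm_num) n ?_ ?_
  · refine this.trans (le_of_eq (by ring))
  · intro z hz
    have := (re_of_mem_closedBall hz).2
    refine differentiableAt_riemannZeta (ne_one_of_im ?_)
    intro h
    rw [h, zero_sub, abs_neg] at this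
    linarith
  · intro z hz
    obtain ⟨a1, a2⟩ := (re_of_mem_closedBall (Metric.sphere_subset_closedBall hz))
    have a3 := abs_le.1 a1
    have a4 := abs_sub_abs_le_abs_sub s.im z.im
    have a5 := abs_sub_abs_le_abs_sub z.im s.im
    rw [abs_sub_comm] at a4
    refine (h z (by linarith) (by linarith) (by linarith)).trans ?_
    have : |z.im| ^ (3/4 : ℝ) ≤ 2 * |s.im| ^ (3/4 : ℝ) := by
      calc _ ≤ (2 * |s.im|) ^ (3/4 : ℝ) := by gcongr; linarith
        _ = 2 ^ (3/4 : ℝ) * |s.im| ^ (3/4 : ℝ) := by rw [Real.mul_rpow] <;> positivity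
        _ ≤ 2 ^ (1 : ℝ) * |s.im| ^ (3/4 : ℝ) := by gcongr <;> norm_num
        _ = _ := by norm_num
    calc _ ≤ C * (2 * |s.im| ^ (3/4 : ℝ)) := by gcongr
      _ = _ := by ring
end Zet2
end ZS

namespace ZS
section Landau
open Complex Filter Topology Asymptotics Set Metric

lemma order_ne_top {f : ℂ → ℂ} (hf : Differentiable ℂ f) {s₀ : ℂ} (h0 : f s₀ ≠ 0) (ρ : ℂ) :
    analyticOrderAt f ρ ≠ ⊤ := by
  have hA : AnalyticOnNhd ℂ f univ := fun z _ => hf.analyticAt z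
  refine hA.analyticOrderAt_ne_top_of_isPreconnected isPreconnected_univ (mem_univ s₀) (mem_univ ρ) ?_
  rw [((hf.analyticAt s₀).analyticOrderAt_eq_zero).2 h0]
  simp

/-- pull out one zero -/
lemma factor_one {f : ℂ → ℂ} (hf : Differentiable ℂ f) {s₀ : ℂ} (h0 : f s₀ ≠ 0) (ρ : ℂ) :
    ∃ g : ℂ → ℂ, Differentiable ℂ g ∧ g ρ ≠ 0 ∧ ∀ z, f z = (z - ρ) ^ analyticOrderNatAt f ρ * g z := by
  set m := analyticOrderNatAt f ρ with hm
  have hne := order_ne_top hf h0 ρ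
  have h1 := ((hf.analyticAt ρ).analyticOrderAt_eq_natCast (n := m)).1 (Nat.cast_analyticOrderNatAt hne).symm
  obtain ⟨g, hg, hg0, hgf⟩ := h1
  refine ⟨fun z => if z = ρ then g ρ else f z / (z - ρ) ^ m, ?_, by simp [hg0], ?_⟩
  · intro z
    by_cases hz : z = ρ
    · subst hz
      apply hg.differentiableAt.congr_of_eventuallyEq
      filter_upwards [hgf] with w hw
      split_ifs with h
      · rw [h]
      · rw [hw, smul_eq_mul, mul_div_assoc, mul_comm]
        have : (w - z) ^ m ≠ 0 := pow_ne_zero _ (sub_ne_zero.2 h)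
        field_simp
    · have hh : DifferentiableAt ℂ (fun z => f z / (z - ρ) ^ m) z := by
        refine (hf z).div (by fun_prop) (pow_ne_zero _ (sub_ne_zero.2 hz))
      apply hh.congr_of_eventuallyEq
      filter_upwards [isOpen_ne.mem_nhds hz] with w hw
      exact if_neg hw
  · intro z
    by_cases hz : z = ρ
    · subst hz
      simp only [if_true]
      have := hgf.self_of_nhds
      simpa [smul_eq_mul] using this
    · simp only [if_neg hz]
      have : (z - ρ) ^ m ≠ 0 := pow_ne_zero _ (sub_ne_zero.2 hz)
      field_simp

lemma factor_all {f : ℂ → ℂ} (hf : Differentiable ℂ f) {s₀ : ℂ} (h0 : f s₀ ≠ 0) (Z : Finset ℂ) :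
    ∃ g : ℂ → ℂ, Differentiable ℂ g ∧ (∀ ρ ∈ Z, g ρ ≠ 0) ∧
      (∀ z, f z = (∏ ρ ∈ Z, (z - ρ) ^ analyticOrderNatAt f ρ) * g z) := by
  classical
  induction Z using Finset.induction_on with
  | empty => exact ⟨f, hf, by simp, by simp⟩
  | insert a Z ha ih =>
    obtain ⟨g, hg, hgZ, hgf⟩ := ih
    have hg0 : g s₀ ≠ 0 := by
      intro h; rw [hgf, h, mul_zero] at h0; exact h0 rfl
    obtain ⟨k, hk, hka, hkg⟩ := factor_one hg hg0 a
    have hord : analyticOrderNatAt g a = analyticOrderNatAt f a := by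
      have hP : Differentiable ℂ (fun z => ∏ ρ ∈ Z, (z - ρ) ^ analyticOrderNatAt f ρ) := by fun_prop
      have hPa : (fun z => ∏ ρ ∈ Z, (z - ρ) ^ analyticOrderNatAt f ρ) a ≠ 0 := by
        simp only
        rw [Finset.prod_ne_zero_iff]
        intro ρ hρ
        apply pow_ne_zero
        rw [sub_ne_zero]
        rintro rfl
        exact ha hρ
      have : f = (fun z => ∏ ρ ∈ Z, (z - ρ) ^ analyticOrderNatAt f ρ) * g := by
        funext z; exact hgf z
      have e : analyticOrderAt f a = analyticOrderAt g a := by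
        conv_lhs => rw [this]
        rw [analyticOrderAt_mul (hP.analyticAt a) (hg.analyticAt a),
          ((hP.analyticAt a).analyticOrderAt_eq_zero).2 hPa, zero_add]
      unfold analyticOrderNatAt
      rw [e]
    refine ⟨k, hk, ?_, ?_⟩
    · intro ρ hρ
      rcases Finset.mem_insert.1 hρ with rfl | h
      · exact hka
      · intro h'
        apply hgZ ρ h
        rw [hkg, h', mul_zero]
    · intro z
      rw [Finset.prod_insert ha, hgf z, hkg z, hord]
      ring

/-- logarithmic derivative of a factorization -/
lemma logDeriv_factor {f g : ℂ → ℂ} {Z : Finset ℂ} {m : ℂ → ℕ} 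
    (h : ∀ z, f z = (∏ ρ ∈ Z, (z - ρ) ^ m ρ) * g z) {s : ℂ} (hg : DifferentiableAt ℂ g s) (hs : f s ≠ 0)
    (hsZ : ∀ ρ ∈ Z, s ≠ ρ) :
    deriv f s / f s = deriv g s / g s + ∑ ρ ∈ Z, (m ρ : ℂ) / (s - ρ) := by
  have hgs : g s ≠ 0 := by intro h'; rw [h, h', mul_zero] at hs; exact hs rfl
  have hf : f = fun z => (∏ ρ ∈ Z, (z - ρ) ^ m ρ) * g z := funext h
  have h1 : logDeriv f s = logDeriv (fun z => ∏ ρ ∈ Z, (z - ρ) ^ m ρ) s + logDeriv g s := by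
    rw [hf]
    refine logDeriv_mul s ?_ hgs (by fun_prop) hg
    rw [Finset.prod_ne_zero_iff]
    intro ρ hρ
    exact pow_ne_zero _ (sub_ne_zero.2 (hsZ ρ hρ))
  rw [← logDeriv_apply, h1, ← logDeriv_apply, add_comm]
  congr 1
  rw [logDeriv_prod (f := fun ρ z => (z - ρ) ^ m ρ)]
  · apply Finset.sum_congr rfl
    intro ρ hρ
    rw [logDeriv_fun_pow (by fun_prop)]
    rw [logDeriv_apply, deriv_sub_const, deriv_id'']
    ring
  · intro ρ hρ
    exact pow_ne_zero _ (sub_ne_zero.2 (hsZ ρ hρ))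
  · intro ρ hρ; fun_prop

lemma logderiv_bd {g : ℂ → ℂ} {s₀ : ℂ} {R M : ℝ} (hR : 0 < R) (hM : 0 < M)
    (hg : DifferentiableOn ℂ g (ball s₀ R)) (hg0 : ∀ z ∈ ball s₀ R, g z ≠ 0)
    (hb : ∀ z ∈ ball s₀ R, ‖g z‖ ≤ Real.exp M * ‖g s₀‖) :
    ∀ s ∈ closedBall s₀ (5 * R / 6), ‖deriv g s / g s‖ ≤ 264 * M / R := by
  have hs0 : s₀ ∈ ball s₀ R := mem_ball_self hR
  have hd : ∀ z ∈ ball s₀ R, DifferentiableAt ℂ g z := fun z hz => (hg z hz).differentiableAt (isOpen_ball.mem_nhds hz)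
  have hdl : DifferentiableOn ℂ (fun z => deriv g z / g z) (ball s₀ R) :=
    (hg.deriv isOpen_ball).div hg hg0
  obtain ⟨L, hL0, hL⟩ := (hdl.isExactOn_ball).with_val_at s₀ 0
  have hexp : ∀ z ∈ ball s₀ R, g z * Complex.exp (-L z) = g s₀ := by
    intro z hz
    have : ∀ z ∈ ball s₀ R, HasDerivAt (fun z => g z * Complex.exp (-L z)) 0 z := by
      intro z hz
      have h1 := (hd z hz).hasDerivAt.fun_mul ((hL z hz).fun_neg.cexp)
      refine h1.congr_deriv ?_
      have := hg0 z hz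
      have e : g z * (deriv g z / g z) = deriv g z := mul_div_cancel₀ _ this
      linear_combination -Complex.exp (-L z) * e
    have h2 := (convex_ball s₀ R).is_const_of_fderivWithin_eq_zero (𝕜 := ℂ) (f := fun z => g z * Complex.exp (-L z))
      (fun z hz => (this z hz).differentiableAt.differentiableWithinAt) (fun z hz => by
        rw [fderivWithin_of_isOpen isOpen_ball hz]
        have := (this z hz).hasFDerivAt.fderiv
        rw [this]; ext; simp) hz hs0
    rw [h2, hL0]; simp
  have hRe : ∀ z ∈ ball s₀ R, (L z).re ≤ M := by
    intro z hz
    have h1 : g z = g s₀ * Complex.exp (L z) := by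
      rw [← hexp z hz, mul_assoc, ← Complex.exp_add]; simp
    have h2 := hb z hz
    rw [h1, norm_mul, mul_comm, Complex.norm_exp] at h2
    have h3 := le_of_mul_le_mul_right h2 (norm_pos_iff.2 (hg0 _ hs0))
    exact Real.exp_le_exp.1 h3
  have hBC : ∀ z ∈ closedBall s₀ (11 * R / 12), ‖L z‖ ≤ 22 * M := by
    intro z hz
    rw [mem_closedBall, dist_eq_norm] at hz
    have hzR : ‖z - s₀‖ < R := by linarith
    have h1 := Complex.borelCaratheodory_zero (f := fun w => L (s₀ + w)) (R := R) (z := z - s₀) hM ?_ ?_ hR (by simpa using hzR) (by simpa using hL0)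
    · simp only [add_sub_cancel] at h1
      refine h1.trans ?_
      rw [div_le_iff₀ (by linarith)]
      nlinarith
    · intro w hw
      have : s₀ + w ∈ ball s₀ R := by simpa using hw
      have := (hL _ this).differentiableAt
      exact (DifferentiableAt.comp w (f := fun w => s₀ + w) this (by fun_prop)).differentiableWithinAt
    · intro w hw
      exact hRe _ (by simpa using hw)
  intro s hs
  have hsR : s ∈ ball s₀ R := by
    rw [mem_closedBall] at hs; rw [mem_ball]; linarith
  rw [← (hL s hsR).deriv]
  have hsub : ∀ z ∈ closedBall s (R / 12), z ∈ closedBall s₀ (11 * R / 12) := by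
    intro z hz
    rw [mem_closedBall] at *
    have := dist_triangle z s s₀
    linarith
  have := cauchy_deriv (f := L) (c := s) (R := R / 12) (B := 22 * M) (by linarith) 1 (fun z hz => by
      have := hsub z hz
      refine (hL z ?_).differentiableAt
      rw [mem_closedBall] at this; rw [mem_ball]; linarith) (fun z hz => hBC z (hsub z (sphere_subset_closedBall hz)))
  rw [iteratedDeriv_one] at this
  refine this.trans (le_of_eq ?_)
  simp; field_simp; norm_num

lemma finite_zeros {f : ℂ → ℂ} (hf : Differentiable ℂ f) {s₀ : ℂ} (h0 : f s₀ ≠ 0) {K : Set ℂ} (hK : IsCompact K) :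
    {z ∈ K | f z = 0}.Finite := by
  by_contra hinf
  obtain ⟨z, hz, hacc⟩ := Set.Infinite.exists_accPt_of_subset_isCompact (s := {z ∈ K | f z = 0}) hinf hK (fun z hz => hz.1)
  have hA : AnalyticOnNhd ℂ f univ := fun z _ => hf.analyticAt z
  have hfr : ∃ᶠ w in 𝓝[≠] z, f w = 0 := by
    rw [accPt_iff_frequently_nhdsNE] at hacc
    exact hacc.mono (fun w hw => hw.2)
  have := hA.eqOn_zero_of_preconnected_of_frequently_eq_zero isPreconnected_univ (mem_univ z) hfr
  exact h0 (this (mem_univ s₀))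

/-- Landau lemma -/
lemma landau {f : ℂ → ℂ} (hf : Differentiable ℂ f) {s₀ : ℂ} (h0 : f s₀ ≠ 0) {R M : ℝ} (hR : 0 < R) (hM : 0 < M)
    (hb : ∀ z ∈ closedBall s₀ (3 * R), ‖f z‖ ≤ Real.exp M * ‖f s₀‖) (Z : Finset ℂ)
    (hZ : ∀ z, z ∈ Z ↔ z ∈ closedBall s₀ R ∧ f z = 0) :
    (∑ ρ ∈ Z, (analyticOrderNatAt f ρ : ℝ)) ≤ 2 * M ∧
    ∀ s ∈ closedBall s₀ (5 * R / 6), f s ≠ 0 →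
      ‖deriv f s / f s - ∑ ρ ∈ Z, (analyticOrderNatAt f ρ : ℂ) / (s - ρ)‖ ≤ 264 * M / R := by
  obtain ⟨g, hg, hgZ, hgf⟩ := factor_all hf h0 Z
  set m := analyticOrderNatAt f with hm
  have hg0 : g s₀ ≠ 0 := by intro h; rw [hgf, h, mul_zero] at h0; exact h0 rfl
  have hsph : ∀ z ∈ sphere s₀ (3 * R), 2 ^ (∑ ρ ∈ Z, m ρ) * ‖g z‖ ≤ Real.exp M * ‖g s₀‖ := by
    intro z hz
    have h1 := hb z (sphere_subset_closedBall hz)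
    rw [hgf z, hgf s₀, norm_mul, norm_mul, Complex.norm_prod, Complex.norm_prod] at h1
    have h2 : 2 ^ (∑ ρ ∈ Z, m ρ) * ∏ ρ ∈ Z, ‖(s₀ - ρ) ^ m ρ‖ ≤ ∏ ρ ∈ Z, ‖(z - ρ) ^ m ρ‖ := by
      rw [← Finset.prod_pow_eq_pow_sum, ← Finset.prod_mul_distrib]
      apply Finset.prod_le_prod
      · intro ρ _; positivity
      · intro ρ hρ
        rw [norm_pow, norm_pow, ← mul_pow]
        have a1 := ((hZ ρ).1 hρ).1
        rw [mem_closedBall, dist_eq_norm, norm_sub_rev] at a1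
        rw [mem_sphere, dist_eq_norm] at hz
        have a2 := norm_sub_norm_le (z - s₀) (ρ - s₀)
        rw [sub_sub_sub_cancel_right, norm_sub_rev ρ s₀] at a2
        gcongr
        linarith
    have hpos : 0 < ∏ ρ ∈ Z, ‖(s₀ - ρ) ^ m ρ‖ := by
      rw [← Complex.norm_prod, norm_pos_iff]
      intro h; rw [hgf, h, zero_mul] at h0; exact h0 rfl
    refine le_of_mul_le_mul_left ?_ hpos
    calc _ = (2 ^ (∑ ρ ∈ Z, m ρ) * ∏ ρ ∈ Z, ‖(s₀ - ρ) ^ m ρ‖) * ‖g z‖ := by ring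
      _ ≤ (∏ ρ ∈ Z, ‖(z - ρ) ^ m ρ‖) * ‖g z‖ := by gcongr
      _ ≤ _ := h1
      _ = _ := by ring
  have hmax : ∀ z ∈ closedBall s₀ (3 * R), 2 ^ (∑ ρ ∈ Z, m ρ) * ‖g z‖ ≤ Real.exp M * ‖g s₀‖ := by
    intro z hz
    have h3R : 3 * R ≠ 0 := by positivity
    have h2 : ‖g z‖ ≤ (Real.exp M * ‖g s₀‖) / 2 ^ (∑ ρ ∈ Z, m ρ) := by
      apply Complex.norm_le_of_forall_mem_frontier_norm_le (U := ball s₀ (3 * R)) isBounded_ball hg.diffContOnCl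
      · intro w hw
        rw [frontier_ball _ h3R] at hw
        rw [le_div_iff₀ (by positivity), mul_comm]
        exact hsph w hw
      · rwa [closure_ball _ h3R]
    rw [le_div_iff₀ (by positivity), mul_comm] at h2
    exact h2
  constructor
  · have h1 := hmax s₀ (mem_closedBall_self (by linarith))
    have h2 := le_of_mul_le_mul_right h1 (norm_pos_iff.2 hg0)
    have h3 := Real.log_le_log (by positivity) h2
    rw [Real.log_exp, Real.log_pow] at h3
    push_cast at h3
    have h4 : (1/2 : ℝ) ≤ Real.log 2 := by linarith [Real.log_two_gt_d9]
    have h5 : 0 ≤ ∑ ρ ∈ Z, (m ρ : ℝ) := Finset.sum_nonneg (fun _ _ => Nat.cast_nonneg _)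
    nlinarith
  · intro s hs hfs
    have hsZ : ∀ ρ ∈ Z, s ≠ ρ := by
      rintro ρ hρ rfl
      exact hfs ((hZ s).1 hρ).2
    rw [logDeriv_factor hgf (hg s) hfs hsZ, add_sub_cancel_right]
    refine logderiv_bd hR hM hg.differentiableOn ?_ ?_ s hs
    · intro z hz hgz
      have : z ∈ Z := (hZ z).2 ⟨ball_subset_closedBall hz, by rw [hgf, hgz, mul_zero]⟩
      exact hgZ z this hgz
    · intro z hz
      have h1 := hmax z (ball_subset_closedBall (ball_subset_ball (by linarith) hz))
      refine le_trans ?_ h1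
      have : (1:ℝ) ≤ 2 ^ (∑ ρ ∈ Z, m ρ) := one_le_pow₀ (by norm_num)
      have := norm_nonneg (g z)
      nlinarith
end Landau
end ZS

namespace ZS
section ZF
open Complex Filter Topology Asymptotics Set Metric

/-- size function -/
noncomputable def LL (t : ℝ) : ℝ := Real.log (|t| + 3)

lemma one_le_LL (t : ℝ) : 1 ≤ LL t := by
  unfold LL
  rw [Real.le_log_iff_exp_le (by positivity)]
  have := Real.exp_one_lt_d9
  have := abs_nonneg t
  linarith

lemma LL_add (t u : ℝ) (k : ℝ) (hu : |u - t| ≤ k) (hk : k ≤ 6) : LL u ≤ 2 * LL t := by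
  unfold LL
  rw [← Real.log_rpow (by positivity)]
  apply Real.log_le_log (by positivity)
  have h1 := abs_nonneg t
  have h2 : |u| ≤ |t| + 6 := by
    have := abs_sub_abs_le_abs_sub u t
    linarith
  rw [Real.rpow_two]
  nlinarith

lemma LL_two_mul (t : ℝ) : LL (2 * t) ≤ 2 * LL t := by
  unfold LL
  rw [← Real.log_rpow (by positivity)]
  apply Real.log_le_log (by positivity)
  have h1 := abs_nonneg t
  rw [Real.rpow_two, abs_mul]
  norm_num
  nlinarith

lemma zeta_two_lower (t : ℝ) : 1/3 ≤ ‖riemannZeta (2 + t * I)‖ := by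
  set s : ℂ := 2 + t * I with hsdef
  have hsre : s.re = 2 := by simp [hsdef]
  have hz := zeta_eq_tsum_one_div_nat_add_one_cpow (s := s) (by rw [hsre]; norm_num)
  have hsum : Summable (fun n : ℕ => 1 / ((n:ℂ) + 1) ^ s) := by
    have := (summable_nat_add_iff 1).2 (Complex.summable_one_div_nat_cpow.2 (by rw [hsre]; norm_num : 1 < s.re))
    simpa using this
  rw [hsum.tsum_eq_zero_add] at hz
  simp only [Nat.cast_zero, zero_add, one_cpow, div_one] at hz
  have h2 : HasSum (fun n : ℕ => 1 / (((n + 2 : ℕ) : ℝ)) ^ 2) (Real.pi ^ 2 / 6 - 1) := by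
    have := (hasSum_nat_add_iff' 2).2 hasSum_zeta_two
    simpa [Finset.sum_range_succ] using this
  have : ‖∑' n : ℕ, 1 / (((n + 1 : ℕ):ℂ) + 1) ^ s‖ ≤ Real.pi ^ 2 / 6 - 1 := by
    refine tsum_of_norm_bounded h2 ?_
    intro n
    have e : (((n + 1 : ℕ):ℂ) + 1) = (((n + 2 : ℕ) : ℝ) : ℂ) := by push_cast; ring
    rw [norm_div, e, Complex.norm_cpow_eq_rpow_re_of_pos (by positivity), norm_one, hsre, Real.rpow_two]
  have hpi : Real.pi ^ 2 < 9.93 := by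
    have := Real.pi_lt_d2
    have := Real.pi_pos
    nlinarith
  have h3 := norm_sub_norm_le (1:ℂ) (-∑' n : ℕ, 1 / (((n + 1 : ℕ):ℂ) + 1) ^ s)
  rw [sub_neg_eq_add, ← hz, norm_neg, norm_one] at h3
  linarith

lemma zeta1_two_lower (t : ℝ) : 1/3 ≤ ‖riemannZeta₁ (2 + t * I)‖ := by
  rw [zeta1_eq _ (ne_one_of_re (by simp)), norm_mul]
  have h1 := zeta_two_lower t
  have h2 : 1 ≤ ‖(2 + t * I : ℂ) - 1‖ := by
    refine le_trans ?_ (Complex.re_le_norm _)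
    simp; norm_num
  nlinarith

lemma zeta1_two_ne (t : ℝ) : riemannZeta₁ (2 + t * I) ≠ 0 := by
  have := zeta1_two_lower t
  intro h; rw [h] at this; simp at this; linarith

/-- zeros near height t -/
noncomputable def Zt (t : ℝ) : Finset ℂ :=
  (finite_zeros differentiable_riemannZeta₁ (zeta1_two_ne t) (isCompact_closedBall (2 + t * I : ℂ) (63/25))).toFinset

lemma mem_Zt {t : ℝ} {z : ℂ} : z ∈ Zt t ↔ z ∈ closedBall (2 + t * I : ℂ) (63/25) ∧ riemannZeta₁ z = 0 := by
  simp [Zt]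

lemma local_exp : ∃ A : ℝ, 0 < A ∧ ∀ t : ℝ, 
    (∑ ρ ∈ Zt t, (analyticOrderNatAt riemannZeta₁ ρ : ℝ)) ≤ A * LL t ∧
    ∀ s ∈ closedBall (2 + t * I : ℂ) (21/10), riemannZeta₁ s ≠ 0 →
      ‖deriv riemannZeta₁ s / riemannZeta₁ s - ∑ ρ ∈ Zt t, (analyticOrderNatAt riemannZeta₁ ρ : ℂ) / (s - ρ)‖ ≤ A * LL t := by
  obtain ⟨G, hG, hg⟩ := zeta1_growth
  set A0 : ℝ := |Real.log (3 * G)| + 12 * 4 with hA0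
  have hA0p : 0 < A0 := by positivity
  refine ⟨264 * A0, by positivity, ?_⟩
  intro t
  have hL := one_le_LL t
  have hLp : 0 < LL t := by linarith
  have hgr : ∀ z ∈ closedBall (2 + t * I : ℂ) (3 * (63/25)), ‖riemannZeta₁ z‖ ≤ Real.exp (A0 * LL t) * ‖riemannZeta₁ (2 + t * I)‖ := by
    intro z hz
    obtain ⟨h1, h2⟩ := re_of_mem_closedBall hz
    simp at h1 h2
    have h1' := abs_le.1 h1
    have hzre : -7 ≤ z.re := by linarith
    have h3 := hg z hzre
    have hn : 3 + ‖z‖ ≤ (|t| + 3) ^ 4 := by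
      have a1 := Complex.norm_le_abs_re_add_abs_im z
      have a2 : |z.re| ≤ 10 := by rw [abs_le]; constructor <;> linarith
      have a3 := abs_sub_abs_le_abs_sub z.im t
      have a4 := abs_nonneg t
      have a5 : 3 + ‖z‖ ≤ |t| + 21 := by linarith
      have a6 : (9:ℝ) ≤ (|t| + 3) ^ 2 := by nlinarith
      nlinarith
    have h4 : ‖riemannZeta₁ z‖ ≤ G * ((|t| + 3) ^ 4) ^ 12 := h3.trans (by gcongr)
    have h5 : 3 * G * ((|t| + 3) ^ 4) ^ 12 ≤ Real.exp (A0 * LL t) := by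
      have e1 : 3 * G ≤ Real.exp (|Real.log (3 * G)| * LL t) := by
        calc 3 * G = Real.exp (Real.log (3 * G)) := (Real.exp_log (by positivity)).symm
          _ ≤ _ := by
            apply Real.exp_le_exp.2
            have := le_abs_self (Real.log (3 * G))
            have := abs_nonneg (Real.log (3 * G))
            nlinarith
      have e2 : ((|t| + 3) ^ 4) ^ 12 = Real.exp (12 * 4 * LL t) := by
        unfold LL
        rw [← pow_mul, show (12 * 4 * Real.log (|t| + 3) : ℝ) = ((4 * 12 : ℕ) : ℝ) * Real.log (|t| + 3) by push_cast; ring, Real.exp_nat_mul, Real.exp_log (by positivity)]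
      rw [hA0, add_mul, Real.exp_add, e2]
      gcongr
    have h6 := zeta1_two_lower t
    have h7 : 0 ≤ G * ((|t| + 3) ^ 4) ^ 12 := by positivity
    nlinarith [Real.exp_pos (A0 * LL t)]
  obtain ⟨h1, h2⟩ := landau differentiable_riemannZeta₁ (zeta1_two_ne t) (R := 63/25) (M := A0 * LL t) (by norm_num) (by positivity) hgr (Zt t) (fun z => mem_Zt)
  constructor
  · refine h1.trans ?_
    nlinarith
  · intro s hs hs0
    refine (h2 s (by convert hs using 2; norm_num) hs0).trans ?_
    rw [div_le_iff₀ (by norm_num)]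
    have : 0 < A0 * LL t := by positivity
    nlinarith

lemma logderiv_rel (s : ℂ) (hs : s ≠ 1) (h0 : riemannZeta s ≠ 0) :
    deriv riemannZeta s / riemannZeta s = deriv riemannZeta₁ s / riemannZeta₁ s - 1 / (s - 1) := by
  have hs1 : s - 1 ≠ 0 := sub_ne_zero.2 hs
  have e : riemannZeta₁ =ᶠ[𝓝 s] fun z => (z - 1) * riemannZeta z := by
    filter_upwards [isOpen_ne.mem_nhds hs] with z hz
    exact zeta1_eq z hz
  have hd := differentiableAt_riemannZeta hs
  have hdd : deriv riemannZeta₁ s = 1 * riemannZeta s + (s - 1) * deriv riemannZeta s := by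
    rw [e.deriv_eq]
    exact (((hasDerivAt_id s).sub_const 1).mul hd.hasDerivAt).deriv
  rw [hdd, zeta1_eq s hs]
  field_simp
  ring

open ArithmeticFunction in
lemma three_four_one (σ t : ℝ) (hσ : 1 < σ) :
    0 ≤ 3 * (-(deriv riemannZeta σ / riemannZeta σ)).re + 4 * (-(deriv riemannZeta (σ + t * I) / riemannZeta (σ + t * I))).re
      + (-(deriv riemannZeta (σ + (2 * t : ℝ) * I) / riemannZeta (σ + (2 * t : ℝ) * I))).re := by
  have key : ∀ u : ℝ, HasSum (fun n : ℕ => (Λ n * (n:ℝ) ^ (-σ)) * Real.cos (u * Real.log n)) (-(deriv riemannZeta (σ + u * I) / riemannZeta (σ + u * I))).re := by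
    intro u
    have hre : 1 < (σ + u * I : ℂ).re := by simpa using hσ
    have h1 := (LSeriesSummable_vonMangoldt hre).hasSum
    have h2 := LSeries_vonMangoldt_eq_deriv_riemannZeta_div hre
    rw [LSeries] at h2
    rw [h2] at h1
    have h3 := Complex.hasSum_re h1
    rw [neg_div] at h3
    have e : (fun n : ℕ => (Λ n * (n:ℝ) ^ (-σ)) * Real.cos (u * Real.log n)) = fun n : ℕ => (LSeries.term (fun n => (Λ n : ℂ)) (σ + u * I) n).re := by
      funext n
      rcases Nat.eq_zero_or_pos n with rfl | hn
      · simp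
      · have hn' : (0:ℝ) < n := by exact_mod_cast hn
        rw [LSeries.term_of_ne_zero (by omega), div_eq_mul_inv, ← Complex.cpow_neg, Complex.re_ofReal_mul, mul_assoc]
        congr 1
        rw [show ((n:ℕ):ℂ) = ((n:ℝ):ℂ) by simp, Complex.cpow_def_of_ne_zero (by exact_mod_cast hn'.ne'), ← Complex.ofReal_log hn'.le, Complex.exp_re, Real.rpow_def_of_pos hn']
        have e1 : ((Real.log n : ℝ) : ℂ) * -(σ + u * I) = ((Real.log n * -σ : ℝ) : ℂ) + ((-(u * Real.log n) : ℝ) : ℂ) * I := by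
          push_cast; ring
        rw [e1, Complex.add_re, Complex.add_im, Complex.re_ofReal_mul, Complex.im_ofReal_mul, Complex.ofReal_re, Complex.ofReal_im, Complex.I_re, Complex.I_im]
        simp
    rw [e]
    exact h3
  have k0 := key 0
  have k1 := key t
  have k2 := key (2 * t)
  simp only [Complex.ofReal_zero, zero_mul, add_zero] at k0
  have k := ((k0.mul_left 3).add (k1.mul_left 4)).add k2
  refine k.nonneg ?_
  intro n
  have h1 : Real.cos (2 * t * Real.log n) = 2 * Real.cos (t * Real.log n) ^ 2 - 1 := by
    rw [mul_assoc, Real.cos_two_mul]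
  have h2 : 0 ≤ Λ n * (n:ℝ) ^ (-σ) := mul_nonneg vonMangoldt_nonneg (by positivity)
  rw [h1]
  simp only [Real.cos_zero]
  have : 0 ≤ (Λ n * (n:ℝ) ^ (-σ)) * (2 * (1 + Real.cos (t * Real.log n)) ^ 2) := by positivity
  simp
  nlinarith

lemma zeta1_ne_of_one_le {s : ℂ} (hs : 1 ≤ s.re) : riemannZeta₁ s ≠ 0 := by
  by_cases h : s = 1
  · rw [h, riemannZeta₁_one]; exact one_ne_zero
  · rw [zeta1_eq s h]
    exact mul_ne_zero (sub_ne_zero.2 h) (riemannZeta_ne_zero_of_one_le_re hs)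

lemma order_pos_of_zero {ρ : ℂ} (h : riemannZeta₁ ρ = 0) : 1 ≤ analyticOrderNatAt riemannZeta₁ ρ := by
  have ha : AnalyticAt ℂ riemannZeta₁ ρ := differentiable_riemannZeta₁.analyticAt ρ
  have h1 : analyticOrderAt riemannZeta₁ ρ ≠ 0 := ha.analyticOrderAt_ne_zero.2 h
  have h2 := order_ne_top differentiable_riemannZeta₁ (zeta1_two_ne 0) ρ
  have h3 := Nat.cast_analyticOrderNatAt h2
  rw [← h3] at h1
  have : analyticOrderNatAt riemannZeta₁ ρ ≠ 0 := by exact_mod_cast h1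
  omega

lemma re_inv_nonneg (m : ℕ) {z : ℂ} (hz : 0 ≤ z.re) : 0 ≤ ((m:ℂ) / z).re := by
  rw [div_eq_mul_inv, show ((m:ℕ):ℂ) = ((m:ℝ):ℂ) by simp, Complex.re_ofReal_mul, Complex.inv_re]
  have := Complex.normSq_nonneg z
  positivity

lemma zf_large : ∃ c : ℝ, 0 < c ∧ ∀ ρ : ℂ, riemannZeta₁ ρ = 0 → 1 ≤ |ρ.im| → 1/2 ≤ ρ.re → ρ.re ≤ 1 - c / LL ρ.im := by
  obtain ⟨A, hA, hloc⟩ := local_exp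
  obtain ⟨K, hK⟩ : ∃ K, ∀ x ∈ Icc (1:ℝ) 2, ‖deriv riemannZeta₁ (x:ℂ) / riemannZeta₁ (x:ℂ)‖ ≤ K := by
    refine isCompact_Icc.exists_bound_of_continuousOn ?_
    refine ContinuousOn.div ?_ ?_ ?_
    · have : Continuous (deriv riemannZeta₁) := (differentiable_riemannZeta₁.contDiff (n := 1)).continuous_deriv le_rfl
      exact (this.comp Complex.continuous_ofReal).continuousOn
    · exact (differentiable_riemannZeta₁.continuous.comp Complex.continuous_ofReal).continuousOn
    · intro x hx
      exact zeta1_ne_of_one_le (by simpa using hx.1)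
  have hK0 : 0 ≤ K := le_trans (norm_nonneg _) (hK 1 (by simp))
  set A2 : ℝ := 3 * K + 6 * A + 5 with hA2
  have hA2p : 5 ≤ A2 := by linarith
  set δ : ℝ := 1 / (2 * A2) with hδ
  have hδp : 0 < δ := by positivity
  have hδ1 : δ ≤ 1 := by
    rw [hδ, div_le_one (by linarith)]; linarith
  refine ⟨δ / 7, by positivity, ?_⟩
  intro ρ h0 him hre
  set L := LL ρ.im with hLdef
  have hL : 1 ≤ L := one_le_LL _
  have hLp : 0 < L := by linarith
  set γ := ρ.im with hγ
  have hβ : ρ.re < 1 := by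
    by_contra hcon
    push Not at hcon
    exact zeta1_ne_of_one_le hcon h0
  set σ : ℝ := 1 + δ / L with hσ
  have hd0 : 0 < δ / L := by positivity
  have hσ1 : 1 < σ := by linarith
  have hσ2 : σ ≤ 2 := by
    have : δ / L ≤ 1 := by rw [div_le_one hLp]; linarith
    linarith
  have h341 := three_four_one σ γ hσ1
  have gen : ∀ u : ℝ, 1 ≤ |u| → (-(deriv riemannZeta (σ + u * I) / riemannZeta (σ + u * I))).re ≤ A * LL u + 1 - (∑ ρ ∈ Zt u, (analyticOrderNatAt riemannZeta₁ ρ : ℂ) / ((σ + u * I) - ρ)).re := by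
    intro u hu
    have hs1 : (σ + u * I : ℂ) ≠ 1 := ne_one_of_re (by simpa using hσ1)
    rw [logderiv_rel _ hs1 (riemannZeta_ne_zero_of_one_le_re (by simp; exact hσ1.le))]
    have h1 := (hloc u).2 (σ + u * I) (by
      rw [mem_closedBall, dist_eq_norm]
      have : (σ + u * I : ℂ) - (2 + u * I) = ((σ - 2 : ℝ) : ℂ) := by push_cast; ring
      rw [this, Complex.norm_real, Real.norm_eq_abs, abs_le]
      constructor <;> linarith) (zeta1_ne_of_one_le (by simp; exact hσ1.le))
    have h2 := (abs_le.1 ((Complex.abs_re_le_norm _).trans h1)).1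
    have h3 : (1 / ((σ + u * I : ℂ) - 1)).re ≤ 1 := by
      refine (Complex.re_le_norm _).trans ?_
      rw [norm_div, norm_one, div_le_one (by
        rw [norm_pos_iff]; exact sub_ne_zero.2 hs1)]
      refine hu.trans ?_
      have := Complex.abs_im_le_norm ((σ + u * I : ℂ) - 1)
      simpa using this
    rw [Complex.sub_re] at h2
    rw [Complex.neg_re, Complex.sub_re]
    linarith
  have nn : ∀ u : ℝ, ∀ z ∈ Zt u, 0 ≤ ((analyticOrderNatAt riemannZeta₁ z : ℂ) / ((σ + u * I) - z)).re := by
    intro u z hz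
    apply re_inv_nonneg
    have hz0 := (mem_Zt.1 hz).2
    have : z.re < 1 := by
      by_contra hcon
      push Not at hcon
      exact zeta1_ne_of_one_le hcon hz0
    simp; linarith
  have b1 := gen γ him
  have b2 := gen (2 * γ) (by rw [abs_mul]; norm_num; linarith)
  have hmem : ρ ∈ Zt γ := by
    rw [mem_Zt]
    refine ⟨?_, h0⟩
    rw [mem_closedBall, dist_eq_norm]
    have : ρ - (2 + γ * I) = ((ρ.re - 2 : ℝ) : ℂ) := by
      apply Complex.ext <;> simp [hγ]
    rw [this, Complex.norm_real, Real.norm_eq_abs, abs_le]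
    constructor <;> linarith
  have s1 : 1 / (σ - ρ.re) ≤ (∑ ρ ∈ Zt γ, (analyticOrderNatAt riemannZeta₁ ρ : ℂ) / ((σ + γ * I) - ρ)).re := by
    rw [Complex.re_sum]
    refine le_trans ?_ (Finset.single_le_sum (nn γ) hmem)
    have e : (σ + γ * I : ℂ) - ρ = ((σ - ρ.re : ℝ) : ℂ) := by
      apply Complex.ext <;> simp [hγ]
    rw [e, ← Complex.ofReal_natCast, ← Complex.ofReal_div, Complex.ofReal_re]
    have : (1:ℝ) ≤ analyticOrderNatAt riemannZeta₁ ρ := by exact_mod_cast order_pos_of_zero h0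
    apply div_le_div_of_nonneg_right this
    linarith
  have s2 : 0 ≤ (∑ ρ ∈ Zt (2 * γ), (analyticOrderNatAt riemannZeta₁ ρ : ℂ) / ((σ + (2 * γ : ℝ) * I) - ρ)).re := by
    rw [Complex.re_sum]
    exact Finset.sum_nonneg (nn (2 * γ))
  have b0 : (-(deriv riemannZeta σ / riemannZeta σ)).re ≤ 1 / (σ - 1) + K := by
    have hs1 : (σ : ℂ) ≠ 1 := ne_one_of_re (by simpa using hσ1)
    rw [logderiv_rel _ hs1 (riemannZeta_ne_zero_of_one_le_re (by simp; exact hσ1.le))]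
    have h2 := (abs_le.1 ((Complex.abs_re_le_norm _).trans (hK σ ⟨hσ1.le, hσ2⟩))).1
    have e : (1 / ((σ : ℂ) - 1)).re = 1 / (σ - 1) := by
      rw [← Complex.ofReal_one, ← Complex.ofReal_sub, ← Complex.ofReal_div, Complex.ofReal_re]
    rw [Complex.neg_re, Complex.sub_re, e]
    linarith
  have hLL2 := LL_two_mul γ
  have hAL : A * LL (2 * γ) ≤ 2 * A * L := by nlinarith
  have e1 : 1 / (σ - 1) = L / δ := by rw [hσ, add_sub_cancel_left, one_div_div]
  have e2 : A2 * L = L / (2 * δ) := by rw [hδ]; field_simp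
  have main : 4 * (1 / (σ - ρ.re)) ≤ 3.5 * (L / δ) := by
    have e3 : L / (2 * δ) = 0.5 * (L / δ) := by field_simp; norm_num
    rw [e1] at b0
    rw [e3] at e2
    have : A2 * L = (3 * K) * L + 6 * A * L + 5 * L := by rw [hA2]; ring
    have : K ≤ K * L := by nlinarith
    linarith
  have hσβ : 0 < σ - ρ.re := by linarith
  have : 4 * δ ≤ 3.5 * L * (σ - ρ.re) := by
    rw [mul_one_div, div_le_iff₀ hσβ] at main
    have e4 : 3.5 * (L / δ) * (σ - ρ.re) * δ = 3.5 * L * (σ - ρ.re) := by field_simp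
    nlinarith
  have : 8 / 7 * (δ / L) ≤ σ - ρ.re := by
    rw [← mul_div_assoc, div_le_iff₀ hLp]
    linarith
  have e5 : δ / 7 / L = 1 / 7 * (δ / L) := by ring
  rw [e5]
  linarith

lemma zf : ∃ c : ℝ, 0 < c ∧ c ≤ 1/2 ∧ ∀ ρ : ℂ, riemannZeta₁ ρ = 0 → ρ.re ≤ 1 - c / LL ρ.im := by
  obtain ⟨c1, hc1, h1⟩ := zf_large
  have hfin := finite_zeros differentiable_riemannZeta₁ (zeta1_two_ne 0) (isCompact_closedBall (0 : ℂ) 2)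
  obtain ⟨c2, hc2, h2⟩ : ∃ c2 : ℝ, 0 < c2 ∧ ∀ z ∈ hfin.toFinset, z.re ≤ 1 - c2 := by
    have : ∀ S : Finset ℂ, (∀ z ∈ S, z.re < 1) → ∃ c2 : ℝ, 0 < c2 ∧ ∀ z ∈ S, z.re ≤ 1 - c2 := by
      intro S
      induction S using Finset.induction_on with
      | empty => intro _; exact ⟨1, one_pos, by simp⟩
      | insert a S ha ih =>
        intro h
        obtain ⟨c, hc, h'⟩ := ih (fun z hz => h z (Finset.mem_insert_of_mem hz))
        have haa := h a (Finset.mem_insert_self _ _)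
        refine ⟨min c (1 - a.re), lt_min hc (by linarith), ?_⟩
        intro z hz
        rcases Finset.mem_insert.1 hz with rfl | hz
        · have := min_le_right c (1 - z.re); linarith
        · have := min_le_left c (1 - a.re); have := h' z hz; linarith
    apply this
    intro z hz
    by_contra hcon
    push Not at hcon
    simp at hz
    exact zeta1_ne_of_one_le hcon hz.2
  refine ⟨min (min c1 c2) (1/2), by positivity, min_le_right _ _, ?_⟩
  intro ρ h0
  set c := min (min c1 c2) (1/2) with hc
  have hcp : 0 < c := by positivity
  have l1 : c ≤ c1 := (min_le_left _ _).trans (min_le_left _ _)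
  have l2 : c ≤ c2 := (min_le_left _ _).trans (min_le_right _ _)
  have l3 : c ≤ 1/2 := min_le_right _ _
  have hL := one_le_LL ρ.im
  have hcl : c / LL ρ.im ≤ c := div_le_self hcp.le hL
  by_cases hr : ρ.re < 1/2
  · linarith
  push Not at hr
  by_cases hi : 1 ≤ |ρ.im|
  · have := h1 ρ h0 hi hr
    have : c / LL ρ.im ≤ c1 / LL ρ.im := by gcongr
    linarith
  · push Not at hi
    have hre1 : ρ.re < 1 := by
      by_contra hcon
      push Not at hcon
      exact zeta1_ne_of_one_le hcon h0
    have := h2 ρ (by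
      simp only [Set.Finite.mem_toFinset]
      refine ⟨?_, h0⟩
      rw [mem_closedBall, dist_zero_right]
      have := Complex.norm_le_abs_re_add_abs_im ρ
      have : |ρ.re| ≤ 1 := by rw [abs_le]; constructor <;> linarith
      linarith)
    linarith
end ZF
end ZS

namespace ZS
section LD
open Complex Filter Topology Asymptotics Set Metric

/-- log derivative of (s-1)zeta(s) -/
noncomputable def DD (s : ℂ) : ℂ := deriv riemannZeta₁ s / riemannZeta₁ s

lemma ld : ∃ c C : ℝ, 0 < c ∧ c ≤ 1/8 ∧ 0 < C ∧ ∀ s : ℂ, 1 - c / LL s.im ≤ s.re → s.re ≤ 3 →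
    riemannZeta₁ s ≠ 0 ∧ ‖DD s‖ ≤ C * LL s.im ^ 2 := by
  obtain ⟨c0, hc0, hc0', hz⟩ := zf
  obtain ⟨A, hA, hloc⟩ := local_exp
  refine ⟨c0 / 4, A + A * (4 / c0), by positivity, by linarith, by positivity, ?_⟩
  intro s h1 h2
  have hL := one_le_LL s.im
  set L := LL s.im with hLdef
  have hLp : 0 < L := by linarith
  have hq : 0 < c0 / L := by positivity
  have e4 : c0 / 4 / L = (c0 / L) / 4 := by ring
  have hs0 : riemannZeta₁ s ≠ 0 := by
    intro h
    have := hz s h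
    rw [← hLdef] at this
    linarith
  refine ⟨hs0, ?_⟩
  have hcl : c0 / L ≤ c0 := div_le_self hc0.le hL
  obtain ⟨hc, hl⟩ := hloc s.im
  have hl' := hl s (by
    rw [mem_closedBall, dist_eq_norm]
    have : s - (2 + s.im * I) = ((s.re - 2 : ℝ) : ℂ) := by
      apply Complex.ext <;> simp
    rw [this, Complex.norm_real, Real.norm_eq_abs, abs_le]
    constructor <;> linarith) hs0
  rw [← hLdef] at hl' hc
  have hsum : ‖∑ ρ ∈ Zt s.im, (analyticOrderNatAt riemannZeta₁ ρ : ℂ) / (s - ρ)‖ ≤ A * L * (4 * L / c0) := by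
    refine (norm_sum_le _ _).trans ?_
    refine le_trans ?_ (mul_le_mul_of_nonneg_right hc (by positivity))
    rw [Finset.sum_mul]
    apply Finset.sum_le_sum
    intro ρ hρ
    obtain ⟨hb, h0⟩ := mem_Zt.1 hρ
    have him := (re_of_mem_closedBall hb).2
    simp at him
    have hLρ := LL_add s.im ρ.im _ him (by norm_num)
    have hzρ := hz ρ h0
    have hLρ1 := one_le_LL ρ.im
    have k1 : c0 / (2 * L) ≤ c0 / LL ρ.im := by gcongr
    have k2 : c0 / (2 * L) = (c0 / L) / 2 := by ring
    have k3 : c0 / (4 * L) ≤ ‖s - ρ‖ := by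
      refine le_trans ?_ (Complex.re_le_norm _)
      rw [Complex.sub_re]
      have : c0 / (4 * L) = (c0 / L) / 4 := by ring
      linarith
    rw [norm_div, div_eq_mul_inv]
    have e : 4 * L / c0 = (c0 / (4 * L))⁻¹ := by rw [inv_div]
    rw [e]
    have : (0:ℝ) < c0 / (4 * L) := by positivity
    have := inv_anti₀ this k3
    simp only [Complex.norm_natCast]
    gcongr
  have := norm_sub_norm_le (deriv riemannZeta₁ s / riemannZeta₁ s) (∑ ρ ∈ Zt s.im, (analyticOrderNatAt riemannZeta₁ ρ : ℂ) / (s - ρ))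
  have e5 : A * L * (4 * L / c0) = A * (4 / c0) * L ^ 2 := by ring
  have : A * L ≤ A * L ^ 2 := by gcongr; nlinarith
  rw [DD]
  linarith

lemma DD_differentiableAt {s : ℂ} (h : riemannZeta₁ s ≠ 0) : DifferentiableAt ℂ DD s := by
  have : Differentiable ℂ (deriv riemannZeta₁) := by
    intro z
    exact (differentiable_riemannZeta₁.analyticAt z).deriv.differentiableAt
  exact (this s).div (differentiable_riemannZeta₁ s) h

/-- derivatives of DD in the zero free region -/
lemma DD_deriv_bd : ∃ c : ℝ, 0 < c ∧ c ≤ 1/32 ∧ (∀ s : ℂ, 1 - c / LL s.im ≤ s.re → riemannZeta₁ s ≠ 0) ∧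
    ∀ n : ℕ, ∃ C : ℝ, 0 < C ∧ ∀ s : ℂ, 1 - c / LL s.im ≤ s.re → s.re ≤ 2 →
    ‖iteratedDeriv n DD s‖ ≤ C * LL s.im ^ (n + 2) := by
  obtain ⟨c1, C, hc1, hc1', hC, h⟩ := ld
  refine ⟨c1 / 4, by positivity, by linarith, ?_, ?_⟩
  · intro s hs
    by_cases h3 : s.re ≤ 3
    · refine (h s ?_ h3).1
      have hL := one_le_LL s.im
      have : c1 / 4 / LL s.im ≤ c1 / LL s.im := by gcongr; linarith
      linarith
    · exact zeta1_ne_of_one_le (by linarith)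
  intro n
  refine ⟨n.factorial * (C * 4) / (c1 / 4) ^ n, by positivity, ?_⟩
  intro s h1 h2
  have hL := one_le_LL s.im
  set L := LL s.im with hLdef
  have hLp : 0 < L := by linarith
  set R : ℝ := c1 / 4 / L with hR
  have hRp : 0 < R := by positivity
  have hR1 : R ≤ 1 := by
    rw [hR, div_le_one hLp]; linarith
  have key : ∀ z ∈ closedBall s R, riemannZeta₁ z ≠ 0 ∧ ‖DD z‖ ≤ C * (2 * L) ^ 2 := by
    intro z hz
    obtain ⟨a1, a2⟩ := re_of_mem_closedBall hz
    have hLz := LL_add s.im z.im R a2 (by linarith)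
    have a1' := abs_le.1 a1
    have hLz1 := one_le_LL z.im
    have : c1 / (2 * L) ≤ c1 / LL z.im := by gcongr
    have e : c1 / (2 * L) = 2 * R := by rw [hR]; ring
    obtain ⟨b1, b2⟩ := h z (by linarith) (by linarith)
    refine ⟨b1, b2.trans ?_⟩
    gcongr
  have := cauchy_deriv (f := DD) (c := s) hRp n (fun z hz => DD_differentiableAt (key z hz).1) (B := C * (2 * L) ^ 2) (fun z hz => (key z (sphere_subset_closedBall hz)).2)
  refine this.trans (le_of_eq ?_)
  rw [hR, div_pow]
  field_simp
  ring

lemma zero_nontrivial {ρ : ℂ} (h : riemannZeta ρ = 0) (him : ρ.im ≠ 0) : 0 < ρ.re ∧ ρ.re < 1 := by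
  constructor
  · by_contra hcon
    push Not at hcon
    have hw : 1 ≤ (1 - ρ).re := by simp; linarith
    have hwim : (1 - ρ).im ≠ 0 := by simpa using him
    have hfe := riemannZeta_one_sub (s := 1 - ρ) (by
      intro n hn
      rw [hn] at hwim
      simp at hwim) (by
      intro hn
      rw [hn] at hwim
      simp at hwim)
    rw [sub_sub_cancel, h] at hfe
    have h1 := riemannZeta_ne_zero_of_one_le_re hw
    have h2 : Complex.Gamma (1 - ρ) ≠ 0 := Complex.Gamma_ne_zero_of_re_pos (by linarith)
    have h3 : Complex.cos (Real.pi * (1 - ρ) / 2) ≠ 0 := by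
      intro hcos
      rw [Complex.cos_eq_zero_iff] at hcos
      obtain ⟨k, hk⟩ := hcos
      have := congrArg Complex.im hk
      have e1 : (Real.pi * (1 - ρ) / 2 : ℂ).im = Real.pi / 2 * (1 - ρ).im := by
        rw [show (Real.pi * (1 - ρ) / 2 : ℂ) = ((Real.pi / 2 : ℝ) : ℂ) * (1 - ρ) by push_cast; ring, Complex.im_ofReal_mul]
      have e2 : ((2 * (k:ℂ) + 1) * Real.pi / 2).im = 0 := by
        rw [show ((2 * (k:ℂ) + 1) * Real.pi / 2) = (((2 * (k:ℝ) + 1) * Real.pi / 2 : ℝ) : ℂ) by push_cast; ring, Complex.ofReal_im]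
      rw [e1, e2] at this
      have := Real.pi_pos
      have : Real.pi / 2 ≠ 0 := by positivity
      simp_all
    have h4 : ((2 * Real.pi : ℂ)) ^ (-(1 - ρ)) ≠ 0 := by
      rw [Complex.cpow_ne_zero_iff]
      left
      exact_mod_cast Real.two_pi_pos.ne'
    exact mul_ne_zero (mul_ne_zero (mul_ne_zero (mul_ne_zero two_ne_zero h4) h2) h3) h1 hfe.symm
  · by_contra hcon
    push Not at hcon
    exact riemannZeta_ne_zero_of_one_le_re hcon h

lemma zeta_zero_of_zeta1 {ρ : ℂ} (h : riemannZeta₁ ρ = 0) : ρ ≠ 1 ∧ riemannZeta ρ = 0 := by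
  have h1 : ρ ≠ 1 := by
    rintro rfl
    rw [riemannZeta₁_one] at h
    exact one_ne_zero h
  refine ⟨h1, ?_⟩
  rw [zeta1_eq ρ h1] at h
  rcases mul_eq_zero.1 h with h | h
  · exact absurd (sub_eq_zero.1 h) h1
  · exact h

/-- bound of logarithmic derivative at admissible heights -/
lemma hb_adm (δ : ℝ) (hδ : 0 < δ) : ∃ A : ℝ, 0 < A ∧ ∀ T : ℝ, 3 ≤ T →
    (∀ ρ : ℂ, riemannZeta ρ = 0 → 0 < ρ.re → ρ.re < 1 → δ / Real.log T ≤ |T - ρ.im|) →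
    ∀ s : ℂ, s.im = T → -1/10 ≤ s.re → s.re ≤ 4 → riemannZeta₁ s ≠ 0 ∧ ‖DD s‖ ≤ A * LL T ^ 2 := by
  obtain ⟨A, hA, hloc⟩ := local_exp
  refine ⟨A + A / δ, by positivity, ?_⟩
  intro T hT hadm s hsT hs1 hs2
  have hlog : 0 < Real.log T := Real.log_pos (by linarith)
  have hL := one_le_LL T
  have hlogL : Real.log T ≤ LL T := by
    unfold LL
    apply Real.log_le_log (by linarith)
    rw [abs_of_pos (by linarith)]; linarith
  have hdl : 0 < δ / Real.log T := by positivity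
  have hs0 : riemannZeta₁ s ≠ 0 := by
    intro h
    obtain ⟨_, h2⟩ := zeta_zero_of_zeta1 h
    obtain ⟨h3, h4⟩ := zero_nontrivial h2 (by rw [hsT]; linarith)
    have := hadm s h2 h3 h4
    rw [hsT, sub_self, abs_zero] at this
    linarith
  refine ⟨hs0, ?_⟩
  obtain ⟨hc, hl⟩ := hloc T
  have hl' := hl s (by
    rw [mem_closedBall, dist_eq_norm]
    have : s - (2 + T * I) = ((s.re - 2 : ℝ) : ℂ) := by
      apply Complex.ext <;> simp [hsT]
    rw [this, Complex.norm_real, Real.norm_eq_abs, abs_le]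
    constructor <;> linarith) hs0
  have hsum : ‖∑ ρ ∈ Zt T, (analyticOrderNatAt riemannZeta₁ ρ : ℂ) / (s - ρ)‖ ≤ A * LL T * (Real.log T / δ) := by
    refine (norm_sum_le _ _).trans ?_
    refine le_trans ?_ (mul_le_mul_of_nonneg_right hc (by positivity))
    rw [Finset.sum_mul]
    apply Finset.sum_le_sum
    intro ρ hρ
    obtain ⟨hb, h0⟩ := mem_Zt.1 hρ
    have him := (re_of_mem_closedBall hb).2
    simp at him
    have him' := abs_le.1 him
    obtain ⟨_, h2⟩ := zeta_zero_of_zeta1 h0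
    obtain ⟨h3, h4⟩ := zero_nontrivial h2 (by intro h; rw [h] at him'; linarith)
    have h5 := hadm ρ h2 h3 h4
    have k3 : δ / Real.log T ≤ ‖s - ρ‖ := by
      refine h5.trans ?_
      have := Complex.abs_im_le_norm (s - ρ)
      rwa [Complex.sub_im, hsT] at this
    rw [norm_div, div_eq_mul_inv, ← inv_div δ]
    have := inv_anti₀ hdl k3
    simp only [Complex.norm_natCast]
    gcongr
  have := norm_sub_norm_le (deriv riemannZeta₁ s / riemannZeta₁ s) (∑ ρ ∈ Zt T, (analyticOrderNatAt riemannZeta₁ ρ : ℂ) / (s - ρ))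
  have e5 : A * LL T * (Real.log T / δ) ≤ A / δ * LL T ^ 2 := by
    rw [show A * LL T * (Real.log T / δ) = A / δ * (LL T * Real.log T) by ring]
    gcongr
    nlinarith
  have : A * LL T ≤ A * LL T ^ 2 := by gcongr; nlinarith
  rw [DD]
  linarith

lemma norm_Gamma_half_lower (t : ℝ) :
    Real.exp (-(Real.pi / 2 * |t|)) ≤ ‖Complex.Gamma (1/2 + t * I)‖ := by
  have h := Complex.Gamma_mul_Gamma_one_sub (1/2 + t * I)
  have hc : (1 : ℂ) - (1/2 + t * I) = (starRingEnd ℂ) (1/2 + t * I) := by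
    apply Complex.ext <;> simp <;> norm_num
  rw [hc, Complex.Gamma_conj] at h
  have hs : Complex.sin (Real.pi * (1/2 + t * I)) = (Real.cosh (Real.pi * t) : ℂ) := by
    rw [show (Real.pi : ℂ) * (1/2 + t * I) = (Real.pi * t : ℂ) * I + Real.pi / 2 by ring]
    rw [Complex.sin_add_pi_div_two, Complex.cos_mul_I]
    push_cast; rfl
  rw [hs, Complex.mul_conj] at h
  have h2 : Complex.normSq (Complex.Gamma (1/2 + t * I)) = Real.pi / Real.cosh (Real.pi * t) := by
    exact_mod_cast h
  rw [Complex.normSq_eq_norm_sq] at h2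
  have hp := Real.cosh_pos (Real.pi * t)
  have h3 : Real.cosh (Real.pi * t) ≤ Real.exp (Real.pi * |t|) := by
    rw [← Real.cosh_abs, Real.cosh_eq, abs_mul, abs_of_pos Real.pi_pos]
    have : Real.exp (-(Real.pi * |t|)) ≤ Real.exp (Real.pi * |t|) := by
      apply Real.exp_le_exp.2
      have : 0 ≤ Real.pi * |t| := by positivity
      linarith
    linarith
  refine (sq_le_sq₀ (Real.exp_pos _).le (norm_nonneg _)).1 ?_
  rw [h2, ← Real.exp_nat_mul, le_div_iff₀ hp]
  calc Real.exp ((2:ℕ) * -(Real.pi / 2 * |t|)) * Real.cosh (Real.pi * t) ≤ Real.exp ((2:ℕ) * -(Real.pi / 2 * |t|)) * Real.exp (Real.pi * |t|) := by gcongr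
    _ = 1 := by
      rw [← Real.exp_add]
      convert Real.exp_zero using 2
      push_cast; ring
    _ ≤ Real.pi := by linarith [Real.pi_gt_three]

lemma digamma_strip : ∃ C : ℝ, 0 < C ∧ ∀ s : ℂ, 1 ≤ s.re → s.re ≤ 2 → ‖Complex.digamma s‖ ≤ C * LL s.im := by
  obtain ⟨C, hC, hG⟩ := Gamma_bd_gen 1
  set M0 : ℝ := |Real.log (2 * C * Real.exp (Real.pi / 2))| + 4 with hM0
  have hM0p : 0 < M0 := by positivity
  refine ⟨264 * M0, by positivity, ?_⟩
  intro s h1 h2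
  set t := s.im with ht
  have hL := one_le_LL t
  have hLp : 0 < LL t := by linarith
  set s₀ : ℂ := 3/2 + t * I with hs0
  have hre0 : s₀.re = 3/2 := by simp [hs0]
  have him0 : s₀.im = t := by simp [hs0]
  have hball : ∀ z ∈ ball s₀ 1, 1/2 < z.re ∧ z.re < 5/2 ∧ |z.im - t| ≤ 1 := by
    intro z hz
    have hz' : ‖z - s₀‖ < 1 := by rwa [mem_ball, dist_eq_norm] at hz
    have a := (Complex.abs_re_le_norm (z - s₀)).trans_lt hz'
    have b := (Complex.abs_im_le_norm (z - s₀)).trans_lt hz'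
    rw [Complex.sub_re, hre0, abs_lt] at a
    rw [Complex.sub_im, him0] at b
    exact ⟨by linarith, by linarith, b.le⟩
  have hlow : 1/2 * Real.exp (-(Real.pi / 2 * |t|)) ≤ ‖Complex.Gamma s₀‖ := by
    have e : s₀ = (1/2 + t * I) + 1 := by rw [hs0]; ring
    rw [e, Complex.Gamma_add_one _ (by
      intro h
      have := congrArg Complex.re h
      simp at this), norm_mul]
    have := norm_Gamma_half_lower t
    have : (1/2 : ℝ) ≤ ‖(1/2 + t * I : ℂ)‖ := by
      refine le_trans ?_ (Complex.re_le_norm _)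
      simp
    gcongr
  have := logderiv_bd (g := Complex.Gamma) (s₀ := s₀) (R := 1) (M := M0 * LL t) one_pos (by positivity) (by
    intro z hz
    apply DifferentiableAt.differentiableWithinAt
    apply Complex.differentiableAt_Gamma
    intro m hm
    have := (hball z hz).1
    rw [hm] at this
    simp at this
    have : (0:ℝ) ≤ m := by positivity
    linarith) (fun z hz => Complex.Gamma_ne_zero_of_re_pos (by linarith [(hball z hz).1])) (by
    intro z hz
    obtain ⟨a1, a2, a3⟩ := hball z hz
    have hg := hG z a1.le (by norm_num; linarith)
    have hzn : ‖z‖ ≤ (|t| + 3) ^ 2 := by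
      have b1 := Complex.norm_le_abs_re_add_abs_im z
      rw [abs_of_pos (by linarith : 0 < z.re)] at b1
      have b2 := abs_sub_abs_le_abs_sub z.im t
      have := abs_nonneg t
      nlinarith
    have hz1 : 1 ≤ (|t| + 3) ^ 2 := by
      have := abs_nonneg t
      nlinarith
    have p1 : ‖z‖ ^ (z.re - 1/2) ≤ (|t| + 3) ^ 4 := by
      calc ‖z‖ ^ (z.re - 1/2) ≤ ((|t| + 3) ^ 2) ^ (z.re - 1/2) := by
            apply Real.rpow_le_rpow (norm_nonneg _) hzn (by linarith)
        _ ≤ ((|t| + 3) ^ 2) ^ (2:ℝ) := Real.rpow_le_rpow_of_exponent_le hz1 (by linarith)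
        _ = _ := by rw [Real.rpow_two]; ring
    have p2 : Real.exp (-(Real.pi / 2 * |z.im|)) ≤ Real.exp (Real.pi / 2) * Real.exp (-(Real.pi / 2 * |t|)) := by
      rw [← Real.exp_add]
      apply Real.exp_le_exp.2
      have := abs_sub_abs_le_abs_sub t z.im
      rw [abs_sub_comm] at this
      have := Real.pi_pos
      nlinarith
    have h5 : 2 * C * Real.exp (Real.pi / 2) * (|t| + 3) ^ 4 ≤ Real.exp (M0 * LL t) := by
      have e1 : 2 * C * Real.exp (Real.pi / 2) ≤ Real.exp (|Real.log (2 * C * Real.exp (Real.pi / 2))| * LL t) := by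
        calc 2 * C * Real.exp (Real.pi / 2) = Real.exp (Real.log (2 * C * Real.exp (Real.pi / 2))) := (Real.exp_log (by positivity)).symm
          _ ≤ _ := by
            apply Real.exp_le_exp.2
            have := le_abs_self (Real.log (2 * C * Real.exp (Real.pi / 2)))
            have := abs_nonneg (Real.log (2 * C * Real.exp (Real.pi / 2)))
            nlinarith
      have e2 : (|t| + 3) ^ 4 = Real.exp (4 * LL t) := by
        unfold LL
        rw [show (4 * Real.log (|t| + 3) : ℝ) = ((4 : ℕ) : ℝ) * Real.log (|t| + 3) by push_cast; ring, Real.exp_nat_mul, Real.exp_log (by positivity)]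
      rw [hM0, add_mul, Real.exp_add, e2]
      gcongr
    calc ‖Complex.Gamma z‖ ≤ C * (|t| + 3) ^ 4 * (Real.exp (Real.pi / 2) * Real.exp (-(Real.pi / 2 * |t|))) := by
          refine hg.trans ?_
          gcongr
      _ = (2 * C * Real.exp (Real.pi / 2) * (|t| + 3) ^ 4) * (1/2 * Real.exp (-(Real.pi / 2 * |t|))) := by ring
      _ ≤ _ := by gcongr) s (by
    rw [mem_closedBall, dist_eq_norm]
    have : s - s₀ = ((s.re - 3/2 : ℝ) : ℂ) := by
      apply Complex.ext <;> simp [hs0, ht]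
    rw [this, Complex.norm_real, Real.norm_eq_abs, abs_le]
    constructor <;> linarith)
  rw [Complex.digamma_def, logDeriv_apply]
  refine this.trans (le_of_eq ?_)
  ring

lemma digamma_bd : ∃ C : ℝ, 0 < C ∧ ∀ s : ℂ, 1 ≤ s.re → ‖Complex.digamma s‖ ≤ C * LL s.im + s.re := by
  obtain ⟨C, hC, h⟩ := digamma_strip
  refine ⟨C, hC, ?_⟩
  have key : ∀ k : ℕ, ∀ s : ℂ, 1 ≤ s.re → s.re ≤ 2 + k → ‖Complex.digamma s‖ ≤ C * LL s.im + s.re := by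
    intro k
    induction k with
    | zero =>
      intro s h1 h2
      have := h s h1 (by simpa using h2)
      linarith
    | succ k ih =>
      intro s h1 h2
      by_cases hs : s.re ≤ 2
      · have := h s h1 hs
        linarith
      push Not at hs
      have i1 := ih (s - 1) (by simp; linarith) (by simp; push_cast at h2; linarith)
      have e := Complex.digamma_apply_add_one (s - 1) (by
        intro m hm
        have := congrArg Complex.re hm
        simp at this
        have : (0:ℝ) ≤ m := by positivity
        linarith)
      rw [sub_add_cancel] at e
      rw [e]
      refine (norm_add_le _ _).trans ?_
      have : ‖(s - 1)⁻¹‖ ≤ 1 := by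
        rw [norm_inv]
        apply inv_le_one_of_one_le₀
        refine le_trans ?_ (Complex.re_le_norm _)
        simp; linarith
      simp at i1
      linarith
  intro s h1
  obtain ⟨k, hk⟩ := exists_nat_ge s.re
  exact key k s h1 (by linarith)
end LD
end ZS

namespace ZS
section PA
open Complex Filter Topology Asymptotics Set Metric ArithmeticFunction

/-- the coefficients, up to sign -/
noncomputable def qa (n m : ℕ) : ℝ := ∑ d ∈ m.divisors, Λ d * Real.log d ^ n

lemma qa_zero (n : ℕ) : qa n 0 = 0 := by simp [qa]

lemma qa_nonneg (n m : ℕ) : 0 ≤ qa n m := by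
  apply Finset.sum_nonneg
  intro d _
  exact mul_nonneg vonMangoldt_nonneg (pow_nonneg (Real.log_natCast_nonneg d) n)

lemma qa_le (n m : ℕ) : qa n m ≤ Real.log m ^ (n + 1) := by
  rcases Nat.eq_zero_or_pos m with rfl | hm
  · simp [qa]
  calc qa n m ≤ ∑ d ∈ m.divisors, Λ d * Real.log m ^ n := by
        apply Finset.sum_le_sum
        intro d hd
        have hd' := Nat.pos_of_mem_divisors hd
        have : Real.log d ≤ Real.log m := by
          apply Real.log_le_log (by exact_mod_cast hd')
          exact_mod_cast Nat.divisor_le hd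
        have := Real.log_natCast_nonneg d
        have : 0 ≤ Λ d := vonMangoldt_nonneg
        gcongr
    _ = Real.log m ^ (n + 1) := by
        rw [← Finset.sum_mul, vonMangoldt_sum, pow_succ]; ring

lemma qa_conv (n : ℕ) : (fun m : ℕ => (qa n m : ℂ)) = LSeries.convolution (LSeries.logMul^[n] (fun m => (Λ m : ℂ))) 1 := by
  have hl : ∀ k : ℕ, ∀ m : ℕ, (LSeries.logMul^[k] (fun m => (Λ m : ℂ))) m = ((Λ m * Real.log m ^ k : ℝ) : ℂ) := by
    intro k
    induction k with
    | zero => intro m; simp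
    | succ k ih =>
      intro m
      rw [Function.iterate_succ', Function.comp_apply, LSeries.logMul, ih, ← Complex.natCast_log]
      push_cast; ring
  funext m
  rw [LSeries.convolution_def]
  simp only [hl, Pi.one_apply, mul_one]
  rw [qa]
  push_cast
  exact (Nat.sum_divisorsAntidiagonal (fun d _ => (Λ d : ℂ) * (Complex.log d) ^ n)).symm

lemma absc_Lambda : LSeries.abscissaOfAbsConv (fun m => (Λ m : ℂ)) ≤ 1 := by
  apply LSeries.abscissaOfAbsConv_le_of_forall_lt_LSeriesSummable
  intro y hy
  exact LSeriesSummable_vonMangoldt (by simpa using hy)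

/-- n-th derivative of zeta'/zeta -/
noncomputable def QQ (n : ℕ) (s : ℂ) : ℂ := iteratedDeriv n (fun z => deriv riemannZeta z / riemannZeta z) s

lemma qa_LSeries (n : ℕ) {s : ℂ} (hs : 1 < s.re) :
    LSeriesHasSum (fun m => (qa n m : ℂ)) s ((-1) ^ (n + 1) * QQ n s * riemannZeta s) := by
  have h1 : LSeries.abscissaOfAbsConv (fun m => (Λ m : ℂ)) < s.re := absc_Lambda.trans_lt (by exact_mod_cast hs)
  have hsum1 : LSeriesSummable (LSeries.logMul^[n] (fun m => (Λ m : ℂ))) s := by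
    apply LSeriesSummable_of_abscissaOfAbsConv_lt_re
    rwa [LSeries.absicssaOfAbsConv_logPowMul]
  have hsum2 : LSeriesSummable (1 : ℕ → ℂ) s := LSeriesSummable_one_iff.2 hs
  have hc := LSeriesHasSum.convolution hsum1.LSeriesHasSum hsum2.LSeriesHasSum
  rw [← qa_conv, LSeries_one_eq_riemannZeta hs] at hc
  convert hc using 2
  have h2 := LSeries_iteratedDeriv n h1
  have h3 : iteratedDeriv n (LSeries (fun m => (Λ m : ℂ))) s = - QQ n s := by
    rw [QQ, ← iteratedDeriv_fun_neg]
    apply Filter.EventuallyEq.iteratedDeriv_eq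
    have : {z : ℂ | 1 < z.re} ∈ 𝓝 s := (isOpen_lt continuous_const Complex.continuous_re).mem_nhds hs
    filter_upwards [this] with z hz
    rw [LSeries_vonMangoldt_eq_deriv_riemannZeta_div hz, neg_div]
  rw [h3] at h2
  have h4 : ((-1 : ℂ) ^ n) * ((-1) ^ n) = 1 := by rw [← mul_pow]; simp
  calc (-1 : ℂ) ^ (n + 1) * QQ n s = (-1) ^ n * (- QQ n s) := by ring
    _ = _ := by rw [h2, ← mul_assoc, h4, one_mul]

lemma qa_hasSum (n : ℕ) {s : ℂ} (hs : 1 < s.re) :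
    HasSum (fun m : ℕ => (qa n m : ℂ) * (m : ℂ) ^ (-s)) ((-1) ^ (n + 1) * QQ n s * riemannZeta s) := by
  have h := qa_LSeries n hs
  rw [LSeriesHasSum] at h
  have e : (fun m : ℕ => (qa n m : ℂ) * (m : ℂ) ^ (-s)) = LSeries.term (fun m => (qa n m : ℂ)) s := by
    funext m
    rcases Nat.eq_zero_or_pos m with rfl | hm
    · simp [qa_zero]
    · rw [LSeries.term_of_ne_zero (by omega), div_eq_mul_inv, Complex.cpow_neg]
  rw [e]; exact h

lemma qa_summable (n : ℕ) {σ : ℝ} (hs : 1 < σ) : Summable (fun m : ℕ => qa n m * (m : ℝ) ^ (-σ)) := by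
  have h := (qa_hasSum n (s := (σ : ℂ)) (by simpa using hs)).summable
  have e : (fun m : ℕ => (qa n m : ℂ) * (m : ℂ) ^ (-(σ:ℂ))) = fun m : ℕ => ((qa n m * (m : ℝ) ^ (-σ) : ℝ) : ℂ) := by
    funext m
    rw [Complex.ofReal_mul, Complex.ofReal_cpow (by positivity)]
    simp
  rw [e] at h
  exact Complex.summable_ofReal.1 h

lemma DD_analyticAt {s : ℂ} (h : riemannZeta₁ s ≠ 0) : AnalyticAt ℂ DD s :=
  (differentiable_riemannZeta₁.analyticAt s).deriv.div (differentiable_riemannZeta₁.analyticAt s) h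

lemma DD_iter_analyticAt (n : ℕ) {s : ℂ} (h : riemannZeta₁ s ≠ 0) : AnalyticAt ℂ (iteratedDeriv n DD) s := by
  induction n with
  | zero => simpa using DD_analyticAt h
  | succ n ih => rw [iteratedDeriv_succ]; exact ih.deriv

lemma QQ_eq (n : ℕ) : ∀ {s : ℂ}, s ≠ 1 → riemannZeta₁ s ≠ 0 →
    QQ n s = iteratedDeriv n DD s - (-1) ^ n * n.factorial / (s - 1) ^ (n + 1) := by
  induction n with
  | zero =>
    intro s h1 h0
    have : riemannZeta s ≠ 0 := by
      intro h
      apply h0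
      rw [zeta1_eq s h1, h, mul_zero]
    simp only [QQ, iteratedDeriv_zero]
    rw [logderiv_rel s h1 this]
    simp [DD]
  | succ n ih =>
    intro s h1 h0
    have hs1 : s - 1 ≠ 0 := sub_ne_zero.2 h1
    have hev : QQ n =ᶠ[𝓝 s] fun s => iteratedDeriv n DD s - (-1) ^ n * n.factorial / (s - 1) ^ (n + 1) := by
      have o1 : {z : ℂ | riemannZeta₁ z ≠ 0} ∈ 𝓝 s := (isOpen_ne_fun differentiable_riemannZeta₁.continuous continuous_const).mem_nhds h0
      filter_upwards [o1, isOpen_ne.mem_nhds h1] with z hz1 hz2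
      exact ih hz2 hz1
    have e1 : QQ (n + 1) s = deriv (QQ n) s := by
      rw [QQ, iteratedDeriv_succ]; rfl
    rw [e1, hev.deriv_eq, iteratedDeriv_succ]
    have d1 := (DD_iter_analyticAt n h0).differentiableAt.hasDerivAt
    have d2 : HasDerivAt (fun s : ℂ => (-1 : ℂ) ^ n * n.factorial / (s - 1) ^ (n + 1)) ((-1) ^ (n + 1) * (n + 1).factorial / (s - 1) ^ (n + 1 + 1)) s := by
      have := (((hasDerivAt_id s).sub_const 1).pow (n + 1)).inv (pow_ne_zero _ hs1)
      have := this.const_mul ((-1 : ℂ) ^ n * n.factorial)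
      simp only [div_eq_mul_inv]
      refine HasDerivAt.congr_deriv this ?_
      simp only [id, Nat.factorial_succ, Pi.pow_apply]
      push_cast
      field_simp
      ring
    exact (d1.sub d2).deriv

/-- Taylor coefficients of the regular part of zeta at 1 -/
noncomputable def cz (k : ℕ) : ℂ := (fun f => dslope f 1)^[k] riemannZeta₀ 1

lemma dslope_entire {f : ℂ → ℂ} (hf : Differentiable ℂ f) (c : ℂ) : Differentiable ℂ (dslope f c) := by
  rw [← differentiableOn_univ] at *
  exact (Complex.differentiableOn_dslope univ_mem).2 hf

lemma iter_dslope_entire (k : ℕ) : Differentiable ℂ ((fun f => dslope f 1)^[k] riemannZeta₀) := by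
  induction k with
  | zero => exact differentiable_riemannZeta₀
  | succ k ih =>
    rw [Function.iterate_succ', Function.comp_apply]
    exact dslope_entire ih 1

lemma zeta0_taylor (k : ℕ) (s : ℂ) : riemannZeta₀ s = ∑ j ∈ Finset.range k, cz j * (s - 1) ^ j +
    (s - 1) ^ k * (fun f => dslope f 1)^[k] riemannZeta₀ s := by
  induction k with
  | zero => simp
  | succ k ih =>
    rw [ih, Finset.sum_range_succ, Function.iterate_succ', Function.comp_apply]
    have := sub_smul_dslope ((fun f => dslope f 1)^[k] riemannZeta₀) 1 s
    rw [smul_eq_mul] at this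
    rw [pow_succ, mul_assoc ((s - 1) ^ k), this, cz]
    ring

/-- regularised generating function -/
noncomputable def EE (n : ℕ) (s : ℂ) : ℂ :=
  n.factorial * (fun f => dslope f 1)^[n + 1] riemannZeta₀ s +
    (-1) ^ (n + 1) * (dslope (iteratedDeriv n DD) 1 s + iteratedDeriv n DD s * riemannZeta₀ s)

/-- polar part -/
noncomputable def polar (n : ℕ) (s : ℂ) : ℂ :=
  n.factorial / (s - 1) ^ (n + 2) + (∑ k ∈ Finset.range (n + 1), n.factorial * cz k / (s - 1) ^ (n + 1 - k))
    + (-1) ^ (n + 1) * iteratedDeriv n DD 1 / (s - 1)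

lemma EE_eq (n : ℕ) {s : ℂ} (h1 : s ≠ 1) (h0 : riemannZeta₁ s ≠ 0) :
    (-1) ^ (n + 1) * QQ n s * riemannZeta s = EE n s + polar n s := by
  have hs1 : s - 1 ≠ 0 := sub_ne_zero.2 h1
  rw [QQ_eq n h1 h0, riemannZeta_eq_inv_sub_add h1, EE, polar]
  have t1 : (fun f => dslope f 1)^[n + 1] riemannZeta₀ s = (riemannZeta₀ s - ∑ j ∈ Finset.range (n + 1), cz j * (s - 1) ^ j) / (s - 1) ^ (n + 1) := by
    rw [eq_div_iff (pow_ne_zero _ hs1)]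
    have := zeta0_taylor (n + 1) s
    linear_combination -this
  have t2 : dslope (iteratedDeriv n DD) 1 s = (iteratedDeriv n DD s - iteratedDeriv n DD 1) / (s - 1) := by
    rw [eq_div_iff hs1]
    have := sub_smul_dslope (iteratedDeriv n DD) 1 s
    rw [smul_eq_mul] at this
    linear_combination this
  have t3 : (∑ k ∈ Finset.range (n + 1), n.factorial * cz k / (s - 1) ^ (n + 1 - k)) = n.factorial * (∑ j ∈ Finset.range (n + 1), cz j * (s - 1) ^ j) / (s - 1) ^ (n + 1) := by
    rw [Finset.mul_sum, Finset.sum_div]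
    apply Finset.sum_congr rfl
    intro k hk
    have hk' : k ≤ n + 1 := by simp at hk; omega
    rw [div_eq_div_iff (pow_ne_zero _ hs1) (pow_ne_zero _ hs1)]
    have : (s - 1) ^ (n + 1) = (s - 1) ^ k * (s - 1) ^ (n + 1 - k) := by rw [← pow_add]; congr 1; omega
    rw [this]; ring
  have h4 : ((-1 : ℂ) ^ n) ^ 2 = 1 := by rw [← pow_mul, mul_comm, pow_mul]; simp
  rw [t1, t2, t3]
  have e : (s-1) ^ (n+2) = (s-1)^(n+1) * (s-1) := by ring
  rw [e]
  set p := (s-1)^(n+1) with hp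
  have hp0 : p ≠ 0 := pow_ne_zero _ hs1
  set Sg := ∑ j ∈ Finset.range (n + 1), cz j * (s - 1) ^ j
  rw [pow_succ (-1 : ℂ) n]
  set ε := (-1 : ℂ) ^ n
  field_simp
  linear_combination ((n.factorial : ℂ) + n.factorial * (s-1) * riemannZeta₀ s) * h4

lemma EE_differentiableAt (n : ℕ) {s : ℂ} (h0 : riemannZeta₁ s ≠ 0) : DifferentiableAt ℂ (EE n) s := by
  have ho : IsOpen {z : ℂ | riemannZeta₁ z ≠ 0} := isOpen_ne_fun differentiable_riemannZeta₁.continuous continuous_const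
  have h1 : (1:ℂ) ∈ {z : ℂ | riemannZeta₁ z ≠ 0} := by
    simp [riemannZeta₁_one]
  have hD : DifferentiableOn ℂ (iteratedDeriv n DD) {z : ℂ | riemannZeta₁ z ≠ 0} := fun z hz => (DD_iter_analyticAt n hz).differentiableAt.differentiableWithinAt
  have hds := (Complex.differentiableOn_dslope (ho.mem_nhds h1)).2 hD
  have a1 := (hds s h0).differentiableAt (ho.mem_nhds h0)
  have a2 := (hD s h0).differentiableAt (ho.mem_nhds h0)
  unfold EE
  exact ((iter_dslope_entire (n + 1) s).const_mul _).add ((a1.add (a2.mul (differentiable_riemannZeta₀ s))).const_mul _)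
end PA
end ZS

namespace ZS
section PB
open Complex Filter Topology Asymptotics Set Metric

lemma logpow_le (k : ℕ) {ε : ℝ} (hε : 0 < ε) : ∃ C : ℝ, 0 < C ∧ ∀ y : ℝ, 1 ≤ y → Real.log y ^ k ≤ C * y ^ ε := by
  rcases Nat.eq_zero_or_pos k with rfl | hk
  · refine ⟨1, one_pos, ?_⟩
    intro y hy
    simpa using Real.one_le_rpow hy hε.le
  have hk' : (0:ℝ) < k := by exact_mod_cast hk
  refine ⟨(k / ε) ^ k, by positivity, ?_⟩
  intro y hy
  have h := Real.log_le_rpow_div (x := y) (ε := ε / k) (by linarith) (by positivity)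
  calc Real.log y ^ k ≤ (y ^ (ε / k) / (ε / k)) ^ k := by
        have := Real.log_nonneg hy
        gcongr
    _ = (k / ε) ^ k * y ^ ε := by
        rw [div_pow, ← Real.rpow_natCast, ← Real.rpow_mul (by linarith), div_mul_cancel₀ _ hk'.ne']
        rw [div_pow, div_pow]
        field_simp

lemma LL_continuous : Continuous LL := by
  unfold LL
  apply Continuous.log (by fun_prop)
  intro x
  positivity

lemma polar_bd (n : ℕ) : ∃ C : ℝ, 0 < C ∧ ∀ s : ℂ, 1 ≤ ‖s - 1‖ → ‖polar n s‖ ≤ C := by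
  refine ⟨n.factorial + (∑ k ∈ Finset.range (n + 1), ‖(n.factorial * cz k : ℂ)‖) + ‖iteratedDeriv n DD 1‖, by positivity, ?_⟩
  intro s hs
  have key : ∀ (a : ℂ) (k : ℕ), ‖a / (s - 1) ^ k‖ ≤ ‖a‖ := by
    intro a k
    rw [norm_div, norm_pow]
    exact div_le_self (norm_nonneg _) (one_le_pow₀ hs)
  unfold polar
  refine (norm_add_le _ _).trans (add_le_add ((norm_add_le _ _).trans (add_le_add ?_ ?_)) ?_)
  · simpa using key n.factorial (n + 2)
  · refine (norm_sum_le _ _).trans (Finset.sum_le_sum fun k _ => key _ _)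
  · have := key ((-1) ^ (n + 1) * iteratedDeriv n DD 1) 1
    simpa using this

lemma EE_bd (n : ℕ) : ∃ c C : ℝ, 0 < c ∧ c ≤ 1/32 ∧ 0 < C ∧ ∀ s : ℂ, 1 - c / LL s.im ≤ s.re → s.re ≤ 11/10 →
    riemannZeta₁ s ≠ 0 ∧ ‖EE n s‖ ≤ C * (3 + |s.im|) ^ (9/10 : ℝ) := by
  obtain ⟨c, hc, hc', hne, hD⟩ := DD_deriv_bd
  obtain ⟨C1, hC1, hD1⟩ := hD n
  obtain ⟨C2, hC2, hz⟩ := zeta_deriv_convexity 0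
  obtain ⟨C3, hC3, hl⟩ := logpow_le (n + 2) (show (0:ℝ) < 3/20 by norm_num)
  obtain ⟨C4, hC4, hp⟩ := polar_bd n
  set K : Set ℂ := {s : ℂ | 1 - c / LL s.im ≤ s.re ∧ s.re ≤ 11/10 ∧ |s.im| ≤ 2} with hK
  have hKc : IsCompact K := by
    apply Metric.isCompact_of_isClosed_isBounded
    · rw [hK]
      have hLc : Continuous fun s : ℂ => c / LL s.im := by
        apply Continuous.div continuous_const (LL_continuous.comp Complex.continuous_im)
        intro s
        have := one_le_LL s.im
        simp only [Function.comp_apply]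
        linarith
      exact (isClosed_le (continuous_const.sub hLc) Complex.continuous_re).inter
        ((isClosed_le Complex.continuous_re continuous_const).inter (isClosed_le (continuous_abs.comp Complex.continuous_im) continuous_const))
    · apply Metric.isBounded_closedBall (x := (0:ℂ)) (r := 5) |>.subset
      rintro s ⟨h1, h2, h3⟩
      rw [mem_closedBall, dist_zero_right]
      have := Complex.norm_le_abs_re_add_abs_im s
      have hL := one_le_LL s.im
      have : c / LL s.im ≤ c := div_le_self hc.le hL
      have : |s.re| ≤ 3 := by rw [abs_le]; constructor <;> linarith
      linarith
  obtain ⟨C5, hC5⟩ := hKc.exists_bound_of_continuousOn (f := EE n) (fun s hs => (EE_differentiableAt n (hne s hs.1)).continuousAt.continuousWithinAt)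
  refine ⟨c, |C5| + ((C1 * C3 + n.factorial) * C2 + C4), hc, hc', by positivity, ?_⟩
  intro s h1 h2
  refine ⟨hne s h1, ?_⟩
  have hpow : 1 ≤ (3 + |s.im|) ^ (9/10 : ℝ) := by
    apply Real.one_le_rpow _ (by norm_num)
    have := abs_nonneg s.im
    linarith
  by_cases him : |s.im| ≤ 2
  · have := hC5 s ⟨h1, h2, him⟩
    have := le_abs_self C5
    have : |C5| ≤ |C5| * (3 + |s.im|) ^ (9/10 : ℝ) := by
      have := abs_nonneg C5
      nlinarith
    have : 0 ≤ ((C1 * C3 + n.factorial) * C2 + C4) * (3 + |s.im|) ^ (9/10 : ℝ) := by positivity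
    rw [add_mul]
    linarith
  push Not at him
  have hL := one_le_LL s.im
  have hcL : c / LL s.im ≤ c := div_le_self hc.le hL
  have hn1 : s ≠ 1 := ne_one_of_im (by intro h; rw [h] at him; simp at him; linarith)
  have hs1 : 1 ≤ ‖s - 1‖ := by
    have := Complex.abs_im_le_norm (s - 1)
    simp at this
    linarith
  have e : EE n s = (-1) ^ (n + 1) * QQ n s * riemannZeta s - polar n s := by
    rw [EE_eq n hn1 (hne s h1)]; ring
  set y := 3 + |s.im| with hy
  have hy1 : 1 ≤ y := by have := abs_nonneg s.im; linarith
  have b1 : ‖QQ n s‖ ≤ (C1 * C3 + n.factorial) * y ^ (3/20 : ℝ) := by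
    rw [QQ_eq n hn1 (hne s h1)]
    refine (norm_sub_le _ _).trans ?_
    rw [add_mul]
    apply add_le_add
    · refine (hD1 s h1 (by linarith)).trans ?_
      rw [mul_assoc]
      have := hl y hy1
      rw [LL, add_comm]
      gcongr
    · rw [norm_div, norm_mul, norm_pow, norm_pow, norm_neg, norm_one, one_pow, one_mul, Complex.norm_natCast]
      refine (div_le_self (by positivity) (one_le_pow₀ hs1)).trans ?_
      have : 1 ≤ y ^ (3/20:ℝ) := Real.one_le_rpow hy1 (by norm_num)
      have : (0:ℝ) ≤ n.factorial := by positivity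
      nlinarith
  have b2 : ‖riemannZeta s‖ ≤ C2 * y ^ (3/4 : ℝ) := by
    have := hz s (by linarith) h2 him.le
    rw [iteratedDeriv_zero] at this
    refine this.trans ?_
    gcongr
    linarith
  rw [e]
  refine (norm_sub_le _ _).trans ?_
  rw [norm_mul, norm_mul, norm_pow, norm_neg, norm_one, one_pow, one_mul]
  have b3 : ‖QQ n s‖ * ‖riemannZeta s‖ ≤ ((C1 * C3 + n.factorial) * C2) * y ^ (9/10:ℝ) := by
    calc ‖QQ n s‖ * ‖riemannZeta s‖ ≤ ((C1 * C3 + n.factorial) * y ^ (3/20 : ℝ)) * (C2 * y ^ (3/4 : ℝ)) := by gcongr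
      _ = ((C1 * C3 + n.factorial) * C2) * (y ^ (3/20 : ℝ) * y ^ (3/4:ℝ)) := by ring
      _ = _ := by rw [← Real.rpow_add (by linarith)]; norm_num
  have b4 := hp s hs1
  have b5 : C4 ≤ C4 * y ^ (9/10:ℝ) := by nlinarith
  have b6 : 0 ≤ |C5| * y ^ (9/10:ℝ) := by positivity
  rw [add_mul, add_mul]
  linarith
end PB
end ZS

namespace ZS
section PC
open Complex Filter Topology Asymptotics Set Metric MeasureTheory

/-- the smoothing kernel -/
noncomputable def kf (t : ℝ) : ℂ := indicator (Ioc 0 1) (fun _ => (1:ℂ)) t - indicator (Ioc 0 1) (fun t : ℝ => (t:ℂ) ^ (1:ℂ)) t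

lemma kf_eq {t : ℝ} (ht : 0 < t) : kf t = ((max (1 - t) 0 : ℝ) : ℂ) := by
  unfold kf
  by_cases h : t ≤ 1
  · have hm : t ∈ Ioc (0:ℝ) 1 := ⟨ht, h⟩
    rw [indicator_of_mem hm, indicator_of_mem hm, max_eq_left (by linarith)]
    simp
  · have hm : t ∉ Ioc (0:ℝ) 1 := fun hh => h hh.2
    rw [indicator_of_notMem hm, indicator_of_notMem hm, max_eq_right (by linarith)]
    simp

lemma kf_mellin {s : ℂ} (hs : 0 < s.re) : HasMellin kf s (1 / (s * (s + 1))) := by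
  have h1 := hasMellin_one_Ioc hs
  have h2 := hasMellin_cpow_Ioc 1 (s := s) (by simp; linarith)
  have h := hasMellin_sub h1.1 h2.1
  have e : mellin (fun t => (Ioc 0 1).indicator (fun x : ℝ => (1:ℂ)) t) s - mellin (fun t => (Ioc 0 1).indicator (fun t : ℝ => (t:ℂ) ^ (1:ℂ)) t) s = 1 / (s * (s + 1)) := by
    rw [h1.2, h2.2]
    have : s ≠ 0 := by rintro rfl; simp at hs
    have : s + 1 ≠ 0 := by intro hh; have := congrArg Complex.re hh; simp at this; linarith
    field_simp
    ring
  rw [e] at h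
  exact h

lemma kf_contAt {x : ℝ} (hx : 0 < x) : ContinuousAt kf x := by
  have : kf =ᶠ[𝓝 x] fun t => ((max (1 - t) 0 : ℝ) : ℂ) := by
    filter_upwards [lt_mem_nhds hx] with t ht
    exact kf_eq ht
  rw [continuousAt_congr this]
  fun_prop

lemma ss_lower {σ : ℝ} (hσ : 1/2 ≤ σ) (t : ℝ) : (1 + t ^ 2) / 4 ≤ ‖(σ + t * I : ℂ) * ((σ + t * I : ℂ) + 1)‖ := by
  have e : ‖(σ + t * I : ℂ)‖ ^ 2 = σ ^ 2 + t ^ 2 := by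
    rw [← Complex.normSq_eq_norm_sq, Complex.normSq_add_mul_I]
  have e2 : ‖(σ + t * I : ℂ) + 1‖ ^ 2 = (σ + 1) ^ 2 + t ^ 2 := by
    rw [show (σ + t * I : ℂ) + 1 = ((σ + 1 : ℝ) : ℂ) + t * I by push_cast; ring, ← Complex.normSq_eq_norm_sq, Complex.normSq_add_mul_I]
  have hle : ‖(σ + t * I : ℂ)‖ ≤ ‖(σ + t * I : ℂ) + 1‖ := by
    apply le_of_sq_le_sq _ (norm_nonneg _)
    rw [e, e2]; nlinarith
  rw [norm_mul]
  have := norm_nonneg (σ + t * I : ℂ)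
  nlinarith

lemma ss_ne {σ : ℝ} (hσ : 1/2 ≤ σ) (t : ℝ) : (σ + t * I : ℂ) * ((σ + t * I : ℂ) + 1) ≠ 0 := by
  have := ss_lower hσ t
  intro h
  rw [h, norm_zero] at this
  nlinarith

lemma ss_cont {σ : ℝ} (hσ : 1/2 ≤ σ) : Continuous fun t : ℝ => 1 / ((σ + t * I : ℂ) * ((σ + t * I : ℂ) + 1)) := by
  apply Continuous.div continuous_const (by fun_prop)
  exact ss_ne hσ

lemma ss_integrable {σ : ℝ} (hσ : 1/2 ≤ σ) : Integrable fun t : ℝ => 1 / ((σ + t * I : ℂ) * ((σ + t * I : ℂ) + 1)) := by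
  apply (integrable_inv_one_add_sq.const_mul 4).mono (ss_cont hσ).aestronglyMeasurable
  refine Eventually.of_forall fun t => ?_
  rw [norm_div, norm_one, Real.norm_eq_abs, abs_of_pos (by positivity), one_div, ← inv_inv (4:ℝ), ← mul_inv]
  apply inv_anti₀ (by positivity)
  have := ss_lower hσ t
  linarith

lemma kf_inv {σ u : ℝ} (hσ : 1/2 ≤ σ) (hu : 0 < u) :
    kf u = (1 / (2 * Real.pi) : ℂ) * ∫ t : ℝ, (u : ℂ) ^ (-(σ + t * I : ℂ)) * (1 / ((σ + t * I : ℂ) * ((σ + t * I : ℂ) + 1))) := by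
  have hm : ∀ t : ℝ, mellin kf (σ + t * I) = 1 / ((σ + t * I : ℂ) * ((σ + t * I : ℂ) + 1)) := by
    intro t
    exact (kf_mellin (by simp; linarith)).2
  have h := mellinInv_mellin_eq σ kf hu (kf_mellin (by simp; linarith)).1 (by
    unfold Complex.VerticalIntegrable
    simp only [hm]
    exact ss_integrable hσ) (kf_contAt hu)
  rw [← h, mellinInv]
  simp only [hm, smul_eq_mul]
  rw [← Complex.coe_smul, smul_eq_mul]
  push_cast
  rfl

lemma perron_gen {α : Type*} [MeasurableSpace α] (μ : Measure α) [SFinite μ] (w : α → ℂ) (u : α → ℝ)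
    (hu : Measurable u) (hup : ∀ a, 0 < u a) (hw : Measurable w) {σ : ℝ} (hσ : 1/2 ≤ σ)
    (hIntg : Integrable (fun a => w a * (u a : ℂ) ^ (-(σ : ℂ))) μ) {x : ℝ} (hx : 0 < x) :
    ∫ a, w a * kf (u a / x) ∂μ = (1 / (2 * Real.pi) : ℂ) * (∫ t : ℝ,
      ((∫ a, w a * (u a : ℂ) ^ (-(σ + t * I : ℂ)) ∂μ) * ((x : ℂ) ^ (σ + t * I : ℂ) * (1 / ((σ + t * I : ℂ) * ((σ + t * I : ℂ) + 1)))))) ∧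
    Integrable (fun t : ℝ =>
      ((∫ a, w a * (u a : ℂ) ^ (-(σ + t * I : ℂ)) ∂μ) * ((x : ℂ) ^ (σ + t * I : ℂ) * (1 / ((σ + t * I : ℂ) * ((σ + t * I : ℂ) + 1)))))) := by
  have hsplit : ∀ a, ∀ t : ℝ, ((u a / x : ℝ) : ℂ) ^ (-(σ + t * I : ℂ)) = (u a : ℂ) ^ (-(σ + t * I : ℂ)) * (x : ℂ) ^ (σ + t * I : ℂ) := by
    intro a t
    rw [div_eq_mul_inv, Complex.ofReal_mul, Complex.mul_cpow_ofReal_nonneg (hup a).le (by positivity), Complex.ofReal_inv,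
      Complex.inv_cpow _ _ (by rw [Complex.arg_ofReal_of_nonneg hx.le]; exact Real.pi_pos.ne), Complex.cpow_neg (x:ℂ), inv_inv]
  have e1 : ∀ a, w a * kf (u a / x) = (1 / (2 * Real.pi) : ℂ) * ∫ t : ℝ, (w a * (u a : ℂ) ^ (-(σ + t * I : ℂ))) * ((x : ℂ) ^ (σ + t * I : ℂ) * (1 / ((σ + t * I : ℂ) * ((σ + t * I : ℂ) + 1)))) := by
    intro a
    rw [kf_inv hσ (div_pos (hup a) hx), mul_left_comm, ← integral_const_mul]
    congr 2
    funext t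
    rw [hsplit]
    ring
  have hprod : Integrable (Function.uncurry fun a (t:ℝ) => (w a * (u a : ℂ) ^ (-(σ + t * I : ℂ))) * ((x : ℂ) ^ (σ + t * I : ℂ) * (1 / ((σ + t * I : ℂ) * ((σ + t * I : ℂ) + 1))))) (μ.prod volume) := by
    have hg : Integrable (fun t : ℝ => (x : ℂ) ^ (σ + t * I : ℂ) * (1 / ((σ + t * I : ℂ) * ((σ + t * I : ℂ) + 1)))) := by
      refine (ss_integrable hσ).bdd_mul (c := x ^ σ) ?_ ?_
      · apply Continuous.aestronglyMeasurable
        have : (x:ℂ) ≠ 0 := by exact_mod_cast hx.ne'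
        exact Continuous.const_cpow (by fun_prop) (Or.inl this)
      · refine Eventually.of_forall fun t => ?_
        rw [Complex.norm_cpow_eq_rpow_re_of_pos hx]
        simp
    refine (hIntg.mul_prod hg).mono ?_ ?_
    · apply Measurable.aestronglyMeasurable
      have m1 : Measurable fun p : α × ℝ => w p.1 * (u p.1 : ℂ) ^ (-(σ + p.2 * I : ℂ)) := by
        apply (hw.comp measurable_fst).mul
        apply Measurable.pow
        · exact Complex.measurable_ofReal.comp (hu.comp measurable_fst)
        · fun_prop
      have m2 : Measurable fun p : α × ℝ => ((x : ℂ) ^ (σ + p.2 * I : ℂ) * (1 / ((σ + p.2 * I : ℂ) * ((σ + p.2 * I : ℂ) + 1)))) := by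
        fun_prop
      exact m1.mul m2
    · refine Eventually.of_forall fun p => ?_
      simp only [Function.uncurry, norm_mul]
      rw [Complex.norm_cpow_eq_rpow_re_of_pos (hup _), Complex.norm_cpow_eq_rpow_re_of_pos (hup _)]
      simp
  constructor
  · simp only [e1]
    rw [integral_const_mul]
    congr 1
    rw [integral_integral_swap hprod]
    congr 1
    funext t
    rw [integral_mul_const]
  · have := hprod.integral_prod_right
    refine this.congr (Eventually.of_forall fun t => ?_)
    simp only [Function.uncurry]
    rw [integral_mul_const]
end PC
end ZS

namespace ZS
section PD
open Complex Filter Topology Asymptotics Set Metric MeasureTheory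

lemma gam_integrable (k : ℕ) {z : ℂ} (hz : 0 < z.re) :
    IntegrableOn (fun v : ℝ => (v:ℂ) ^ k * cexp (-(z * v))) (Ioi 0) := by
  have h := integrableOn_rpow_mul_exp_neg_mul_rpow (s := (k:ℝ)) (p := 1) (b := z.re) (by
    have : (0:ℝ) ≤ k := by positivity
    linarith) (by norm_num) hz
  refine Integrable.mono' h (by
    apply Continuous.aestronglyMeasurable; fun_prop) ?_
  filter_upwards [ae_restrict_mem measurableSet_Ioi] with v hv
  have hv : 0 < v := hv
  rw [norm_mul, norm_pow, Complex.norm_real, Real.norm_of_nonneg hv.le, Complex.norm_exp]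
  simp [Real.rpow_natCast]

lemma gam_cpow_bd {a z : ℂ} {b v : ℝ} (hv : 0 < v) (hz : b ≤ z.re) :
    ‖(v:ℂ) ^ a * cexp (-(z * v))‖ ≤ v ^ a.re * Real.exp (-b * v ^ (1:ℝ)) := by
  rw [norm_mul, Complex.norm_cpow_eq_rpow_re_of_pos hv, Complex.norm_exp, Real.rpow_one]
  refine mul_le_mul_of_nonneg_left (Real.exp_le_exp.2 ?_) (by positivity)
  simp only [neg_re, mul_re, ofReal_re, ofReal_im, mul_zero, sub_zero]
  nlinarith

lemma gam_meas (a z : ℂ) : AEStronglyMeasurable (fun v : ℝ => (v:ℂ) ^ a * cexp (-(z * v))) (volume.restrict (Ioi 0)) := by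
  refine ContinuousOn.aestronglyMeasurable ?_ measurableSet_Ioi
  refine ContinuousOn.mul (fun v hv => ?_) (by fun_prop)
  exact (Complex.continuousAt_ofReal_cpow_const v a (Or.inr (ne_of_gt hv))).continuousWithinAt

lemma gam_cpow_integrable {a z : ℂ} (ha : -1 < a.re) (hz : 0 < z.re) :
    IntegrableOn (fun v : ℝ => (v:ℂ) ^ a * cexp (-(z * v))) (Ioi 0) := by
  refine Integrable.mono' (integrableOn_rpow_mul_exp_neg_mul_rpow (s := a.re) (p := 1) (b := z.re) ha (by norm_num) hz)
    (gam_meas a z) ?_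
  filter_upwards [ae_restrict_mem measurableSet_Ioi] with v hv
  exact gam_cpow_bd hv le_rfl

lemma gam_cpow {a z : ℂ} (ha : 0 < a.re) (hz : 0 < z.re) :
    ∫ v : ℝ in Ioi 0, (v:ℂ) ^ (a - 1) * cexp (-(z * v)) = z ^ (-a) * Complex.Gamma a := by
  have ha1 : -1 < (a - 1).re := by simp; linarith
  set U : Set ℂ := {z | 0 < z.re} with hU
  have hUo : IsOpen U := isOpen_lt continuous_const Complex.continuous_re
  have hUc : Convex ℝ U := convex_halfSpace_re_gt 0
  have hd : DifferentiableOn ℂ (fun z : ℂ => ∫ v : ℝ in Ioi 0, (v:ℂ) ^ (a - 1) * cexp (-(z * v))) U := by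
    intro z hz
    have hz : 0 < z.re := hz
    have hb := integrableOn_rpow_mul_exp_neg_mul_rpow (s := a.re) (p := 1) (b := z.re / 2) (by linarith) (by norm_num) (by linarith)
    have := hasDerivAt_integral_of_dominated_loc_of_deriv_le (μ := volume.restrict (Ioi (0:ℝ))) (s := ball z (z.re / 2)) (x₀ := z)
      (F := fun z v => (v:ℂ) ^ (a - 1) * cexp (-(z * v))) (F' := fun z v => -((v:ℂ) ^ a * cexp (-(z * v))))
      (bound := fun v => v ^ a.re * Real.exp (-(z.re/2) * v ^ (1:ℝ))) (ball_mem_nhds z (by linarith))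
      (Filter.Eventually.of_forall fun z => gam_meas _ _) (gam_cpow_integrable ha1 hz) ((gam_meas a z).neg) (by
        filter_upwards [ae_restrict_mem measurableSet_Ioi] with v hv x hx
        rw [norm_neg]
        refine gam_cpow_bd hv ?_
        have h1 := Complex.abs_re_le_norm (x - z)
        rw [mem_ball, dist_eq_norm] at hx
        have h2 := abs_lt.1 (h1.trans_lt hx)
        simp only [sub_re] at h2
        linarith [h2.1]) hb (by
        filter_upwards [ae_restrict_mem measurableSet_Ioi] with v hv x hx
        have hv0 : (v:ℂ) ≠ 0 := by exact_mod_cast (ne_of_gt hv)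
        have e : -((v:ℂ) ^ a * cexp (-(x * v))) = (v:ℂ) ^ (a-1) * (cexp (-(x * v)) * (-(1 * (v:ℂ)))) := by
          rw [Complex.cpow_sub _ _ hv0, Complex.cpow_one]; field_simp
        rw [e]
        exact (((hasDerivAt_id x).mul_const (v:ℂ)).fun_neg.cexp).const_mul _)
    exact this.2.differentiableAt.differentiableWithinAt
  have hd2 : DifferentiableOn ℂ (fun z : ℂ => z ^ (-a) * Complex.Gamma a) U := by
    intro z hz
    exact (((hasDerivAt_id z).cpow_const (Or.inl hz)).differentiableAt.mul_const _).differentiableWithinAt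
  refine (hd.analyticOnNhd hUo).eqOn_of_preconnected_of_frequently_eq (hd2.analyticOnNhd hUo) hUc.isPreconnected
    (z₀ := 1) (by simp [hU]) ?_ hz
  have ht : Tendsto (fun k : ℕ => (((1:ℝ) + 1 / ((k:ℝ) + 1) : ℝ) : ℂ)) atTop (𝓝[≠] 1) := by
    refine tendsto_nhdsWithin_iff.2 ⟨?_, Filter.Eventually.of_forall fun k => ?_⟩
    · have h : Tendsto (fun k : ℕ => (1:ℝ) + 1 / ((k:ℝ) + 1)) atTop (𝓝 (1 + 0)) :=
        tendsto_const_nhds.add tendsto_one_div_add_atTop_nhds_zero_nat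
      have h2 := (Complex.continuous_ofReal.tendsto _).comp h
      simpa [Function.comp_def] using h2
    · have : (1:ℝ) + 1 / ((k:ℝ) + 1) ≠ 1 := by
        have : (0:ℝ) < 1 / ((k:ℝ) + 1) := by positivity
        linarith
      simp only [mem_compl_iff, mem_singleton_iff]
      exact_mod_cast this
  refine ht.frequently (Filter.Frequently.of_forall fun k => ?_)
  have hp : (0:ℝ) < (1:ℝ) + 1 / ((k:ℝ) + 1) := by positivity
  rw [Complex.integral_cpow_mul_exp_neg_mul_Ioi ha hp, one_div, Complex.inv_cpow _ _ (by rw [Complex.arg_ofReal_of_nonneg hp.le]; exact Real.pi_pos.ne), Complex.cpow_neg]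

lemma gam_integral (k : ℕ) {z : ℂ} (hz : 0 < z.re) :
    ∫ v : ℝ in Ioi 0, (v:ℂ) ^ k * cexp (-(z * v)) = k.factorial / z ^ (k + 1) := by
  have h := gam_cpow (a := (k:ℂ) + 1) (z := z) (by
    simp; positivity) hz
  rw [Complex.Gamma_nat_eq_factorial] at h
  have e : ((k:ℂ) + 1) = ((k + 1 : ℕ) : ℂ) := by push_cast; ring
  rw [show z ^ (-((k:ℂ) + 1)) = 1 / z ^ (k + 1) by rw [e, Complex.cpow_neg, Complex.cpow_natCast]; simp] at h
  rw [show (k.factorial : ℂ) / z ^ (k + 1) = 1 / z ^ (k + 1) * k.factorial by ring, ← h]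
  refine setIntegral_congr_fun measurableSet_Ioi fun v hv => ?_
  simp

/-- the polynomial of the main term -/
noncomputable def PP (n : ℕ) (v : ℝ) : ℂ :=
  (n.factorial / (n+1).factorial : ℂ) * (v:ℂ) ^ (n + 1)
    + (∑ k ∈ Finset.range (n + 1), (n.factorial * cz k / (n - k).factorial : ℂ) * (v:ℂ) ^ (n - k))
    + (-1) ^ (n + 1) * iteratedDeriv n DD 1

lemma PP_cont (n : ℕ) : Continuous (PP n) := by unfold PP; fun_prop

lemma PP_expand (n : ℕ) (v : ℝ) (E : ℂ) : PP n v * E =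
   (n.factorial / (n+1).factorial : ℂ) * ((v:ℂ) ^ (n + 1) * E)
    + (∑ k ∈ Finset.range (n + 1), (n.factorial * cz k / (n - k).factorial : ℂ) * ((v:ℂ) ^ (n - k) * E))
    + (-1) ^ (n + 1) * iteratedDeriv n DD 1 * ((v:ℂ) ^ 0 * E) := by
  unfold PP
  rw [add_mul, add_mul, Finset.sum_mul]
  simp only [mul_assoc, pow_zero, one_mul]

lemma PP_laplace (n : ℕ) {s : ℂ} (hs : 1 < s.re) :
    IntegrableOn (fun v : ℝ => PP n v * cexp (-((s - 1) * v))) (Ioi 0) ∧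
    ∫ v : ℝ in Ioi 0, PP n v * cexp (-((s - 1) * v)) = polar n s := by
  have hz : 0 < (s - 1).re := by simp; linarith
  have h1 := (gam_integrable (n+1) hz).const_mul (n.factorial / (n+1).factorial : ℂ)
  have h2 : ∀ k ∈ Finset.range (n+1), Integrable (fun v : ℝ => (n.factorial * cz k / (n - k).factorial : ℂ) * ((v:ℂ) ^ (n - k) * cexp (-((s - 1) * v)))) (volume.restrict (Ioi 0)) :=
    fun k _ => (gam_integrable (n-k) hz).const_mul _
  have h3 := (gam_integrable 0 hz).const_mul ((-1) ^ (n + 1) * iteratedDeriv n DD 1)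
  have h2' := integrable_finsetSum _ h2
  simp only [PP_expand]
  refine ⟨(Integrable.add (Integrable.add h1 h2') h3), ?_⟩
  rw [integral_add (f := fun v : ℝ => (n.factorial / (n+1).factorial : ℂ) * ((v:ℂ) ^ (n + 1) * cexp (-((s - 1) * v))) + (∑ k ∈ Finset.range (n + 1), (n.factorial * cz k / (n - k).factorial : ℂ) * ((v:ℂ) ^ (n - k) * cexp (-((s - 1) * v))))) (Integrable.add h1 h2') h3, integral_add h1 h2', integral_finsetSum _ h2]
  simp only [integral_const_mul, gam_integral _ hz]
  unfold polar
  have f1 : ((n+1).factorial : ℂ) ≠ 0 := by exact_mod_cast (n+1).factorial_ne_zero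
  congr 1
  · congr 1
    · field_simp
    · refine Finset.sum_congr rfl fun k hk => ?_
      have f2 : ((n-k).factorial : ℂ) ≠ 0 := by exact_mod_cast (n-k).factorial_ne_zero
      rw [show n - k + 1 = n + 1 - k by have := Finset.mem_range.1 hk; omega]
      field_simp
  · simp; ring

/-- smoothed difference -/
noncomputable def Del (n : ℕ) (x : ℝ) : ℂ :=
  (∑' m : ℕ, (qa n (m+1) : ℂ) * kf (((m+1 : ℕ) : ℝ) / x)) - ∫ v : ℝ in Ioi 0, (PP n v * Real.exp v) * kf (Real.exp v / x)

lemma exp_cpow (v : ℝ) (s : ℂ) : ((Real.exp v : ℝ) : ℂ) ^ s = cexp (s * v) := by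
  rw [Complex.cpow_def_of_ne_zero (by exact_mod_cast (Real.exp_pos v).ne'), ← Complex.ofReal_log (Real.exp_pos v).le, Real.log_exp, mul_comm]

lemma qa_hasSum' (n : ℕ) {s : ℂ} (hs : 1 < s.re) :
    HasSum (fun m : ℕ => (qa n (m+1) : ℂ) * (((m+1 : ℕ) : ℝ) : ℂ) ^ (-s)) ((-1)^(n+1)*QQ n s*riemannZeta s) := by
  have h := qa_hasSum n hs
  rw [← hasSum_nat_add_iff' 1] at h
  simpa [qa_zero] using h

lemma perron_diff (n : ℕ) {σ x : ℝ} (hσ : 1 < σ) (hx : 0 < x) :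
    Del n x = (1/(2*Real.pi):ℂ) * ∫ t : ℝ, EE n (σ+t*I) * ((x:ℂ)^(σ+t*I : ℂ)*(1/((σ+t*I : ℂ)*((σ+t*I : ℂ)+1)))) ∧
    Integrable fun t : ℝ => EE n (σ+t*I) * ((x:ℂ)^(σ+t*I : ℂ)*(1/((σ+t*I : ℂ)*((σ+t*I : ℂ)+1)))) := by
  have hre : ∀ t : ℝ, 1 < (σ + t * I : ℂ).re := fun t => by simpa using hσ
  have p1 := perron_gen (Measure.count : Measure ℕ) (fun m => (qa n (m+1) : ℂ)) (fun m => ((m+1 : ℕ) : ℝ)) (σ := σ) (x := x)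
    (by fun_prop) (fun m => by positivity) (by fun_prop) (by linarith) (by
      rw [integrable_count_iff]
      exact ((qa_hasSum' n (s := (σ:ℂ)) (by simpa using hσ)).summable).norm) hx
  have p2 := perron_gen (volume.restrict (Ioi (0:ℝ))) (fun v => PP n v * Real.exp v) Real.exp (σ := σ) (x := x)
    (by fun_prop) (fun m => Real.exp_pos m) (by have := PP_cont n; fun_prop) (by linarith) (by
      have := (PP_laplace n (s := (σ:ℂ)) (by simpa using hσ)).1
      refine this.congr (Filter.Eventually.of_forall fun v => ?_)
      simp only [exp_cpow]
      rw [mul_assoc, Complex.ofReal_exp, ← Complex.exp_add]; congr 2; ring) hx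
  have e1 : ∀ t : ℝ, (∫ a : ℕ, (qa n (a+1) : ℂ) * (((a+1 : ℕ) : ℝ):ℂ) ^ (-(σ + t * I : ℂ)) ∂Measure.count) = (-1)^(n+1)*QQ n (σ+t*I)*riemannZeta (σ+t*I) := fun t => by
    have h := qa_hasSum' n (hre t)
    rw [integral_countable' (integrable_count_iff.2 h.summable.norm)]
    simp only [measureReal_def, Measure.count_singleton, ENNReal.toReal_one, one_smul]
    exact h.tsum_eq
  have e2 : ∀ t : ℝ, (∫ v : ℝ in Ioi 0, PP n v * Real.exp v * ((Real.exp v : ℝ):ℂ) ^ (-(σ + t * I : ℂ))) = polar n (σ+t*I) := fun t => by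
    rw [← (PP_laplace n (hre t)).2]
    refine integral_congr_ae (Filter.Eventually.of_forall fun v => ?_)
    simp only [exp_cpow]
    rw [mul_assoc, Complex.ofReal_exp, ← Complex.exp_add]; congr 2; ring
  simp only [e1] at p1
  simp only [e2] at p2
  have e3 : ∀ t : ℝ, EE n (σ+t*I) = (-1)^(n+1)*QQ n (σ+t*I)*riemannZeta (σ+t*I) - polar n (σ+t*I) := fun t => by
    rw [EE_eq n (ne_one_of_re (hre t)) (zeta1_ne_of_one_le (hre t).le)]; ring
  have e4 := p1.2.sub p2.2
  simp only [e3, sub_mul]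
  refine ⟨?_, e4⟩
  rw [integral_sub p1.2 p2.2, mul_sub, ← p1.1, ← p2.1, Del]
  congr 1
  have hfin : Summable fun m : ℕ => ‖(qa n (m+1) : ℂ) * kf (((m+1 : ℕ) : ℝ) / x)‖ := by
    refine summable_of_finite_support (Set.Finite.subset (Set.finite_Iio (⌈x⌉₊)) fun m hm => ?_)
    by_contra hc
    apply hm
    have : x ≤ m := by simpa using hc
    show ‖(qa n (m+1) : ℂ) * kf (((m+1 : ℕ) : ℝ) / x)‖ = 0
    rw [kf_eq (by positivity), max_eq_right]
    · simp
    · rw [sub_nonpos, le_div_iff₀ hx]; push_cast; linarith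
  rw [integral_countable' (integrable_count_iff.2 hfin)]
  simp only [measureReal_def, Measure.count_singleton, ENNReal.toReal_one, one_smul]

end PD
end ZS

namespace ZS
section PE
open Complex Filter Topology Asymptotics Set Metric MeasureTheory

lemma rect_eq (f : ℂ → ℂ) {a b c d : ℝ} (hab : a ≤ b) (hcd : c ≤ d)
    (H : ∀ s : ℂ, a ≤ s.re → s.re ≤ b → c ≤ s.im → s.im ≤ d → DifferentiableAt ℂ f s) :
    I * ∫ y : ℝ in c..d, f (b + y * I) = I * (∫ y : ℝ in c..d, f (a + y * I)) + (∫ x : ℝ in a..b, f (x + d * I)) - ∫ x : ℝ in a..b, f (x + c * I) := by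
  have h := Complex.integral_boundary_rect_eq_zero_of_differentiableOn f (a + c * I) (b + d * I) (by
    intro s hs
    rw [Complex.mem_reProdIm] at hs
    simp only [add_re, ofReal_re, mul_re, I_re, mul_zero, ofReal_im, I_im, mul_one, sub_self, add_zero, add_im, mul_im, zero_add, uIcc_of_le hab, uIcc_of_le hcd] at hs
    exact (H s hs.1.1 hs.1.2 hs.2.1 hs.2.2).differentiableWithinAt)
  simp only [add_re, ofReal_re, mul_re, I_re, mul_zero, ofReal_im, I_im, mul_one, sub_self, add_zero, add_im, mul_im, zero_add, smul_eq_mul] at h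
  linear_combination h

lemma integrable_three_add {r : ℝ} (hr : 1 < r) : Integrable fun t : ℝ => (3 + |t|) ^ (-r) := by
  have h := integrable_one_add_norm (E := ℝ) (μ := volume) (r := r) (by simpa using hr)
  refine h.mono' ?_ (Filter.Eventually.of_forall fun t => ?_)
  · apply Continuous.aestronglyMeasurable
    refine Continuous.rpow_const (by fun_prop) fun t => Or.inl (by positivity)
  · rw [Real.norm_of_nonneg (by positivity), Real.norm_eq_abs]
    exact Real.rpow_le_rpow_of_nonpos (by positivity) (by linarith [abs_nonneg t]) (by linarith)

lemma EEf_bd {n : ℕ} {C σ x t : ℝ} (hC : 0 < C) (hσ : 1/2 ≤ σ) (hx : 0 < x)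
    (h : ‖EE n (σ + t * I)‖ ≤ C * (3 + |t|) ^ (9/10:ℝ)) :
    ‖EE n (σ+t*I) * ((x:ℂ)^(σ+t*I : ℂ)*(1/((σ+t*I : ℂ)*((σ+t*I : ℂ)+1))))‖ ≤ 40 * C * x ^ σ * (3 + |t|) ^ (-(11/10):ℝ) := by
  rw [norm_mul, norm_mul, Complex.norm_cpow_eq_rpow_re_of_pos hx, norm_div, norm_one]
  have e : (σ + t * I : ℂ).re = σ := by simp
  rw [e]
  have h1 : 1 / ‖(σ+t*I : ℂ)*((σ+t*I : ℂ)+1)‖ ≤ 40 * (3 + |t|) ^ (-2:ℝ) := by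
    have h2 := ss_lower hσ t
    have hp : (0:ℝ) < (1 + t^2)/4 := by positivity
    refine (one_div_le_one_div_of_le hp h2).trans ?_
    rw [Real.rpow_neg (by positivity), show (2:ℝ) = ((2:ℕ):ℝ) by norm_num, Real.rpow_natCast, ← div_eq_mul_inv, div_le_div_iff₀ hp (by positivity)]
    nlinarith [sq_abs t, sq_nonneg (3 * |t| - 1)]
  calc _ ≤ (C * (3 + |t|) ^ (9/10:ℝ)) * (x ^ σ * (40 * (3 + |t|) ^ (-2:ℝ))) :=
        mul_le_mul h (mul_le_mul_of_nonneg_left h1 (by positivity)) (by positivity) (by positivity)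
    _ = 40 * C * x ^ σ * ((3 + |t|) ^ (9/10:ℝ) * (3 + |t|) ^ (-2:ℝ)) := by ring
    _ = _ := by rw [← Real.rpow_add (by positivity)]; norm_num

lemma LL_exp_le {r : ℝ} (hr : 1 ≤ r) : LL (Real.exp r) ≤ 2 * r := by
  unfold LL
  rw [abs_of_pos (Real.exp_pos r), Real.log_le_iff_le_exp (by positivity)]
  have h1 : Real.exp (2 * r) = Real.exp r * Real.exp r := by rw [← Real.exp_add]; ring_nf
  have h2 : (2.7:ℝ) ≤ Real.exp r := by
    have := Real.exp_one_gt_d9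
    linarith [Real.exp_le_exp.2 hr]
  rw [h1]; nlinarith

lemma LL_mono {t u : ℝ} (h : |t| ≤ |u|) : LL t ≤ LL u := by
  unfold LL
  exact Real.log_le_log (by positivity) (by linarith)

set_option maxHeartbeats 1000000 in
lemma Del_bd (n : ℕ) : ∃ c K : ℝ, 0 < c ∧ c ≤ 1/64 ∧ 0 < K ∧ ∀ x : ℝ, Real.exp 10 ≤ x →
    ‖Del n x‖ ≤ K * x * Real.exp (-c * Real.sqrt (Real.log x)) := by
  obtain ⟨c, C, hc, hc2, hC, hEE⟩ := EE_bd n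
  set W1 : ℝ := ∫ t : ℝ, (3 + |t|) ^ (-(11/10):ℝ) with hW1
  set W2 : ℝ := ∫ t : ℝ, (3 + |t|) ^ (-(21/20):ℝ) with hW2
  have i1 : Integrable fun t : ℝ => (3 + |t|) ^ (-(11/10):ℝ) := integrable_three_add (by norm_num)
  have i2 : Integrable fun t : ℝ => (3 + |t|) ^ (-(21/20):ℝ) := integrable_three_add (by norm_num)
  have W1p : 0 ≤ W1 := integral_nonneg fun t => by positivity
  have W2p : 0 ≤ W2 := integral_nonneg fun t => by positivity
  refine ⟨c/2, 40 * C * (W1 + 3 * W2 + 6) + 1, by linarith, by linarith, by positivity, fun x hx => ?_⟩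
  have hx0 : 0 < x := (Real.exp_pos 10).trans_le hx
  set L := Real.log x with hL
  have hL10 : 10 ≤ L := by rw [hL, Real.le_log_iff_exp_le hx0]; exact hx
  set r := Real.sqrt L with hr
  have hr2 : r ^ 2 = L := Real.sq_sqrt (by linarith)
  have hr1 : 1 ≤ r := by rw [hr, Real.one_le_sqrt]; linarith
  set U := Real.exp r with hU
  have hU1 : 1 ≤ U := by rw [hU]; exact Real.one_le_exp (by linarith)
  set a := 1 - c / LL U with ha
  set b := 1 + 1 / L with hb
  have hLLU : 1 ≤ LL U := one_le_LL U
  have hcL : c / LL U ≤ 1/32 := (div_le_self hc.le hLLU).trans hc2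
  have hcL0 : 0 < c / LL U := by positivity
  have h1L : 1 / L ≤ 1/10 := one_div_le_one_div_of_le (by norm_num) hL10
  have h1L0 : 0 < 1 / L := by positivity
  have hab : a ≤ b := by linarith
  have hbd : ∀ σ t : ℝ, a ≤ σ → σ ≤ b → |t| ≤ U → riemannZeta₁ (σ + t * I) ≠ 0 ∧ ‖EE n (σ + t * I)‖ ≤ C * (3 + |t|) ^ (9/10:ℝ) := by
    intro σ t h1 h2 h3
    have := hEE (σ + t * I) (by
      simp only [add_im, ofReal_im, mul_im, ofReal_re, I_im, mul_one, I_re, mul_zero, add_zero, zero_add, add_re, mul_re, sub_self]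
      have : c / LL U ≤ c / LL t := div_le_div_of_nonneg_left hc.le (by linarith [one_le_LL t]) (LL_mono (by rw [abs_of_pos (by linarith : 0 < U)]; exact h3))
      linarith) (by simp; linarith)
    simpa using this
  have hbd2 : ∀ t : ℝ, ‖EE n (b + t * I)‖ ≤ C * (3 + |t|) ^ (9/10:ℝ) := by
    intro t
    have := (hEE (b + t * I) (by
      have := one_le_LL (b + t * I : ℂ).im
      have : 0 < c / LL (b + t * I : ℂ).im := by positivity
      have e : (b + t * I : ℂ).re = b := by simp
      rw [e]; linarith) (by simp; linarith)).2
    simpa using this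
  have hxa : x ^ a ≤ x * Real.exp (-(c/2) * r) := by
    rw [ha, Real.rpow_sub hx0, Real.rpow_one, div_eq_mul_inv]
    refine mul_le_mul_of_nonneg_left ?_ hx0.le
    rw [← Real.rpow_neg hx0.le, Real.rpow_def_of_pos hx0, Real.exp_le_exp]
    have h2 := LL_exp_le hr1
    have h3 : c / (2 * r) ≤ c / LL U := div_le_div_of_nonneg_left hc.le (by linarith) h2
    have h4 : c / 2 * r = L * (c / (2 * r)) := by rw [← hr2]; field_simp
    nlinarith
  have hxb : x ^ b ≤ 3 * x := by
    rw [hb, Real.rpow_add hx0, Real.rpow_one, Real.rpow_def_of_pos hx0, ← hL, mul_one_div_cancel (by linarith)]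
    nlinarith [Real.exp_one_lt_three]
  obtain ⟨p1, p2⟩ := perron_diff n (σ := b) (x := x) (by linarith) hx0
  set f : ℂ → ℂ := fun s => EE n s * ((x:ℂ)^s*(1/(s*(s+1)))) with hf
  have hfd : ∀ σ t : ℝ, a ≤ σ → σ ≤ b → |t| ≤ U → DifferentiableAt ℂ f (σ + t * I) := by
    intro σ t h1 h2 h3
    refine (EE_differentiableAt n (hbd σ t h1 h2 h3).1).mul (DifferentiableAt.mul ?_ ?_)
    · exact DifferentiableAt.const_cpow differentiableAt_id (Or.inl (by exact_mod_cast hx0.ne'))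
    · exact DifferentiableAt.div (by fun_prop) (by fun_prop) (ss_ne (by linarith) t)
  have hrect := rect_eq f hab (by linarith : -U ≤ U) (fun s h1 h2 h3 h4 => by
    have := hfd s.re s.im h1 h2 (abs_le.2 ⟨h3, h4⟩)
    rwa [Complex.re_add_im] at this)
  -- decay
  have hUd : U ^ (-(11/10):ℝ) ≤ Real.exp (-(c/2) * r) := by
    rw [hU, ← Real.exp_mul, Real.exp_le_exp]; nlinarith
  have hUd2 : U ^ (-(1/20):ℝ) ≤ Real.exp (-(c/2) * r) := by
    rw [hU, ← Real.exp_mul, Real.exp_le_exp]; nlinarith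
  set Ex := Real.exp (-(c/2) * r) with hEx
  have hEx0 : 0 < Ex := Real.exp_pos _
  have vert : ‖∫ y : ℝ in (-U)..U, f (a + y * I)‖ ≤ 40 * C * (x * Ex) * W1 := by
    rw [intervalIntegral.integral_of_le (by linarith)]
    refine (norm_integral_le_of_norm_le (g := fun t => 40 * C * (x * Ex) * (3 + |t|) ^ (-(11/10):ℝ)) ((i1.const_mul _).integrableOn) ?_).trans ?_
    · filter_upwards [ae_restrict_mem measurableSet_Ioc] with t ht
      refine (EEf_bd hC (by linarith) hx0 (hbd a t le_rfl hab (abs_le.2 ⟨ht.1.le, ht.2⟩)).2).trans ?_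
      exact mul_le_mul_of_nonneg_right (mul_le_mul_of_nonneg_left hxa (by positivity)) (by positivity)
    · refine (setIntegral_le_integral (i1.const_mul _) (Filter.Eventually.of_forall fun t => by positivity)).trans ?_
      rw [integral_const_mul]
  have horiz : ∀ u : ℝ, |u| = U → ‖∫ y : ℝ in a..b, f (y + u * I)‖ ≤ 120 * C * (x * Ex) := by
    intro u hu
    refine (intervalIntegral.norm_integral_le_of_norm_le_const (C := 120 * C * (x * Ex)) fun y hy => ?_).trans ?_
    · rw [uIoc_of_le hab] at hy
      refine (EEf_bd hC (by linarith [hy.1]) hx0 (hbd y u hy.1.le hy.2 hu.le).2).trans ?_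
      have h1 : x ^ y ≤ 3 * x := (Real.rpow_le_rpow_of_exponent_le (by linarith [Real.add_one_le_exp (10:ℝ)]) hy.2).trans hxb
      have h2 : (3 + |u|) ^ (-(11/10):ℝ) ≤ Ex := by
        rw [hu]
        exact (Real.rpow_le_rpow_of_nonpos (by linarith) (by linarith) (by norm_num)).trans hUd
      calc _ ≤ 40 * C * (3 * x) * Ex := mul_le_mul (mul_le_mul_of_nonneg_left h1 (by positivity)) h2 (by positivity) (by positivity)
        _ = _ := by ring
    · have : |b - a| ≤ 1 := by rw [abs_of_nonneg (by linarith)]; linarith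
      have h0 : 0 ≤ 120 * C * (x * Ex) := by positivity
      nlinarith
  have tail : ‖∫ t in (Ioc (-U) U)ᶜ, f (b + t * I)‖ ≤ 120 * C * (x * Ex) * W2 := by
    refine (norm_integral_le_of_norm_le (g := fun t => 120 * C * (x * Ex) * (3 + |t|) ^ (-(21/20):ℝ)) ((i2.const_mul _).integrableOn) ?_).trans ?_
    · filter_upwards [ae_restrict_mem measurableSet_Ioc.compl] with t ht
      refine (EEf_bd hC (by linarith) hx0 (hbd2 t)).trans ?_
      have hUt : U ≤ |t| := by
        by_contra hcon
        push Not at hcon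
        exact ht ⟨(abs_lt.1 hcon).1, (abs_lt.1 hcon).2.le⟩
      have h2 : (3 + |t|) ^ (-(11/10):ℝ) ≤ Ex * (3 + |t|) ^ (-(21/20):ℝ) := by
        rw [show (-(11/10):ℝ) = -(1/20) + -(21/20) by norm_num, Real.rpow_add (by positivity)]
        refine mul_le_mul_of_nonneg_right ?_ (by positivity)
        exact (Real.rpow_le_rpow_of_nonpos (by linarith) (by linarith) (by norm_num)).trans hUd2
      calc _ ≤ 40 * C * (3 * x) * (Ex * (3 + |t|) ^ (-(21/20):ℝ)) := mul_le_mul (mul_le_mul_of_nonneg_left hxb (by positivity)) h2 (by positivity) (by positivity)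
        _ = _ := by ring
    · refine (setIntegral_le_integral (i2.const_mul _) (Filter.Eventually.of_forall fun t => by positivity)).trans ?_
      rw [integral_const_mul]
  have split := integral_add_compl (measurableSet_Ioc (a := -U) (b := U)) p2
  rw [← intervalIntegral.integral_of_le (by linarith)] at split
  have mid : ‖∫ y : ℝ in (-U)..U, f (b + y * I)‖ ≤ 40 * C * (x * Ex) * W1 + 2 * (120 * C * (x * Ex)) := by
    have e : ‖∫ y : ℝ in (-U)..U, f (b + y * I)‖ = ‖I * ∫ y : ℝ in (-U)..U, f (b + y * I)‖ := by simp
    rw [e, hrect]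
    refine (norm_sub_le _ _).trans ?_
    have h1 := horiz U (abs_of_pos (by linarith))
    have h2 := horiz (-U) (by rw [abs_neg]; exact abs_of_pos (by linarith))
    have h3 := norm_add_le (I * ∫ y : ℝ in (-U)..U, f (a + y * I)) (∫ y : ℝ in a..b, f (y + U * I))
    rw [norm_mul, norm_I, one_mul] at h3
    linarith
  have hpi : ‖(1/(2*Real.pi):ℂ)‖ ≤ 1 := by
    rw [norm_div, norm_one, norm_mul, Complex.norm_real, Real.norm_of_nonneg Real.pi_pos.le, show ‖(2:ℂ)‖ = 2 by norm_num]
    have := Real.pi_gt_three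
    rw [div_le_one (by positivity)]
    linarith
  rw [p1, norm_mul]
  have hsum : ‖∫ t : ℝ, f (b + t * I)‖ ≤ 40 * C * (x * Ex) * W1 + 2 * (120 * C * (x * Ex)) + 120 * C * (x * Ex) * W2 := by
    have : ∫ t : ℝ, f (b + t * I) = (∫ y : ℝ in (-U)..U, f (b + y * I)) + ∫ t in (Ioc (-U) U)ᶜ, f (b + t * I) := split.symm
    rw [this]
    exact (norm_add_le _ _).trans (add_le_add mid tail)
  have hxE : 0 < x * Ex := by positivity
  calc _ ≤ 1 * (40 * C * (x * Ex) * W1 + 2 * (120 * C * (x * Ex)) + 120 * C * (x * Ex) * W2) := mul_le_mul hpi hsum (norm_nonneg _) (by norm_num)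
    _ ≤ _ := by nlinarith

end PE
end ZS

namespace ZS
section PF
open Complex Filter Topology Asymptotics Set Metric MeasureTheory

lemma PP_bd (n : ℕ) : ∃ B > 0, ∀ v : ℝ, 0 ≤ v → ‖PP n v‖ ≤ B * (1 + v) ^ (n + 1) := by
  refine ⟨‖(n.factorial / (n+1).factorial : ℂ)‖ + (∑ k ∈ Finset.range (n + 1), ‖(n.factorial * cz k / (n - k).factorial : ℂ)‖)
    + ‖(-1) ^ (n + 1) * iteratedDeriv n DD 1‖ + 1, by positivity, fun v hv => ?_⟩
  have hp : ∀ k : ℕ, k ≤ n + 1 → ‖(v:ℂ)‖ ^ k ≤ (1 + v) ^ (n + 1) := fun k hk => by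
    rw [Complex.norm_real, Real.norm_of_nonneg hv]
    exact (pow_le_pow_left₀ hv (by linarith) k).trans (pow_le_pow_right₀ (by linarith) hk)
  unfold PP
  refine (norm_add₃_le).trans ?_
  rw [add_mul, add_mul, add_mul, Finset.sum_mul]
  have h1 : ‖(n.factorial / (n+1).factorial : ℂ) * (v:ℂ) ^ (n + 1)‖ ≤ ‖(n.factorial / (n+1).factorial : ℂ)‖ * (1 + v) ^ (n + 1) := by
    rw [norm_mul, norm_pow]
    exact mul_le_mul_of_nonneg_left (hp _ le_rfl) (norm_nonneg _)
  have h2 : ‖∑ k ∈ Finset.range (n + 1), (n.factorial * cz k / (n - k).factorial : ℂ) * (v:ℂ) ^ (n - k)‖ ≤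
      ∑ k ∈ Finset.range (n + 1), ‖(n.factorial * cz k / (n - k).factorial : ℂ)‖ * (1 + v) ^ (n + 1) := by
    refine norm_sum_le_of_le _ fun k hk => ?_
    rw [norm_mul, norm_pow]
    exact mul_le_mul_of_nonneg_left (hp _ (by omega)) (norm_nonneg _)
  have h3 : ‖(-1) ^ (n + 1) * iteratedDeriv n DD 1‖ ≤ ‖(-1) ^ (n + 1) * iteratedDeriv n DD 1‖ * (1 + v) ^ (n + 1) :=
    le_mul_of_one_le_right (norm_nonneg _) (one_le_pow₀ (by linarith))
  have h4 : 0 ≤ (1:ℝ) * (1 + v) ^ (n + 1) := by positivity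
  linarith

/-- summatory function -/
noncomputable def SS (n : ℕ) (x : ℝ) : ℂ := ∑ m ∈ Finset.range ⌊x⌋₊, (qa n (m+1) : ℂ)

/-- main term of the summatory function -/
noncomputable def MM (n : ℕ) (x : ℝ) : ℂ := ∫ v : ℝ in (0:ℝ)..(Real.log x), PP n v * Real.exp v

lemma xDel (n : ℕ) {x y : ℝ} (hx : 1 ≤ x) (hxy : x ≤ y) : (x:ℂ) * Del n x =
    (∑ m ∈ Finset.range ⌊y⌋₊, (qa n (m+1) : ℂ) * ((max (x - (m+1)) 0 : ℝ) : ℂ)) -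
      ∫ v : ℝ in (0:ℝ)..(Real.log y), PP n v * Real.exp v * ((max (x - Real.exp v) 0 : ℝ) : ℂ) := by
  have hx0 : 0 < x := by linarith
  have hk : ∀ u : ℝ, 0 < u → (x:ℂ) * kf (u / x) = ((max (x - u) 0 : ℝ) : ℂ) := by
    intro u hu
    rw [kf_eq (by positivity), ← Complex.ofReal_mul, mul_max_of_nonneg _ _ hx0.le]
    congr 2
    · field_simp
    · simp
  unfold Del
  rw [mul_sub]
  congr 1
  · rw [tsum_eq_sum (s := Finset.range ⌊y⌋₊), Finset.mul_sum]
    · refine Finset.sum_congr rfl fun m hm => ?_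
      rw [mul_left_comm, hk _ (by positivity)]
      push_cast; ring
    · intro m hm
      have hm : ⌊y⌋₊ ≤ m := by simpa using hm
      have : y < m + 1 := (Nat.lt_floor_add_one y).trans_le (by exact_mod_cast Nat.succ_le_succ hm)
      rw [kf_eq (by positivity), max_eq_right]
      · simp
      · rw [sub_nonpos, le_div_iff₀ hx0]; push_cast; linarith
  · rw [intervalIntegral.integral_of_le (Real.log_nonneg (by linarith)), ← integral_const_mul]
    have : ∀ v : ℝ, (x:ℂ) * (PP n v * Real.exp v * kf (Real.exp v / x)) = PP n v * Real.exp v * ((max (x - Real.exp v) 0 : ℝ) : ℂ) := fun v => by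
      rw [mul_left_comm, hk _ (Real.exp_pos v)]
    simp only [this]
    refine setIntegral_eq_of_subset_of_forall_diff_eq_zero measurableSet_Ioi (fun v hv => hv.1) fun v hv => ?_
    have h0 : 0 < v := hv.1
    have h1 : Real.log y < v := by
      by_contra hc
      exact hv.2 ⟨h0, not_lt.1 hc⟩
    have h2 : y < Real.exp v := (Real.log_lt_iff_lt_exp (by linarith)).1 h1
    rw [max_eq_right (by linarith)]; simp

lemma unsmooth (n : ℕ) {B : ℝ} (hB0 : 0 < B) (hB : ∀ v : ℝ, 0 ≤ v → ‖PP n v‖ ≤ B * (1 + v) ^ (n + 1)) {x y : ℝ} (hx : 1 ≤ x) (hxy : x ≤ y) :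
    (y - x) * ‖SS n x - MM n x‖ ≤ ‖(y:ℂ) * Del n y‖ + ‖(x:ℂ) * Del n x‖ + (y - x) * (y - x + 1) * ((1 + B) * (1 + Real.log y) ^ (n+1)) := by
  have hx0 : 0 < x := by linarith
  have hly : 0 ≤ Real.log y := Real.log_nonneg (by linarith)
  have hlx : 0 ≤ Real.log x := Real.log_nonneg (by linarith)
  have hlxy : Real.log x ≤ Real.log y := Real.log_le_log hx0 hxy
  have e1 := xDel n hx hxy
  have e2 := xDel n (hx.trans hxy) (le_refl y)
  set g : ℝ → ℝ := fun u => max (y - u) 0 - max (x - u) 0 with hg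
  have hgc : Continuous g := by rw [hg]; fun_prop
  have g1 : ∀ u, u ≤ x → g u = y - x := fun u hu => by
    simp only [hg]; rw [max_eq_left (by linarith), max_eq_left (by linarith)]; ring
  have g2 : ∀ u, x ≤ u → u ≤ y → |g u| ≤ y - x := fun u h1 h2 => by
    simp only [hg]; rw [max_eq_left (by linarith), max_eq_right (by linarith), abs_of_nonneg (by linarith)]; linarith
  have cont : ∀ z : ℝ, Continuous fun v : ℝ => PP n v * Real.exp v * ((max (z - Real.exp v) 0 : ℝ) : ℂ) := fun z => by
    have := PP_cont n; fun_prop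
  have contg : Continuous fun v : ℝ => PP n v * Real.exp v * ((g (Real.exp v) : ℝ) : ℂ) := by
    have := PP_cont n; fun_prop
  have e3 : (y:ℂ) * Del n y - (x:ℂ) * Del n x = (∑ m ∈ Finset.range ⌊y⌋₊, (qa n (m+1) : ℂ) * ((g (m+1) : ℝ) : ℂ)) -
      ∫ v : ℝ in (0:ℝ)..(Real.log y), PP n v * Real.exp v * ((g (Real.exp v) : ℝ) : ℂ) := by
    have : (∫ v : ℝ in (0:ℝ)..(Real.log y), PP n v * Real.exp v * ((g (Real.exp v) : ℝ) : ℂ)) =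
       (∫ v : ℝ in (0:ℝ)..(Real.log y), PP n v * Real.exp v * ((max (y - Real.exp v) 0 : ℝ) : ℂ)) -
        ∫ v : ℝ in (0:ℝ)..(Real.log y), PP n v * Real.exp v * ((max (x - Real.exp v) 0 : ℝ) : ℂ) := by
      rw [← intervalIntegral.integral_sub ((cont y).intervalIntegrable _ _) ((cont x).intervalIntegrable _ _)]
      congr 1; funext v; simp only [hg]; push_cast; ring
    rw [e1, e2, this]
    have : (∑ m ∈ Finset.range ⌊y⌋₊, (qa n (m+1) : ℂ) * ((g (m+1) : ℝ) : ℂ)) = (∑ m ∈ Finset.range ⌊y⌋₊, (qa n (m+1) : ℂ) * ((max (y - (m+1)) 0 : ℝ) : ℂ)) -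
       ∑ m ∈ Finset.range ⌊y⌋₊, (qa n (m+1) : ℂ) * ((max (x - (m+1)) 0 : ℝ) : ℂ) := by
      rw [← Finset.sum_sub_distrib]
      refine Finset.sum_congr rfl fun m _ => ?_
      simp only [hg]; push_cast; ring
    rw [this]; ring
  have hfl : ⌊x⌋₊ ≤ ⌊y⌋₊ := Nat.floor_le_floor hxy
  have s1 : (∑ m ∈ Finset.range ⌊y⌋₊, (qa n (m+1) : ℂ) * ((g (m+1) : ℝ) : ℂ)) = ((y - x : ℝ) : ℂ) * SS n x + ∑ m ∈ Finset.Ico ⌊x⌋₊ ⌊y⌋₊, (qa n (m+1) : ℂ) * ((g (m+1) : ℝ) : ℂ) := by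
    rw [← Finset.sum_range_add_sum_Ico _ hfl, SS, Finset.mul_sum]
    congr 1
    refine Finset.sum_congr rfl fun m hm => ?_
    have : ((m + 1 : ℕ) : ℝ) ≤ x := (Nat.cast_le.2 (Nat.succ_le_of_lt (Finset.mem_range.1 hm))).trans (Nat.floor_le hx0.le)
    rw [g1 _ (by exact_mod_cast this)]; ring
  have s2 : (∫ v : ℝ in (0:ℝ)..(Real.log y), PP n v * Real.exp v * ((g (Real.exp v) : ℝ) : ℂ)) = ((y - x : ℝ) : ℂ) * MM n x + ∫ v : ℝ in (Real.log x)..(Real.log y), PP n v * Real.exp v * ((g (Real.exp v) : ℝ) : ℂ) := by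
    rw [← intervalIntegral.integral_add_adjacent_intervals (contg.intervalIntegrable 0 (Real.log x)) (contg.intervalIntegrable _ _), MM, ← intervalIntegral.integral_const_mul]
    congr 1
    refine intervalIntegral.integral_congr fun v hv => ?_
    rw [uIcc_of_le hlx] at hv
    have : Real.exp v ≤ x := (Real.le_log_iff_exp_le hx0).1 hv.2
    simp only [g1 _ this]; ring
  have s3 : ‖∑ m ∈ Finset.Ico ⌊x⌋₊ ⌊y⌋₊, (qa n (m+1) : ℂ) * ((g (m+1) : ℝ) : ℂ)‖ ≤ (y - x + 1) * ((1 + Real.log y) ^ (n+1) * (y - x)) := by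
    have : ∀ m ∈ Finset.Ico ⌊x⌋₊ ⌊y⌋₊, ‖(qa n (m+1) : ℂ) * ((g (m+1) : ℝ) : ℂ)‖ ≤ (1 + Real.log y) ^ (n+1) * (y - x) := by
      intro m hm
      obtain ⟨h1, h2⟩ := Finset.mem_Ico.1 hm
      have h3 : ((m + 1 : ℕ) : ℝ) ≤ y := (Nat.cast_le.2 (Nat.succ_le_of_lt h2)).trans (Nat.floor_le (by linarith))
      have h4 : x ≤ ((m + 1 : ℕ) : ℝ) := (Nat.lt_floor_add_one x).le.trans (by exact_mod_cast Nat.succ_le_succ h1)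
      rw [norm_mul, Complex.norm_real, Complex.norm_real, Real.norm_of_nonneg (qa_nonneg _ _)]
      refine mul_le_mul ?_ (by push_cast at h3 h4; exact g2 _ h4 h3) (norm_nonneg _) (by positivity)
      refine (qa_le n (m+1)).trans (pow_le_pow_left₀ (Real.log_nonneg (by push_cast; linarith [(Nat.cast_nonneg m : (0:ℝ) ≤ m)])) ?_ _)
      have := Real.log_le_log (by positivity) h3
      linarith
    refine (norm_sum_le_of_le _ this).trans ?_
    rw [Finset.sum_const, Nat.card_Ico, nsmul_eq_mul]
    refine mul_le_mul_of_nonneg_right ?_ (mul_nonneg (by positivity) (by linarith))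
    rw [Nat.cast_sub hfl]
    have := Nat.floor_le (by linarith : 0 ≤ y)
    have := Nat.lt_floor_add_one x
    linarith
  have s4 : ‖∫ v : ℝ in (Real.log x)..(Real.log y), PP n v * Real.exp v * ((g (Real.exp v) : ℝ) : ℂ)‖ ≤ (B * (1 + Real.log y) ^ (n+1) * (y - x)) * (y - x) := by
    refine (intervalIntegral.norm_integral_le_of_norm_le (g := fun v => B * (1 + Real.log y) ^ (n+1) * (y - x) * Real.exp v) hlxy (Filter.Eventually.of_forall fun v hv => ?_) (Continuous.intervalIntegrable (by fun_prop) _ _)).trans ?_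
    · have hv0 : 0 ≤ v := hlx.trans hv.1.le
      rw [norm_mul, norm_mul, Complex.norm_real, Complex.norm_real, Real.norm_of_nonneg (Real.exp_pos v).le]
      have h1 : ‖PP n v‖ ≤ B * (1 + Real.log y) ^ (n+1) := (hB v hv0).trans (mul_le_mul_of_nonneg_left (pow_le_pow_left₀ (by linarith) (by linarith [hv.2]) _) hB0.le)
      have h2 : ‖g (Real.exp v)‖ ≤ y - x := g2 _ ((Real.log_le_iff_le_exp hx0).1 hv.1.le) ((Real.le_log_iff_exp_le (by linarith)).1 hv.2)
      calc _ ≤ (B * (1 + Real.log y) ^ (n+1) * Real.exp v) * (y - x) := mul_le_mul (mul_le_mul_of_nonneg_right h1 (Real.exp_pos v).le) h2 (norm_nonneg _) (by positivity)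
        _ = _ := by ring
    · rw [intervalIntegral.integral_const_mul, integral_exp, Real.exp_log (by linarith), Real.exp_log hx0]
  have fin : ((y - x : ℝ) : ℂ) * (SS n x - MM n x) = (y:ℂ) * Del n y - (x:ℂ) * Del n x - (∑ m ∈ Finset.Ico ⌊x⌋₊ ⌊y⌋₊, (qa n (m+1) : ℂ) * ((g (m+1) : ℝ) : ℂ)) + ∫ v : ℝ in (Real.log x)..(Real.log y), PP n v * Real.exp v * ((g (Real.exp v) : ℝ) : ℂ) := by
    rw [e3, s1, s2]; ring
  have fin2 : (y - x) * ‖SS n x - MM n x‖ = ‖((y - x : ℝ) : ℂ) * (SS n x - MM n x)‖ := by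
    rw [norm_mul, Complex.norm_real, Real.norm_of_nonneg (by linarith)]
  rw [fin2, fin]
  refine (norm_add_le _ _).trans ?_
  have t1 := norm_sub_le ((y:ℂ) * Del n y - (x:ℂ) * Del n x) (∑ m ∈ Finset.Ico ⌊x⌋₊ ⌊y⌋₊, (qa n (m+1) : ℂ) * ((g (m+1) : ℝ) : ℂ))
  have t2 := norm_sub_le ((y:ℂ) * Del n y) ((x:ℂ) * Del n x)
  have hp : 0 ≤ B * (1 + Real.log y) ^ (n+1) * (y - x) := mul_nonneg (by positivity) (by linarith)
  nlinarith

lemma pow_le_exp (k : ℕ) {ε : ℝ} (hε : 0 < ε) : ∃ C > 0, ∀ r : ℝ, 1 ≤ r → r ^ k ≤ C * Real.exp (ε * r) := by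
  obtain ⟨C, hC, h⟩ := logpow_le k hε
  refine ⟨C, hC, fun r hr => ?_⟩
  have := h (Real.exp r) (Real.one_le_exp (by linarith))
  rwa [Real.log_exp, ← Real.exp_mul, mul_comm r] at this

lemma SS_asymp (n : ℕ) : ∃ c K : ℝ, 0 < c ∧ 0 < K ∧ ∀ x : ℝ, Real.exp 10 ≤ x →
    ‖SS n x - MM n x‖ ≤ K * x * Real.exp (-c * Real.sqrt (Real.log x)) := by
  obtain ⟨c, K, hc, hc2, hK, hD⟩ := Del_bd n
  obtain ⟨B, hB0, hB⟩ := PP_bd n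
  obtain ⟨C, hC, hpe⟩ := pow_le_exp (2 * (n+1)) (by linarith : 0 < c / 4)
  refine ⟨c/4, 5 * K + 2 * (1 + B) * (3 ^ (n+1) * C), by linarith, by positivity, fun x hx => ?_⟩
  have hx0 : 0 < x := (Real.exp_pos 10).trans_le hx
  have hx1 : 1 ≤ x := by linarith [Real.add_one_le_exp (10:ℝ)]
  set L := Real.log x with hL
  have hL10 : 10 ≤ L := by rw [hL, Real.le_log_iff_exp_le hx0]; exact hx
  set r := Real.sqrt L with hr
  have hr2 : r ^ 2 = L := Real.sq_sqrt (by linarith)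
  have hr1 : 1 ≤ r := by rw [hr, Real.one_le_sqrt]; linarith
  set h := x * Real.exp (-(c/2) * r) with hh
  have hh0 : 0 < h := by positivity
  have hhx : h ≤ x := by
    have : Real.exp (-(c/2) * r) ≤ 1 := Real.exp_le_one_iff.2 (by nlinarith)
    nlinarith
  have hh1 : 1 ≤ h := by
    rw [hh, ← Real.exp_log hx0, ← hL, ← Real.exp_add]
    exact Real.one_le_exp (by nlinarith)
  have main := unsmooth n hB0 hB (x := x) (y := x + h) hx1 (by linarith)
  rw [show x + h - x = h by ring] at main
  have d1 := hD x hx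
  have d2 := hD (x + h) (by linarith)
  have hxh : L ≤ Real.log (x + h) := Real.log_le_log hx0 (by linarith)
  have d3 : Real.exp (-c * Real.sqrt (Real.log (x + h))) ≤ Real.exp (-c * r) := by
    rw [Real.exp_le_exp]
    have := Real.sqrt_le_sqrt hxh
    nlinarith
  have hlog : (1 + Real.log (x + h)) ^ (n+1) ≤ 3 ^ (n+1) * C * Real.exp (c/4 * r) := by
    have : 1 + Real.log (x + h) ≤ 3 * r ^ 2 := by
      have h2 : Real.log (x + h) ≤ Real.log (2 * x) := Real.log_le_log (by linarith) (by linarith)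
      rw [Real.log_mul (by norm_num) hx0.ne'] at h2
      have := Real.log_two_lt_d9
      nlinarith
    calc _ ≤ (3 * r^2) ^ (n+1) := pow_le_pow_left₀ (by linarith) this _
      _ = 3 ^ (n+1) * r ^ (2 * (n+1)) := by rw [mul_pow, ← pow_mul]
      _ ≤ 3 ^ (n+1) * (C * Real.exp (c/4 * r)) := mul_le_mul_of_nonneg_left (hpe r hr1) (by positivity)
      _ = _ := by ring
  have b1 : ‖(x:ℂ) * Del n x‖ ≤ K * x ^ 2 * Real.exp (-c * r) := by
    rw [norm_mul, Complex.norm_real, Real.norm_of_nonneg hx0.le]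
    calc _ ≤ x * (K * x * Real.exp (-c * r)) := mul_le_mul_of_nonneg_left d1 hx0.le
      _ = _ := by ring
  have b2 : ‖((x+h:ℝ):ℂ) * Del n (x+h)‖ ≤ 4 * K * x ^ 2 * Real.exp (-c * r) := by
    rw [norm_mul, Complex.norm_real, Real.norm_of_nonneg (by linarith)]
    calc _ ≤ (2*x) * (K * (2*x) * Real.exp (-c * r)) := by
          refine mul_le_mul (by linarith) (d2.trans ?_) (norm_nonneg _) (by linarith)
          exact mul_le_mul (mul_le_mul_of_nonneg_left (by linarith) hK.le) d3 (Real.exp_pos _).le (by positivity)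
      _ = _ := by ring
  have hE : Real.exp (-c * r) = Real.exp (-(c/2) * r) * Real.exp (-(c/2) * r) := by rw [← Real.exp_add]; congr 1; ring
  have hE2 : Real.exp (-(c/2) * r) * Real.exp (c/4 * r) = Real.exp (-(c/4) * r) := by rw [← Real.exp_add]; congr 1; ring
  have hE3 : Real.exp (-(c/2) * r) ≤ Real.exp (-(c/4) * r) := by rw [Real.exp_le_exp]; nlinarith
  have m2 : h * ‖SS n x - MM n x‖ ≤ h * ((5 * K + 2 * (1 + B) * (3 ^ (n+1) * C)) * x * Real.exp (-(c/4) * r)) := by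
    have q1 : K * x ^ 2 * Real.exp (-c * r) = h * (K * x * Real.exp (-(c/2) * r)) := by rw [hE, hh]; ring
    have q2 : h * (h + 1) * ((1 + B) * (1 + Real.log (x + h)) ^ (n+1)) ≤ h * (2 * (1 + B) * (3 ^ (n+1) * C) * x * Real.exp (-(c/4) * r)) := by
      rw [mul_assoc]
      refine mul_le_mul_of_nonneg_left ?_ hh0.le
      calc (h + 1) * ((1 + B) * (1 + Real.log (x + h)) ^ (n+1)) ≤ (2 * h) * ((1 + B) * (3 ^ (n+1) * C * Real.exp (c/4 * r))) :=
            mul_le_mul (by linarith) (mul_le_mul_of_nonneg_left hlog (by positivity)) (mul_nonneg (by positivity) (pow_nonneg (by linarith) _)) (by positivity)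
        _ = 2 * (1 + B) * (3 ^ (n+1) * C) * x * (Real.exp (-(c/2) * r) * Real.exp (c/4 * r)) := by rw [hh]; ring
        _ = _ := by rw [hE2]
    have q3 : h * (K * x * Real.exp (-(c/2) * r)) ≤ h * (K * x * Real.exp (-(c/4) * r)) :=
      mul_le_mul_of_nonneg_left (mul_le_mul_of_nonneg_left hE3 (by positivity)) hh0.le
    nlinarith
  exact le_of_mul_le_mul_left m2 hh0

end PF
end ZS

namespace ZS
section PG
open Complex Filter Topology Asymptotics Set Metric MeasureTheory

lemma coef_punct {g : ℂ → ℂ} (hg : ContinuousAt g 1) {c : ℕ → ℂ}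
    (h : ∀ᶠ s in nhdsWithin (1 : ℂ) {(1 : ℂ)}ᶜ, HasSum (fun j : ℕ => c j * (s - 1) ^ j) (g s)) :
    HasFPowerSeriesAt g (FormalMultilinearSeries.ofScalars ℂ c) 1 := by
  have h1 : HasFPowerSeriesAt (Function.update g 1 (c 0)) (FormalMultilinearSeries.ofScalars ℂ c) 1 := by
    rw [hasFPowerSeriesAt_iff']
    rw [eventually_nhdsWithin_iff] at h
    filter_upwards [h] with z hz
    simp only [FormalMultilinearSeries.coeff_ofScalars, smul_eq_mul]
    by_cases hz1 : z = 1
    · subst hz1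
      rw [Function.update_self]
      have := hasSum_single (f := fun n : ℕ => ((1:ℂ) - 1) ^ n * c n) 0 (fun n hn => by simp [hn])
      simpa using this
    · rw [Function.update_of_ne hz1]
      simpa [mul_comm] using hz hz1
  have h2 : Function.update g 1 (c 0) = g := by
    have hc := h1.continuousAt
    have t1 : Tendsto (Function.update g 1 (c 0)) (𝓝[≠] 1) (𝓝 (c 0)) := by
      have := hc.tendsto.mono_left (nhdsWithin_le_nhds (s := {(1:ℂ)}ᶜ))
      rwa [Function.update_self] at this
    have t2 : Tendsto (Function.update g 1 (c 0)) (𝓝[≠] 1) (𝓝 (g 1)) := by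
      refine (hg.tendsto.mono_left (nhdsWithin_le_nhds (s := {(1:ℂ)}ᶜ))).congr' ?_
      filter_upwards [self_mem_nhdsWithin] with z hz
      rw [Function.update_of_ne hz]
    rw [tendsto_nhds_unique t1 t2, Function.update_eq_self]
  rwa [h2] at h1

lemma cz_eq {C : ℕ → ℂ} (hC : ∀ᶠ s in nhdsWithin (1 : ℂ) {(1 : ℂ)}ᶜ,
      HasSum (fun j : ℕ => C j * (s - 1) ^ j) (riemannZeta s - 1 / (s - 1))) (k : ℕ) : cz k = C k := by
  have h := coef_punct (g := riemannZeta₀) (c := C) differentiable_riemannZeta₀.continuous.continuousAt (by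
    filter_upwards [hC, self_mem_nhdsWithin] with s hs h1
    rw [riemannZeta_eq_inv_sub_add h1] at hs
    convert hs using 1
    simp)
  have h2 := h.has_fpower_series_iterate_dslope_fslope k
  have h3 := h2.coeff_zero (fun _ => 1)
  have h4 : (FormalMultilinearSeries.fslope^[k] (FormalMultilinearSeries.ofScalars ℂ C)).coeff 0 = C k := by
    rw [FormalMultilinearSeries.coeff_iterate_fslope, FormalMultilinearSeries.coeff_ofScalars, zero_add]
  rw [← h4]
  exact h3.symm

lemma DD_one_eq {A : ℕ → ℂ} (hA : ∀ᶠ s in nhdsWithin (1 : ℂ) {(1 : ℂ)}ᶜ,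
      HasSum (fun j : ℕ => A j * (s - 1) ^ j)
        (deriv riemannZeta s / riemannZeta s + 1 / (s - 1))) (n : ℕ) : iteratedDeriv n DD 1 = n.factorial * A n := by
  have h10 : riemannZeta₁ 1 ≠ 0 := by simp
  have han : AnalyticAt ℂ DD 1 := DD_analyticAt h10
  have hne : ∀ᶠ s in nhdsWithin (1 : ℂ) {(1 : ℂ)}ᶜ, riemannZeta₁ s ≠ 0 :=
    (differentiable_riemannZeta₁.continuous.continuousAt.eventually_ne h10).filter_mono nhdsWithin_le_nhds
  have h := coef_punct (g := DD) (c := A) han.continuousAt (by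
    filter_upwards [hA, self_mem_nhdsWithin, hne] with s hs h1 h2
    have h3 : riemannZeta s ≠ 0 := fun h0 => h2 (by rw [zeta1_eq s h1, h0, mul_zero])
    rw [logderiv_rel s h1 h3] at hs
    simpa [DD] using hs)
  have h2 := congrArg (fun p => FormalMultilinearSeries.coeff p n) (han.hasFPowerSeriesAt.eq_formalMultilinearSeries h)
  simp only [FormalMultilinearSeries.coeff_ofScalars] at h2
  have : (n.factorial : ℂ) ≠ 0 := by exact_mod_cast n.factorial_ne_zero
  rw [← h2]; field_simp

/-- main term divided by x -/
noncomputable def GG (C A : ℕ → ℂ) (n : ℕ) (v : ℝ) : ℂ :=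
  1 / ((n : ℂ) + 1) * (v:ℂ) ^ (n + 1) + (∑ k ∈ Finset.range (n + 1),
        (n.choose k : ℂ) * (-1 : ℂ) ^ k * (k.factorial : ℂ) *
          (-1 + ∑ j ∈ Finset.range (k + 1), (-1 : ℂ) ^ j * C j) * (v:ℂ) ^ (n - k)) + (-1 : ℂ) ^ (n + 1) * ((n.factorial : ℂ) * A n)

lemma GG_deriv (C A : ℕ → ℂ) (n : ℕ) (v : ℝ) : HasDerivAt (GG C A n)
    ((v:ℂ) ^ n + ∑ k ∈ Finset.range (n + 1),
        (n.choose k : ℂ) * (-1 : ℂ) ^ k * (k.factorial : ℂ) *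
          (-1 + ∑ j ∈ Finset.range (k + 1), (-1 : ℂ) ^ j * C j) * (((n - k : ℕ) : ℂ) * (v:ℂ) ^ (n - k - 1))) v := by
  have hp : ∀ k : ℕ, HasDerivAt (fun v : ℝ => (v:ℂ) ^ k) ((k:ℂ) * (v:ℂ) ^ (k - 1)) v := fun k => by
    have := (hasDerivAt_pow k (v:ℂ)).comp_ofReal
    exact this
  unfold GG
  have h1 := (hp (n+1)).const_mul (1 / ((n : ℂ) + 1))
  have h2 := HasDerivAt.fun_sum (u := Finset.range (n+1)) (A := fun k (v : ℝ) => (n.choose k : ℂ) * (-1 : ℂ) ^ k * (k.factorial : ℂ) *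
          (-1 + ∑ j ∈ Finset.range (k + 1), (-1 : ℂ) ^ j * C j) * (v:ℂ) ^ (n - k)) (x := v) (fun k _ => (hp (n-k)).const_mul _)
  refine ((h1.add h2).add_const ((-1 : ℂ) ^ (n + 1) * ((n.factorial : ℂ) * A n))).congr_deriv ?_
  congr 1
  have : ((n:ℂ) + 1) ≠ 0 := by exact_mod_cast n.succ_ne_zero
  push_cast
  field_simp

lemma GG_ode {C A : ℕ → ℂ} {n : ℕ} (hcz : ∀ k, cz k = C k) (hD : iteratedDeriv n DD 1 = n.factorial * A n) (v : ℝ) :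
    PP n v = GG C A n v + ((v:ℂ) ^ n + ∑ k ∈ Finset.range (n + 1),
        (n.choose k : ℂ) * (-1 : ℂ) ^ k * (k.factorial : ℂ) *
          (-1 + ∑ j ∈ Finset.range (k + 1), (-1 : ℂ) ^ j * C j) * (((n - k : ℕ) : ℂ) * (v:ℂ) ^ (n - k - 1))) := by
  unfold PP GG
  rw [hD]
  simp only [hcz]
  have f1 : (n.factorial / (n+1).factorial : ℂ) = 1 / ((n:ℂ)+1) := by
    have : (n.factorial : ℂ) ≠ 0 := by exact_mod_cast n.factorial_ne_zero
    have h2 : ((n:ℂ) + 1) ≠ 0 := by exact_mod_cast n.succ_ne_zero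
    rw [Nat.factorial_succ]; push_cast; field_simp
  rw [f1]
  have key : (∑ k ∈ Finset.range (n + 1), (n.factorial * C k / (n - k).factorial : ℂ) * (v:ℂ) ^ (n - k)) =
     (∑ k ∈ Finset.range (n + 1),
        (n.choose k : ℂ) * (-1 : ℂ) ^ k * (k.factorial : ℂ) *
          (-1 + ∑ j ∈ Finset.range (k + 1), (-1 : ℂ) ^ j * C j) * (v:ℂ) ^ (n - k)) + ((v:ℂ) ^ n + ∑ k ∈ Finset.range (n + 1),
        (n.choose k : ℂ) * (-1 : ℂ) ^ k * (k.factorial : ℂ) *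
          (-1 + ∑ j ∈ Finset.range (k + 1), (-1 : ℂ) ^ j * C j) * (((n - k : ℕ) : ℂ) * (v:ℂ) ^ (n - k - 1))) := by
    have hch : ∀ k, k ≤ n → (n.choose k : ℂ) * k.factorial = n.factorial / (n-k).factorial := fun k hk => by
      have h := Nat.choose_mul_factorial_mul_factorial hk
      have h3 : ((n-k).factorial : ℂ) ≠ 0 := by exact_mod_cast (n-k).factorial_ne_zero
      rw [eq_div_iff h3]; exact_mod_cast h
    rw [Finset.sum_range_succ' (fun k => (n.factorial * C k / (n - k).factorial : ℂ) * (v:ℂ) ^ (n - k)),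
      Finset.sum_range_succ' (fun k => (n.choose k : ℂ) * (-1 : ℂ) ^ k * (k.factorial : ℂ) *
          (-1 + ∑ j ∈ Finset.range (k + 1), (-1 : ℂ) ^ j * C j) * (v:ℂ) ^ (n - k)),
      Finset.sum_range_succ (fun k => (n.choose k : ℂ) * (-1 : ℂ) ^ k * (k.factorial : ℂ) *
          (-1 + ∑ j ∈ Finset.range (k + 1), (-1 : ℂ) ^ j * C j) * (((n - k : ℕ) : ℂ) * (v:ℂ) ^ (n - k - 1)))]
    have f0 : (n.factorial : ℂ) ≠ 0 := by exact_mod_cast n.factorial_ne_zero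
    have e1 : ∑ k ∈ Finset.range n, (n.factorial * C (k+1) / (n - (k+1)).factorial : ℂ) * (v:ℂ) ^ (n - (k+1)) =
       (∑ k ∈ Finset.range n, (n.choose (k+1) : ℂ) * (-1 : ℂ) ^ (k+1) * ((k+1).factorial : ℂ) *
          (-1 + ∑ j ∈ Finset.range (k + 1 + 1), (-1 : ℂ) ^ j * C j) * (v:ℂ) ^ (n - (k+1))) +
       ∑ k ∈ Finset.range n, (n.choose k : ℂ) * (-1 : ℂ) ^ k * (k.factorial : ℂ) *
          (-1 + ∑ j ∈ Finset.range (k + 1), (-1 : ℂ) ^ j * C j) * (((n - k : ℕ) : ℂ) * (v:ℂ) ^ (n - k - 1)) := by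
      rw [← Finset.sum_add_distrib]
      refine Finset.sum_congr rfl fun k hk => ?_
      have hk := Finset.mem_range.1 hk
      have a1 := hch (k+1) (by omega)
      have a2 := hch k (by omega)
      have a3 : (n - k) = (n - (k+1)) + 1 := by omega
      have a4 : ((n-k).factorial : ℂ) = ((n - k : ℕ) : ℂ) * ((n - (k+1)).factorial : ℂ) := by
        rw [a3, Nat.factorial_succ]; push_cast; ring
      have a5 : ((n - (k+1)).factorial : ℂ) ≠ 0 := by exact_mod_cast (n-(k+1)).factorial_ne_zero
      have a6 : ((n - k : ℕ) : ℂ) ≠ 0 := by exact_mod_cast (by omega : n - k ≠ 0)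
      have a7 : n - k - 1 = n - (k+1) := by omega
      rw [a7, Finset.sum_range_succ _ (k+1)]
      have a8 : ((-1:ℂ)) ^ (k+1) * (-1) ^ (k+1) = 1 := by rw [← mul_pow]; norm_num
      rw [a4] at a2
      have a9 : (n.choose k : ℂ) * k.factorial * ((n - k : ℕ) : ℂ) = n.factorial / (n - (k+1)).factorial := by
        rw [a2]; field_simp
      set S := ∑ j ∈ Finset.range (k + 1), (-1 : ℂ) ^ j * C j
      set V := (v:ℂ) ^ (n - (k+1))
      calc _ = (n.factorial / (n - (k+1)).factorial : ℂ) * C (k+1) * V := by ring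
        _ = (n.choose (k+1) * (k+1).factorial : ℂ) * ((-1)^(k+1) * (-1) ^ (k+1)) * C (k+1) * V := by rw [a8, a1]; ring
        _ = (n.choose (k+1) * (k+1).factorial : ℂ) * (-1)^(k+1) * (-1 + (S + (-1)^(k+1) * C (k+1))) * V + (n.choose (k+1) * (k+1).factorial : ℂ) * (-1) ^ k * (-1 + S) * V := by ring
        _ = _ := by rw [a1, ← a9, mul_comm ((n.choose k : ℂ) * k.factorial) _]; linear_combination (n.choose (k+1) * (k+1).factorial - (n.choose k * k.factorial * ((n - k : ℕ) : ℂ)) : ℂ) * 0 + (-1)^(k+1) * (-1 + (S + (-1)^(k+1) * C (k+1))) * V * (a9 - a1)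
    rw [e1]
    simp [f0]
    ring
  rw [key]; ring

lemma MM_eq {C A : ℕ → ℂ} {n : ℕ} (hcz : ∀ k, cz k = C k) (hD : iteratedDeriv n DD 1 = n.factorial * A n) {x : ℝ} (hx : 0 < x) :
    MM n x = x * GG C A n (Real.log x) - GG C A n 0 := by
  unfold MM
  rw [intervalIntegral.integral_eq_sub_of_hasDerivAt (f := fun v : ℝ => GG C A n v * ((Real.exp v : ℝ) : ℂ))]
  · rw [Real.exp_log hx]; simp; ring
  · intro v _
    refine ((GG_deriv C A n v).mul ((Real.hasDerivAt_exp v).ofReal_comp)).congr_deriv ?_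
    rw [GG_ode hcz hD v]; ring
  · refine Continuous.intervalIntegrable ?_ _ _
    have := PP_cont n; fun_prop

end PG
end ZS

namespace ZS
section PH
open Complex Filter Topology Asymptotics Set Metric MeasureTheory

lemma Gam_low {τ : ℝ} (hτ : 0 < τ) : ∃ G > 0, ∀ σ t : ℝ, 1/10 ≤ σ → σ ≤ 11/10 → τ ≤ t →
    ‖Complex.Gamma (σ + t * I)‖ ≤ G * t ^ (σ - 1/2) * Real.exp (-(Real.pi/2 * t)) := by
  obtain ⟨C, hC, h⟩ := Gamma_bd_gen 1
  set K := 21/10/τ + 1 with hK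
  have hK1 : 1 ≤ K := by have : 0 < 21/10/τ := by positivity
                         linarith
  refine ⟨C * K ^ 2, by positivity, fun σ t h1 h2 h3 => ?_⟩
  have ht : 0 < t := hτ.trans_le h3
  have hb := h (σ + t * I + 1) (by simp; linarith) (by simp; norm_num; linarith)
  have hs0 : (σ + t * I : ℂ) ≠ 0 := by
    intro h0; have := congrArg Complex.im h0; simp at this; linarith
  rw [Complex.Gamma_add_one _ hs0, norm_mul] at hb
  have e1 : (σ + t * I + 1 : ℂ).re = σ + 1 := by simp
  have e2 : (σ + t * I + 1 : ℂ).im = t := by simp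
  rw [e1, e2, abs_of_pos ht] at hb
  have hn : t ≤ ‖(σ + t * I : ℂ)‖ := by
    have := Complex.abs_im_le_norm (σ + t * I : ℂ)
    simp at this; exact (le_abs_self t).trans this
  have hn2 : ‖(σ + t * I + 1 : ℂ)‖ ≤ K * t := by
    have h5 : ‖(σ + t * I + 1 : ℂ)‖ ≤ (σ + 1) + t := by
      have := Complex.norm_le_abs_re_add_abs_im (σ + t * I + 1 : ℂ)
      rw [e1, e2, abs_of_pos ht, abs_of_pos (by linarith)] at this
      exact this
    have h6 : 21/10 ≤ 21/10/τ * t := by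
      rw [div_mul_eq_mul_div, le_div_iff₀ hτ]; nlinarith
    rw [hK]; nlinarith
  have hp : ‖(σ + t * I + 1 : ℂ)‖ ^ (σ + 1 - 1/2) ≤ K ^ 2 * (t ^ (σ - 1/2) * t) := by
    calc _ ≤ (K * t) ^ (σ + 1 - 1/2) := Real.rpow_le_rpow (norm_nonneg _) hn2 (by linarith)
      _ = K ^ (σ + 1 - 1/2) * t ^ (σ + 1 - 1/2) := Real.mul_rpow (by linarith) ht.le
      _ ≤ K ^ (2:ℝ) * t ^ (σ + 1 - 1/2) := mul_le_mul_of_nonneg_right (Real.rpow_le_rpow_of_exponent_le hK1 (by linarith)) (by positivity)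
      _ = _ := by
        rw [show σ + 1 - 1/2 = (σ - 1/2) + 1 by ring, Real.rpow_add ht, Real.rpow_one]
        norm_num
  have hfin : t * ‖Complex.Gamma (σ + t * I)‖ ≤ t * (C * K ^ 2 * t ^ (σ - 1/2) * Real.exp (-(Real.pi/2 * t))) := by
    calc _ ≤ ‖(σ + t * I : ℂ)‖ * ‖Complex.Gamma (σ + t * I)‖ := mul_le_mul_of_nonneg_right hn (norm_nonneg _)
      _ ≤ _ := hb
      _ ≤ C * (K ^ 2 * (t ^ (σ - 1/2) * t)) * Real.exp (-(Real.pi/2 * t)) :=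
        mul_le_mul_of_nonneg_right (mul_le_mul_of_nonneg_left hp hC.le) (Real.exp_pos _).le
      _ = _ := by ring
  exact le_of_mul_le_mul_left hfin ht

/-- the basic integrand -/
noncomputable def Ph (θ y : ℝ) (w : ℂ) : ℂ := Complex.Gamma w * cexp (-(θ * I) * w) * (y:ℂ) ^ (-w)

lemma Ph_norm {θ y σ t : ℝ} (hy : 0 < y) : ‖Ph θ y (σ + t * I)‖ = ‖Complex.Gamma (σ + t * I)‖ * Real.exp (θ * t) * y ^ (-σ) := by
  unfold Ph
  rw [norm_mul, norm_mul, Complex.norm_exp, Complex.norm_cpow_eq_rpow_re_of_pos hy]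
  congr 3
  · simp
  · simp

lemma Ph_differentiableAt {θ y : ℝ} (hy : 0 < y) {w : ℂ} (hw : 0 < w.re) : DifferentiableAt ℂ (Ph θ y) w := by
  unfold Ph
  refine DifferentiableAt.mul (DifferentiableAt.mul ?_ (by fun_prop)) ?_
  · refine Complex.differentiableAt_Gamma _ fun m h => ?_
    rw [h] at hw; simp at hw; linarith [(Nat.cast_nonneg m : (0:ℝ) ≤ m)]
  · exact DifferentiableAt.const_cpow (by fun_prop) (Or.inl (by exact_mod_cast hy.ne'))

lemma Ph_rec {θ y : ℝ} (hy : 0 < y) {w : ℂ} (hw : w ≠ 1) : (w - 1) * Ph θ y (w - 1) = cexp (θ * I) * y * Ph θ y w := by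
  unfold Ph
  have h := Complex.Gamma_add_one (w - 1) (sub_ne_zero.2 hw)
  rw [sub_add_cancel] at h
  rw [h, show -(θ * I) * (w - 1) = -(θ * I) * w + θ * I by ring, Complex.exp_add, show -(w - 1) = -w + 1 by ring,
    Complex.cpow_add _ _ (by exact_mod_cast hy.ne'), Complex.cpow_one]
  ring

/-- modified integrand -/
noncomputable def Ps (θ y : ℝ) (w : ℂ) : ℂ := Ph θ y w * ((w - 1) / (w - 1 - cexp (θ * I) * y))

lemma Ps_diff {θ y : ℝ} (hy : 0 < y) {w : ℂ} (h1 : w ≠ 1) (h2 : w ≠ 2) (h3 : w - 1 - cexp (θ * I) * y ≠ 0) (h4 : w - 2 - cexp (θ * I) * y ≠ 0) :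
    Ph θ y w = Ps θ y w - Ps θ y (w - 1) + Ph θ y w * ((cexp (θ * I) * y) ^ 2 / ((w - 1) * (w - 1 - cexp (θ * I) * y) * (w - 2 - cexp (θ * I) * y))) := by
  have hr := Ph_rec (θ := θ) hy h1
  unfold Ps
  set q := cexp (θ * I) * y
  have h1' : w - 1 ≠ 0 := sub_ne_zero.2 h1
  have e : Ph θ y (w - 1) = q * Ph θ y w / (w - 1) := by
    rw [← hr]; field_simp
  have h5 : w - 1 - 1 - q ≠ 0 := by rwa [show w - 1 - 1 - q = w - 2 - q by ring]
  rw [e, show w - 2 - q = w - 1 - 1 - q by ring]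
  field_simp
  ring

lemma q_re_im (θ y : ℝ) : (cexp (θ * I) * y).im = y * Real.sin θ ∧ ‖cexp (θ * I) * (y:ℂ)‖ = |y| := by
  constructor
  · rw [Complex.im_mul_ofReal, Complex.exp_ofReal_mul_I_im]; ring
  · rw [norm_mul, Complex.norm_exp_ofReal_mul_I, one_mul, Complex.norm_real, Real.norm_eq_abs]

lemma shift_bd {τ : ℝ} (hτ : 0 < τ) : ∃ G > 0, ∀ θ y a b : ℝ, 0 ≤ θ → θ ≤ Real.pi / 2 → 0 < y → τ ≤ a → a ≤ b →
    (∀ t ∈ Icc a b, t ≠ y * Real.sin θ) →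
    ‖∫ t : ℝ in a..b, Ph θ y ((11/10 : ℝ) + t * I)‖ ≤
      G * (a ^ (1/2:ℝ) * ((a/y) ^ (1/10:ℝ) + (a/y) ^ (11/10:ℝ)) * Real.exp (-((Real.pi/2 - θ) * a)) / |a - y * Real.sin θ|) +
      G * (b ^ (1/2:ℝ) * ((b/y) ^ (1/10:ℝ) + (b/y) ^ (11/10:ℝ)) * Real.exp (-((Real.pi/2 - θ) * b)) / |b - y * Real.sin θ|) +
      G * ∫ t : ℝ in a..b, y ^ (9/10:ℝ) * t ^ (-(2/5):ℝ) / (t - y * Real.sin θ) ^ 2 := by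
  obtain ⟨G, hG, hGam⟩ := Gam_low hτ
  set K := 1/τ + 1 with hK
  have hK1 : 1 ≤ K := by have : 0 < 1/τ := by positivity
                         linarith
  refine ⟨G * K, by positivity, fun θ y a b hθ0 hθ hy ha hab hne => ?_⟩
  have ha0 : 0 < a := hτ.trans_le ha
  set Y := y * Real.sin θ with hY
  set q := cexp (θ * I) * y with hq
  have hqim : q.im = Y := (q_re_im θ y).1
  have hqn : ‖q‖ = y := by rw [(q_re_im θ y).2, abs_of_pos hy]
  have hPh : ∀ σ t : ℝ, 1/10 ≤ σ → σ ≤ 11/10 → a ≤ t → ‖Ph θ y (σ + t * I)‖ ≤ G * t ^ (σ - 1/2) * y ^ (-σ) * Real.exp (-((Real.pi/2 - θ) * t)) := by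
    intro σ t h1 h2 h3
    rw [Ph_norm hy]
    calc _ ≤ (G * t ^ (σ - 1/2) * Real.exp (-(Real.pi/2 * t))) * Real.exp (θ * t) * y ^ (-σ) :=
          mul_le_mul_of_nonneg_right (mul_le_mul_of_nonneg_right (hGam σ t h1 h2 (ha.trans h3)) (Real.exp_pos _).le) (by positivity)
      _ = G * t ^ (σ - 1/2) * y ^ (-σ) * (Real.exp (-(Real.pi/2 * t)) * Real.exp (θ * t)) := by ring
      _ = _ := by rw [← Real.exp_add]; congr 2; ring
  have hden : ∀ (σ t k : ℝ), |t - Y| ≤ ‖(σ + t * I : ℂ) - k - q‖ := by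
    intro σ t k
    have := Complex.abs_im_le_norm ((σ + t * I : ℂ) - k - q)
    simpa [hqim] using this
  have hden0 : ∀ (σ t k : ℝ), t ∈ Icc a b → (σ + t * I : ℂ) - k - q ≠ 0 := by
    intro σ t k ht h0
    have h1 := hden σ t k
    rw [h0, norm_zero] at h1
    have : t - Y = 0 := abs_nonpos_iff.1 h1
    exact hne t ht (by linarith)
  have hnek : ∀ (σ t k : ℝ), t ∈ Icc a b → (σ + t * I : ℂ) ≠ k := by
    intro σ t k ht h0
    have := congrArg Complex.im h0
    simp at this
    linarith [ht.1]
  -- rectangle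
  have hrect := rect_eq (Ps θ y) (a := 1/10) (b := 11/10) (c := a) (d := b) (by norm_num) hab (fun s h1 h2 h3 h4 => by
    have e : s = (s.re + s.im * I : ℂ) := (Complex.re_add_im s).symm
    refine (Ph_differentiableAt hy (by linarith)).mul (DifferentiableAt.div (by fun_prop) (by fun_prop) ?_)
    have := hden0 s.re s.im 1 ⟨h3, h4⟩
    rw [← e] at this
    simpa using this)
  have hH : ∀ u ∈ Icc a b, ‖∫ x : ℝ in (1/10:ℝ)..(11/10:ℝ), Ps θ y (x + u * I)‖ ≤ G * K * (u ^ (1/2:ℝ) * ((u/y) ^ (1/10:ℝ) + (u/y) ^ (11/10:ℝ)) * Real.exp (-((Real.pi/2 - θ) * u)) / |u - Y|) := by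
    intro u hu
    have hu0 : 0 < u := ha0.trans_le hu.1
    have huY : 0 < |u - Y| := abs_pos.2 (sub_ne_zero.2 (hne u hu))
    refine (intervalIntegral.norm_integral_le_of_norm_le_const (C := G * K * (u ^ (1/2:ℝ) * ((u/y) ^ (1/10:ℝ) + (u/y) ^ (11/10:ℝ)) * Real.exp (-((Real.pi/2 - θ) * u)) / |u - Y|)) fun x hx => ?_).trans (by norm_num)
    rw [uIoc_of_le (by norm_num)] at hx
    unfold Ps
    rw [norm_mul, norm_div]
    have h1 := hPh x u hx.1.le hx.2 hu.1
    have h2 : ‖(x + u * I : ℂ) - 1‖ ≤ K * u := by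
      have h5 := Complex.norm_le_abs_re_add_abs_im ((x + u * I : ℂ) - 1)
      have e1 : ((x + u * I : ℂ) - 1).re = x - 1 := by simp
      have e2 : ((x + u * I : ℂ) - 1).im = u := by simp
      rw [e1, e2, abs_of_pos hu0] at h5
      have h6 : |x - 1| ≤ 1 := abs_le.2 ⟨by linarith [hx.1], by linarith [hx.2]⟩
      have h7 : 1 ≤ 1/τ * u := by
        rw [div_mul_eq_mul_div, le_div_iff₀ hτ]; linarith [hu.1]
      rw [hK]; nlinarith
    have h3 := hden x u 1
    rw [Complex.ofReal_one] at h3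
    have h4 : ‖(x + u * I : ℂ) - 1‖ / ‖(x + u * I : ℂ) - 1 - q‖ ≤ K * u / |u - Y| :=
      div_le_div₀ (by positivity) h2 huY h3
    have h5 : u ^ (x - 1/2) * y ^ (-x) * u = u ^ (1/2:ℝ) * (u / y) ^ x := by
      rw [Real.div_rpow hu0.le hy.le, Real.rpow_neg hy.le, show u ^ (x - 1/2) * (y ^ x)⁻¹ * u = (u ^ (x - 1/2) * u ^ (1:ℝ)) * (y ^ x)⁻¹ by rw [Real.rpow_one]; ring,
        ← Real.rpow_add hu0, show x - 1/2 + 1 = 1/2 + x by ring, Real.rpow_add hu0]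
      ring
    have h6 : (u / y) ^ x ≤ (u/y) ^ (1/10:ℝ) + (u/y) ^ (11/10:ℝ) := by
      have p1 : 0 ≤ (u/y) ^ (1/10:ℝ) := by positivity
      have p2 : 0 ≤ (u/y) ^ (11/10:ℝ) := by positivity
      rcases le_total 1 (u/y) with h | h
      · have := Real.rpow_le_rpow_of_exponent_le h hx.2
        linarith
      · have := Real.rpow_le_rpow_of_exponent_ge (by positivity) h hx.1.le
        linarith
    calc _ ≤ (G * u ^ (x - 1/2) * y ^ (-x) * Real.exp (-((Real.pi/2 - θ) * u))) * (K * u / |u - Y|) := mul_le_mul h1 h4 (by positivity) (by positivity)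
      _ = G * K * ((u ^ (x - 1/2) * y ^ (-x) * u) * Real.exp (-((Real.pi/2 - θ) * u)) / |u - Y|) := by ring
      _ ≤ _ := by
        rw [h5]
        refine mul_le_mul_of_nonneg_left (div_le_div_of_nonneg_right (mul_le_mul_of_nonneg_right (mul_le_mul_of_nonneg_left h6 (by positivity)) (Real.exp_pos _).le) huY.le) (by positivity)
  -- decomposition
  set er : ℝ → ℂ := fun t => Ph θ y ((11/10:ℝ) + t * I) * (q ^ 2 / ((((11/10:ℝ) + t * I : ℂ) - 1) * (((11/10:ℝ) + t * I : ℂ) - 1 - q) * (((11/10:ℝ) + t * I : ℂ) - 2 - q))) with her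
  have contP : ∀ σ : ℝ, 0 < σ → Continuous fun t : ℝ => Ph θ y (σ + t * I) := by
    intro σ hσ
    rw [continuous_iff_continuousAt]
    intro t
    exact ContinuousAt.comp (f := fun t : ℝ => (σ + t * I : ℂ)) (g := Ph θ y) (Ph_differentiableAt hy (by simpa using hσ)).continuousAt (by fun_prop)
  have contS : ∀ σ : ℝ, 0 < σ → ContinuousOn (fun t : ℝ => Ps θ y (σ + t * I)) (uIcc a b) := by
    intro σ hσ
    unfold Ps
    refine (contP σ hσ).continuousOn.mul (ContinuousOn.div (by fun_prop) (by fun_prop) fun t ht => ?_)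
    rw [uIcc_of_le hab] at ht
    simpa using hden0 σ t 1 ht
  have conte : ContinuousOn er (uIcc a b) := by
    refine (contP (11/10) (by norm_num)).continuousOn.mul (ContinuousOn.div (by fun_prop) (by fun_prop) fun t ht => ?_)
    rw [uIcc_of_le hab] at ht
    refine mul_ne_zero (mul_ne_zero ?_ ?_) ?_
    · exact sub_ne_zero.2 (by simpa using hnek (11/10) t 1 ht)
    · simpa using hden0 (11/10) t 1 ht
    · simpa using hden0 (11/10) t 2 ht
  have hdec : ∫ t : ℝ in a..b, Ph θ y ((11/10 : ℝ) + t * I) = (∫ t : ℝ in a..b, Ps θ y ((11/10 : ℝ) + t * I)) - (∫ t : ℝ in a..b, Ps θ y ((1/10 : ℝ) + t * I)) + ∫ t : ℝ in a..b, er t := by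
    rw [← intervalIntegral.integral_sub (contS _ (by norm_num)).intervalIntegrable (contS _ (by norm_num)).intervalIntegrable,
      ← intervalIntegral.integral_add (f := fun t : ℝ => Ps θ y (((11/10 : ℝ) : ℂ) + t * I) - Ps θ y (((1/10 : ℝ) : ℂ) + t * I)) (((contS (11/10) (by norm_num)).sub (contS (1/10) (by norm_num))).intervalIntegrable) conte.intervalIntegrable]
    refine intervalIntegral.integral_congr fun t ht => ?_
    rw [uIcc_of_le hab] at ht
    have := Ps_diff (θ := θ) hy (w := (11/10:ℝ) + t * I) (by simpa using hnek (11/10) t 1 ht) (by simpa using hnek (11/10) t 2 ht) (by simpa using hden0 (11/10) t 1 ht) (by simpa using hden0 (11/10) t 2 ht)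
    have e : (((11/10:ℝ) : ℂ) + t * I) - 1 = ((1/10:ℝ) : ℂ) + t * I := by push_cast; ring
    rw [e] at this
    simp only [her]
    rw [e]
    exact this
  have herr : ‖∫ t : ℝ in a..b, er t‖ ≤ G * K * ∫ t : ℝ in a..b, y ^ (9/10:ℝ) * t ^ (-(2/5):ℝ) / (t - Y) ^ 2 := by
    rw [← intervalIntegral.integral_const_mul]
    refine intervalIntegral.norm_integral_le_of_norm_le hab (Filter.Eventually.of_forall fun t ht => ?_) ?_
    · have ht' : t ∈ Icc a b := ⟨ht.1.le, ht.2⟩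
      have ht0 : 0 < t := ha0.trans ht.1
      have htY : 0 < |t - Y| := abs_pos.2 (sub_ne_zero.2 (hne t ht'))
      simp only [her]
      rw [norm_mul, norm_div, norm_mul, norm_mul, norm_pow, hqn]
      have h1 := hPh (11/10) t (by norm_num) le_rfl ht.1.le
      have h1' : Real.exp (-((Real.pi/2 - θ) * t)) ≤ 1 := Real.exp_le_one_iff.2 (by nlinarith)
      have h2 : t ≤ ‖((11/10:ℝ) + t * I : ℂ) - 1‖ := by
        have := Complex.abs_im_le_norm (((11/10:ℝ) + t * I : ℂ) - 1)
        have e2 : (((11/10:ℝ) + t * I : ℂ) - 1).im = t := by simp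
        rw [e2] at this
        exact (le_abs_self t).trans this
      have h3 := hden (11/10) t 1
      have h4 := hden (11/10) t 2
      rw [Complex.ofReal_one] at h3
      rw [Complex.ofReal_ofNat] at h4
      have h5 : y ^ 2 / (‖((11/10:ℝ) + t * I : ℂ) - 1‖ * ‖((11/10:ℝ) + t * I : ℂ) - 1 - q‖ * ‖((11/10:ℝ) + t * I : ℂ) - 2 - q‖) ≤ y ^ 2 / (t * (t - Y) ^ 2) := by
        refine div_le_div_of_nonneg_left (by positivity) ?_ ?_
        · rw [← sq_abs (t - Y)]; positivity
        · rw [← sq_abs (t - Y), sq, ← mul_assoc]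
          exact mul_le_mul (mul_le_mul h2 h3 htY.le (norm_nonneg _)) h4 htY.le (by positivity)
      have h6 : t ^ ((11/10:ℝ) - 1/2) / t = t ^ (-(2/5):ℝ) := by
        rw [← Real.rpow_sub_one ht0.ne']; norm_num
      have h7 : y ^ (-(11/10):ℝ) * y ^ 2 = y ^ (9/10:ℝ) := by
        rw [← Real.rpow_natCast y 2, ← Real.rpow_add hy]; norm_num
      calc _ ≤ (G * t ^ ((11/10:ℝ) - 1/2) * y ^ (-(11/10):ℝ) * 1) * (y ^ 2 / (t * (t - Y) ^ 2)) :=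
            mul_le_mul (h1.trans (mul_le_mul_of_nonneg_left h1' (by positivity))) h5 (by positivity) (by positivity)
        _ = G * ((y ^ (-(11/10):ℝ) * y ^ 2) * (t ^ ((11/10:ℝ) - 1/2) / t) / (t - Y)^2) := by
            field_simp
        _ = G * (y ^ (9/10:ℝ) * t ^ (-(2/5):ℝ) / (t - Y) ^ 2) := by rw [h6, h7]
        _ ≤ _ := mul_le_mul_of_nonneg_right (le_mul_of_one_le_right hG.le hK1) (by positivity)
    · refine ContinuousOn.intervalIntegrable ?_
      rw [uIcc_of_le hab]
      have c1 : ContinuousOn (fun t : ℝ => (t - Y) ^ 2) (Icc a b) := by fun_prop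
      refine ContinuousOn.mul continuousOn_const (ContinuousOn.div (ContinuousOn.mul continuousOn_const (fun t ht => ?_)) c1 fun t ht => ?_)
      · exact (Real.continuousAt_rpow_const _ _ (Or.inl (ha0.trans_le ht.1).ne')).continuousWithinAt
      · exact pow_ne_zero _ (sub_ne_zero.2 (hne t ht))
  have hb1 := hH a ⟨le_rfl, hab⟩
  have hb2 := hH b ⟨hab, le_rfl⟩
  have hmain : ‖(∫ t : ℝ in a..b, Ps θ y ((11/10 : ℝ) + t * I)) - (∫ t : ℝ in a..b, Ps θ y ((1/10 : ℝ) + t * I))‖ ≤ ‖∫ x : ℝ in (1/10:ℝ)..(11/10:ℝ), Ps θ y (x + a * I)‖ + ‖∫ x : ℝ in (1/10:ℝ)..(11/10:ℝ), Ps θ y (x + b * I)‖ := by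
    have e : ‖(∫ t : ℝ in a..b, Ps θ y ((11/10 : ℝ) + t * I)) - (∫ t : ℝ in a..b, Ps θ y ((1/10 : ℝ) + t * I))‖ = ‖I * ((∫ t : ℝ in a..b, Ps θ y ((11/10 : ℝ) + t * I)) - (∫ t : ℝ in a..b, Ps θ y ((1/10 : ℝ) + t * I)))‖ := by
      rw [norm_mul, norm_I, one_mul]
    rw [e, mul_sub, hrect]
    set X1 := ∫ x : ℝ in (1/10:ℝ)..(11/10:ℝ), Ps θ y (x + a * I)
    set X2 := ∫ x : ℝ in (1/10:ℝ)..(11/10:ℝ), Ps θ y (x + b * I)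
    set X3 := I * ∫ t : ℝ in a..b, Ps θ y ((1/10 : ℝ) + t * I)
    rw [show X3 + X2 - X1 - X3 = X2 - X1 by ring]
    linarith [norm_sub_le X2 X1]
  rw [hdec]
  refine (norm_add_le _ _).trans ?_
  linarith

end PH
end ZS

namespace ZS
section PI1
open Complex Filter Topology Asymptotics Set Metric MeasureTheory

lemma Gam_e {ε : ℝ} (hε : 0 < ε) : ∃ C > 0, ∀ t : ℝ,
    ‖Complex.Gamma ((11/10:ℝ) + t * I)‖ * Real.exp ((Real.pi/2 - ε) * |t|) ≤ C * (3 + |t|) ^ (-2:ℝ) := by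
  obtain ⟨C, hC, h⟩ := Gamma_bd_gen 0
  obtain ⟨K, hK, hk⟩ := pow_le_exp 3 hε
  refine ⟨C * (K * Real.exp (ε * 3)), by positivity, fun t => ?_⟩
  have hb := h ((11/10:ℝ) + t * I) (by simp; norm_num) (by simp; norm_num)
  have e1 : (((11/10:ℝ):ℂ) + t * I).re = 11/10 := by simp
  have e2 : (((11/10:ℝ):ℂ) + t * I).im = t := by simp
  rw [e1, e2] at hb
  have hr : 1 ≤ 3 + |t| := by linarith [abs_nonneg t]
  have hn : ‖((11/10:ℝ):ℂ) + t * I‖ ^ ((11/10:ℝ) - 1/2) ≤ 3 + |t| := by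
    have h5 := Complex.norm_le_abs_re_add_abs_im (((11/10:ℝ):ℂ) + t * I)
    rw [e1, e2, abs_of_pos (by norm_num : (0:ℝ) < 11/10)] at h5
    calc _ ≤ (3 + |t|) ^ ((11/10:ℝ) - 1/2) := Real.rpow_le_rpow (norm_nonneg _) (by linarith) (by norm_num)
      _ ≤ (3 + |t|) ^ (1:ℝ) := Real.rpow_le_rpow_of_exponent_le hr (by norm_num)
      _ = _ := Real.rpow_one _
  have h3 := hk (3 + |t|) hr
  have e3 : (3 + |t|) ^ (-2:ℝ) = (3 + |t|) / (3 + |t|) ^ 3 := by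
    rw [Real.rpow_neg (by linarith)]
    have : 3 + |t| ≠ 0 := by linarith
    rw [show (2:ℝ) = ((2:ℕ):ℝ) by norm_num, Real.rpow_natCast]
    field_simp
  have h4 : Real.exp (-(ε * |t|)) ≤ K * Real.exp (ε * 3) / (3 + |t|) ^ 3 := by
    rw [le_div_iff₀ (by positivity)]
    calc _ ≤ Real.exp (-(ε * |t|)) * (K * Real.exp (ε * (3 + |t|))) := mul_le_mul_of_nonneg_left h3 (Real.exp_pos _).le
      _ = K * (Real.exp (-(ε * |t|)) * Real.exp (ε * (3 + |t|))) := by ring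
      _ = _ := by rw [← Real.exp_add]; congr 2; ring
  calc _ ≤ (C * (3 + |t|) * Real.exp (-(Real.pi/2 * |t|))) * Real.exp ((Real.pi/2 - ε) * |t|) :=
        mul_le_mul_of_nonneg_right (hb.trans (mul_le_mul_of_nonneg_right (mul_le_mul_of_nonneg_left hn hC.le) (Real.exp_pos _).le)) (Real.exp_pos _).le
    _ = C * (3 + |t|) * (Real.exp (-(Real.pi/2 * |t|)) * Real.exp ((Real.pi/2 - ε) * |t|)) := by ring
    _ = C * (3 + |t|) * Real.exp (-(ε * |t|)) := by rw [← Real.exp_add]; congr 2; ring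
    _ ≤ C * (3 + |t|) * (K * Real.exp (ε * 3) / (3 + |t|) ^ 3) := mul_le_mul_of_nonneg_left h4 (by positivity)
    _ = _ := by rw [e3]; ring

lemma Ph_cont {θ y : ℝ} (hy : 0 < y) : Continuous fun t : ℝ => Ph θ y ((11/10:ℝ) + t * I) := by
  rw [continuous_iff_continuousAt]
  intro t
  exact ContinuousAt.comp (f := fun t : ℝ => (((11/10:ℝ):ℂ) + t * I)) (g := Ph θ y) (Ph_differentiableAt hy (by simp)).continuousAt (by fun_prop)

lemma Gam_vcont : Continuous fun t : ℝ => Complex.Gamma ((11/10:ℝ) + t * I) := by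
  have := Ph_cont (θ := 0) (y := 1) one_pos
  simpa [Ph] using this

lemma Gam_vint : Integrable fun t : ℝ => ‖Complex.Gamma ((11/10:ℝ) + t * I)‖ := by
  obtain ⟨C, hC, h⟩ := Gam_e (ε := Real.pi/2) (by positivity)
  refine ((integrable_three_add (r := 2) (by norm_num)).const_mul C).mono' Gam_vcont.norm.aestronglyMeasurable (Eventually.of_forall fun t => ?_)
  have := h t
  simp only [sub_self, zero_mul, Real.exp_zero, mul_one] at this
  rwa [norm_norm]

lemma Ph_vint {θ y : ℝ} (hy : 0 < y) (hθ : |θ| < Real.pi/2) : Integrable fun t : ℝ => Ph θ y ((11/10:ℝ) + t * I) := by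
  obtain ⟨C, hC, h⟩ := Gam_e (ε := Real.pi/2 - |θ|) (by linarith)
  refine ((integrable_three_add (r := 2) (by norm_num)).const_mul (C * y ^ (-(11/10):ℝ))).mono' (Ph_cont hy).aestronglyMeasurable (Eventually.of_forall fun t => ?_)
  rw [Ph_norm hy]
  have h1 := h t
  rw [sub_sub_cancel] at h1
  have h2 : Real.exp (θ * t) ≤ Real.exp (|θ| * |t|) := Real.exp_le_exp.2 (by rw [← abs_mul]; exact le_abs_self _)
  calc _ ≤ (C * (3 + |t|) ^ (-2:ℝ)) * y ^ (-(11/10):ℝ) :=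
        mul_le_mul_of_nonneg_right ((mul_le_mul_of_nonneg_left h2 (norm_nonneg _)).trans h1) (by positivity)
    _ = _ := by ring

lemma expI_cpow {θ : ℝ} (hθ : |θ| < Real.pi/2) (w : ℂ) : (cexp (θ * I)) ^ (-w) = cexp (-(θ * I) * w) := by
  rw [Complex.cpow_def_of_ne_zero (Complex.exp_ne_zero _), Complex.log_exp]
  · ring_nf
  · have := (abs_lt.1 hθ).1
    simp; linarith [Real.pi_pos]
  · have := (abs_lt.1 hθ).2
    simp; linarith [Real.pi_pos]

lemma Ph_full {θ y : ℝ} (hy : 0 < y) (hθ : |θ| < Real.pi/2) :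
    ∫ t : ℝ, Ph θ y ((11/10:ℝ) + t * I) = 2 * Real.pi * cexp (-(cexp (θ * I) * y)) := by
  set z := cexp (θ * I) with hz
  have hzre : 0 < z.re := by
    rw [hz, Complex.exp_ofReal_mul_I_re]
    exact Real.cos_pos_of_mem_Ioo ⟨(abs_lt.1 hθ).1, (abs_lt.1 hθ).2⟩
  set f : ℝ → ℂ := fun v => cexp (-(z * v)) with hf
  have hm : ∀ t : ℝ, mellin f ((11/10:ℝ) + t * I) = z ^ (-((11/10:ℝ) + t * I : ℂ)) * Complex.Gamma ((11/10:ℝ) + t * I) := by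
    intro t
    unfold mellin
    simp only [smul_eq_mul, hf]
    exact gam_cpow (by simp) hzre
  have hc : MellinConvergent f ((11/10:ℝ):ℂ) := by
    unfold MellinConvergent
    simp only [smul_eq_mul, hf]
    exact gam_cpow_integrable (by simp) hzre
  have hP : ∀ t : ℝ, Ph θ y ((11/10:ℝ) + t * I) = (y:ℂ) ^ (-((11/10:ℝ) + t * I : ℂ)) * mellin f ((11/10:ℝ) + t * I) := by
    intro t
    rw [hm, hz, expI_cpow hθ, Ph]; ring
  have hv : Complex.VerticalIntegrable (mellin f) (11/10) := by
    unfold Complex.VerticalIntegrable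
    have := Ph_vint (θ := θ) one_pos hθ
    refine this.congr (Eventually.of_forall fun t => ?_)
    simp only
    rw [hm, hz, expI_cpow hθ, Ph, Complex.ofReal_one, Complex.one_cpow]; ring
  have h := mellinInv_mellin_eq (11/10) f hy hc hv (by simp only [hf]; fun_prop)
  rw [mellinInv] at h
  simp only [smul_eq_mul, ← hP] at h
  rw [← Complex.coe_smul, smul_eq_mul] at h
  have hpi : (Real.pi : ℂ) ≠ 0 := by exact_mod_cast Real.pi_ne_zero
  simp only [hf] at h
  rw [← h]
  generalize (∫ t : ℝ, Ph θ y ((11/10:ℝ) + t * I)) = W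
  push_cast
  field_simp

lemma rpow_int {τ T : ℝ} (hτ : 0 < τ) (hT : τ ≤ T) : ∫ t in τ..T, t ^ (-(2/5):ℝ) ≤ 5/3 * T ^ (3/5:ℝ) := by
  rw [integral_rpow (Or.inl (by norm_num))]
  have : 0 ≤ τ ^ (3/5:ℝ) := by positivity
  norm_num
  linarith

lemma inv_sq_int {a b y : ℝ} (hab : a ≤ b) (h : ∀ t ∈ Icc a b, t ≠ y) : ∫ t in a..b, 1 / (t - y) ^ 2 = 1/(a - y) - 1/(b - y) := by
  rw [intervalIntegral.integral_eq_sub_of_hasDerivAt (f := fun t => -(1/(t - y)))]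
  · ring
  · intro t ht
    rw [uIcc_of_le hab] at ht
    have h0 : t - y ≠ 0 := sub_ne_zero.2 (h t ht)
    have h1 : HasDerivAt (fun t : ℝ => t - y) 1 t := (hasDerivAt_id t).sub_const y
    have h2 := (h1.fun_inv h0).fun_neg
    simp only [one_div]
    convert h2 using 1
    rw [neg_div, neg_neg, one_div]
  · refine ContinuousOn.intervalIntegrable ?_
    rw [uIcc_of_le hab]
    have c1 : ContinuousOn (fun t : ℝ => (t - y) ^ 2) (Icc a b) := by fun_prop
    exact continuousOn_const.div c1 fun t ht => pow_ne_zero _ (sub_ne_zero.2 (h t ht))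

/-- (A) trivial bound -/
lemma Ph_triv {τ : ℝ} (hτ : 0 < τ) : ∃ C > 0, ∀ y T : ℝ, 0 < y → τ ≤ T →
    ‖∫ t : ℝ in τ..T, Ph (Real.pi/2) y ((11/10:ℝ) + t * I)‖ ≤ C * T ^ (8/5:ℝ) * y ^ (-(11/10):ℝ) := by
  obtain ⟨G, hG, h⟩ := Gam_low hτ
  refine ⟨G, hG, fun y T hy hT => ?_⟩
  have hT0 : 0 < T := hτ.trans_le hT
  refine (intervalIntegral.norm_integral_le_of_norm_le_const (C := G * T ^ (3/5:ℝ) * y ^ (-(11/10):ℝ)) fun t ht => ?_).trans ?_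
  · rw [uIoc_of_le hT] at ht
    have ht0 : 0 < t := hτ.trans ht.1
    rw [Ph_norm hy]
    refine mul_le_mul_of_nonneg_right ?_ (by positivity)
    have h1 := h (11/10) t (by norm_num) le_rfl ht.1.le
    calc _ ≤ (G * t ^ ((11/10:ℝ) - 1/2) * Real.exp (-(Real.pi/2*t))) * Real.exp (Real.pi/2*t) := mul_le_mul_of_nonneg_right h1 (Real.exp_pos _).le
      _ = G * t ^ (3/5:ℝ) * (Real.exp (-(Real.pi/2*t)) * Real.exp (Real.pi/2*t)) := by norm_num; ring
      _ = G * t ^ (3/5:ℝ) := by rw [← Real.exp_add]; simp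
      _ ≤ _ := mul_le_mul_of_nonneg_left (Real.rpow_le_rpow ht0.le ht.2 (by norm_num)) hG.le
  · rw [abs_of_nonneg (by linarith)]
    have e : T ^ (8/5:ℝ) = T ^ (3/5:ℝ) * T := by
      rw [← Real.rpow_add_one hT0.ne']; norm_num
    rw [e]
    have : G * T ^ (3/5:ℝ) * y ^ (-(11/10):ℝ) * (T - τ) ≤ G * T ^ (3/5:ℝ) * y ^ (-(11/10):ℝ) * T :=
      mul_le_mul_of_nonneg_left (by linarith) (by positivity)
    linarith

/-- (A') the other half -/
lemma Ph_other : ∃ C > 0, ∀ τ y T : ℝ, 0 < τ → 0 < y → τ ≤ T →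
    ‖∫ t : ℝ in τ..T, Ph (-(Real.pi/2)) y ((11/10:ℝ) + t * I)‖ ≤ C * y ^ (-(11/10):ℝ) := by
  have hn : 0 ≤ ∫ t : ℝ, ‖Complex.Gamma ((11/10:ℝ) + t * I)‖ := integral_nonneg fun t => norm_nonneg _
  refine ⟨(∫ t : ℝ, ‖Complex.Gamma ((11/10:ℝ) + t * I)‖) + 1, by linarith, fun τ y T hτ hy hT => ?_⟩
  have hb : ‖∫ t : ℝ in τ..T, Ph (-(Real.pi/2)) y ((11/10:ℝ) + t * I)‖ ≤ ∫ t : ℝ in τ..T, ‖Complex.Gamma ((11/10:ℝ) + t * I)‖ * y ^ (-(11/10):ℝ) := by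
    refine intervalIntegral.norm_integral_le_of_norm_le hT (Eventually.of_forall fun t ht => ?_) ((Gam_vint.mul_const _).intervalIntegrable)
    rw [Ph_norm hy]
    refine mul_le_mul_of_nonneg_right (mul_le_of_le_one_right (norm_nonneg _) (Real.exp_le_one_iff.2 ?_)) (by positivity)
    have : 0 < t := hτ.trans ht.1
    nlinarith [Real.pi_pos]
  refine hb.trans ?_
  rw [intervalIntegral.integral_mul_const]
  refine mul_le_mul_of_nonneg_right ?_ (by positivity)
  rw [intervalIntegral.integral_of_le hT]
  linarith [setIntegral_le_integral (s := Ioc τ T) Gam_vint (Eventually.of_forall fun t => norm_nonneg _)]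

/-- (B) -/
lemma Ph_large {τ : ℝ} (hτ : 0 < τ) (hτ1 : τ ≤ 1) : ∃ C > 0, ∀ y T : ℝ, 1 ≤ T → T < y →
    ‖∫ t : ℝ in τ..T, Ph (Real.pi/2) y ((11/10:ℝ) + t * I)‖ ≤ C * (T ^ (3/5:ℝ) * y ^ (-(1/10):ℝ) / (y - T)) := by
  obtain ⟨G, hG, h⟩ := shift_bd hτ
  refine ⟨7 * G, by positivity, fun y T hT hy => ?_⟩
  have hy0 : 0 < y := by linarith
  have hT0 : 0 < T := by linarith
  have hyT : 0 < y - T := by linarith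
  have hb := h (Real.pi/2) y τ T (by positivity) le_rfl hy0 le_rfl (hτ1.trans hT) (fun t ht => by
    rw [Real.sin_pi_div_two, mul_one]; linarith [ht.2])
  rw [Real.sin_pi_div_two, mul_one, sub_self, zero_mul, zero_mul, neg_zero, Real.exp_zero, mul_one, mul_one] at hb
  have hT1 : 1 ≤ T ^ (3/5:ℝ) := Real.one_le_rpow hT (by norm_num)
  set B := T ^ (3/5:ℝ) * y ^ (-(1/10):ℝ) / (y - T) with hB
  have hyp : 0 < y ^ (-(1/10):ℝ) := by positivity
  have key : ∀ a : ℝ, 0 < a → a ≤ T → a ^ (1/2:ℝ) * ((a/y) ^ (1/10:ℝ) + (a/y) ^ (11/10:ℝ)) / |a - y| ≤ 2 * B := by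
    intro a ha haT
    have h1 : (a/y) ^ (11/10:ℝ) ≤ (a/y) ^ (1/10:ℝ) := Real.rpow_le_rpow_of_exponent_ge (by positivity) (by rw [div_le_one hy0]; linarith) (by norm_num)
    have h2 : a ^ (1/2:ℝ) * (a/y) ^ (1/10:ℝ) = a ^ (3/5:ℝ) * y ^ (-(1/10):ℝ) := by
      rw [Real.div_rpow ha.le hy0.le, Real.rpow_neg hy0.le, mul_div_assoc', ← Real.rpow_add ha]
      norm_num; ring
    have h3 : a ^ (3/5:ℝ) ≤ T ^ (3/5:ℝ) := Real.rpow_le_rpow ha.le haT (by norm_num)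
    have h4 : y - T ≤ |a - y| := by rw [abs_sub_comm, abs_of_pos (by linarith)]; linarith
    calc _ ≤ (2 * (T ^ (3/5:ℝ) * y ^ (-(1/10):ℝ))) / (y - T) := by
          refine div_le_div₀ (by positivity) ?_ hyT h4
          calc _ ≤ a ^ (1/2:ℝ) * ((a/y) ^ (1/10:ℝ) + (a/y) ^ (1/10:ℝ)) := mul_le_mul_of_nonneg_left (by linarith) (by positivity)
            _ = 2 * (a ^ (1/2:ℝ) * (a/y) ^ (1/10:ℝ)) := by ring
            _ ≤ _ := by rw [h2]; exact mul_le_mul_of_nonneg_left (mul_le_mul_of_nonneg_right h3 hyp.le) (by norm_num)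
      _ = _ := by rw [hB]; ring
  have k1 := key τ hτ (hτ1.trans hT)
  have k2 := key T hT0 le_rfl
  have hIntg : ∫ t : ℝ in τ..T, y ^ (9/10:ℝ) * t ^ (-(2/5):ℝ) / (t - y) ^ 2 ≤ 3 * B := by
    have c0 : ContinuousOn (fun t : ℝ => t ^ (-(2/5):ℝ)) (Icc τ T) := fun t ht =>
      (Real.continuousAt_rpow_const _ _ (Or.inl (hτ.trans_le ht.1).ne')).continuousWithinAt
    have c1 : ContinuousOn (fun t : ℝ => (t - y) ^ 2) (Icc τ T) := by fun_prop
    have n1 : ∀ t ∈ Icc τ T, (t - y) ^ 2 ≠ 0 := fun t ht => pow_ne_zero _ (by linarith [ht.2])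
    have hle : ∫ t : ℝ in τ..T, y ^ (9/10:ℝ) * t ^ (-(2/5):ℝ) / (t - y) ^ 2 ≤
        ∫ t : ℝ in τ..T, ((y ^ (-(1/10):ℝ) / (y - T)) * t ^ (-(2/5):ℝ) + (y ^ (-(1/10):ℝ) * T ^ (3/5:ℝ)) * (1 / (t - y) ^ 2)) := by
      refine intervalIntegral.integral_mono_on (hτ1.trans hT) ?_ ?_ fun t ht => ?_
      · refine ContinuousOn.intervalIntegrable ?_
        rw [uIcc_of_le (hτ1.trans hT)]
        exact (continuousOn_const.mul c0).div c1 n1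
      · refine ContinuousOn.intervalIntegrable ?_
        rw [uIcc_of_le (hτ1.trans hT)]
        exact (continuousOn_const.mul c0).add (continuousOn_const.mul (continuousOn_const.div c1 n1))
      · have ht0 : 0 < t := hτ.trans_le ht.1
        have e1 : y ^ (9/10:ℝ) = y ^ (-(1/10):ℝ) * y := by rw [← Real.rpow_add_one hy0.ne']; norm_num
        have e2 : t ^ (3/5:ℝ) = t ^ (-(2/5):ℝ) * t := by rw [← Real.rpow_add_one ht0.ne']; norm_num
        have h3 : t ^ (3/5:ℝ) ≤ T ^ (3/5:ℝ) := Real.rpow_le_rpow ht0.le ht.2 (by norm_num)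
        have hyt : 0 < y - t := by linarith [ht.2]
        have e3 : y ^ (9/10:ℝ) * t ^ (-(2/5):ℝ) / (t - y) ^ 2 = y ^ (-(1/10):ℝ) / (y - t) * t ^ (-(2/5):ℝ) + (y ^ (-(1/10):ℝ) * t ^ (3/5:ℝ)) * (1 / (t - y) ^ 2) := by
          rw [e1, e2, show (t - y) ^ 2 = (y - t) ^ 2 by ring]
          field_simp
          ring
        rw [e3]
        refine add_le_add (mul_le_mul_of_nonneg_right (div_le_div_of_nonneg_left hyp.le hyT (by linarith [ht.2])) (by positivity)) ?_
        exact mul_le_mul_of_nonneg_right (mul_le_mul_of_nonneg_left h3 hyp.le) (by positivity)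
    refine hle.trans ?_
    rw [intervalIntegral.integral_add]
    · rw [intervalIntegral.integral_const_mul, intervalIntegral.integral_const_mul, inv_sq_int (hτ1.trans hT) (fun t ht => by linarith [ht.2])]
      have h5 := rpow_int hτ (hτ1.trans hT)
      have h6 : 1/(τ - y) - 1/(T - y) ≤ 1/(y - T) := by
        have : 1/(τ - y) ≤ 0 := one_div_nonpos.2 (by linarith)
        have e : 1/(y - T) = -(1/(T - y)) := by rw [← neg_sub T y, one_div_neg_eq_neg_one_div]
        linarith
      calc _ ≤ (y ^ (-(1/10):ℝ) / (y - T)) * (5/3 * T ^ (3/5:ℝ)) + (y ^ (-(1/10):ℝ) * T ^ (3/5:ℝ)) * (1/(y - T)) :=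
            add_le_add (mul_le_mul_of_nonneg_left h5 (by positivity)) (mul_le_mul_of_nonneg_left h6 (by positivity))
        _ = 8/3 * B := by rw [hB]; ring
        _ ≤ _ := by
          have : 0 ≤ B := by positivity
          linarith
    · refine ContinuousOn.intervalIntegrable ?_
      rw [uIcc_of_le (hτ1.trans hT)]
      exact continuousOn_const.mul c0
    · refine ContinuousOn.intervalIntegrable ?_
      rw [uIcc_of_le (hτ1.trans hT)]
      exact continuousOn_const.mul (continuousOn_const.div c1 n1)
  refine hb.trans ?_
  have j1 := mul_le_mul_of_nonneg_left k1 hG.le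
  have j2 := mul_le_mul_of_nonneg_left k2 hG.le
  have j3 := mul_le_mul_of_nonneg_left hIntg hG.le
  linarith


lemma Ph_tail_fin {τ : ℝ} (hτ : 0 < τ) : ∃ C > 0, ∀ θ y T R : ℝ, 0 ≤ θ → θ ≤ Real.pi/2 → τ ≤ T → 0 < y → y < T → T ≤ R →
    ‖∫ t : ℝ in T..R, Ph θ y ((11/10:ℝ) + t * I)‖ ≤ C * (T ^ (8/5:ℝ) * y ^ (-(11/10):ℝ) / (T - y)) +
      C * (R ^ (8/5:ℝ) * y ^ (-(11/10):ℝ) / (T - y)) * Real.exp (-((Real.pi/2 - θ) * R)) := by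
  obtain ⟨G, hG, h⟩ := shift_bd hτ
  refine ⟨3 * G, by positivity, fun θ y T R hθ0 hθ hT hy0 hy hR => ?_⟩
  have hT0 : 0 < T := hτ.trans_le hT
  have hyT : 0 < T - y := by linarith
  have hYy : y * Real.sin θ ≤ y := mul_le_of_le_one_right hy0.le (Real.sin_le_one θ)
  have hb := h θ y T R hθ0 hθ hy0 hT hR (fun t ht => by linarith [ht.1])
  set Y := y * Real.sin θ with hY
  have key : ∀ a : ℝ, T ≤ a → a ^ (1/2:ℝ) * ((a/y) ^ (1/10:ℝ) + (a/y) ^ (11/10:ℝ)) * Real.exp (-((Real.pi/2 - θ) * a)) / |a - Y| ≤ 2 * (a ^ (8/5:ℝ) * y ^ (-(11/10):ℝ) / (T - y)) * Real.exp (-((Real.pi/2 - θ) * a)) := by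
    intro a haT
    have ha : 0 < a := hT0.trans_le haT
    have h1 : (a/y) ^ (1/10:ℝ) ≤ (a/y) ^ (11/10:ℝ) := Real.rpow_le_rpow_of_exponent_le (by rw [one_le_div hy0]; linarith) (by norm_num)
    have h2 : a ^ (1/2:ℝ) * (a/y) ^ (11/10:ℝ) = a ^ (8/5:ℝ) * y ^ (-(11/10):ℝ) := by
      rw [Real.div_rpow ha.le hy0.le, Real.rpow_neg hy0.le, mul_div_assoc', ← Real.rpow_add ha]
      norm_num; ring
    have h4 : T - y ≤ |a - Y| := by rw [abs_of_pos (by linarith)]; linarith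
    have hE := Real.exp_pos (-((Real.pi/2 - θ) * a))
    set E := Real.exp (-((Real.pi/2 - θ) * a))
    calc _ ≤ (2 * (a ^ (8/5:ℝ) * y ^ (-(11/10):ℝ)) * E) / (T - y) := by
          refine div_le_div₀ (by positivity) (mul_le_mul_of_nonneg_right ?_ hE.le) hyT h4
          calc _ ≤ a ^ (1/2:ℝ) * ((a/y) ^ (11/10:ℝ) + (a/y) ^ (11/10:ℝ)) := mul_le_mul_of_nonneg_left (by linarith) (by positivity)
            _ = 2 * (a ^ (1/2:ℝ) * (a/y) ^ (11/10:ℝ)) := by ring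
            _ ≤ _ := by rw [h2]
      _ = _ := by ring
  have k1 := key T le_rfl
  have k2 := key R hR
  have k1' : 2 * (T ^ (8/5:ℝ) * y ^ (-(11/10):ℝ) / (T - y)) * Real.exp (-((Real.pi/2 - θ) * T)) ≤ 2 * (T ^ (8/5:ℝ) * y ^ (-(11/10):ℝ) / (T - y)) :=
    mul_le_of_le_one_right (by positivity) (Real.exp_le_one_iff.2 (by nlinarith))
  have hIntg : ∫ t : ℝ in T..R, y ^ (9/10:ℝ) * t ^ (-(2/5):ℝ) / (t - Y) ^ 2 ≤ T ^ (8/5:ℝ) * y ^ (-(11/10):ℝ) / (T - y) := by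
    have c0 : ContinuousOn (fun t : ℝ => t ^ (-(2/5):ℝ)) (Icc T R) := fun t ht =>
      (Real.continuousAt_rpow_const _ _ (Or.inl (hT0.trans_le ht.1).ne')).continuousWithinAt
    have c1 : ∀ z : ℝ, ContinuousOn (fun t : ℝ => (t - z) ^ 2) (Icc T R) := fun z => by fun_prop
    have n1 : ∀ t ∈ Icc T R, (t - Y) ^ 2 ≠ 0 := fun t ht => pow_ne_zero _ (by linarith [ht.1])
    have n2 : ∀ t ∈ Icc T R, (t - y) ^ 2 ≠ 0 := fun t ht => pow_ne_zero _ (by linarith [ht.1])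
    have hle : ∫ t : ℝ in T..R, y ^ (9/10:ℝ) * t ^ (-(2/5):ℝ) / (t - Y) ^ 2 ≤
        ∫ t : ℝ in T..R, (y ^ (9/10:ℝ) * T ^ (-(2/5):ℝ)) * (1 / (t - y) ^ 2) := by
      refine intervalIntegral.integral_mono_on hR ?_ ?_ fun t ht => ?_
      · refine ContinuousOn.intervalIntegrable ?_
        rw [uIcc_of_le hR]
        exact (continuousOn_const.mul c0).div (c1 Y) n1
      · refine ContinuousOn.intervalIntegrable ?_
        rw [uIcc_of_le hR]
        exact (continuousOn_const.mul (continuousOn_const.div (c1 y) n2))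
      · have ht0 : 0 < t := hT0.trans_le ht.1
        have h3 : t ^ (-(2/5):ℝ) ≤ T ^ (-(2/5):ℝ) := Real.rpow_le_rpow_of_nonpos hT0 ht.1 (by norm_num)
        have hyt : 0 < t - y := by linarith [ht.1]
        rw [mul_one_div]
        refine div_le_div₀ (by positivity) (mul_le_mul_of_nonneg_left h3 (by positivity)) (by positivity) ?_
        exact pow_le_pow_left₀ hyt.le (by linarith) 2
    refine hle.trans ?_
    rw [intervalIntegral.integral_const_mul, inv_sq_int hR (fun t ht => by linarith [ht.1])]
    have h6 : 1/(T - y) - 1/(R - y) ≤ 1/(T - y) := by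
      have : 0 ≤ 1/(R - y) := one_div_nonneg.2 (by linarith)
      linarith
    have e1 : y ^ (9/10:ℝ) = y ^ (-(11/10):ℝ) * y ^ 2 := by
      rw [← Real.rpow_natCast y 2, ← Real.rpow_add hy0]; norm_num
    have e2 : T ^ (8/5:ℝ) = T ^ (-(2/5):ℝ) * T ^ 2 := by
      rw [← Real.rpow_natCast T 2, ← Real.rpow_add hT0]; norm_num
    have e3 : y ^ 2 ≤ T ^ 2 := pow_le_pow_left₀ hy0.le hy.le 2
    calc _ ≤ (y ^ (9/10:ℝ) * T ^ (-(2/5):ℝ)) * (1/(T - y)) := mul_le_mul_of_nonneg_left h6 (by positivity)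
      _ = (y ^ (-(11/10):ℝ) * T ^ (-(2/5):ℝ) * (1/(T - y))) * y ^ 2 := by rw [e1]; ring
      _ ≤ (y ^ (-(11/10):ℝ) * T ^ (-(2/5):ℝ) * (1/(T - y))) * T ^ 2 := mul_le_mul_of_nonneg_left e3 (by positivity)
      _ = _ := by rw [e2]; ring
  refine hb.trans ?_
  have hpos : 0 ≤ (R ^ (8/5:ℝ) * y ^ (-(11/10):ℝ) / (T - y)) * Real.exp (-((Real.pi/2 - θ) * R)) := by
    have : 0 < R := hT0.trans_le hR
    positivity
  have j1 := mul_le_mul_of_nonneg_left (k1.trans k1') hG.le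
  have j2 := mul_le_mul_of_nonneg_left k2 hG.le
  have j3 := mul_le_mul_of_nonneg_left hIntg hG.le
  have j4 := mul_nonneg hG.le hpos
  nlinarith

lemma Ph_left {θ τ y : ℝ} (hy : 0 < y) (h0 : 0 ≤ θ) (hθ : θ ≤ Real.pi/2) (hτ1 : τ ≤ 1) :
    ‖∫ t : ℝ in Iic τ, Ph θ y ((11/10:ℝ) + t * I)‖ ≤ (Real.exp 2 * ∫ t : ℝ, ‖Complex.Gamma ((11/10:ℝ) + t * I)‖) * y ^ (-(11/10):ℝ) := by
  have hi : Integrable fun t : ℝ => (Real.exp 2 * ‖Complex.Gamma ((11/10:ℝ) + t * I)‖) * y ^ (-(11/10):ℝ) := (Gam_vint.const_mul _).mul_const _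
  have h1 : ‖∫ t : ℝ in Iic τ, Ph θ y ((11/10:ℝ) + t * I)‖ ≤ ∫ t : ℝ in Iic τ, (Real.exp 2 * ‖Complex.Gamma ((11/10:ℝ) + t * I)‖) * y ^ (-(11/10):ℝ) := by
    refine norm_integral_le_of_norm_le hi.integrableOn ?_
    filter_upwards [ae_restrict_mem measurableSet_Iic] with t ht
    rw [Ph_norm hy]
    refine mul_le_mul_of_nonneg_right ?_ (by positivity)
    rw [mul_comm]
    refine mul_le_mul_of_nonneg_right (Real.exp_le_exp.2 ?_) (norm_nonneg _)
    have ht' : t ≤ 1 := le_trans ht hτ1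
    nlinarith [Real.pi_le_four]
  refine h1.trans ((setIntegral_le_integral hi (Eventually.of_forall fun t => by positivity)).trans ?_)
  rw [integral_mul_const, integral_const_mul]

lemma Ph_small_theta {τ : ℝ} (hτ : 0 < τ) (hτ1 : τ ≤ 1) : ∃ C > 0, ∀ θ y T : ℝ, 0 ≤ θ → θ < Real.pi/2 → τ ≤ T → 0 < y → y < T →
    ‖(∫ t : ℝ in τ..T, Ph θ y ((11/10:ℝ) + t * I)) - 2 * Real.pi * cexp (-(cexp (θ * I) * y))‖ ≤
      C * (T ^ (8/5:ℝ) * y ^ (-(11/10):ℝ) / (T - y)) + C * y ^ (-(11/10):ℝ) := by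
  obtain ⟨G, hG, h⟩ := Ph_tail_fin hτ
  set W := Real.exp 2 * ∫ t : ℝ, ‖Complex.Gamma ((11/10:ℝ) + t * I)‖ with hW
  have hW0 : 0 ≤ W := by
    have : 0 ≤ ∫ t : ℝ, ‖Complex.Gamma ((11/10:ℝ) + t * I)‖ := integral_nonneg fun t => norm_nonneg _
    positivity
  refine ⟨G + W, by positivity, fun θ y T hθ0 hθ hT hy0 hy => ?_⟩
  have habs : |θ| < Real.pi/2 := by rwa [abs_of_nonneg hθ0]
  have hi := Ph_vint (θ := θ) hy0 habs
  have hT0 : 0 < T := hτ.trans_le hT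
  have hyT : 0 < T - y := by linarith
  have htail : ‖∫ t : ℝ in Ioi T, Ph θ y ((11/10:ℝ) + t * I)‖ ≤ G * (T ^ (8/5:ℝ) * y ^ (-(11/10):ℝ) / (T - y)) := by
    have hl := (intervalIntegral_tendsto_integral_Ioi T hi.integrableOn tendsto_id).norm
    have hr : Tendsto (fun R : ℝ => G * (T ^ (8/5:ℝ) * y ^ (-(11/10):ℝ) / (T - y)) +
      G * (R ^ (8/5:ℝ) * y ^ (-(11/10):ℝ) / (T - y)) * Real.exp (-((Real.pi/2 - θ) * R))) atTop (𝓝 (G * (T ^ (8/5:ℝ) * y ^ (-(11/10):ℝ) / (T - y)) + (G * y ^ (-(11/10):ℝ) / (T - y)) * 0)) := by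
      have h0 := tendsto_rpow_mul_exp_neg_mul_atTop_nhds_zero (8/5) (Real.pi/2 - θ) (by linarith)
      refine tendsto_const_nhds.add ((h0.const_mul (G * y ^ (-(11/10):ℝ) / (T - y))).congr fun R => ?_)
      rw [neg_mul]; ring
    rw [mul_zero, add_zero] at hr
    refine le_of_tendsto_of_tendsto hl hr ?_
    filter_upwards [eventually_ge_atTop T] with R hR
    exact h θ y T R hθ0 hθ.le hT hy0 hy hR
  have hleft := Ph_left (θ := θ) (τ := τ) hy0 hθ0 hθ.le hτ1
  have hsplit : ∫ t : ℝ, Ph θ y ((11/10:ℝ) + t * I) = (∫ t : ℝ in Iic τ, Ph θ y ((11/10:ℝ) + t * I)) + (∫ t : ℝ in τ..T, Ph θ y ((11/10:ℝ) + t * I)) + ∫ t : ℝ in Ioi T, Ph θ y ((11/10:ℝ) + t * I) := by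
    rw [← intervalIntegral.integral_Iic_add_Ioi (b := T) hi.integrableOn hi.integrableOn, ← intervalIntegral.integral_Iic_sub_Iic (a := τ) hi.integrableOn hi.integrableOn]
    ring
  rw [Ph_full hy0 habs] at hsplit
  rw [hsplit, show (∫ t : ℝ in τ..T, Ph θ y ((11/10:ℝ) + t * I)) - ((∫ t : ℝ in Iic τ, Ph θ y ((11/10:ℝ) + t * I)) + (∫ t : ℝ in τ..T, Ph θ y ((11/10:ℝ) + t * I)) + ∫ t : ℝ in Ioi T, Ph θ y ((11/10:ℝ) + t * I)) = -((∫ t : ℝ in Iic τ, Ph θ y ((11/10:ℝ) + t * I)) + ∫ t : ℝ in Ioi T, Ph θ y ((11/10:ℝ) + t * I)) by ring, norm_neg]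
  refine (norm_add_le _ _).trans ?_
  have p1 : 0 ≤ W * (T ^ (8/5:ℝ) * y ^ (-(11/10):ℝ) / (T - y)) := by positivity
  have p2 : 0 ≤ G * y ^ (-(11/10):ℝ) := by positivity
  linarith

/-- (C) -/
lemma Ph_small {τ : ℝ} (hτ : 0 < τ) (hτ1 : τ ≤ 1) : ∃ C > 0, ∀ y T : ℝ, τ ≤ T → 0 < y → y < T →
    ‖(∫ t : ℝ in τ..T, Ph (Real.pi/2) y ((11/10:ℝ) + t * I)) - 2 * Real.pi * cexp (-(I * y))‖ ≤
      C * (T ^ (8/5:ℝ) * y ^ (-(11/10):ℝ) / (T - y)) + C * y ^ (-(11/10):ℝ) := by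
  obtain ⟨C, hC, h⟩ := Ph_small_theta hτ hτ1
  refine ⟨C, hC, fun y T hT hy0 hy => ?_⟩
  have hcont : Continuous fun θ : ℝ => ‖(∫ t : ℝ in τ..T, Ph θ y ((11/10:ℝ) + t * I)) - 2 * Real.pi * cexp (-(cexp (θ * I) * y))‖ := by
    have h1 : Continuous fun θ : ℝ => ∫ t : ℝ in τ..T, Ph θ y ((11/10:ℝ) + t * I) := by
      apply intervalIntegral.continuous_parametric_intervalIntegral_of_continuous'
      unfold Function.uncurry
      unfold Ph
      refine Continuous.mul (Continuous.mul (Gam_vcont.comp continuous_snd) (by fun_prop)) ?_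
      exact Continuous.const_cpow (by fun_prop) (Or.inl (by exact_mod_cast hy0.ne'))
    fun_prop
  have hl := (hcont.tendsto (Real.pi/2)).mono_left (nhdsWithin_le_nhds (s := Iio (Real.pi/2)))
  have e : cexp (((Real.pi/2 : ℝ) : ℂ) * I) = I := by
    push_cast
    exact Complex.exp_pi_div_two_mul_I
  rw [e] at hl
  refine le_of_tendsto hl ?_
  have : Ioo 0 (Real.pi/2) ∈ 𝓝[<] (Real.pi/2) := Ioo_mem_nhdsLT (by positivity)
  filter_upwards [this] with θ hθ
  exact h θ y T hθ.1.le hθ.2 hT hy0 hy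

end PI1
end ZS

namespace ZS
section SUMJ
open Complex Filter Topology Asymptotics Set Metric MeasureTheory

lemma jq1 {x m k : ℝ} (hm : 1 ≤ m) (hk : 1 ≤ k) (hkx : k ≤ x) (hu : k/2 ≤ x - m) :
    m ^ (1/20:ℝ) * (x ^ (8/5:ℝ) * m ^ (-(11/10):ℝ) / (x - m)) ≤ 2 * x ^ (13/20:ℝ) * (m ^ (-(21/20):ℝ) + k ^ (-(21/20):ℝ)) := by
  have hx : 1 ≤ x := hk.trans hkx
  have hx0 : 0 < x := by linarith
  have hm0 : 0 < m := by linarith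
  have hk0 : 0 < k := by linarith
  have hu0 : 0 < x - m := by linarith
  have e1 : x ^ (8/5:ℝ) = x ^ (3/5:ℝ) * (m + (x - m)) := by
    rw [show m + (x - m) = x by ring, ← Real.rpow_add_one hx0.ne']; norm_num
  have e2 : m ^ (1/20:ℝ) * m ^ (-(11/10):ℝ) = m ^ (-(21/20):ℝ) := by rw [← Real.rpow_add hm0]; norm_num
  have e3 : m ^ (-(21/20):ℝ) * m = m ^ (-(1/20):ℝ) := by rw [← Real.rpow_add_one hm0.ne']; norm_num
  have e4 : m ^ (1/20:ℝ) * (x ^ (8/5:ℝ) * m ^ (-(11/10):ℝ) / (x - m)) = x ^ (3/5:ℝ) * (m ^ (-(1/20):ℝ) * (1 / (x - m)) + m ^ (-(21/20):ℝ)) := by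
    rw [e1, ← e3, ← e2]; field_simp
  have h1 : m ^ (-(1/20):ℝ) ≤ 1 := Real.rpow_le_one_of_one_le_of_nonpos hm (by norm_num)
  have h2 : 1 / (x - m) ≤ 2 * (x ^ (1/20:ℝ) * k ^ (-(21/20):ℝ)) := by
    have : k ^ (1/20:ℝ) * k ^ (-(21/20):ℝ) = k⁻¹ := by rw [← Real.rpow_add hk0, ← Real.rpow_neg_one]; norm_num
    calc _ ≤ 1 / (k/2) := one_div_le_one_div_of_le (by positivity) hu
      _ = 2 * (k ^ (1/20:ℝ) * k ^ (-(21/20):ℝ)) := by rw [this]; field_simp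
      _ ≤ _ := mul_le_mul_of_nonneg_left (mul_le_mul_of_nonneg_right (Real.rpow_le_rpow hk0.le hkx (by norm_num)) (by positivity)) (by norm_num)
  have h3 : x ^ (13/20:ℝ) = x ^ (3/5:ℝ) * x ^ (1/20:ℝ) := by rw [← Real.rpow_add hx0]; norm_num
  have h4 : 1 ≤ x ^ (1/20:ℝ) := Real.one_le_rpow hx (by norm_num)
  have h5 : 0 ≤ m ^ (-(21/20):ℝ) := by positivity
  rw [e4]
  calc _ ≤ x ^ (3/5:ℝ) * (1 * (2 * (x ^ (1/20:ℝ) * k ^ (-(21/20):ℝ))) + (2 * x ^ (1/20:ℝ)) * m ^ (-(21/20):ℝ)) := by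
        refine mul_le_mul_of_nonneg_left (add_le_add (mul_le_mul h1 h2 (by positivity) (by norm_num)) ?_) (by positivity)
        exact le_mul_of_one_le_left h5 (by linarith)
    _ = _ := by rw [h3]; ring

lemma jq3 {x m k : ℝ} (hx : 1 ≤ x) (hk : 1 ≤ k) (hkx : k ≤ m) (hu : k/3 ≤ m - x) :
    m ^ (1/20:ℝ) * (x ^ (3/5:ℝ) * m ^ (-(1/10):ℝ) / (m - x)) ≤ 3 * x ^ (13/20:ℝ) * (m ^ (-(21/20):ℝ) + k ^ (-(21/20):ℝ)) := by
  have hx0 : 0 < x := by linarith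
  have hm0 : 0 < m := by linarith
  have hk0 : 0 < k := by linarith
  have hu0 : 0 < m - x := by linarith
  have e2 : m ^ (1/20:ℝ) * m ^ (-(1/10):ℝ) = m ^ (-(1/20):ℝ) := by rw [← Real.rpow_add hm0]; norm_num
  have h1 : m ^ (-(1/20):ℝ) ≤ k ^ (-(1/20):ℝ) := Real.rpow_le_rpow_of_nonpos hk0 hkx (by norm_num)
  have h2 : 1 / (m - x) ≤ 3 * k⁻¹ := by
    calc _ ≤ 1 / (k/3) := one_div_le_one_div_of_le (by positivity) hu
      _ = _ := by field_simp
  have h3 : k ^ (-(1/20):ℝ) * k⁻¹ = k ^ (-(21/20):ℝ) := by rw [← Real.rpow_neg_one, ← Real.rpow_add hk0]; norm_num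
  have h4 : x ^ (3/5:ℝ) ≤ x ^ (13/20:ℝ) := Real.rpow_le_rpow_of_exponent_le hx (by norm_num)
  have h5 : 0 ≤ m ^ (-(21/20):ℝ) := by positivity
  calc _ = x ^ (3/5:ℝ) * ((m ^ (1/20:ℝ) * m ^ (-(1/10):ℝ)) * (1 / (m - x))) := by ring
    _ ≤ x ^ (13/20:ℝ) * (k ^ (-(1/20):ℝ) * (3 * k⁻¹)) := by
      rw [e2]
      exact mul_le_mul h4 (mul_le_mul h1 h2 (by positivity) (by positivity)) (by positivity) (by positivity)
    _ = 3 * x ^ (13/20:ℝ) * k ^ (-(21/20):ℝ) := by rw [← h3]; ring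
    _ ≤ _ := mul_le_mul_of_nonneg_left (by linarith) (by positivity)

lemma jq2 {x m k : ℝ} (hx : 1 ≤ x) (hk : 1 ≤ k) (hk2 : k ≤ 2) (h1 : x/2 ≤ m) (h2 : m ≤ 2*x) :
    m ^ (1/20:ℝ) * (x ^ (8/5:ℝ) * m ^ (-(11/10):ℝ) + 1) ≤ 24 * x ^ (13/20:ℝ) * (m ^ (-(21/20):ℝ) + k ^ (-(21/20):ℝ)) := by
  have hx0 : 0 < x := by linarith
  have hm0 : 0 < m := by linarith
  have hk0 : 0 < k := by linarith
  have two : (2:ℝ) ^ (21/20:ℝ) ≤ 4 := by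
    calc _ ≤ (2:ℝ) ^ (2:ℝ) := Real.rpow_le_rpow_of_exponent_le (by norm_num) (by norm_num)
      _ = 4 := by norm_num
  have two' : (2:ℝ) ^ (1/20:ℝ) ≤ 2 := by
    calc _ ≤ (2:ℝ) ^ (1:ℝ) := Real.rpow_le_rpow_of_exponent_le (by norm_num) (by norm_num)
      _ = 2 := by norm_num
  have hk3 : 1/4 ≤ k ^ (-(21/20):ℝ) := by
    rw [Real.rpow_neg hk0.le, one_div]
    refine inv_anti₀ (by positivity) (le_trans (Real.rpow_le_rpow hk0.le hk2 (by norm_num)) two)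
  have e2 : m ^ (1/20:ℝ) * m ^ (-(11/10):ℝ) = m ^ (-(21/20):ℝ) := by rw [← Real.rpow_add hm0]; norm_num
  have h3 : m ^ (-(21/20):ℝ) ≤ 4 * x ^ (-(21/20):ℝ) := by
    calc _ ≤ (x/2) ^ (-(21/20):ℝ) := Real.rpow_le_rpow_of_nonpos (by positivity) h1 (by norm_num)
      _ = 2 ^ (21/20:ℝ) * x ^ (-(21/20):ℝ) := by
        rw [Real.div_rpow hx0.le (by norm_num), Real.rpow_neg (by norm_num : (0:ℝ) ≤ 2), div_inv_eq_mul, mul_comm]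
      _ ≤ _ := mul_le_mul_of_nonneg_right two (by positivity)
  have h4 : x ^ (8/5:ℝ) * x ^ (-(21/20):ℝ) ≤ x ^ (13/20:ℝ) := by
    rw [← Real.rpow_add hx0]; exact Real.rpow_le_rpow_of_exponent_le hx (by norm_num)
  have h5 : m ^ (1/20:ℝ) ≤ 2 * x ^ (13/20:ℝ) := by
    calc _ ≤ (2*x) ^ (1/20:ℝ) := Real.rpow_le_rpow hm0.le h2 (by norm_num)
      _ = 2 ^ (1/20:ℝ) * x ^ (1/20:ℝ) := Real.mul_rpow (by norm_num) hx0.le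
      _ ≤ 2 * x ^ (13/20:ℝ) := mul_le_mul two' (Real.rpow_le_rpow_of_exponent_le hx (by norm_num)) (by positivity) (by norm_num)
  have h6 : 0 ≤ m ^ (-(21/20):ℝ) := by positivity
  have hX : 0 ≤ x ^ (13/20:ℝ) := by positivity
  calc _ = x ^ (8/5:ℝ) * (m ^ (1/20:ℝ) * m ^ (-(11/10):ℝ)) + m ^ (1/20:ℝ) := by ring
    _ ≤ x ^ (8/5:ℝ) * (4 * x ^ (-(21/20):ℝ)) + 2 * x ^ (13/20:ℝ) := by
      rw [e2]
      exact add_le_add (mul_le_mul_of_nonneg_left h3 (by positivity)) h5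
    _ ≤ 6 * x ^ (13/20:ℝ) := by linarith
    _ = 24 * x ^ (13/20:ℝ) * (1/4) := by ring
    _ ≤ _ := mul_le_mul_of_nonneg_left (by linarith) (by positivity)

/-- the kernel -/
noncomputable def JJ (τ T : ℝ) (m : ℕ) : ℂ :=
  (∫ t : ℝ in τ..T, Ph (Real.pi/2) (2*Real.pi*m) ((11/10:ℝ) + t * I)) + ∫ t : ℝ in τ..T, Ph (-(Real.pi/2)) (2*Real.pi*m) ((11/10:ℝ) + t * I)

lemma exp_two_pi_nat (m : ℕ) : cexp (-(I * ((2*Real.pi*m : ℝ) : ℂ))) = 1 := by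
  rw [Complex.exp_neg, show I * ((2*Real.pi*m : ℝ) : ℂ) = m * (2 * Real.pi * I) by push_cast; ring, Complex.exp_nat_mul_two_pi_mul_I, inv_one]

set_option maxHeartbeats 1000000 in
lemma JJ_bd {τ : ℝ} (hτ : 0 < τ) (hτ1 : τ ≤ 1) : ∃ K > 0, ∀ x : ℝ, 2 ≤ x → ∀ m : ℕ, 1 ≤ m →
    (m:ℝ) ^ (1/20:ℝ) * ‖JJ τ (2*Real.pi*x) m - (if m ≤ ⌊x⌋₊ then 2*Real.pi else 0)‖ ≤ K * x ^ (13/20:ℝ) * ((m:ℝ) ^ (-(21/20):ℝ) + (1 + |(m:ℝ) - ⌊x⌋₊|) ^ (-(21/20):ℝ)) := by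
  obtain ⟨CA, hCA, hA⟩ := Ph_triv hτ
  obtain ⟨CO, hCO, hO⟩ := Ph_other
  obtain ⟨CB, hCB, hB⟩ := Ph_large hτ hτ1
  obtain ⟨CC, hCC, hC⟩ := Ph_small hτ hτ1
  refine ⟨CO + 24 * (4 * CA + 8) + 3 * CB + 3 * CC, by positivity, fun x hx m hm => ?_⟩
  set N := ⌊x⌋₊ with hN
  have hx0 : 0 < x := by linarith
  have hN1 : (N:ℝ) ≤ x := Nat.floor_le hx0.le
  have hN2 : x < N + 1 := Nat.lt_floor_add_one x
  have hN0 : (1:ℝ) ≤ N := by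
    have : 1 ≤ N := Nat.le_floor (by norm_num; linarith)
    exact_mod_cast this
  have hmr : (1:ℝ) ≤ m := by exact_mod_cast hm
  have hm0 : (0:ℝ) < m := by linarith
  have hpi := Real.pi_gt_three
  have hp0 : 0 < 2 * Real.pi := by positivity
  have hp1 : 1 ≤ 2 * Real.pi := by linarith
  set T := 2 * Real.pi * x with hT
  set y := 2 * Real.pi * (m:ℝ) with hy
  have hy0 : 0 < y := by positivity
  have hT1 : 1 ≤ T := by nlinarith
  set k := 1 + |(m:ℝ) - N| with hk
  have hk1 : 1 ≤ k := by linarith [abs_nonneg ((m:ℝ) - N)]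
  have hk0 : 0 < k := by linarith
  set D := x ^ (13/20:ℝ) * ((m:ℝ) ^ (-(21/20):ℝ) + k ^ (-(21/20):ℝ)) with hD
  have hD0 : 0 ≤ D := by positivity
  have hyp : y ^ (-(11/10):ℝ) = (2*Real.pi) ^ (-(11/10):ℝ) * (m:ℝ) ^ (-(11/10):ℝ) := Real.mul_rpow hp0.le hm0.le
  have hyp' : y ^ (-(11/10):ℝ) ≤ (m:ℝ) ^ (-(11/10):ℝ) := by
    rw [hyp]; exact mul_le_of_le_one_left (by positivity) (Real.rpow_le_one_of_one_le_of_nonpos hp1 (by norm_num))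
  have hX1 : 1 ≤ x ^ (13/20:ℝ) := Real.one_le_rpow (by linarith) (by norm_num)
  have hmD : (m:ℝ) ^ (1/20:ℝ) * y ^ (-(11/10):ℝ) ≤ D := by
    have e2 : (m:ℝ) ^ (1/20:ℝ) * (m:ℝ) ^ (-(11/10):ℝ) = (m:ℝ) ^ (-(21/20):ℝ) := by rw [← Real.rpow_add hm0]; norm_num
    calc _ ≤ (m:ℝ) ^ (1/20:ℝ) * (m:ℝ) ^ (-(11/10):ℝ) := mul_le_mul_of_nonneg_left hyp' (by positivity)
      _ = (m:ℝ) ^ (-(21/20):ℝ) := e2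
      _ ≤ (m:ℝ) ^ (-(21/20):ℝ) + k ^ (-(21/20):ℝ) := le_add_of_nonneg_right (by positivity)
      _ ≤ D := le_mul_of_one_le_left (by positivity) hX1
  have hO' := hO τ y T hτ hy0 (hτ1.trans hT1)
  have hmp : 0 < (m:ℝ) ^ (1/20:ℝ) := by positivity
  -- reduce to first half
  suffices h : (m:ℝ) ^ (1/20:ℝ) * ‖(∫ t : ℝ in τ..T, Ph (Real.pi/2) y ((11/10:ℝ) + t * I)) - (if m ≤ N then 2*Real.pi else 0)‖ ≤ (24 * (4 * CA + 8) + 3 * CB + 3 * CC) * D by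
    have h1 : ‖JJ τ T m - (if m ≤ N then 2*Real.pi else 0)‖ ≤ ‖(∫ t : ℝ in τ..T, Ph (Real.pi/2) y ((11/10:ℝ) + t * I)) - (if m ≤ N then 2*Real.pi else 0)‖ + CO * y ^ (-(11/10):ℝ) := by
      unfold JJ
      rw [← hy]
      have := norm_add_le ((∫ t : ℝ in τ..T, Ph (Real.pi/2) y ((11/10:ℝ) + t * I)) - (if m ≤ N then 2*Real.pi else 0)) (∫ t : ℝ in τ..T, Ph (-(Real.pi/2)) y ((11/10:ℝ) + t * I))
      rw [sub_add_eq_add_sub] at this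
      exact this.trans (by linarith)
    calc _ ≤ (m:ℝ) ^ (1/20:ℝ) * (‖(∫ t : ℝ in τ..T, Ph (Real.pi/2) y ((11/10:ℝ) + t * I)) - (if m ≤ N then 2*Real.pi else 0)‖ + CO * y ^ (-(11/10):ℝ)) := mul_le_mul_of_nonneg_left h1 hmp.le
      _ = (m:ℝ) ^ (1/20:ℝ) * ‖(∫ t : ℝ in τ..T, Ph (Real.pi/2) y ((11/10:ℝ) + t * I)) - (if m ≤ N then 2*Real.pi else 0)‖ + CO * ((m:ℝ) ^ (1/20:ℝ) * y ^ (-(11/10):ℝ)) := by ring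
      _ ≤ (24 * (4 * CA + 8) + 3 * CB + 3 * CC) * D + CO * D := add_le_add h (mul_le_mul_of_nonneg_left hmD hCO.le)
      _ = _ := by rw [hD]; ring
  have q1 : 0 ≤ CA * D := by positivity
  have q2 : 0 ≤ CB * D := by positivity
  have q3 : 0 ≤ CC * D := by positivity
  have hq : (2*Real.pi) ^ (1/2:ℝ) ≤ 4 := by
    rw [← Real.sqrt_eq_rpow]
    refine (Real.sqrt_le_sqrt (by linarith [Real.pi_le_four] : 2*Real.pi ≤ 4^2)).trans ?_
    rw [Real.sqrt_sq (by norm_num)]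
  have hq' : (2*Real.pi) ^ (-(1/2):ℝ) ≤ 1 := Real.rpow_le_one_of_one_le_of_nonpos hp1 (by norm_num)
  rcases Nat.lt_or_ge m N with h | h
  · -- m < N
    have hmN : (m:ℝ) + 1 ≤ N := by exact_mod_cast h
    have hc := hC y T (hτ1.trans hT1) hy0 (by rw [hy, hT]; exact mul_lt_mul_of_pos_left (by linarith) hp0)
    rw [exp_two_pi_nat, mul_one] at hc
    rw [if_pos h.le]
    have habs : k = 1 + (N - m) := by rw [hk, abs_sub_comm, abs_of_nonneg (by linarith)]
    have hj := jq1 hmr hk1 (by rw [habs]; linarith : k ≤ x) (by rw [habs]; linarith)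
    have hsc : T ^ (8/5:ℝ) * y ^ (-(11/10):ℝ) / (T - y) ≤ x ^ (8/5:ℝ) * (m:ℝ) ^ (-(11/10):ℝ) / (x - m) := by
      have e : T ^ (8/5:ℝ) * y ^ (-(11/10):ℝ) / (T - y) = (2*Real.pi) ^ (-(1/2):ℝ) * (x ^ (8/5:ℝ) * (m:ℝ) ^ (-(11/10):ℝ) / (x - m)) := by
        have e1 : (2*Real.pi) ^ (-(1/2):ℝ) = (2*Real.pi) ^ (8/5:ℝ) * (2*Real.pi) ^ (-(11/10):ℝ) / (2 * Real.pi) := by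
          rw [← Real.rpow_add hp0, ← Real.rpow_sub_one hp0.ne']; norm_num
        have e2 : T - y = 2*Real.pi * (x - m) := by rw [hT, hy]; ring
        rw [e1, e2, hyp, hT, Real.mul_rpow hp0.le hx0.le]
        have : x - m ≠ 0 := by linarith
        field_simp
      rw [e]
      exact mul_le_of_le_one_left (div_nonneg (by positivity) (by linarith)) hq'
    rw [Complex.ofReal_mul, Complex.ofReal_ofNat]
    calc _ ≤ (m:ℝ) ^ (1/20:ℝ) * (CC * (x ^ (8/5:ℝ) * (m:ℝ) ^ (-(11/10):ℝ) / (x - m)) + CC * y ^ (-(11/10):ℝ)) :=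
          mul_le_mul_of_nonneg_left (hc.trans (add_le_add_left (mul_le_mul_of_nonneg_left hsc hCC.le) _)) hmp.le
      _ = CC * ((m:ℝ) ^ (1/20:ℝ) * (x ^ (8/5:ℝ) * (m:ℝ) ^ (-(11/10):ℝ) / (x - m))) + CC * ((m:ℝ) ^ (1/20:ℝ) * y ^ (-(11/10):ℝ)) := by ring
      _ ≤ CC * (2 * D) + CC * D := by
        refine add_le_add (mul_le_mul_of_nonneg_left (hj.trans (by rw [hD]; linarith)) hCC.le) (mul_le_mul_of_nonneg_left hmD hCC.le)
      _ ≤ _ := by linarith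
  · rcases Nat.lt_or_ge (N + 1) m with h' | h'
    · skip
      have hmN : (N:ℝ) + 2 ≤ m := by exact_mod_cast h'
      rw [if_neg (by lia)]
      have hyT : T < y := by rw [hy, hT]; exact mul_lt_mul_of_pos_left (by linarith) hp0
      have hb := hB y T hT1 hyT
      have habs : k = 1 + (m - N) := by rw [hk, abs_of_nonneg (by linarith)]
      have hj := jq3 (x := x) (m := m) (by linarith) hk1 (by rw [habs]; linarith) (by rw [habs]; linarith)
      have hsc : T ^ (3/5:ℝ) * y ^ (-(1/10):ℝ) / (y - T) ≤ x ^ (3/5:ℝ) * (m:ℝ) ^ (-(1/10):ℝ) / (m - x) := by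
        have e : T ^ (3/5:ℝ) * y ^ (-(1/10):ℝ) / (y - T) = (2*Real.pi) ^ (-(1/2):ℝ) * (x ^ (3/5:ℝ) * (m:ℝ) ^ (-(1/10):ℝ) / (m - x)) := by
          have e1 : (2*Real.pi) ^ (-(1/2):ℝ) = (2*Real.pi) ^ (3/5:ℝ) * (2*Real.pi) ^ (-(1/10):ℝ) / (2 * Real.pi) := by
            rw [← Real.rpow_add hp0, ← Real.rpow_sub_one hp0.ne']; norm_num
          have e2 : y - T = 2*Real.pi * (m - x) := by rw [hT, hy]; ring
          rw [e1, e2, hy, hT, Real.mul_rpow hp0.le hx0.le, Real.mul_rpow hp0.le hm0.le]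
          have : (m:ℝ) - x ≠ 0 := by linarith
          field_simp
        rw [e]
        exact mul_le_of_le_one_left (div_nonneg (by positivity) (by linarith)) hq'
      simp only [Complex.ofReal_zero, sub_zero]
      calc _ ≤ (m:ℝ) ^ (1/20:ℝ) * (CB * (x ^ (3/5:ℝ) * (m:ℝ) ^ (-(1/10):ℝ) / (m - x))) :=
            mul_le_mul_of_nonneg_left (hb.trans (mul_le_mul_of_nonneg_left hsc hCB.le)) hmp.le
        _ = CB * ((m:ℝ) ^ (1/20:ℝ) * (x ^ (3/5:ℝ) * (m:ℝ) ^ (-(1/10):ℝ) / (m - x))) := by ring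
        _ ≤ CB * (3 * D) := mul_le_mul_of_nonneg_left (hj.trans (by rw [hD]; linarith)) hCB.le
        _ ≤ _ := by linarith
    · have hmN1 : (N:ℝ) ≤ m := by exact_mod_cast h
      have hmN2 : (m:ℝ) ≤ N + 1 := by exact_mod_cast h'
      have habs : k = 1 + (m - N) := by rw [hk, abs_of_nonneg (by linarith)]
      have hj := jq2 (x := x) (m := m) (k := k) (by linarith) hk1 (by linarith) (by linarith) (by linarith)
      have ha := hA y T hy0 (hτ1.trans hT1)
      have hsc : T ^ (8/5:ℝ) * y ^ (-(11/10):ℝ) ≤ 4 * (x ^ (8/5:ℝ) * (m:ℝ) ^ (-(11/10):ℝ)) := by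
        have e1 : (2*Real.pi) ^ (1/2:ℝ) = (2*Real.pi) ^ (8/5:ℝ) * (2*Real.pi) ^ (-(11/10):ℝ) := by
          rw [← Real.rpow_add hp0]; norm_num
        have e : T ^ (8/5:ℝ) * y ^ (-(11/10):ℝ) = (2*Real.pi) ^ (1/2:ℝ) * (x ^ (8/5:ℝ) * (m:ℝ) ^ (-(11/10):ℝ)) := by
          rw [e1, hyp, hT, Real.mul_rpow hp0.le hx0.le]; ring
        rw [e]
        exact mul_le_mul_of_nonneg_right hq (by positivity)
      have hif : ‖(((if m ≤ N then 2*Real.pi else 0 : ℝ)) : ℂ)‖ ≤ 8 := by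
        rw [Complex.norm_real, Real.norm_eq_abs]
        split_ifs
        · rw [abs_of_pos hp0]; linarith [Real.pi_le_four]
        · simp
      have hP : 0 ≤ x ^ (8/5:ℝ) * (m:ℝ) ^ (-(11/10):ℝ) := by positivity
      calc _ ≤ (m:ℝ) ^ (1/20:ℝ) * ((4 * CA + 8) * (x ^ (8/5:ℝ) * (m:ℝ) ^ (-(11/10):ℝ) + 1)) := by
            refine mul_le_mul_of_nonneg_left ((norm_sub_le _ _).trans ?_) hmp.le
            have : CA * (T ^ (8/5:ℝ) * y ^ (-(11/10):ℝ)) ≤ CA * (4 * (x ^ (8/5:ℝ) * (m:ℝ) ^ (-(11/10):ℝ))) := mul_le_mul_of_nonneg_left hsc hCA.le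
            nlinarith
        _ = (4 * CA + 8) * ((m:ℝ) ^ (1/20:ℝ) * (x ^ (8/5:ℝ) * (m:ℝ) ^ (-(11/10):ℝ) + 1)) := by ring
        _ ≤ (4 * CA + 8) * (24 * D) := mul_le_mul_of_nonneg_left (hj.trans (by rw [hD]; linarith)) (by positivity)
        _ ≤ _ := by linarith


lemma Ph_sum_eq (m : ℕ) (hm : 1 ≤ m) (w : ℂ) :
    Ph (Real.pi/2) (2*Real.pi*m) w + Ph (-(Real.pi/2)) (2*Real.pi*m) w = 2 * (2 * Real.pi : ℂ) ^ (-w) * Complex.Gamma w * Complex.cos (Real.pi * w / 2) * ((m:ℝ):ℂ) ^ (-w) := by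
  unfold Ph
  have e : ((2*Real.pi*(m:ℝ) : ℝ) : ℂ) ^ (-w) = (2 * Real.pi : ℂ) ^ (-w) * ((m:ℝ):ℂ) ^ (-w) := by
    rw [Complex.ofReal_mul, Complex.mul_cpow_ofReal_nonneg (by positivity) (by positivity)]
    push_cast; rfl
  rw [e, Complex.cos]
  push_cast
  rw [show -((Real.pi:ℂ)/2 * I) * w = -(Real.pi * w / 2) * I by ring, show -(-((Real.pi:ℂ)/2) * I) * w = (Real.pi * w / 2) * I by ring]
  ring

lemma QQ_zeta_hasSum (n : ℕ) {w : ℂ} (hw : 1 < w.re) :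
    HasSum (fun m : ℕ => (qa n (m+1) : ℂ) * (Ph (Real.pi/2) (2*Real.pi*((m+1:ℕ):ℝ)) w + Ph (-(Real.pi/2)) (2*Real.pi*((m+1:ℕ):ℝ)) w))
      ((-1)^(n+1) * (QQ n w * riemannZeta (1 - w))) := by
  have h := (qa_hasSum' n hw).mul_left (2 * (2 * Real.pi : ℂ) ^ (-w) * Complex.Gamma w * Complex.cos (Real.pi * w / 2))
  have hfe := riemannZeta_one_sub (s := w) (fun k h0 => by
    rw [h0] at hw; simp at hw; linarith [(Nat.cast_nonneg k : (0:ℝ) ≤ k)]) (fun h0 => by rw [h0] at hw; simp at hw)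
  rw [hfe]
  have e1 : (fun m : ℕ => (qa n (m+1) : ℂ) * (Ph (Real.pi/2) (2*Real.pi*((m+1:ℕ):ℝ)) w + Ph (-(Real.pi/2)) (2*Real.pi*((m+1:ℕ):ℝ)) w)) = fun i : ℕ => 2 * (2 * Real.pi : ℂ) ^ (-w) * Complex.Gamma w * Complex.cos (Real.pi * w / 2) * ((qa n (i + 1) : ℂ) * (((i + 1 : ℕ) : ℝ) : ℂ) ^ (-w)) := by
    funext m
    rw [Ph_sum_eq (m+1) (by lia)]
    ring
  rw [e1, show (-1 : ℂ) ^ (n + 1) * (QQ n w * (2 * (2 * Real.pi : ℂ) ^ (-w) * Complex.Gamma w * Complex.cos (Real.pi * w / 2) * riemannZeta w)) = 2 * (2 * Real.pi : ℂ) ^ (-w) * Complex.Gamma w * Complex.cos (Real.pi * w / 2) * ((-1) ^ (n + 1) * QQ n w * riemannZeta w) by ring]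
  exact h

lemma qa_small (n : ℕ) : ∃ C > 0, ∀ m : ℕ, 1 ≤ m → qa n m ≤ C * (m:ℝ) ^ (1/20:ℝ) := by
  obtain ⟨C, hC, h⟩ := logpow_le (n+1) (ε := 1/20) (by norm_num)
  exact ⟨C, hC, fun m hm => (qa_le n m).trans (h m (by exact_mod_cast hm))⟩

lemma QQ_int_hasSum (n : ℕ) {τ T : ℝ} (hτ : 0 < τ) (hT : τ ≤ T) :
    HasSum (fun m : ℕ => (qa n (m+1) : ℂ) * JJ τ T (m+1))
      ((-1)^(n+1) * ∫ t : ℝ in τ..T, QQ n ((11/10:ℝ) + t * I) * riemannZeta (1 - ((11/10:ℝ) + t * I))) := by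
  obtain ⟨C, hC, hq⟩ := qa_small n
  obtain ⟨M, hM⟩ := (isCompact_Icc (a := τ) (b := T)).exists_bound_of_continuousOn Gam_vcont.continuousOn
  have hM0 : 0 ≤ M := (norm_nonneg _).trans (hM τ ⟨le_rfl, hT⟩)
  have hT0 : 0 < T := hτ.trans_le hT
  have hpi := Real.pi_gt_three
  have hP : ∀ m : ℕ, ∀ θ t : ℝ, |θ| ≤ Real.pi/2 → τ < t → t ≤ T → ‖Ph θ (2*Real.pi*((m+1:ℕ):ℝ)) ((11/10:ℝ) + t * I)‖ ≤ M * Real.exp (Real.pi/2*T) * ((m:ℝ)+1) ^ (-(11/10):ℝ) := by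
    intro m θ t hθ h1 h2
    have hm0 : (0:ℝ) ≤ m := Nat.cast_nonneg m
    rw [Ph_norm (by positivity)]
    refine mul_le_mul (mul_le_mul (hM t ⟨h1.le, h2⟩) (Real.exp_le_exp.2 ?_) (Real.exp_pos _).le hM0) ?_ (by positivity) (by positivity)
    · have := (abs_le.1 hθ).2
      have ht0 : 0 < t := hτ.trans h1
      nlinarith
    · refine Real.rpow_le_rpow_of_nonpos (by positivity) ?_ (by norm_num)
      push_cast
      nlinarith
  have hsm : Summable fun m : ℕ => C * (2 * (M * Real.exp (Real.pi/2*T))) * ((m:ℝ)+1) ^ (-(21/20):ℝ) := (summable_shift (21/20) (by norm_num)).mul_left _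
  have hmain := intervalIntegral.hasSum_integral_of_dominated_convergence (μ := volume) (a := τ) (b := T)
    (F := fun (m : ℕ) (t : ℝ) => (qa n (m+1) : ℂ) * (Ph (Real.pi/2) (2*Real.pi*((m+1:ℕ):ℝ)) ((11/10:ℝ) + t * I) + Ph (-(Real.pi/2)) (2*Real.pi*((m+1:ℕ):ℝ)) ((11/10:ℝ) + t * I)))
    (f := fun t : ℝ => (-1)^(n+1) * (QQ n ((11/10:ℝ) + t * I) * riemannZeta (1 - ((11/10:ℝ) + t * I))))
    (fun (m : ℕ) (_ : ℝ) => C * (2 * (M * Real.exp (Real.pi/2*T))) * ((m:ℝ)+1) ^ (-(21/20):ℝ)) ?_ ?_ ?_ ?_ ?_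
  · rw [intervalIntegral.integral_const_mul] at hmain
    have e1 : (fun m : ℕ => (qa n (m+1) : ℂ) * JJ τ T (m+1)) = (fun m : ℕ => ∫ t : ℝ in τ..T, (qa n (m+1) : ℂ) * (Ph (Real.pi/2) (2*Real.pi*((m+1:ℕ):ℝ)) ((11/10:ℝ) + t * I) + Ph (-(Real.pi/2)) (2*Real.pi*((m+1:ℕ):ℝ)) ((11/10:ℝ) + t * I))) := by
      funext m
      have hm0 : (0:ℝ) < 2*Real.pi*((m+1:ℕ):ℝ) := by positivity
      rw [intervalIntegral.integral_const_mul, intervalIntegral.integral_add ((Ph_cont hm0).intervalIntegrable _ _) ((Ph_cont hm0).intervalIntegrable _ _), JJ]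
    rw [e1]; exact hmain
  · intro m
    have hm0 : (0:ℝ) < 2*Real.pi*((m+1:ℕ):ℝ) := by positivity
    exact (continuous_const.mul ((Ph_cont hm0).add (Ph_cont hm0))).aestronglyMeasurable
  · intro m
    refine Eventually.of_forall fun t ht => ?_
    rw [uIoc_of_le hT] at ht
    have hm0 : (0:ℝ) ≤ m := Nat.cast_nonneg m
    have h1 := hP m (Real.pi/2) t (by rw [abs_of_pos (by positivity)]) ht.1 ht.2
    have h2 := hP m (-(Real.pi/2)) t (by rw [abs_neg, abs_of_pos (by positivity)]) ht.1 ht.2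
    rw [norm_mul, Complex.norm_real, Real.norm_of_nonneg (qa_nonneg _ _)]
    have h3 := hq (m+1) (by lia)
    rw [Nat.cast_add, Nat.cast_one] at h3
    have e : ((m:ℝ)+1) ^ (-(21/20):ℝ) = ((m:ℝ)+1) ^ (1/20:ℝ) * ((m:ℝ)+1) ^ (-(11/10):ℝ) := by
      rw [← Real.rpow_add (by positivity)]; norm_num
    calc _ ≤ (C * ((m:ℝ)+1) ^ (1/20:ℝ)) * (M * Real.exp (Real.pi/2*T) * ((m:ℝ)+1) ^ (-(11/10):ℝ) + M * Real.exp (Real.pi/2*T) * ((m:ℝ)+1) ^ (-(11/10):ℝ)) :=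
          mul_le_mul h3 ((norm_add_le _ _).trans (add_le_add h1 h2)) (norm_nonneg _) (by positivity)
      _ = _ := by rw [e]; ring
  · exact Eventually.of_forall fun t _ => hsm
  · exact intervalIntegrable_const
  · refine Eventually.of_forall fun t _ => ?_
    exact QQ_zeta_hasSum n (by simp; norm_num)

lemma sum_dist_bd : ∃ B > 0, ∀ N : ℕ, Summable (fun m : ℕ => (((m+1:ℕ):ℝ) ^ (-(21/20):ℝ) + (1 + |((m+1:ℕ):ℝ) - N|) ^ (-(21/20):ℝ))) ∧
    ∑' m : ℕ, (((m+1:ℕ):ℝ) ^ (-(21/20):ℝ) + (1 + |((m+1:ℕ):ℝ) - N|) ^ (-(21/20):ℝ)) ≤ B := by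
  have s1 := summable_shift (21/20) (by norm_num)
  have s2 : Summable fun k : ℤ => (1 + |(k:ℝ)|) ^ (-(21/20):ℝ) := by
    refine Summable.of_nat_of_neg ?_ ?_
    · refine s1.congr fun m => ?_
      simp [add_comm]
    · refine s1.congr fun m => ?_
      simp [add_comm]
  refine ⟨(∑' m : ℕ, ((m:ℝ)+1) ^ (-(21/20):ℝ)) + (∑' k : ℤ, (1 + |(k:ℝ)|) ^ (-(21/20):ℝ)) + 1, ?_, fun N => ?_⟩
  · have p1 : 0 ≤ ∑' m : ℕ, ((m:ℝ)+1) ^ (-(21/20):ℝ) := tsum_nonneg fun m => by positivity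
    have p2 : 0 ≤ ∑' k : ℤ, (1 + |(k:ℝ)|) ^ (-(21/20):ℝ) := tsum_nonneg fun m => by positivity
    linarith
  have hinj : Function.Injective fun m : ℕ => ((m + 1 : ℕ) : ℤ) - (N : ℤ) := fun a b h => by simpa using h
  have s3 := s2.comp_injective hinj
  have l3 := tsum_comp_le_tsum_of_inj s2 (fun k => by positivity) hinj
  have e : ((fun k : ℤ => (1 + |(k:ℝ)|) ^ (-(21/20):ℝ)) ∘ fun m : ℕ => ((m + 1 : ℕ) : ℤ) - (N : ℤ)) = fun m : ℕ => (1 + |((m+1:ℕ):ℝ) - N|) ^ (-(21/20):ℝ) := by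
    funext m
    simp
  rw [e] at s3
  rw [e] at l3
  have s1' : Summable fun m : ℕ => ((m+1:ℕ):ℝ) ^ (-(21/20):ℝ) := by simpa using s1
  refine ⟨s1'.add s3, ?_⟩
  rw [s1'.tsum_add s3]
  have e1 : ∑' m : ℕ, ((m+1:ℕ):ℝ) ^ (-(21/20):ℝ) = ∑' m : ℕ, ((m:ℝ)+1) ^ (-(21/20):ℝ) := by simp
  rw [e1]
  linarith

/-- main result of this part -/
lemma QQ_int_asymp (n : ℕ) {τ : ℝ} (hτ : 0 < τ) (hτ1 : τ ≤ 1) : ∃ K > 0, ∀ x : ℝ, 2 ≤ x →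
    ‖(-1)^(n+1) * (∫ t : ℝ in τ..(2*Real.pi*x), QQ n ((11/10:ℝ) + t * I) * riemannZeta (1 - ((11/10:ℝ) + t * I))) - 2 * Real.pi * SS n x‖ ≤ K * x ^ (13/20:ℝ) := by
  obtain ⟨K, hK, hJ⟩ := JJ_bd hτ hτ1
  obtain ⟨C, hC, hq⟩ := qa_small n
  obtain ⟨B, hB, hs⟩ := sum_dist_bd
  refine ⟨C * K * B, by positivity, fun x hx => ?_⟩
  have hpi := Real.pi_gt_three
  have h1 := QQ_int_hasSum n hτ (T := 2*Real.pi*x) (by nlinarith)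
  have h2 : HasSum (fun m : ℕ => (qa n (m+1) : ℂ) * ((if m + 1 ≤ ⌊x⌋₊ then 2*Real.pi else 0 : ℝ) : ℂ)) (2 * Real.pi * SS n x) := by
    have h3 : HasSum (fun m : ℕ => (qa n (m+1) : ℂ) * ((if m + 1 ≤ ⌊x⌋₊ then 2*Real.pi else 0 : ℝ) : ℂ)) (∑ m ∈ Finset.range ⌊x⌋₊, (qa n (m+1) : ℂ) * ((if m + 1 ≤ ⌊x⌋₊ then 2*Real.pi else 0 : ℝ) : ℂ)) := hasSum_sum_of_ne_finset_zero (fun m hm => by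
      rw [Finset.mem_range] at hm
      rw [if_neg (by lia)]; simp)
    suffices e : (2 * Real.pi * SS n x : ℂ) = ∑ m ∈ Finset.range ⌊x⌋₊, (qa n (m+1) : ℂ) * ((if m + 1 ≤ ⌊x⌋₊ then 2*Real.pi else 0 : ℝ) : ℂ) by
      rw [e]; exact h3
    rw [SS, Finset.mul_sum]
    refine Finset.sum_congr rfl fun m hm => ?_
    rw [Finset.mem_range] at hm
    rw [if_pos (by lia)]
    push_cast; ring
  have h3 := h1.sub h2
  obtain ⟨hsm, hle⟩ := hs ⌊x⌋₊
  rw [← h3.tsum_eq]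
  refine (tsum_of_norm_bounded (hsm.hasSum.mul_left (C * K * x ^ (13/20:ℝ))) fun m => ?_).trans ?_
  · rw [← mul_sub, norm_mul, Complex.norm_real, Real.norm_of_nonneg (qa_nonneg _ _)]
    have h4 := hJ x hx (m+1) (by lia)
    have h5 := hq (m+1) (by lia)
    calc _ ≤ (C * ((m+1:ℕ):ℝ) ^ (1/20:ℝ)) * ‖JJ τ (2*Real.pi*x) (m+1) - ((if m+1 ≤ ⌊x⌋₊ then 2*Real.pi else 0 : ℝ) : ℂ)‖ := mul_le_mul_of_nonneg_right h5 (norm_nonneg _)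
      _ = C * (((m+1:ℕ):ℝ) ^ (1/20:ℝ) * ‖JJ τ (2*Real.pi*x) (m+1) - ((if m+1 ≤ ⌊x⌋₊ then 2*Real.pi else 0 : ℝ) : ℂ)‖) := by ring
      _ ≤ C * _ := mul_le_mul_of_nonneg_left h4 hC.le
      _ = _ := by ring
  · calc _ ≤ (C * K * x ^ (13/20:ℝ)) * B := mul_le_mul_of_nonneg_left hle (by positivity)
      _ = _ := by ring

lemma QQ_conj (n : ℕ) {w : ℂ} (hw : 1 < w.re) : QQ n ((starRingEnd ℂ) w) = (starRingEnd ℂ) (QQ n w) := by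
  have h1 := qa_hasSum' n hw
  have hw' : 1 < ((starRingEnd ℂ) w).re := by simpa using hw
  have h2 := qa_hasSum' n hw'
  have h3 := h1.map (starRingEnd ℂ) Complex.continuous_conj
  have e : ((starRingEnd ℂ) ∘ fun m : ℕ => (qa n (m+1) : ℂ) * (((m+1:ℕ):ℝ):ℂ) ^ (-w)) = fun m : ℕ => (qa n (m+1) : ℂ) * (((m+1:ℕ):ℝ):ℂ) ^ (-((starRingEnd ℂ) w)) := by
    funext m
    have ha : ((((m+1:ℕ):ℝ):ℂ)).arg ≠ Real.pi := by
      rw [Complex.arg_ofReal_of_nonneg (by positivity)]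
      exact Real.pi_pos.ne
    have := Complex.cpow_conj (((m+1:ℕ):ℝ):ℂ) (-w) ha
    rw [map_neg, Complex.conj_ofReal] at this
    rw [Function.comp_apply, map_mul, Complex.conj_ofReal, this]
  rw [e] at h3
  have h4 := h2.unique h3
  rw [map_mul, map_mul, map_pow, map_neg, map_one, ← riemannZeta_conj] at h4
  have hz : riemannZeta ((starRingEnd ℂ) w) ≠ 0 := riemannZeta_ne_zero_of_one_le_re hw'.le
  exact mul_left_cancel₀ (pow_ne_zero _ (by norm_num)) (mul_right_cancel₀ hz h4)

/-- main result, on the left edge -/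
lemma left_edge (n : ℕ) {τ : ℝ} (hτ : 0 < τ) (hτ1 : τ ≤ 1) : ∃ K > 0, ∀ x : ℝ, 2 ≤ x →
    ‖(-1)^(n+1) * (∫ t : ℝ in τ..(2*Real.pi*x), QQ n (1 - (((-1/10:ℝ):ℂ) + t * I)) * riemannZeta (((-1/10:ℝ):ℂ) + t * I)) - 2 * Real.pi * SS n x‖ ≤ K * x ^ (13/20:ℝ) := by
  obtain ⟨K, hK, h⟩ := QQ_int_asymp n hτ hτ1
  refine ⟨K, hK, fun x hx => ?_⟩
  refine le_trans (le_of_eq ?_) (h x hx)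
  rw [← Complex.norm_conj]
  congr 1
  rw [map_sub, map_mul, map_mul, map_mul, map_pow, map_neg, map_one, Complex.conj_ofReal, map_ofNat]
  have e1 : (starRingEnd ℂ) (SS n x) = SS n x := by
    simp [SS]
  have e0 : ∀ f : ℝ → ℂ, (starRingEnd ℂ) (∫ t : ℝ in τ..(2*Real.pi*x), f t) = ∫ t : ℝ in τ..(2*Real.pi*x), (starRingEnd ℂ) (f t) := fun f => by
    rw [intervalIntegral, intervalIntegral, map_sub, integral_conj, integral_conj]
  rw [e1, e0]
  congr 2
  refine intervalIntegral.integral_congr fun t _ => ?_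
  have e2 : (1 - (((-1/10:ℝ):ℂ) + t * I)) = (starRingEnd ℂ) ((11/10:ℝ) + t * I) := by
    rw [map_add, map_mul, Complex.conj_ofReal, Complex.conj_ofReal, Complex.conj_I]
    push_cast; ring
  have e3 : (((-1/10:ℝ):ℂ) + t * I) = (starRingEnd ℂ) (1 - ((11/10:ℝ) + t * I)) := by
    rw [map_sub, ← e2, map_one]; ring
  show (starRingEnd ℂ) (QQ n (1 - (((-1/10:ℝ):ℂ) + t * I)) * riemannZeta (((-1/10:ℝ):ℂ) + t * I)) = _
  rw [e2, QQ_conj n (by simp; norm_num), e3, riemannZeta_conj, map_mul, Complex.conj_conj, Complex.conj_conj]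

end SUMJ
end ZS

namespace ZS
section RES
open Complex Filter Topology Asymptotics Set Metric MeasureTheory

/-- boundary integral over a rectangle -/
noncomputable def RI (f : ℂ → ℂ) (a b c d : ℝ) : ℂ :=
  (∫ x : ℝ in a..b, f (x + c * I)) - (∫ x : ℝ in a..b, f (x + d * I)) + I * (∫ y : ℝ in c..d, f (b + y * I)) - I * ∫ y : ℝ in c..d, f (a + y * I)

/-- boundary of a rectangle -/
def Bd (a b c d : ℝ) : Set ℂ := {s | a ≤ s.re ∧ s.re ≤ b ∧ c ≤ s.im ∧ s.im ≤ d ∧ (s.re = a ∨ s.re = b ∨ s.im = c ∨ s.im = d)}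

lemma Bd_h {a b c d : ℝ} (hcd : c ≤ d) {x : ℝ} (hx : x ∈ Icc a b) : (x + c * I : ℂ) ∈ Bd a b c d ∧ (x + d * I : ℂ) ∈ Bd a b c d := by
  obtain ⟨h1, h2⟩ := hx
  constructor <;> simp [Bd, h1, h2, hcd]

lemma Bd_v {a b c d : ℝ} (hab : a ≤ b) {y : ℝ} (hy : y ∈ Icc c d) : (a + y * I : ℂ) ∈ Bd a b c d ∧ (b + y * I : ℂ) ∈ Bd a b c d := by
  obtain ⟨h1, h2⟩ := hy
  constructor <;> simp [Bd, h1, h2, hab]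

lemma RI_congr {f g : ℂ → ℂ} {a b c d : ℝ} (hab : a ≤ b) (hcd : c ≤ d) (h : ∀ s ∈ Bd a b c d, f s = g s) : RI f a b c d = RI g a b c d := by
  unfold RI
  congr 1
  · congr 1
    · congr 1
      · refine intervalIntegral.integral_congr fun x hx => ?_
        rw [uIcc_of_le hab] at hx
        exact h _ (Bd_h hcd hx).1
      · refine intervalIntegral.integral_congr fun x hx => ?_
        rw [uIcc_of_le hab] at hx
        exact h _ (Bd_h hcd hx).2
    · congr 1
      refine intervalIntegral.integral_congr fun x hx => ?_
      rw [uIcc_of_le hcd] at hx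
      exact h _ (Bd_v hab hx).2
  · congr 1
    refine intervalIntegral.integral_congr fun x hx => ?_
    rw [uIcc_of_le hcd] at hx
    exact h _ (Bd_v hab hx).1

lemma int_h {f : ℂ → ℂ} {a b : ℝ} (hab : a ≤ b) {S : Set ℂ} (hf : ContinuousOn f S) {e : ℝ} (he : ∀ x ∈ Icc a b, (x + e * I : ℂ) ∈ S) : IntervalIntegrable (fun x : ℝ => f (x + e * I)) volume a b := by
  refine ContinuousOn.intervalIntegrable ?_
  rw [uIcc_of_le hab]
  exact hf.comp (Continuous.continuousOn (by fun_prop)) he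

lemma int_v {f : ℂ → ℂ} {c d : ℝ} (hcd : c ≤ d) {S : Set ℂ} (hf : ContinuousOn f S) {e : ℝ} (he : ∀ y ∈ Icc c d, (e + y * I : ℂ) ∈ S) : IntervalIntegrable (fun y : ℝ => f (e + y * I)) volume c d := by
  refine ContinuousOn.intervalIntegrable ?_
  rw [uIcc_of_le hcd]
  exact hf.comp (Continuous.continuousOn (by fun_prop)) he

lemma RI_add {f g : ℂ → ℂ} {a b c d : ℝ} (hab : a ≤ b) (hcd : c ≤ d) (hf : ContinuousOn f (Bd a b c d)) (hg : ContinuousOn g (Bd a b c d)) :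
    RI (fun s => f s + g s) a b c d = RI f a b c d + RI g a b c d := by
  unfold RI
  rw [intervalIntegral.integral_add (int_h hab hf fun x hx => (Bd_h hcd hx).1) (int_h hab hg fun x hx => (Bd_h hcd hx).1),
    intervalIntegral.integral_add (int_h hab hf fun x hx => (Bd_h hcd hx).2) (int_h hab hg fun x hx => (Bd_h hcd hx).2),
    intervalIntegral.integral_add (int_v hcd hf fun x hx => (Bd_v hab hx).1) (int_v hcd hg fun x hx => (Bd_v hab hx).1),
    intervalIntegral.integral_add (int_v hcd hf fun x hx => (Bd_v hab hx).2) (int_v hcd hg fun x hx => (Bd_v hab hx).2)]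
  ring

lemma RI_const_mul (k : ℂ) (f : ℂ → ℂ) (a b c d : ℝ) : RI (fun s => k * f s) a b c d = k * RI f a b c d := by
  unfold RI
  simp only [intervalIntegral.integral_const_mul]
  ring

lemma RI_sum {ι : Type} (Z : Finset ι) {f : ι → ℂ → ℂ} {a b c d : ℝ} (hab : a ≤ b) (hcd : c ≤ d) (hf : ∀ i ∈ Z, ContinuousOn (f i) (Bd a b c d)) :
    RI (fun s => ∑ i ∈ Z, f i s) a b c d = ∑ i ∈ Z, RI (f i) a b c d := by
  classical
  induction Z using Finset.induction_on with
  | empty => simp [RI]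
  | insert i Z hi ih =>
    simp only [Finset.sum_insert hi]
    rw [RI_add hab hcd (hf i (Finset.mem_insert_self i Z)) (continuousOn_finset_sum _ fun j hj => hf j (Finset.mem_insert_of_mem hj)), ih fun j hj => hf j (Finset.mem_insert_of_mem hj)]

lemma RI_zero {f : ℂ → ℂ} {a b c d : ℝ} (hab : a ≤ b) (hcd : c ≤ d) (H : ∀ s : ℂ, a ≤ s.re → s.re ≤ b → c ≤ s.im → s.im ≤ d → DifferentiableAt ℂ f s) :
    RI f a b c d = 0 := by
  have := rect_eq f hab hcd H
  unfold RI
  linear_combination this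

lemma RI_inv {ρ : ℂ} {a b c d : ℝ} (ha : a < ρ.re) (hb : ρ.re < b) (hc : c < ρ.im) (hd : ρ.im < d) :
    RI (fun s => 1 / (s - ρ)) a b c d = 2 * Real.pi * I := by
  have hab : a ≤ b := by linarith
  have hcd : c ≤ d := by linarith
  have H : ∀ e : ℝ, e ≠ ρ.im → ∫ x : ℝ in a..b, 1 / ((x:ℂ) + e * I - ρ) = Complex.log (b + e * I - ρ) - Complex.log (a + e * I - ρ) := by
    intro e he
    have hs : ∀ x : ℝ, ((x:ℂ) + e * I - ρ) ∈ Complex.slitPlane := fun x => Or.inr (by simp [sub_eq_zero, he])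
    rw [intervalIntegral.integral_eq_sub_of_hasDerivAt (f := fun x : ℝ => Complex.log ((x:ℂ) + e * I - ρ)) (f' := fun x : ℝ => 1 / ((x:ℂ) + e * I - ρ))]
    · intro x _
      have h1 : HasDerivAt (fun x : ℝ => (x:ℂ) + e * I - ρ) 1 x := ((Complex.ofRealCLM.hasDerivAt (x := x)).add_const _).sub_const _
      exact h1.clog_real (hs x)
    · refine Continuous.intervalIntegrable (continuous_const.div (by fun_prop) fun x => Complex.slitPlane_ne_zero (hs x)) _ _
  have hy : ∀ e : ℝ, ∀ y : ℝ, HasDerivAt (fun y : ℝ => (e:ℂ) + y * I - ρ) I y := fun e y => by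
    have h1 : HasDerivAt (fun y : ℝ => (y:ℂ)) 1 y := Complex.ofRealCLM.hasDerivAt (x := y)
    exact (((h1.mul_const I).const_add (e:ℂ)).sub_const ρ).congr_deriv (by ring)
  have hR : I * ∫ y : ℝ in c..d, 1 / ((b:ℂ) + y * I - ρ) = Complex.log (b + d * I - ρ) - Complex.log (b + c * I - ρ) := by
    have hs : ∀ y : ℝ, ((b:ℂ) + y * I - ρ) ∈ Complex.slitPlane := fun y => Or.inl (by simp [hb])
    rw [← intervalIntegral.integral_const_mul, intervalIntegral.integral_eq_sub_of_hasDerivAt (f := fun y : ℝ => Complex.log ((b:ℂ) + y * I - ρ)) (f' := fun y : ℝ => I * (1 / ((b:ℂ) + y * I - ρ)))]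
    · intro y _
      exact ((hy b y).clog_real (hs y)).congr_deriv (by ring)
    · refine Continuous.intervalIntegrable (continuous_const.mul (continuous_const.div (by fun_prop) fun x => Complex.slitPlane_ne_zero (hs x))) _ _
  have hL : I * ∫ y : ℝ in c..d, 1 / ((a:ℂ) + y * I - ρ) = Complex.log (-(a + d * I - ρ)) - Complex.log (-(a + c * I - ρ)) := by
    have hs : ∀ y : ℝ, (-((a:ℂ) + y * I - ρ)) ∈ Complex.slitPlane := fun y => Or.inl (by simp [ha])
    have hs0 : ∀ y : ℝ, ((a:ℂ) + y * I - ρ) ≠ 0 := fun y => neg_ne_zero.1 (Complex.slitPlane_ne_zero (hs y))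
    rw [← intervalIntegral.integral_const_mul, intervalIntegral.integral_eq_sub_of_hasDerivAt (f := fun y : ℝ => Complex.log (-((a:ℂ) + y * I - ρ))) (f' := fun y : ℝ => I * (1 / ((a:ℂ) + y * I - ρ)))]
    · intro y _
      exact ((hy a y).fun_neg.clog_real (hs y)).congr_deriv (by rw [neg_div_neg_eq]; ring)
    · refine Continuous.intervalIntegrable (continuous_const.mul (continuous_const.div (by fun_prop) hs0)) _ _
  unfold RI
  rw [H c hc.ne, H d hd.ne', hR, hL]
  have k1 : Complex.log (-((a:ℂ) + d * I - ρ)) = Complex.log ((a:ℂ) + d * I - ρ) - Real.pi * I := by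
    rw [Complex.log, Complex.log, norm_neg, Complex.arg_neg_eq_arg_sub_pi_of_im_pos (by simp [hd])]
    push_cast; ring
  have k2 : Complex.log (-((a:ℂ) + c * I - ρ)) = Complex.log ((a:ℂ) + c * I - ρ) + Real.pi * I := by
    rw [Complex.log, Complex.log, norm_neg, Complex.arg_neg_eq_arg_add_pi_of_im_neg (by simp [hc])]
    push_cast; ring
  rw [k1, k2]
  ring

lemma RI_residue {f h : ℂ → ℂ} (hf : Differentiable ℂ f) {s₀ : ℂ} (h0 : f s₀ ≠ 0) {U : Set ℂ} (hU : IsOpen U) (hh : DifferentiableOn ℂ h U)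
    {a b c d : ℝ} (hab : a ≤ b) (hcd : c ≤ d) (hsub : ∀ s : ℂ, a ≤ s.re → s.re ≤ b → c ≤ s.im → s.im ≤ d → s ∈ U)
    (hbd : ∀ s ∈ Bd a b c d, f s ≠ 0) (Z : Finset ℂ) (hZ : ∀ s : ℂ, s ∈ Z ↔ (a ≤ s.re ∧ s.re ≤ b ∧ c ≤ s.im ∧ s.im ≤ d ∧ f s = 0)) :
    RI (fun s => deriv f s / f s * h s) a b c d = 2 * Real.pi * I * ∑ ρ ∈ Z, (analyticOrderNatAt f ρ : ℂ) * h ρ := by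
  obtain ⟨g, hg, hgZ, hfg⟩ := factor_all hf h0 Z
  have hZU : ∀ ρ ∈ Z, ρ ∈ U := fun ρ hρ => by
    obtain ⟨h1, h2, h3, h4, _⟩ := (hZ ρ).1 hρ
    exact hsub ρ h1 h2 h3 h4
  have hBZ : ∀ s ∈ Bd a b c d, ∀ ρ ∈ Z, s ≠ ρ := fun s hs ρ hρ h => hbd s hs (by rw [h]; exact ((hZ ρ).1 hρ).2.2.2.2)
  have hBU : Bd a b c d ⊆ U := fun s hs => hsub s hs.1 hs.2.1 hs.2.2.1 hs.2.2.2.1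
  have hgne : ∀ s : ℂ, a ≤ s.re → s.re ≤ b → c ≤ s.im → s.im ≤ d → g s ≠ 0 := by
    intro s h1 h2 h3 h4 hgs
    have : f s = 0 := by rw [hfg, hgs, mul_zero]
    exact hgZ s ((hZ s).2 ⟨h1, h2, h3, h4, this⟩) hgs
  have hds : ∀ ρ ∈ Z, DifferentiableOn ℂ (dslope h ρ) U := fun ρ hρ => (Complex.differentiableOn_dslope (hU.mem_nhds (hZU ρ hρ))).2 hh
  have hP1 : ∀ s : ℂ, a ≤ s.re → s.re ≤ b → c ≤ s.im → s.im ≤ d → DifferentiableAt ℂ (fun s => deriv g s / g s * h s + ∑ ρ ∈ Z, (analyticOrderNatAt f ρ : ℂ) * dslope h ρ s) s := by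
    intro s h1 h2 h3 h4
    have hsU := hU.mem_nhds (hsub s h1 h2 h3 h4)
    have hdg : DifferentiableAt ℂ (deriv g) s := (hg.analyticAt s).deriv.differentiableAt
    exact ((hdg.div (hg s) (hgne s h1 h2 h3 h4)).mul (hh.differentiableAt hsU)).add
      (DifferentiableAt.fun_sum fun ρ hρ => (differentiableAt_const _).mul ((hds ρ hρ).differentiableAt hsU))
  have hP2 : ∀ ρ ∈ Z, ContinuousOn (fun s => ((analyticOrderNatAt f ρ : ℂ) * h ρ) * (1 / (s - ρ))) (Bd a b c d) := by
    intro ρ hρ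
    refine continuousOn_const.mul (continuousOn_const.div (by fun_prop) fun s hs => sub_ne_zero.2 (hBZ s hs ρ hρ))
  rw [RI_congr (g := fun s => (deriv g s / g s * h s + ∑ ρ ∈ Z, (analyticOrderNatAt f ρ : ℂ) * dslope h ρ s) + ∑ ρ ∈ Z, ((analyticOrderNatAt f ρ : ℂ) * h ρ) * (1 / (s - ρ))) hab hcd,
    RI_add hab hcd, RI_zero hab hcd hP1, RI_sum Z hab hcd hP2, zero_add, Finset.mul_sum]
  · refine Finset.sum_congr rfl fun ρ hρ => ?_
    obtain ⟨h1, h2, h3, h4, h5⟩ := (hZ ρ).1 hρ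
    have hn : ρ ∉ Bd a b c d := fun hB => hbd ρ hB h5
    have hn' : ¬ (ρ.re = a ∨ ρ.re = b ∨ ρ.im = c ∨ ρ.im = d) := fun hB => hn ⟨h1, h2, h3, h4, hB⟩
    push Not at hn'
    rw [RI_const_mul, RI_inv (lt_of_le_of_ne h1 hn'.1.symm) (lt_of_le_of_ne h2 hn'.2.1) (lt_of_le_of_ne h3 hn'.2.2.1.symm) (lt_of_le_of_ne h4 hn'.2.2.2)]
    ring
  · exact fun s hs => (hP1 s hs.1 hs.2.1 hs.2.2.1 hs.2.2.2.1).continuousAt.continuousWithinAt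
  · exact continuousOn_finset_sum _ hP2
  · intro s hs
    rw [logDeriv_factor hfg (hg s) (hbd s hs) (hBZ s hs), add_mul, add_assoc, ← Finset.sum_add_distrib, Finset.sum_mul]
    congr 1
    refine Finset.sum_congr rfl fun ρ hρ => ?_
    have hne := hBZ s hs ρ hρ
    have hne' := sub_ne_zero.2 hne
    rw [dslope_of_ne _ hne, slope_def_field]
    field_simp
    ring

end RES
end ZS

namespace ZS
section EDG
open Complex Filter Topology Asymptotics Set Metric MeasureTheory

lemma QQ_bdd (n : ℕ) : ∃ C > 0, ∀ s : ℂ, 11/10 ≤ s.re → ‖QQ n s‖ ≤ C := by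
  set f : ℕ → ℂ := LSeries.logMul^[n] (fun m => ((ArithmeticFunction.vonMangoldt m : ℝ) : ℂ)) with hf
  have hsm : ∀ s : ℂ, 1 < s.re → LSeriesSummable f s := by
    intro s hs
    apply LSeriesSummable_of_abscissaOfAbsConv_lt_re
    rw [hf, LSeries.absicssaOfAbsConv_logPowMul]
    exact absc_Lambda.trans_lt (by exact_mod_cast hs)
  have hre : 1 < (((11/10:ℝ):ℂ)).re := by simp; norm_num
  have hs0 := (hsm ((11/10:ℝ):ℂ) hre).norm
  refine ⟨(∑' m, ‖LSeries.term f ((11/10:ℝ):ℂ) m‖) + 1, ?_, fun s hs => ?_⟩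
  · have : 0 ≤ ∑' m, ‖LSeries.term f ((11/10:ℝ):ℂ) m‖ := tsum_nonneg fun m => norm_nonneg _
    linarith
  have hs1 : 1 < s.re := by linarith
  have h1 : LSeries.abscissaOfAbsConv (fun m => ((ArithmeticFunction.vonMangoldt m : ℝ) : ℂ)) < s.re := absc_Lambda.trans_lt (by exact_mod_cast hs1)
  have h2 := LSeries_iteratedDeriv n h1
  have h3 : iteratedDeriv n (LSeries (fun m => ((ArithmeticFunction.vonMangoldt m : ℝ) : ℂ))) s = - QQ n s := by
    rw [QQ, ← iteratedDeriv_fun_neg]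
    apply Filter.EventuallyEq.iteratedDeriv_eq
    have : {z : ℂ | 1 < z.re} ∈ 𝓝 s := (isOpen_lt continuous_const Complex.continuous_re).mem_nhds hs1
    filter_upwards [this] with z hz
    rw [ArithmeticFunction.LSeries_vonMangoldt_eq_deriv_riemannZeta_div hz, neg_div]
  have h4 : ‖QQ n s‖ = ‖LSeries f s‖ := by
    rw [← norm_neg, ← h3, h2, norm_mul, norm_pow, norm_neg, norm_one, one_pow, one_mul]
  rw [h4]
  have h5 : ‖LSeries f s‖ ≤ ∑' m, ‖LSeries.term f ((11/10:ℝ):ℂ) m‖ :=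
    tsum_of_norm_bounded hs0.hasSum fun m => LSeries.norm_term_le_of_re_le_re f (by simpa using hs) m
  linarith

/-- the factor in the functional equation -/
noncomputable def XX (s : ℂ) : ℂ := 2 * (2 * Real.pi : ℂ) ^ (-s) * Complex.Gamma s * Complex.cos (Real.pi * s / 2)

lemma not_neg_nat {s : ℂ} (h : 0 < s.im) (n : ℕ) : s ≠ -n := fun e => by rw [e] at h; simp at h

lemma zeta_FE {s : ℂ} (h : 0 < s.im) : riemannZeta (1 - s) = XX s * riemannZeta s :=
  riemannZeta_one_sub (not_neg_nat h) (fun e => by rw [e] at h; simp at h)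

lemma tan_bd {τ : ℝ} (hτ : 0 < τ) {s : ℂ} (hs : τ ≤ s.im) : Complex.cos (Real.pi * s / 2) ≠ 0 ∧
    ‖Complex.sin (Real.pi * s / 2) / Complex.cos (Real.pi * s / 2)‖ ≤ 2 / (1 - Real.exp (-(Real.pi * τ))) := by
  set z : ℂ := Real.pi * s / 2 with hz
  set y : ℝ := Real.pi * s.im / 2 with hy
  have him : z.im = y := by
    rw [hz, hy, show (Real.pi * s / 2 : ℂ) = ((Real.pi/2 : ℝ) : ℂ) * s by push_cast; ring, Complex.im_ofReal_mul]
    ring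
  have hpi := Real.pi_pos
  have hyτ : Real.pi * τ ≤ 2 * y := by rw [hy]; nlinarith
  have hy0 : 0 < y := by nlinarith
  have n1 : ‖Complex.exp (z * I)‖ = Real.exp (-y) := by rw [Complex.norm_exp]; simp [him]
  have n2 : ‖Complex.exp (-z * I)‖ = Real.exp y := by rw [Complex.norm_exp]; simp [him]
  have hE : Real.exp (-y) = Real.exp y * Real.exp (-(2*y)) := by rw [← Real.exp_add]; congr 1; ring
  have hq : Real.exp (-(2*y)) ≤ Real.exp (-(Real.pi*τ)) := Real.exp_le_exp.2 (by linarith)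
  have hq1 : Real.exp (-(Real.pi*τ)) < 1 := Real.exp_lt_one_iff.2 (by nlinarith)
  have hlow : Real.exp y * (1 - Real.exp (-(Real.pi * τ))) / 2 ≤ ‖Complex.cos z‖ := by
    rw [Complex.cos, norm_div, show ‖(2:ℂ)‖ = 2 by simp]
    refine div_le_div_of_nonneg_right ?_ (by norm_num)
    have := norm_sub_norm_le (Complex.exp (-z * I)) (-Complex.exp (z * I))
    rw [norm_neg, n1, n2, sub_neg_eq_add, add_comm (Complex.exp (-z * I))] at this
    refine le_trans ?_ this
    rw [hE]
    nlinarith [Real.exp_pos y]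
  have hpos : 0 < Real.exp y * (1 - Real.exp (-(Real.pi * τ))) / 2 := by
    have := Real.exp_pos y
    have : 0 < 1 - Real.exp (-(Real.pi * τ)) := by linarith
    positivity
  have hup : ‖Complex.sin z‖ ≤ Real.exp y := by
    rw [Complex.sin, norm_div, norm_mul, Complex.norm_I, show ‖(2:ℂ)‖ = 2 by simp]
    have := norm_sub_le (Complex.exp (-z * I)) (Complex.exp (z * I))
    rw [n1, n2] at this
    have : Real.exp (-y) ≤ Real.exp y := Real.exp_le_exp.2 (by linarith)
    linarith
  refine ⟨norm_pos_iff.1 (hpos.trans_le hlow), ?_⟩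
  rw [norm_div]
  calc _ ≤ Real.exp y / (Real.exp y * (1 - Real.exp (-(Real.pi * τ))) / 2) := div_le_div₀ (Real.exp_pos y).le hup hpos hlow
    _ = _ := by
      have := (Real.exp_pos y).ne'
      have : 1 - Real.exp (-(Real.pi * τ)) ≠ 0 := by linarith
      field_simp

lemma XX_analytic {s : ℂ} (h : 0 < s.im) : AnalyticAt ℂ XX s := by
  have hU : IsOpen {s : ℂ | 0 < s.im} := isOpen_lt continuous_const Complex.continuous_im
  have hd : DifferentiableOn ℂ XX {s : ℂ | 0 < s.im} := fun z hz => by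
    refine DifferentiableAt.differentiableWithinAt ?_
    unfold XX
    have hp : (2 * Real.pi : ℂ) ≠ 0 := by simp [Real.pi_ne_zero]
    have g1 : DifferentiableAt ℂ (fun s : ℂ => (2 * Real.pi : ℂ) ^ (-s)) z := (differentiableAt_id.neg).const_cpow (Or.inl hp)
    have g2 := Complex.differentiableAt_Gamma z (not_neg_nat hz)
    have g3 : DifferentiableAt ℂ (fun s : ℂ => Complex.cos (Real.pi * s / 2)) z := by fun_prop
    exact ((g1.const_mul 2).mul g2).mul g3
  exact hd.analyticAt (hU.mem_nhds h)

lemma XX_ne {s : ℂ} (h : 0 < s.im) : XX s ≠ 0 := by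
  have hp : (2 * Real.pi : ℂ) ≠ 0 := by simp [Real.pi_ne_zero]
  unfold XX
  refine mul_ne_zero (mul_ne_zero (mul_ne_zero two_ne_zero ?_) (Complex.Gamma_ne_zero (not_neg_nat h))) (tan_bd h le_rfl).1
  rw [Complex.cpow_def_of_ne_zero hp]
  exact Complex.exp_ne_zero _

/-- reflected entire zeta -/
noncomputable def ZR (s : ℂ) : ℂ := riemannZeta₁ (1 - s)

lemma ZR_diff : Differentiable ℂ ZR := differentiable_riemannZeta₁.comp (by fun_prop)

lemma ZR_eq {s : ℂ} (h : 0 < s.im) : ZR s = (-s * XX s) * riemannZeta s := by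
  rw [ZR, zeta1_eq _ (fun e => by
    have : s = 0 := by linear_combination -e
    rw [this] at h; simp at h), zeta_FE h]
  ring

lemma ne_zero_of_im {s : ℂ} (h : 0 < s.im) : s ≠ 0 := fun e => by rw [e] at h; simp at h

lemma ZR_zero_iff {s : ℂ} (h : 0 < s.im) : ZR s = 0 ↔ riemannZeta s = 0 := by
  rw [ZR_eq h, mul_eq_zero]
  exact ⟨fun h' => h'.resolve_left (mul_ne_zero (neg_ne_zero.2 (ne_zero_of_im h)) (XX_ne h)), Or.inr⟩

lemma ZR_ne0 : ZR (-1) ≠ 0 := zeta1_ne_of_one_le (by norm_num)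

lemma zeta_analytic {s : ℂ} (h : 0 < s.im) : AnalyticAt ℂ riemannZeta s := by
  have hU : IsOpen {s : ℂ | 0 < s.im} := isOpen_lt continuous_const Complex.continuous_im
  have hd : DifferentiableOn ℂ riemannZeta {s : ℂ | 0 < s.im} := fun z hz =>
    (differentiableAt_riemannZeta (fun e => by rw [e] at hz; simp at hz)).differentiableWithinAt
  exact hd.analyticAt (hU.mem_nhds h)

lemma order_eq {ρ : ℂ} (h : 0 < ρ.im) : sInf {k : ℕ | iteratedDeriv k riemannZeta ρ ≠ 0} = analyticOrderNatAt ZR ρ := by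
  have hU : IsOpen {s : ℂ | 0 < s.im} := isOpen_lt continuous_const Complex.continuous_im
  have e1 : analyticOrderAt ZR ρ = analyticOrderAt riemannZeta ρ := by
    have hc : ZR =ᶠ[𝓝 ρ] (fun s => -s * XX s) * riemannZeta := by
      filter_upwards [hU.mem_nhds h] with s hs
      exact ZR_eq hs
    have ha : AnalyticAt ℂ (fun s => -s * XX s) ρ := (analyticAt_id.neg).mul (XX_analytic h)
    rw [analyticOrderAt_congr hc, analyticOrderAt_mul ha (zeta_analytic h), (ha.analyticOrderAt_eq_zero).2, zero_add]
    exact mul_ne_zero (neg_ne_zero.2 (ne_zero_of_im h)) (XX_ne h)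
  have h2 := Nat.cast_analyticOrderNatAt (order_ne_top ZR_diff ZR_ne0 ρ)
  rw [e1] at h2
  have h3 := (analyticOrderAt_eq_nat_iff_iteratedDeriv_eq_zero (zeta_analytic h)).1 h2.symm
  refine le_antisymm (Nat.sInf_le h3.2) (le_csInf ⟨_, h3.2⟩ fun k hk => ?_)
  by_contra hlt
  exact hk (h3.1 k (by lia))

lemma ZR_logDeriv {s : ℂ} (h : 0 < s.im) (hz : riemannZeta (1 - s) ≠ 0) : deriv ZR s / ZR s = 1 / s - QQ 0 (1 - s) := by
  have hs0 := ne_zero_of_im h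
  have h1 : (1 - s) ≠ 1 := fun e => hs0 (by linear_combination -e)
  have h2 := logderiv_rel (1 - s) h1 hz
  have h3 : HasDerivAt ZR (deriv riemannZeta₁ (1 - s) * (-1)) s := by
    have := (differentiable_riemannZeta₁ (1 - s)).hasDerivAt
    exact HasDerivAt.comp (h₂ := riemannZeta₁) (h := fun s : ℂ => 1 - s) s this ((hasDerivAt_id s).const_sub 1)
  rw [h3.deriv, QQ, iteratedDeriv_zero, h2, ZR]
  rw [show (1 - s - 1) = -s by ring]
  field_simp
  ring

lemma FE_log {s : ℂ} (h : 0 < s.im) (hs : 1 < s.re) : QQ 0 (1 - s) = Real.log (2 * Real.pi) - Complex.digamma s + Real.pi / 2 * (Complex.sin (Real.pi * s / 2) / Complex.cos (Real.pi * s / 2)) - QQ 0 s := by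
  have hU : IsOpen {s : ℂ | 0 < s.im} := isOpen_lt continuous_const Complex.continuous_im
  have hs0 := ne_zero_of_im h
  have h1 : (1 - s) ≠ 1 := fun e => hs0 (by linear_combination -e)
  have hp : (2 * Real.pi : ℂ) ≠ 0 := by simp [Real.pi_ne_zero]
  have e1 : logDeriv (fun s => riemannZeta (1 - s)) s = logDeriv (fun s => XX s * riemannZeta s) s := by
    have : (fun s => riemannZeta (1 - s)) =ᶠ[𝓝 s] (fun s => XX s * riemannZeta s) := by
      filter_upwards [hU.mem_nhds h] with z hz
      exact zeta_FE hz
    rw [logDeriv, logDeriv, Pi.div_apply, Pi.div_apply, this.deriv_eq, this.eq_of_nhds]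
  have hz : riemannZeta s ≠ 0 := riemannZeta_ne_zero_of_one_le_re hs.le
  have d2 : DifferentiableAt ℂ riemannZeta s := (zeta_analytic h).differentiableAt
  have g1 : HasDerivAt (fun s : ℂ => (2 * Real.pi : ℂ) ^ (-s)) ((2 * Real.pi : ℂ) ^ (-s) * Complex.log (2 * Real.pi) * (-1)) s := ((hasDerivAt_id s).neg).const_cpow (Or.inl hp)
  have g2 := Complex.differentiableAt_Gamma s (not_neg_nat h)
  have g3 : HasDerivAt (fun s : ℂ => Complex.cos (Real.pi * s / 2)) (-Complex.sin (Real.pi * s / 2) * (Real.pi / 2)) s := by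
    have : HasDerivAt (fun s : ℂ => (Real.pi * s / 2 : ℂ)) (Real.pi / 2) s := by
      simpa using ((hasDerivAt_id s).const_mul (Real.pi : ℂ)).div_const 2
    exact this.ccos
  have q0 : (2 * Real.pi : ℂ) ^ (-s) ≠ 0 := by
    rw [Complex.cpow_def_of_ne_zero hp]
    exact Complex.exp_ne_zero _
  have q2 := Complex.Gamma_ne_zero (not_neg_nat h)
  have q3 := (tan_bd h (le_refl s.im)).1
  have eX : logDeriv XX s = - Complex.log (2 * Real.pi) + Complex.digamma s - Real.pi / 2 * (Complex.sin (Real.pi * s / 2) / Complex.cos (Real.pi * s / 2)) := by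
    have : XX = fun s => (2 * (2 * Real.pi : ℂ) ^ (-s) * Complex.Gamma s) * Complex.cos (Real.pi * s / 2) := rfl
    rw [this, logDeriv_mul (f := fun s : ℂ => 2 * (2 * Real.pi : ℂ) ^ (-s) * Complex.Gamma s) (g := fun s : ℂ => Complex.cos (Real.pi * s / 2)) s (mul_ne_zero (mul_ne_zero two_ne_zero q0) q2) q3 ((g1.differentiableAt.const_mul 2).mul g2) g3.differentiableAt,
      logDeriv_mul (f := fun s : ℂ => 2 * (2 * Real.pi : ℂ) ^ (-s)) (g := Complex.Gamma) s (mul_ne_zero two_ne_zero q0) q2 (g1.differentiableAt.const_mul 2) g2, Complex.digamma_def]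
    rw [logDeriv_apply (fun s : ℂ => 2 * (2 * Real.pi : ℂ) ^ (-s)), logDeriv_apply (fun s : ℂ => Complex.cos (Real.pi * s / 2)), (g1.const_mul 2).deriv, g3.deriv]
    field_simp
    ring
  have e2 : logDeriv (fun s => riemannZeta (1 - s)) s = - QQ 0 (1 - s) := by
    have h3 : HasDerivAt (fun s => riemannZeta (1 - s)) (deriv riemannZeta (1 - s) * (-1)) s := by
      have := (differentiableAt_riemannZeta h1).hasDerivAt
      exact HasDerivAt.comp (h₂ := riemannZeta) (h := fun s : ℂ => 1 - s) s this ((hasDerivAt_id s).const_sub 1)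
    rw [logDeriv_apply, h3.deriv, QQ, iteratedDeriv_zero]
    ring
  rw [e2, logDeriv_mul s (XX_ne h) hz (XX_analytic h).differentiableAt d2, eX] at e1
  have e3 : logDeriv riemannZeta s = QQ 0 s := by rw [logDeriv_apply, QQ, iteratedDeriv_zero]
  have e4 : Complex.log (2 * Real.pi) = Real.log (2 * Real.pi) := by
    rw [Complex.ofReal_log (by positivity)]; push_cast; rfl
  rw [e3, e4] at e1
  linear_combination -e1

lemma refl_bd {τ : ℝ} (hτ : 0 < τ) : ∃ C > 0, ∀ s : ℂ, 11/10 ≤ s.re → τ ≤ s.im → ‖QQ 0 (1 - s)‖ ≤ C * (LL s.im + s.re) := by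
  obtain ⟨C1, hC1, h1⟩ := digamma_bd
  obtain ⟨C2, hC2, h2⟩ := QQ_bdd 0
  set t0 : ℝ := 2 / (1 - Real.exp (-(Real.pi * τ))) with ht0
  have hpi := Real.pi_gt_three
  have hpi4 := Real.pi_lt_four
  have ht00 : 0 < t0 := by
    have : Real.exp (-(Real.pi*τ)) < 1 := Real.exp_lt_one_iff.2 (by nlinarith)
    have : 0 < 1 - Real.exp (-(Real.pi*τ)) := by linarith
    positivity
  have hl : 0 < Real.log (2 * Real.pi) := Real.log_pos (by linarith)
  refine ⟨Real.log (2 * Real.pi) + C1 + 1 + 2 * t0 + C2, by positivity, fun s hs ht => ?_⟩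
  have him : 0 < s.im := by linarith
  rw [FE_log him (by linarith)]
  have a1 := h1 s (by linarith)
  have a2 := h2 s hs
  have a3 := (tan_bd hτ ht).2
  have a4 := one_le_LL s.im
  have a5 : ‖(Real.pi / 2 * (Complex.sin (Real.pi * s / 2) / Complex.cos (Real.pi * s / 2)) : ℂ)‖ ≤ 2 * t0 := by
    rw [norm_mul]
    refine mul_le_mul ?_ a3 (norm_nonneg _) (by norm_num)
    rw [show (Real.pi / 2 : ℂ) = ((Real.pi/2 : ℝ) : ℂ) by push_cast; rfl, Complex.norm_real, Real.norm_of_nonneg (by linarith)]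
    linarith
  have a6 : ‖((Real.log (2 * Real.pi) : ℝ) : ℂ)‖ = Real.log (2 * Real.pi) := by
    rw [Complex.norm_real, Real.norm_of_nonneg hl.le]
  have b1 := norm_sub_le (Real.log (2 * Real.pi) - Complex.digamma s + Real.pi / 2 * (Complex.sin (Real.pi * s / 2) / Complex.cos (Real.pi * s / 2))) (QQ 0 s)
  have b2 := norm_add_le (Real.log (2 * Real.pi) - Complex.digamma s) (Real.pi / 2 * (Complex.sin (Real.pi * s / 2) / Complex.cos (Real.pi * s / 2)))
  have b3 := norm_sub_le ((Real.log (2 * Real.pi) : ℝ) : ℂ) (Complex.digamma s)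
  have hw : 1 ≤ LL s.im + s.re := by linarith
  calc _ ≤ Real.log (2 * Real.pi) + (C1 * LL s.im + s.re) + 2 * t0 + C2 := by linarith
    _ ≤ _ := by
      have c1 : Real.log (2 * Real.pi) * 1 ≤ Real.log (2 * Real.pi) * (LL s.im + s.re) := mul_le_mul_of_nonneg_left hw hl.le
      have c2 : t0 * 1 ≤ t0 * (LL s.im + s.re) := mul_le_mul_of_nonneg_left hw ht00.le
      have c3 : C2 * 1 ≤ C2 * (LL s.im + s.re) := mul_le_mul_of_nonneg_left hw hC2.le
      have c4 : C1 * LL s.im ≤ C1 * (LL s.im + s.re) := mul_le_mul_of_nonneg_left (by linarith) hC1.le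
      nlinarith

end EDG
end ZS

namespace ZS
section CON
open Complex Filter Topology Asymptotics Set Metric MeasureTheory

/-- the integrand on the contour -/
noncomputable def FF (n : ℕ) (s : ℂ) : ℂ := QQ 0 (1 - s) * iteratedDeriv n riemannZeta s

lemma zeta_iter_analytic {s : ℂ} (h : 0 < s.im) (n : ℕ) : AnalyticAt ℂ (iteratedDeriv n riemannZeta) s := by
  induction n with
  | zero => simpa using zeta_analytic h
  | succ n ih => rw [iteratedDeriv_succ]; exact ih.deriv

lemma Bd_ne {τ T B : ℝ} (hτ : 0 < τ) (hz1 : ∀ ρ : ℂ, riemannZeta ρ = 0 → 0 < ρ.im → τ < ρ.im) (hz2 : ∀ ρ : ℂ, riemannZeta ρ = 0 → ρ.im ≠ T) (hB : 1 ≤ B)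
    {s : ℂ} (hs : s ∈ Bd (-1/10) B τ T) : ZR s ≠ 0 := by
  obtain ⟨h1, h2, h3, h4, h5⟩ := hs
  have him : 0 < s.im := by linarith
  intro h0
  rw [ZR_zero_iff him] at h0
  have h6 := zero_nontrivial h0 him.ne'
  rcases h5 with h | h | h | h
  · linarith
  · linarith
  · linarith [hz1 s h0 him]
  · exact hz2 s h0 h

lemma contour (n : ℕ) {τ T B : ℝ} (hτ : 0 < τ) (hT : τ ≤ T) (hz1 : ∀ ρ : ℂ, riemannZeta ρ = 0 → 0 < ρ.im → τ < ρ.im) (hz2 : ∀ ρ : ℂ, riemannZeta ρ = 0 → ρ.im ≠ T) (hB : 1 ≤ B)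
    (Z : Finset ℂ) (hZ : ∀ s : ℂ, s ∈ Z ↔ (riemannZeta s = 0 ∧ 0 < s.im ∧ s.im ≤ T)) :
    2 * Real.pi * I * ∑ ρ ∈ Z, (analyticOrderNatAt ZR ρ : ℂ) * iteratedDeriv n riemannZeta ρ = - RI (FF n) (-1/10) B τ T := by
  have hU : IsOpen {s : ℂ | 0 < s.im} := isOpen_lt continuous_const Complex.continuous_im
  have hab : (-1/10:ℝ) ≤ B := by linarith
  have hbd := fun s hs => Bd_ne hτ hz1 hz2 hB (s := s) hs
  have hpos : ∀ s ∈ Bd (-1/10) B τ T, 0 < s.im := fun s hs => hτ.trans_le hs.2.2.1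
  have h1 := RI_residue (h := iteratedDeriv n riemannZeta) ZR_diff ZR_ne0 hU (fun s hs => (zeta_iter_analytic hs n).differentiableAt.differentiableWithinAt) hab hT
    (fun s _ _ h _ => hτ.trans_le h) hbd Z (fun s => by
      rw [hZ]
      constructor
      · rintro ⟨k1, k2, k3⟩
        have := zero_nontrivial k1 k2.ne'
        exact ⟨by linarith, by linarith, (hz1 s k1 k2).le, k3, (ZR_zero_iff k2).2 k1⟩
      · rintro ⟨_, _, k3, k4, k5⟩
        have k2 : 0 < s.im := hτ.trans_le k3
        exact ⟨(ZR_zero_iff k2).1 k5, k2, k4⟩)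
  rw [← h1]
  have c1 : ContinuousOn (fun s => (-1) * (deriv ZR s / ZR s * iteratedDeriv n riemannZeta s)) (Bd (-1/10) B τ T) := fun s hs => by
    have d1 : ContinuousAt (deriv ZR) s := (ZR_diff.analyticAt s).deriv.continuousAt
    exact (continuousAt_const.mul ((d1.div (ZR_diff s).continuousAt (hbd s hs)).mul (zeta_iter_analytic (hpos s hs) n).continuousAt)).continuousWithinAt
  have c2' : ∀ s : ℂ, 0 < s.im → DifferentiableAt ℂ (fun s => 1 / s * iteratedDeriv n riemannZeta s) s := fun s hs =>
    ((differentiableAt_const _).div differentiableAt_id (ne_zero_of_im hs)).mul (zeta_iter_analytic hs n).differentiableAt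
  have c2 : ContinuousOn (fun s => 1 / s * iteratedDeriv n riemannZeta s) (Bd (-1/10) B τ T) := fun s hs => (c2' s (hpos s hs)).continuousAt.continuousWithinAt
  have e : RI (FF n) (-1/10) B τ T = RI (fun s => (-1) * (deriv ZR s / ZR s * iteratedDeriv n riemannZeta s) + 1 / s * iteratedDeriv n riemannZeta s) (-1/10) B τ T := by
    refine RI_congr hab hT fun s hs => ?_
    have hs0 := hpos s hs
    have hzz : riemannZeta (1 - s) ≠ 0 := by
      intro h0
      apply hbd s hs
      rw [ZR, zeta1_eq _ (fun e => ne_zero_of_im hs0 (by linear_combination -e)), h0, mul_zero]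
    rw [FF, ZR_logDeriv hs0 hzz]
    ring
  rw [e, RI_add hab hT c1 c2, RI_const_mul, RI_zero (f := fun s => 1 / s * iteratedDeriv n riemannZeta s) hab hT (fun s _ _ h _ => c2' s (hτ.trans_le h))]
  ring

lemma QQ_analytic (k : ℕ) {s : ℂ} (h : 1 < s.re) : AnalyticAt ℂ (QQ k) s := by
  have hU : IsOpen {s : ℂ | 1 < s.re} := isOpen_lt continuous_const Complex.continuous_re
  have hd : DifferentiableOn ℂ riemannZeta {s : ℂ | 1 < s.re} := fun z hz =>
    (differentiableAt_riemannZeta (fun e => by rw [e] at hz; simp at hz)).differentiableWithinAt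
  have ha := hd.analyticAt (hU.mem_nhds h)
  induction k with
  | zero =>
    have : QQ 0 = fun z => deriv riemannZeta z / riemannZeta z := by funext z; rw [QQ, iteratedDeriv_zero]
    rw [this]
    exact ha.deriv.div ha (riemannZeta_ne_zero_of_one_le_re h.le)
  | succ k ih =>
    have : QQ (k+1) = deriv (QQ k) := by
      funext z
      show iteratedDeriv (k+1) (fun z => deriv riemannZeta z / riemannZeta z) z = _
      rw [iteratedDeriv_succ]
      rfl
    rw [this]; exact ih.deriv

lemma QQ_hasDeriv (k : ℕ) {s : ℂ} (h : 1 < s.re) : HasDerivAt (QQ k) (QQ (k+1) s) s := by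
  have h1 := (QQ_analytic k h).differentiableAt.hasDerivAt
  have : QQ (k+1) s = deriv (QQ k) s := by
    show iteratedDeriv (k+1) (fun z => deriv riemannZeta z / riemannZeta z) s = _
    rw [iteratedDeriv_succ]
    rfl
  rw [this]; exact h1

lemma le_cont (k j : ℕ) {τ T : ℝ} (hτ : 0 < τ) (hT : τ ≤ T) : IntervalIntegrable (fun t : ℝ => QQ k (1 - (((-1/10:ℝ):ℂ) + t * I)) * iteratedDeriv j riemannZeta (((-1/10:ℝ):ℂ) + t * I)) volume τ T := by
  refine int_v (f := fun s => QQ k (1 - s) * iteratedDeriv j riemannZeta s) (S := {s | s.re < 0 ∧ 0 < s.im}) hT ?_ fun y hy => ?_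
  · intro s hs
    have h1 : ContinuousAt (QQ k) (1 - s) := (QQ_analytic k (by rw [Complex.sub_re, Complex.one_re]; linarith [hs.1])).continuousAt
    have h2 : ContinuousAt (fun s => QQ k (1 - s)) s := ContinuousAt.comp (f := fun s : ℂ => 1 - s) h1 (by fun_prop)
    exact (h2.mul (zeta_iter_analytic hs.2 j).continuousAt).continuousWithinAt
  · refine ⟨?_, ?_⟩
    · rw [Complex.add_re, Complex.ofReal_re]; simp; norm_num
    · simp; linarith [hy.1]

lemma parts (k j : ℕ) {τ T : ℝ} (hτ : 0 < τ) (hT : τ ≤ T) :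
    (∫ t : ℝ in τ..T, QQ k (1 - (((-1/10:ℝ):ℂ) + t * I)) * iteratedDeriv (j+1) riemannZeta (((-1/10:ℝ):ℂ) + t * I)) - ∫ t : ℝ in τ..T, QQ (k+1) (1 - (((-1/10:ℝ):ℂ) + t * I)) * iteratedDeriv j riemannZeta (((-1/10:ℝ):ℂ) + t * I)
      = -I * (QQ k (1 - (((-1/10:ℝ):ℂ) + T * I)) * iteratedDeriv j riemannZeta (((-1/10:ℝ):ℂ) + T * I)) - -I * (QQ k (1 - (((-1/10:ℝ):ℂ) + τ * I)) * iteratedDeriv j riemannZeta (((-1/10:ℝ):ℂ) + τ * I)) := by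
  have i1 := le_cont k (j+1) hτ hT
  have i2 := le_cont (k+1) j hτ hT
  rw [← intervalIntegral.integral_sub i1 i2]
  refine intervalIntegral.integral_eq_sub_of_hasDerivAt (f := fun t : ℝ => -I * (QQ k (1 - (((-1/10:ℝ):ℂ) + t * I)) * iteratedDeriv j riemannZeta (((-1/10:ℝ):ℂ) + t * I))) ?_ (i1.sub i2)
  intro t ht
  rw [uIcc_of_le hT] at ht
  have him : 0 < ((((-1/10:ℝ):ℂ) + t * I)).im := by simp; linarith [ht.1]
  have hre : 1 < (1 - (((-1/10:ℝ):ℂ) + t * I)).re := by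
    rw [Complex.sub_re, Complex.add_re, Complex.ofReal_re]; simp; norm_num
  have h1 : HasDerivAt (fun y : ℝ => (y:ℂ)) 1 t := Complex.ofRealCLM.hasDerivAt (x := t)
  have h2 : HasDerivAt (fun y : ℝ => ((-1/10:ℝ):ℂ) + y * I) I t := ((h1.mul_const I).const_add _).congr_deriv (by ring)
  have h3 : HasDerivAt (fun y : ℝ => 1 - (((-1/10:ℝ):ℂ) + y * I)) (-I) t := h2.const_sub 1
  have h4 : HasDerivAt (iteratedDeriv j riemannZeta) (iteratedDeriv (j+1) riemannZeta (((-1/10:ℝ):ℂ) + t * I)) (((-1/10:ℝ):ℂ) + t * I) := by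
    rw [iteratedDeriv_succ]; exact (zeta_iter_analytic him j).differentiableAt.hasDerivAt
  have h5 := HasDerivAt.comp (h₂ := QQ k) (h := fun y : ℝ => 1 - (((-1/10:ℝ):ℂ) + y * I)) t (QQ_hasDeriv k hre) h3
  have h6 := HasDerivAt.comp (h₂ := iteratedDeriv j riemannZeta) (h := fun y : ℝ => (((-1/10:ℝ):ℂ) + y * I)) t h4 h2
  refine ((h5.mul h6).const_mul (-I)).congr_deriv ?_
  simp only [Function.comp_apply]
  linear_combination (- QQ k (1 - (((-1/10:ℝ):ℂ) + t * I)) * iteratedDeriv (j+1) riemannZeta (((-1/10:ℝ):ℂ) + t * I) + QQ (k+1) (1 - (((-1/10:ℝ):ℂ) + t * I)) * iteratedDeriv j riemannZeta (((-1/10:ℝ):ℂ) + t * I)) * Complex.I_mul_I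

lemma parts_all (n : ℕ) {τ : ℝ} (hτ : 0 < τ) (hτ1 : τ ≤ 1) : ∀ k : ℕ, ∃ K > 0, ∀ T : ℝ, 2 ≤ T →
    ‖(∫ t : ℝ in τ..T, QQ k (1 - (((-1/10:ℝ):ℂ) + t * I)) * iteratedDeriv n riemannZeta (((-1/10:ℝ):ℂ) + t * I)) - ∫ t : ℝ in τ..T, QQ (k+n) (1 - (((-1/10:ℝ):ℂ) + t * I)) * riemannZeta (((-1/10:ℝ):ℂ) + t * I)‖ ≤ K * T ^ (3/4:ℝ) := by
  induction n with
  | zero =>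
    intro k
    refine ⟨1, one_pos, fun T hT => ?_⟩
    rw [iteratedDeriv_zero, add_zero, sub_self, norm_zero]
    positivity
  | succ n ih =>
    intro k
    obtain ⟨K, hK, h⟩ := ih (k+1)
    obtain ⟨C1, hC1, h1⟩ := QQ_bdd k
    obtain ⟨C2, hC2, h2⟩ := zeta_deriv_convexity n
    set E : ℝ := ‖QQ k (1 - (((-1/10:ℝ):ℂ) + τ * I)) * iteratedDeriv n riemannZeta (((-1/10:ℝ):ℂ) + τ * I)‖ with hE
    refine ⟨C1 * C2 + E + K, by positivity, fun T hT => ?_⟩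
    have hp := parts k n hτ (T := T) (by linarith)
    have hT1 : 1 ≤ T ^ (3/4:ℝ) := Real.one_le_rpow (by linarith) (by norm_num)
    have h3 := h T hT
    have hre : ((((-1/10:ℝ):ℂ) + T * I)).re = -1/10 := by rw [Complex.add_re, Complex.ofReal_re]; simp
    have him : ((((-1/10:ℝ):ℂ) + T * I)).im = T := by simp
    have h4 := h1 (1 - (((-1/10:ℝ):ℂ) + T * I)) (by rw [Complex.sub_re, hre]; norm_num)
    have h5 := h2 (((-1/10:ℝ):ℂ) + T * I) (by rw [hre]) (by rw [hre]; norm_num) (by rw [him, abs_of_pos (by linarith)]; exact hT)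
    rw [him, abs_of_pos (by linarith)] at h5
    rw [show k + (n + 1) = k + 1 + n by ring]
    rw [← sub_add_sub_cancel _ (∫ t : ℝ in τ..T, QQ (k+1) (1 - (((-1/10:ℝ):ℂ) + t * I)) * iteratedDeriv n riemannZeta (((-1/10:ℝ):ℂ) + t * I)), hp]
    refine (norm_add_le _ _).trans ?_
    have h6 : ‖-I * (QQ k (1 - (((-1/10:ℝ):ℂ) + T * I)) * iteratedDeriv n riemannZeta (((-1/10:ℝ):ℂ) + T * I)) - -I * (QQ k (1 - (((-1/10:ℝ):ℂ) + τ * I)) * iteratedDeriv n riemannZeta (((-1/10:ℝ):ℂ) + τ * I))‖ ≤ C1 * (C2 * T ^ (3/4:ℝ)) + E := by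
      refine (norm_sub_le _ _).trans (add_le_add ?_ ?_)
      · rw [norm_mul, norm_neg, Complex.norm_I, one_mul, norm_mul]
        exact mul_le_mul h4 h5 (norm_nonneg _) hC1.le
      · rw [norm_mul, norm_neg, Complex.norm_I, one_mul]
    have h7 : E * 1 ≤ E * T ^ (3/4:ℝ) := mul_le_mul_of_nonneg_left hT1 (norm_nonneg _)
    nlinarith

end CON
end ZS

namespace ZS
section EDB
open Complex Filter Topology Asymptotics Set Metric MeasureTheory

lemma QQ0_conj (w : ℂ) : QQ 0 ((starRingEnd ℂ) w) = (starRingEnd ℂ) (QQ 0 w) := by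
  have h : (starRingEnd ℂ) ∘ riemannZeta ∘ (starRingEnd ℂ) = riemannZeta := by
    funext s
    simp only [Function.comp_apply]
    rw [riemannZeta_conj, Complex.conj_conj]
  have h2 := congrArg (fun f : ℂ → ℂ => deriv f ((starRingEnd ℂ) w)) h
  simp only [deriv_conj_conj, Function.comp_apply, Complex.conj_conj] at h2
  rw [QQ, QQ, iteratedDeriv_zero, riemannZeta_conj, ← h2, map_div₀]

lemma FF_cont (n : ℕ) {s : ℂ} (h : 0 < s.im) (hz : riemannZeta s ≠ 0) : ContinuousAt (FF n) s := by
  have hU : IsOpen {s : ℂ | s ≠ 1} := isOpen_ne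
  have h1 : (1 - s) ≠ 1 := fun e => ne_zero_of_im h (by linear_combination -e)
  have hd : DifferentiableOn ℂ riemannZeta {s : ℂ | s ≠ 1} := fun z hz => (differentiableAt_riemannZeta hz).differentiableWithinAt
  have ha := hd.analyticAt (hU.mem_nhds h1)
  have h2 : ContinuousAt (fun z => deriv riemannZeta z / riemannZeta z) (1 - s) :=
    ha.deriv.continuousAt.div ha.continuousAt (by rw [zeta_FE h]; exact mul_ne_zero (XX_ne h) hz)
  have e : QQ 0 = fun z => deriv riemannZeta z / riemannZeta z := by funext z; rw [QQ, iteratedDeriv_zero]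
  rw [← e] at h2
  have h3 : ContinuousAt (fun s => QQ 0 (1 - s)) s := ContinuousAt.comp (f := fun s : ℂ => 1 - s) h2 (by fun_prop)
  exact h3.mul (zeta_iter_analytic h n).continuousAt

lemma top_small {δ : ℝ} (hδ : 0 < δ) (n : ℕ) : ∃ K > 0, ∀ T : ℝ, 3 ≤ T → (∀ ρ : ℂ, riemannZeta ρ = 0 → 0 < ρ.re → ρ.re < 1 → δ / Real.log T ≤ |T - ρ.im|) →
    ∀ σ : ℝ, -1/10 ≤ σ → σ ≤ 11/10 → ‖FF n (σ + T * I)‖ ≤ K * (LL T ^ 2 * T ^ (3/4:ℝ)) := by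
  obtain ⟨A, hA, h1⟩ := hb_adm δ hδ
  obtain ⟨C, hC, h2⟩ := zeta_deriv_convexity n
  refine ⟨(A + 1) * C, by positivity, fun T hT hadm σ hσ1 hσ2 => ?_⟩
  have hL := one_le_LL T
  set w : ℂ := ((1 - σ : ℝ) : ℂ) + T * I with hw
  have hwre : w.re = 1 - σ := by simp [hw]
  have hwim : w.im = T := by simp [hw]
  have e1 : 1 - ((σ:ℂ) + T * I) = (starRingEnd ℂ) w := by
    rw [hw, map_add, map_mul, Complex.conj_ofReal, Complex.conj_ofReal, Complex.conj_I]
    push_cast; ring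
  obtain ⟨k1, k2⟩ := h1 T hT hadm w hwim (by rw [hwre]; linarith) (by rw [hwre]; linarith)
  have hw1 : w ≠ 1 := fun e => by rw [e] at hwim; simp at hwim; linarith
  have h3 : ‖QQ 0 (1 - ((σ:ℂ) + T * I))‖ ≤ (A + 1) * LL T ^ 2 := by
    rw [e1, QQ0_conj, Complex.norm_conj, QQ_eq 0 hw1 k1, iteratedDeriv_zero]
    have h4 : ‖(-1 : ℂ) ^ 0 * (Nat.factorial 0 : ℂ) / (w - 1) ^ (0 + 1)‖ ≤ 1 := by
      have : 1 ≤ ‖w - 1‖ := by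
        refine le_trans ?_ (Complex.abs_im_le_norm _)
        rw [Complex.sub_im, hwim, Complex.one_im, sub_zero, abs_of_pos (by linarith)]
        linarith
      rw [pow_zero, Nat.factorial_zero, Nat.cast_one, one_mul, zero_add, pow_one, norm_div, norm_one]
      exact (div_le_one (by linarith)).2 this
    have h5 := norm_sub_le (DD w) ((-1 : ℂ) ^ 0 * (Nat.factorial 0 : ℂ) / (w - 1) ^ (0 + 1))
    nlinarith
  have h6 := h2 (σ + T * I) (by simpa using hσ1) (by simpa using hσ2) (by
    simp; rw [abs_of_pos (by linarith)]; linarith)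
  have him : ((σ:ℂ) + T * I).im = T := by simp
  rw [him, abs_of_pos (by linarith)] at h6
  rw [FF, norm_mul]
  calc _ ≤ ((A + 1) * LL T ^ 2) * (C * T ^ (3/4:ℝ)) := mul_le_mul h3 h6 (norm_nonneg _) (by positivity)
    _ = _ := by ring

lemma FF_right {τ : ℝ} (hτ : 0 < τ) (n : ℕ) : ∃ K > 0, ∀ s : ℂ, 11/10 ≤ s.re → τ ≤ s.im → ‖FF n s‖ ≤ K * (LL s.im + s.re) := by
  obtain ⟨C, hC, h⟩ := refl_bd hτ
  obtain ⟨D, hD, h'⟩ := zeta_deriv_bdd_right (11/10) (by norm_num) n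
  refine ⟨C * D, by positivity, fun s h1 h2 => ?_⟩
  have := one_le_LL s.im
  rw [FF, norm_mul]
  calc _ ≤ (C * (LL s.im + s.re)) * D := mul_le_mul (h s h1 h2) (h' s h1) (norm_nonneg _) (by nlinarith)
    _ = _ := by ring

lemma FF_decay {τ : ℝ} (hτ : 0 < τ) (n : ℕ) (hn : 1 ≤ n) : ∃ K > 0, ∀ s : ℂ, 3 ≤ s.re → τ ≤ s.im → ‖FF n s‖ ≤ K * (LL s.im + s.re) * (2:ℝ) ^ (-s.re) := by
  obtain ⟨C, hC, h⟩ := refl_bd hτ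
  obtain ⟨D, hD, h'⟩ := zeta_deriv_decay n hn
  refine ⟨C * D, by positivity, fun s h1 h2 => ?_⟩
  have := one_le_LL s.im
  rw [FF, norm_mul]
  calc _ ≤ (C * (LL s.im + s.re)) * (D * (2:ℝ) ^ (-s.re)) := mul_le_mul (h s (by linarith) h2) (h' s h1) (norm_nonneg _) (by nlinarith)
    _ = _ := by ring

set_option maxHeartbeats 1000000 in
lemma edges {δ τ : ℝ} (hδ : 0 < δ) (hτ : 0 < τ) (hτ1 : τ ≤ 1) (hz1 : ∀ ρ : ℂ, riemannZeta ρ = 0 → 0 < ρ.im → τ < ρ.im) (n : ℕ) (hn : 1 ≤ n) :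
    ∃ K > 0, ∀ T : ℝ, Real.exp 3 ≤ T → (∀ ρ : ℂ, riemannZeta ρ = 0 → 0 < ρ.re → ρ.re < 1 → δ / Real.log T ≤ |T - ρ.im|) →
      ‖RI (FF n) (-1/10) (2 * Real.log T) τ T + I * ∫ y : ℝ in τ..T, FF n (((-1/10:ℝ):ℂ) + y * I)‖ ≤ K * T ^ (9/10:ℝ) := by
  obtain ⟨K1, hK1, h1⟩ := top_small hδ n
  obtain ⟨K2, hK2, h2⟩ := FF_right hτ n
  obtain ⟨K3, hK3, h3⟩ := FF_decay hτ n hn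
  obtain ⟨M, hM⟩ := (isCompact_Icc (a := (-1/10:ℝ)) (b := 11/10)).exists_bound_of_continuousOn (f := fun x : ℝ => FF n (x + τ * I)) (fun x hx => by
    have him : ((x:ℂ) + τ * I).im = τ := by simp
    have hc := FF_cont n (s := x + τ * I) (by rw [him]; exact hτ) (fun h0 => by
      have := hz1 _ h0 (by rw [him]; exact hτ)
      rw [him] at this; exact lt_irrefl _ this)
    exact (ContinuousAt.comp (f := fun x : ℝ => (x:ℂ) + τ * I) hc (by fun_prop)).continuousWithinAt)
  have hM0 : 0 ≤ M := (norm_nonneg _).trans (hM 0 ⟨by norm_num, by norm_num⟩)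
  obtain ⟨C, hC, hlog⟩ := logpow_le 3 (ε := 3/20) (by norm_num)
  refine ⟨(3 * (M + 4 * K2) + 3 * (4 * K1 + 4 * K2) + 4 * K3) * C, by positivity, fun T hT hadm => ?_⟩
  set ℓ : ℝ := Real.log T with hℓ
  have hTpos : 0 < T := (Real.exp_pos 3).trans_le hT
  have hℓ3 : 3 ≤ ℓ := (Real.le_log_iff_exp_le hTpos).2 hT
  have hT4 : 4 ≤ T := by
    have := Real.add_one_le_exp 3
    linarith
  have hLL : LL T ≤ 2 * ℓ := by
    rw [LL, abs_of_pos hTpos, hℓ, ← Real.log_rpow hTpos]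
    refine Real.log_le_log (by linarith) ?_
    rw [Real.rpow_two]; nlinarith
  have hLτ : ∀ y : ℝ, τ ≤ y → y ≤ T → LL y ≤ 2 * ℓ := fun y hy1 hy2 =>
    (LL_mono (by rw [abs_of_pos (by linarith), abs_of_pos hTpos]; exact hy2)).trans hLL
  have hL1 := one_le_LL T
  have hP1 : 1 ≤ T ^ (3/4:ℝ) := Real.one_le_rpow (by linarith) (by norm_num)
  have hτT : τ ≤ T := by linarith
  have hB : (-1/10:ℝ) ≤ 2 * ℓ := by linarith
  have hlen : |2 * ℓ - (-1/10)| ≤ 3 * ℓ := by rw [abs_of_pos (by linarith)]; linarith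
  have hLL2 : LL T ^ 2 ≤ 4 * ℓ ^ 2 := by nlinarith
  -- bottom
  have b1 : ‖∫ x : ℝ in (-1/10:ℝ)..(2 * ℓ), FF n (x + τ * I)‖ ≤ (M + K2 * (4 * ℓ)) * (3 * ℓ) := by
    refine (intervalIntegral.norm_integral_le_of_norm_le_const (C := M + K2 * (4 * ℓ)) fun x hx => ?_).trans (mul_le_mul_of_nonneg_left hlen (by positivity))
    rw [uIoc_of_le hB] at hx
    have hk : 0 ≤ K2 * (4 * ℓ) := by positivity
    by_cases hx2 : x ≤ 11/10
    · linarith [hM x ⟨hx.1.le, hx2⟩]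
    · push Not at hx2
      have hre : ((x:ℂ) + τ * I).re = x := by simp
      have him : ((x:ℂ) + τ * I).im = τ := by simp
      have := h2 (x + τ * I) (by rw [hre]; exact hx2.le) (by rw [him])
      rw [hre, him] at this
      have h5 : K2 * (LL τ + x) ≤ K2 * (4 * ℓ) := mul_le_mul_of_nonneg_left (by linarith [hLτ τ le_rfl hτT, hx.2]) hK2.le
      linarith
  -- top
  have b2 : ‖∫ x : ℝ in (-1/10:ℝ)..(2 * ℓ), FF n (x + T * I)‖ ≤ (K1 * (4 * ℓ ^ 2 * T ^ (3/4:ℝ)) + K2 * (4 * ℓ)) * (3 * ℓ) := by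
    refine (intervalIntegral.norm_integral_le_of_norm_le_const (C := K1 * (4 * ℓ ^ 2 * T ^ (3/4:ℝ)) + K2 * (4 * ℓ)) fun x hx => ?_).trans (mul_le_mul_of_nonneg_left hlen (by positivity))
    rw [uIoc_of_le hB] at hx
    have hk : 0 ≤ K2 * (4 * ℓ) := by positivity
    by_cases hx2 : x ≤ 11/10
    · have h4 := h1 T (by linarith) hadm x hx.1.le hx2
      have h5 : K1 * (LL T ^ 2 * T ^ (3/4:ℝ)) ≤ K1 * (4 * ℓ ^ 2 * T ^ (3/4:ℝ)) := mul_le_mul_of_nonneg_left (mul_le_mul_of_nonneg_right hLL2 (by positivity)) hK1.le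
      linarith
    · push Not at hx2
      have hre : ((x:ℂ) + T * I).re = x := by simp
      have him : ((x:ℂ) + T * I).im = T := by simp
      have := h2 (x + T * I) (by rw [hre]; exact hx2.le) (by rw [him]; exact hτT)
      rw [hre, him] at this
      have h5 : K2 * (LL T + x) ≤ K2 * (4 * ℓ) := mul_le_mul_of_nonneg_left (by linarith [hx.2]) hK2.le
      have h6 : 0 ≤ K1 * (4 * ℓ ^ 2 * T ^ (3/4:ℝ)) := by positivity
      linarith
  -- right
  have b3 : ‖∫ y : ℝ in τ..T, FF n ((2 * ℓ : ℝ) + y * I)‖ ≤ (K3 * (4 * ℓ) * T⁻¹) * T := by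
    refine (intervalIntegral.norm_integral_le_of_norm_le_const (C := K3 * (4 * ℓ) * T⁻¹) fun y hy => ?_).trans (mul_le_mul_of_nonneg_left ?_ (by positivity))
    · rw [uIoc_of_le hτT] at hy
      have hre : (((2 * ℓ : ℝ):ℂ) + y * I).re = 2 * ℓ := by simp
      have him : (((2 * ℓ : ℝ):ℂ) + y * I).im = y := by simp
      have := h3 ((2 * ℓ : ℝ) + y * I) (by rw [hre]; linarith) (by rw [him]; exact hy.1.le)
      rw [hre, him] at this
      refine this.trans (mul_le_mul (mul_le_mul_of_nonneg_left (by linarith [hLτ y hy.1.le hy.2]) hK3.le) ?_ (by positivity) (by positivity))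
      rw [Real.rpow_def_of_pos (by norm_num), ← Real.exp_log (inv_pos.2 hTpos), Real.log_inv]
      refine Real.exp_le_exp.2 ?_
      have := Real.log_two_gt_d9
      nlinarith
    · rw [abs_of_nonneg (by linarith)]; linarith
  have b3' : ‖∫ y : ℝ in τ..T, FF n ((2 * ℓ : ℝ) + y * I)‖ ≤ K3 * (4 * ℓ) := by
    refine b3.trans (le_of_eq ?_)
    rw [mul_assoc, inv_mul_cancel₀ hTpos.ne', mul_one]
  have hfin : ‖RI (FF n) (-1/10) (2 * ℓ) τ T + I * ∫ y : ℝ in τ..T, FF n (((-1/10:ℝ):ℂ) + y * I)‖ ≤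
      (M + K2 * (4 * ℓ)) * (3 * ℓ) + (K1 * (4 * ℓ ^ 2 * T ^ (3/4:ℝ)) + K2 * (4 * ℓ)) * (3 * ℓ) + K3 * (4 * ℓ) := by
    rw [RI, sub_add_cancel]
    refine (norm_add_le _ _).trans (add_le_add ((norm_sub_le _ _).trans (add_le_add b1 b2)) ?_)
    rw [norm_mul, Complex.norm_I, one_mul]
    exact b3'
  refine hfin.trans ?_
  set P : ℝ := T ^ (3/4:ℝ) with hP
  have hl := hlog T (by linarith)
  have e9 : T ^ (9/10:ℝ) = T ^ (3/20:ℝ) * P := by rw [hP, ← Real.rpow_add hTpos]; norm_num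
  have q1 : ℓ ≤ ℓ ^ 3 * P := by
    have : ℓ * 1 ≤ ℓ * (ℓ ^ 2 * P) := mul_le_mul_of_nonneg_left (by nlinarith [mul_le_mul (show (1:ℝ) ≤ ℓ ^ 2 by nlinarith) hP1 (by norm_num) (by positivity)]) (by linarith)
    linarith [show ℓ * (ℓ ^ 2 * P) = ℓ ^ 3 * P by ring]
  have q2 : ℓ ^ 2 ≤ ℓ ^ 3 * P := by
    have : ℓ ^ 2 * 1 ≤ ℓ ^ 2 * (ℓ * P) := mul_le_mul_of_nonneg_left (by nlinarith) (by positivity)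
    linarith [show ℓ ^ 2 * (ℓ * P) = ℓ ^ 3 * P by ring]
  have q3 : ℓ ^ 3 * P ≤ C * T ^ (9/10:ℝ) := by
    rw [e9, ← mul_assoc]
    exact mul_le_mul_of_nonneg_right hl (by positivity)
  calc _ = 3 * M * ℓ + 24 * K2 * ℓ ^ 2 + 12 * K1 * (ℓ ^ 3 * P) + 4 * K3 * ℓ := by ring
    _ ≤ 3 * M * (ℓ ^ 3 * P) + 24 * K2 * (ℓ ^ 3 * P) + 12 * K1 * (ℓ ^ 3 * P) + 4 * K3 * (ℓ ^ 3 * P) := by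
        have r1 := mul_le_mul_of_nonneg_left q1 (show 0 ≤ 3 * M by positivity)
        have r2 := mul_le_mul_of_nonneg_left q2 (show 0 ≤ 24 * K2 by positivity)
        have r3 := mul_le_mul_of_nonneg_left q1 (show 0 ≤ 4 * K3 by positivity)
        linarith
    _ = (3 * (M + 4 * K2) + 3 * (4 * K1 + 4 * K2) + 4 * K3) * (ℓ ^ 3 * P) := by ring
    _ ≤ (3 * (M + 4 * K2) + 3 * (4 * K1 + 4 * K2) + 4 * K3) * (C * T ^ (9/10:ℝ)) := mul_le_mul_of_nonneg_left q3 (by positivity)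
    _ = _ := by ring

end EDB
end ZS

namespace ZS
section FIN
open Complex Filter Topology Asymptotics Set Metric MeasureTheory

lemma zeros_finite (T : ℝ) : {s : ℂ | riemannZeta s = 0 ∧ 0 < s.im ∧ s.im ≤ T}.Finite := by
  refine (finite_zeros differentiable_riemannZeta₁ (zeta1_two_ne 0) (isCompact_closedBall (0:ℂ) (T + 2))).subset ?_
  rintro s ⟨h0, h1, h2⟩
  obtain ⟨h3, h4⟩ := zero_nontrivial h0 h1.ne'
  refine ⟨?_, ?_⟩
  · rw [mem_closedBall, dist_zero_right]
    refine (Complex.norm_le_abs_re_add_abs_im s).trans ?_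
    rw [abs_of_pos h3, abs_of_pos h1]; linarith
  · have hs : s ≠ 1 := by rintro rfl; simp at h1
    rw [zeta1_eq s hs, h0, mul_zero]

lemma exists_tau : ∃ τ : ℝ, 0 < τ ∧ τ ≤ 1 ∧ ∀ ρ : ℂ, riemannZeta ρ = 0 → 0 < ρ.im → τ < ρ.im := by
  have hf := zeros_finite 1
  rcases Set.eq_empty_or_nonempty {s : ℂ | riemannZeta s = 0 ∧ 0 < s.im ∧ s.im ≤ 1} with he | hne
  · refine ⟨1, one_pos, le_rfl, fun ρ h h1 => ?_⟩
    by_contra hcon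
    push Not at hcon
    have : ρ ∈ {s : ℂ | riemannZeta s = 0 ∧ 0 < s.im ∧ s.im ≤ 1} := ⟨h, h1, hcon⟩
    rw [he] at this
    exact this
  · obtain ⟨r, hr, hmin⟩ := Set.exists_min_image _ (fun s : ℂ => s.im) hf hne
    refine ⟨r.im / 2, by linarith [hr.2.1], by linarith [hr.2.2], fun ρ h h1 => ?_⟩
    by_cases hcon : ρ.im ≤ 1
    · have := hmin ρ ⟨h, h1, hcon⟩
      linarith [hr.2.1]
    · linarith [hr.2.2]

lemma comb_aux {S L P s M G R e : ℂ} (hR : 2 * Real.pi * I * S = - R) (he : e * e = 1) (hen : ‖e‖ = 1) {a b c d g : ℝ}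
    (h1 : ‖R + I * L‖ ≤ a) (h2 : ‖L - P‖ ≤ b) (h3 : ‖e * P - 2 * Real.pi * s‖ ≤ c) (h4 : ‖s - (M - G)‖ ≤ d) (h5 : ‖G‖ ≤ g) :
    ‖S - e * M‖ ≤ a + b + c + d + g := by
  have hpi := Real.pi_gt_three
  have hn : ‖(2 * Real.pi : ℂ)‖ = 2 * Real.pi := by
    rw [norm_mul, Complex.norm_real, Real.norm_of_nonneg Real.pi_pos.le]; simp
  have e1 : 2 * Real.pi * (S - e * M) = I * (R + I * L) + (L - P) + e * (e * P - 2 * Real.pi * s) + (2 * Real.pi) * (e * (s - (M - G))) - (2 * Real.pi) * (e * G) := by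
    linear_combination (-I) * hR + (2 * Real.pi * S - L) * I_mul_I - P * he
  have h6 : 2 * Real.pi * ‖S - e * M‖ ≤ a + b + c + 2 * Real.pi * d + 2 * Real.pi * g := by
    calc 2 * Real.pi * ‖S - e * M‖ = ‖2 * Real.pi * (S - e * M)‖ := by rw [norm_mul, hn]
      _ ≤ ‖I * (R + I * L)‖ + ‖L - P‖ + ‖e * (e * P - 2 * Real.pi * s)‖ + ‖(2 * Real.pi) * (e * (s - (M - G)))‖ + ‖(2 * Real.pi) * (e * G)‖ := by
        rw [e1]
        refine (norm_sub_le _ _).trans (add_le_add ?_ le_rfl)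
        refine (norm_add_le _ _).trans (add_le_add ?_ le_rfl)
        refine (norm_add_le _ _).trans (add_le_add ?_ le_rfl)
        exact norm_add_le _ _
      _ = ‖R + I * L‖ + ‖L - P‖ + ‖e * P - 2 * Real.pi * s‖ + 2 * Real.pi * ‖s - (M - G)‖ + 2 * Real.pi * ‖G‖ := by
        simp only [norm_mul I, norm_mul e, norm_mul (2 * Real.pi : ℂ), hn, hen, Complex.norm_I, one_mul]
      _ ≤ _ := by
        have := mul_le_mul_of_nonneg_left h4 (by positivity : 0 ≤ 2 * Real.pi)
        have := mul_le_mul_of_nonneg_left h5 (by positivity : 0 ≤ 2 * Real.pi)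
        linarith
  have ha := (norm_nonneg _).trans h1
  have hb := (norm_nonneg _).trans h2
  have hc := (norm_nonneg _).trans h3
  have h7 : 2 * Real.pi * ‖S - e * M‖ ≤ 2 * Real.pi * (a + b + c + d + g) := by
    nlinarith
  exact le_of_mul_le_mul_left h7 (by positivity)

lemma T_bounds {c T : ℝ} (hc : 0 < c) (hT : Real.exp 100 ≤ T) :
    T ^ (9/10:ℝ) ≤ T * Real.exp (-(min (c/2) (1/10)) * Real.sqrt (Real.log T)) ∧
    T / (2 * Real.pi) * Real.exp (-c * Real.sqrt (Real.log (T / (2 * Real.pi)))) ≤ T * Real.exp (-(min (c/2) (1/10)) * Real.sqrt (Real.log T)) ∧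
    Real.exp 10 ≤ T / (2 * Real.pi) := by
  have hpi := Real.pi_gt_three
  have hpi4 := Real.pi_lt_four
  have hT0 : 0 < T := (Real.exp_pos _).trans_le hT
  have hL : 100 ≤ Real.log T := by rw [Real.le_log_iff_exp_le hT0]; exact hT
  set L := Real.log T with hLdef
  have hTe : T = Real.exp L := (Real.exp_log hT0).symm
  have hlog : Real.log (T / (2 * Real.pi)) = L - Real.log (2 * Real.pi) := Real.log_div hT0.ne' (by positivity)
  have hl2 : Real.log (2 * Real.pi) ≤ 7 := by
    have := Real.log_le_sub_one_of_pos (by positivity : 0 < 2 * Real.pi)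
    linarith
  have hx0 : 0 < T / (2 * Real.pi) := by positivity
  have hx : T / (2 * Real.pi) ≤ T := div_le_self hT0.le (by linarith)
  set m := min (c/2) (1/10) with hm
  have hm0 : 0 < m := lt_min (by linarith) (by norm_num)
  have hs0 := Real.sqrt_nonneg L
  refine ⟨?_, ?_, ?_⟩
  · rw [Real.rpow_def_of_pos hT0, ← hLdef]
    nth_rewrite 1 [hTe]
    rw [← Real.exp_add, Real.exp_le_exp]
    have h1 : Real.sqrt L ≤ L := Real.sqrt_le_iff.2 ⟨by linarith, by nlinarith⟩
    have h2 : m * Real.sqrt L ≤ 1/10 * L := mul_le_mul (min_le_right _ _) h1 hs0 (by norm_num)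
    linarith
  · refine mul_le_mul hx ?_ (Real.exp_pos _).le hT0.le
    rw [Real.exp_le_exp]
    have h1 : Real.sqrt L / 2 ≤ Real.sqrt (Real.log (T / (2 * Real.pi))) := by
      apply Real.le_sqrt_of_sq_le
      rw [div_pow, Real.sq_sqrt (by linarith), hlog]
      linarith
    have h2 : m * Real.sqrt L ≤ c / 2 * Real.sqrt L := mul_le_mul_of_nonneg_right (min_le_left _ _) hs0
    have h3 := mul_le_mul_of_nonneg_left h1 hc.le
    linarith
  · rw [← Real.le_log_iff_exp_le hx0, hlog]; linarith

set_option maxHeartbeats 1000000 in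
theorem final (n : ℕ) (hn : 1 ≤ n) (C A : ℕ → ℂ)
    (hC : ∀ᶠ s in nhdsWithin (1 : ℂ) {(1 : ℂ)}ᶜ,
      HasSum (fun j : ℕ => C j * (s - 1) ^ j) (riemannZeta s - 1 / (s - 1)))
    (hA : ∀ᶠ s in nhdsWithin (1 : ℂ) {(1 : ℂ)}ᶜ,
      HasSum (fun j : ℕ => A j * (s - 1) ^ j)
        (deriv riemannZeta s / riemannZeta s + 1 / (s - 1)))
    (δ : ℝ) (hδ : 0 < δ) :
    ∃ c > (0 : ℝ), ∃ K > (0 : ℝ), ∃ T₀ : ℝ, ∀ T ≥ T₀,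
      (∀ ρ : ℂ, riemannZeta ρ = 0 → 0 < ρ.re → ρ.re < 1 → δ / Real.log T ≤ |T - ρ.im|) →
      ∀ Z : Finset ℂ, (∀ s : ℂ, s ∈ Z ↔ (riemannZeta s = 0 ∧ 0 < s.im ∧ s.im ≤ T)) →
      ‖(∑ ρ ∈ Z, (analyticOrderNatAt ZR ρ : ℂ) * iteratedDeriv n riemannZeta ρ) - (-1:ℂ)^(n+1) * (((T / (2 * Real.pi) : ℝ) : ℂ) * GG C A n (Real.log (T / (2 * Real.pi))))‖ ≤
        K * T * Real.exp (-c * Real.sqrt (Real.log T)) := by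
  obtain ⟨τ, hτ, hτ1, hz1⟩ := exists_tau
  obtain ⟨K1, hK1, h1⟩ := edges hδ hτ hτ1 hz1 n hn
  obtain ⟨K2, hK2, h2⟩ := parts_all n hτ hτ1 0
  obtain ⟨K3, hK3, h3⟩ := left_edge n hτ hτ1
  obtain ⟨c, K4, hc, hK4, h4⟩ := SS_asymp n
  have hcz := fun k => cz_eq hC k
  have hD := DD_one_eq hA n
  refine ⟨min (c/2) (1/10), lt_min (by linarith) (by norm_num), K1 + K2 + K3 + K4 + ‖GG C A n 0‖, by positivity, Real.exp 100, fun T hT hadm Z hZ => ?_⟩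
  obtain ⟨b1, b2, b3⟩ := T_bounds hc hT
  have hpi := Real.pi_gt_three
  have hT0 : 0 < T := (Real.exp_pos _).trans_le hT
  have hT101 : 101 ≤ T := by linarith [Real.add_one_le_exp (100:ℝ), hT.le]
  have hL : 100 ≤ Real.log T := by rw [Real.le_log_iff_exp_le hT0]; exact hT
  have hTe3 : Real.exp 3 ≤ T := (Real.exp_le_exp.2 (by norm_num)).trans hT
  have hx0 : 0 < T / (2 * Real.pi) := by positivity
  have hx2 : 2 ≤ T / (2 * Real.pi) := by linarith [Real.add_one_le_exp (10:ℝ)]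
  have hxT : T / (2 * Real.pi) ≤ T := div_le_self hT0.le (by linarith)
  have hmul : 2 * Real.pi * (T / (2 * Real.pi)) = T := by field_simp
  have hz2 : ∀ ρ : ℂ, riemannZeta ρ = 0 → ρ.im ≠ T := by
    intro ρ h0 him
    obtain ⟨h3, h4⟩ := zero_nontrivial h0 (by rw [him]; exact hT0.ne')
    have := hadm ρ h0 h3 h4
    rw [him, sub_self, abs_zero] at this
    have : 0 < δ / Real.log T := by positivity
    linarith
  have hR := contour n hτ (by linarith) hz1 hz2 (by linarith : 1 ≤ 2 * Real.log T) Z hZ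
  have a1 := h1 T hTe3 hadm
  have a2 := h2 T (by linarith)
  rw [zero_add] at a2
  have a3 := h3 (T / (2 * Real.pi)) hx2
  rw [hmul] at a3
  have a4 := h4 _ b3
  rw [MM_eq hcz hD hx0] at a4
  have he : (-1:ℂ)^(n+1) * (-1:ℂ)^(n+1) = 1 := by
    rw [← mul_pow]; norm_num
  have hen : ‖(-1:ℂ)^(n+1)‖ = 1 := by
    rw [norm_pow, norm_neg, norm_one, one_pow]
  refine (comb_aux hR he hen a1 a2 a3 a4 le_rfl).trans ?_
  have p0 : 1 ≤ T ^ (9/10:ℝ) := Real.one_le_rpow (by linarith) (by norm_num)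
  have p1 : T ^ (3/4:ℝ) ≤ T ^ (9/10:ℝ) := Real.rpow_le_rpow_of_exponent_le (by linarith) (by norm_num)
  have p2 : (T / (2 * Real.pi)) ^ (13/20:ℝ) ≤ T ^ (9/10:ℝ) :=
    (Real.rpow_le_rpow hx0.le hxT (by norm_num)).trans (Real.rpow_le_rpow_of_exponent_le (by linarith) (by norm_num))
  generalize Real.exp (-(min (c/2) (1/10)) * Real.sqrt (Real.log T)) = E at *
  have q1 := mul_le_mul_of_nonneg_left b1 hK1.le
  have q2 := mul_le_mul_of_nonneg_left (p1.trans b1) hK2.le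
  have q3 := mul_le_mul_of_nonneg_left (p2.trans b1) hK3.le
  have q4 := mul_le_mul_of_nonneg_left b2 hK4.le
  have q5 := mul_le_mul_of_nonneg_left (p0.trans b1) (norm_nonneg (GG C A n 0))
  linarith

lemma main_eq (C A : ℕ → ℂ) (n : ℕ) (T : ℝ) : (-1 : ℂ) ^ (n + 1) * (1 / ((n : ℂ) + 1)) *
      (((T / (2 * Real.pi)) * Real.log (T / (2 * Real.pi)) ^ (n + 1) : ℝ) : ℂ)
  + (-1 : ℂ) ^ (n + 1) *
      ∑ k ∈ Finset.range (n + 1),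
        (n.choose k : ℂ) * (-1 : ℂ) ^ k * (k.factorial : ℂ) *
          (-1 + ∑ j ∈ Finset.range (k + 1), (-1 : ℂ) ^ j * C j) *
          (((T / (2 * Real.pi)) * Real.log (T / (2 * Real.pi)) ^ (n - k) : ℝ) : ℂ)
  + (n.factorial : ℂ) * A n * ((T / (2 * Real.pi) : ℝ) : ℂ) = (-1:ℂ)^(n+1) * (((T / (2 * Real.pi) : ℝ) : ℂ) * GG C A n (Real.log (T / (2 * Real.pi)))) := by
  generalize T / (2 * Real.pi) = x
  generalize Real.log x = v
  have he : (-1:ℂ)^(n+1) * (-1:ℂ)^(n+1) = 1 := by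
    rw [← mul_pow]; norm_num
  have hs : ∑ k ∈ Finset.range (n + 1),
        (n.choose k : ℂ) * (-1 : ℂ) ^ k * (k.factorial : ℂ) *
          (-1 + ∑ j ∈ Finset.range (k + 1), (-1 : ℂ) ^ j * C j) * ((x * v ^ (n - k) : ℝ) : ℂ) =
      x * ∑ k ∈ Finset.range (n + 1),
        (n.choose k : ℂ) * (-1 : ℂ) ^ k * (k.factorial : ℂ) *
          (-1 + ∑ j ∈ Finset.range (k + 1), (-1 : ℂ) ^ j * C j) * (v:ℂ) ^ (n - k) := by
    rw [Finset.mul_sum]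
    refine Finset.sum_congr rfl fun k _ => ?_
    rw [Complex.ofReal_mul, Complex.ofReal_pow]; ring
  rw [hs, GG, Complex.ofReal_mul, Complex.ofReal_pow]
  linear_combination (-(x:ℂ) * ((n.factorial : ℂ) * A n)) * he

end FIN
end ZS



open Complex Filter Finset

/-- unconditional full asymptotic expansion of
`∑_{0<γ≤T} ζ^{(n)}(ρ)` with error `O(T e^{-C√(log T)})`. -/
theorem unconditional_full_asymptotic (n : ℕ) (hn : 1 ≤ n) (C A : ℕ → ℂ)
    (hC : ∀ᶠ s in nhdsWithin (1 : ℂ) {(1 : ℂ)}ᶜ,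
      HasSum (fun j : ℕ => C j * (s - 1) ^ j) (riemannZeta s - 1 / (s - 1)))
    (hA : ∀ᶠ s in nhdsWithin (1 : ℂ) {(1 : ℂ)}ᶜ,
      HasSum (fun j : ℕ => A j * (s - 1) ^ j)
        (deriv riemannZeta s / riemannZeta s + 1 / (s - 1)))
    (δ : ℝ) (hδ : 0 < δ) :
    ∃ c > (0 : ℝ), ∃ K > (0 : ℝ), ∃ T₀ : ℝ, ∀ T ≥ T₀, AdmissibleHeight δ T →
      ‖zetaZeroSum n T - mainTerm C A n T‖ ≤
        K * T * Real.exp (-c * Real.sqrt (Real.log T)) := by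
  obtain ⟨c, hc, K, hK, T₀, h⟩ := ZS.final n hn C A hC hA δ hδ
  refine ⟨c, hc, K, hK, T₀, fun T hT hadm => ?_⟩
  have h1 := h T hT (fun ρ h0 h1 h2 => hadm ρ ⟨h0, h1, h2⟩) (ZS.zeros_finite T).toFinset (fun s => by simp)
  have hset : {ρ : ℂ | IsNontrivialZero ρ ∧ 0 < ρ.im ∧ ρ.im ≤ T} = ↑(ZS.zeros_finite T).toFinset := by
    ext ρ
    simp only [Set.Finite.coe_toFinset, Set.mem_setOf_eq]
    constructor
    · rintro ⟨h0, h2, h3⟩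
      exact ⟨h0.1, h2, h3⟩
    · rintro ⟨h0, h2, h3⟩
      exact ⟨⟨h0, ZS.zero_nontrivial h0 h2.ne'⟩, h2, h3⟩
  have hsum : zetaZeroSum n T = ∑ ρ ∈ (ZS.zeros_finite T).toFinset,
      (analyticOrderNatAt ZS.ZR ρ : ℂ) * iteratedDeriv n riemannZeta ρ := by
    unfold zetaZeroSum
    rw [hset, finsum_mem_coe_finset]
    refine Finset.sum_congr rfl fun ρ hρ => ?_
    have hρ' := (ZS.zeros_finite T).mem_toFinset.1 hρ
    unfold zetaZeroOrder
    rw [ZS.order_eq hρ'.2.1]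
  rw [hsum]
  unfold mainTerm
  rw [ZS.main_eq]
  exact h1
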